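/- There exist a C¹ tangent vector field X on the unit sphere S³ ⊂ ℝ⁴ with no zeros and no periodic orbits, and a flow φ : ℝ × S³ → S³ of X (φ₀ = id, φ_{s+t} = φ_s ∘ φ_t, and for each x the curve t ↦ φ_t(x) is differentiable with derivative X(φ_t(x))) such that every map φ_t preserves some finite Borel measure on S³ that is positive on every nonempty open subset. (G. Kuperberg's volume-preserving C¹ counterexample to the Seifert conjecture on S³.) -/

import Mathlib

namespace Seifert

open MeasureTheory Set Filter Topology

/-- The Cauchy-type weight `(1 + t²)^(-1/2)`. -/
noncomputable def wt (t : ℝ) : ℝ := (√(1 + t ^ 2))⁻¹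

lemma wt_pos (t : ℝ) : 0 < wt t := by unfold wt; positivity

lemma wt_le_one (t : ℝ) : wt t ≤ 1 := by
  unfold wt
  apply inv_le_one_of_one_le₀
  rw [Real.one_le_sqrt]; nlinarith [sq_nonneg t]

lemma wt_pow_two (t : ℝ) : wt t ^ 2 = (1 + t ^ 2)⁻¹ := by
  unfold wt; rw [inv_pow, Real.sq_sqrt (by positivity)]

lemma wt_pow_ten (t : ℝ) : wt t ^ 10 = ((1 + t ^ 2) ^ 5)⁻¹ := by
  rw [show wt t ^ 10 = (wt t ^ 2) ^ 5 by ring, wt_pow_two, inv_pow]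

lemma abs_mul_wt_le (t : ℝ) : |t| * wt t ≤ 1 := by
  unfold wt
  rw [← div_eq_mul_inv, div_le_one (by positivity)]
  apply Real.le_sqrt_of_sq_le; rw [sq_abs]; linarith

lemma hasDerivAt_wt_pow (t : ℝ) :
    HasDerivAt (fun t => wt t ^ 10) (-10 * t * wt t ^ 12) t := by
  have h : HasDerivAt (fun t : ℝ => ((1 + t ^ 2) ^ 5)⁻¹)
      (-((5 : ℕ) * (1 + t ^ 2) ^ 4 * (2 * t)) / ((1 + t ^ 2) ^ 5) ^ 2) t := by
    have h1 : HasDerivAt (fun t : ℝ => 1 + t ^ 2) (2 * t) t := by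
      simpa using (hasDerivAt_pow 2 t).const_add 1
    exact (h1.pow 5).inv (pow_ne_zero _ (by positivity : (0:ℝ) < 1 + t ^ 2).ne')
  have e : (fun t => wt t ^ 10) = fun t : ℝ => ((1 + t ^ 2) ^ 5)⁻¹ := funext wt_pow_ten
  rw [e]
  convert h using 1
  rw [show wt t ^ 12 = (wt t ^ 2) ^ 6 by ring, wt_pow_two]
  have : (1 + t ^ 2) ≠ 0 := by positivity
  field_simp
  ring

lemma continuous_wt : Continuous wt := by
  unfold wt
  exact Continuous.inv₀ (by fun_prop) (fun t => by positivity)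

lemma integrable_wt_pow : Integrable (fun t => wt t ^ 10) := by
  refine integrable_inv_one_add_sq.mono' (continuous_wt.pow 10).aestronglyMeasurable
    (Eventually.of_forall fun t => ?_)
  rw [← wt_pow_two, Real.norm_of_nonneg (pow_nonneg (wt_pos t).le _)]
  exact pow_le_pow_of_le_one (wt_pos t).le (wt_le_one t) (by norm_num)

lemma wt_mul_le {L s t : ℝ} (h : |s - t| ≤ 1) :
    wt (L * s) ≤ √(2 + 2 * L ^ 2) * wt (L * t) := by
  unfold wt
  rw [← div_eq_mul_inv, le_div_iff₀ (by positivity), inv_mul_le_iff₀ (by positivity),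
    ← Real.sqrt_mul (by positivity)]
  apply Real.sqrt_le_sqrt
  have h2 : (s - t) ^ 2 ≤ 1 := by rw [← sq_abs]; nlinarith [abs_nonneg (s - t)]
  have h3 : t ^ 2 ≤ 2 * s ^ 2 + 2 := by nlinarith [sq_nonneg (2 * s - t)]
  nlinarith [mul_le_mul_of_nonneg_left h3 (sq_nonneg L), sq_nonneg (L * s), sq_nonneg (L^2 * s),
    sq_nonneg L]

lemma wt_le_div {L : ℝ} (hL : 1 ≤ L) (t : ℝ) : wt (L * t) ≤ 2 / (1 + |t|) := by
  unfold wt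
  rw [le_div_iff₀ (by positivity), inv_mul_le_iff₀ (by positivity), mul_comm]
  have : 1 + |t| ≤ √((2 * √(1 + (L * t) ^ 2)) ^ 2) := by
    apply Real.le_sqrt_of_sq_le
    rw [mul_pow, Real.sq_sqrt (by positivity)]
    have : t ^ 2 ≤ (L * t) ^ 2 := by
      rw [mul_pow]; exact le_mul_of_one_le_left (sq_nonneg t) (one_le_pow₀ hL)
    nlinarith [sq_abs t, abs_nonneg t, sq_nonneg (|t| - 1)]
  rwa [Real.sqrt_sq (by positivity)] at this

/-- A positive `C²` partition of unity `∑ ℓ (x + n) = 1` with polynomial tails, whose derivatives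
are controlled by `ℓ ^ (11/10)`, and which is concentrated. -/
theorem exists_bump {d ε : ℝ} (hd : 0 < d) (hε : 0 < ε) : ∃ (ℓ ℓ' ℓ'' : ℝ → ℝ) (C : ℝ), 0 < C ∧
    (∀ t, HasDerivAt ℓ (ℓ' t) t) ∧ (∀ t, HasDerivAt ℓ' (ℓ'' t) t) ∧ Continuous ℓ'' ∧
    (∀ t, 0 < ℓ t) ∧ (∀ x, HasSum (fun n : ℤ => ℓ (x + n)) 1) ∧
    (∀ t, ℓ t ≤ C / (1 + |t|) ^ 10) ∧
    (∀ t, |ℓ' t| ≤ C * ℓ t ^ (11 / 10 : ℝ)) ∧ (∀ t, |ℓ'' t| ≤ C * ℓ t ^ (11 / 10 : ℝ)) ∧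
    (∀ t, t ≤ -d ∨ 1 + d ≤ t → ℓ t ≤ ε / (1 + |t|) ^ 10) := by
  set Z := ∫ t, wt t ^ 10 with hZ
  have hZpos : 0 < Z := by
    rw [hZ, integral_pos_iff_support_of_nonneg (fun t => pow_nonneg (wt_pos t).le _)
      integrable_wt_pow]
    have : Function.support (fun t => wt t ^ 10) = univ := by
      ext t; simp [(wt_pos t).ne']
    rw [this]; simp
  set q := d / (2 + d) with hq
  have hqpos : 0 < q := by positivity
  obtain ⟨L, hL1, hL⟩ : ∃ L : ℝ, 1 ≤ L ∧ Z⁻¹ * (q ^ 10)⁻¹ / ε ≤ L :=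
    ⟨max 1 (Z⁻¹ * (q ^ 10)⁻¹ / ε), le_max_left _ _, le_max_right _ _⟩
  have hLpos : 0 < L := by linarith
  set A := √(2 + 2 * L ^ 2) with hA
  have hApos : 0 < A := by positivity
  set c := L * Z⁻¹ with hc
  have hcpos : 0 < c := by positivity
  set f : ℝ → ℝ := fun t => c * wt (L * t) ^ 10 with hf
  set f' : ℝ → ℝ := fun t => c * (L * (-10 * (L * t) * wt (L * t) ^ 12)) with hf'
  have hfc : Continuous f := by
    have := continuous_wt; fun_prop
  have hf'c : Continuous f' := by
    have := continuous_wt; fun_prop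
  have hfd : ∀ t, HasDerivAt f (f' t) t := fun t => by
    have h1 : HasDerivAt (fun t : ℝ => L * t) L t := by simpa using (hasDerivAt_id t).const_mul L
    have := ((hasDerivAt_wt_pow (L * t)).comp t h1).const_mul c
    refine this.congr_deriv ?_
    change c * _ = c * _
    ring
  have hfi : Integrable f := (integrable_wt_pow.comp_mul_left' hLpos.ne').const_mul c
  have hfint : ∫ t, f t = 1 := by
    simp only [hf]
    rw [integral_const_mul, Measure.integral_comp_mul_left (fun t => wt t ^ 10), ← hZ,
      abs_of_pos (by positivity), smul_eq_mul, hc]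
    field_simp
  have hf'b : ∀ s t, |s - t| ≤ 1 → |f' s| ≤ 10 * c * L * A ^ 11 * wt (L * t) ^ 11 := fun s t h => by
    have h1 := wt_mul_le (L := L) h
    have h2 := abs_mul_wt_le (L * s)
    have hw := wt_pos (L * s)
    have hw' := wt_pos (L * t)
    calc |f' s| = 10 * c * L * (|L * s| * wt (L * s)) * wt (L * s) ^ 11 := by
          simp only [hf', abs_mul, abs_neg, abs_of_pos hcpos, abs_of_pos hLpos, abs_pow,
            abs_of_pos hw, abs_of_pos (show (0 : ℝ) < 10 by norm_num)]
          ring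
      _ ≤ 10 * c * L * 1 * (A * wt (L * t)) ^ 11 := by gcongr
      _ = _ := by ring
  set ℓ : ℝ → ℝ := fun t => ∫ s in (t - 1)..t, f s with hℓ
  have hprim : ∀ t, HasDerivAt (fun t => ∫ s in (0 : ℝ)..t, f s) (f t) t := fun t =>
    intervalIntegral.integral_hasDerivAt_right (hfc.intervalIntegrable _ _)
      (hfc.stronglyMeasurableAtFilter _ _) hfc.continuousAt
  have hℓe : ℓ = fun t => (∫ s in (0 : ℝ)..t, f s) - ∫ s in (0 : ℝ)..(t - 1), f s := by
    funext t
    simp only [hℓ]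
    rw [intervalIntegral.integral_interval_sub_left (hfc.intervalIntegrable _ _)
      (hfc.intervalIntegrable _ _)]
  have hsub : ∀ t : ℝ, HasDerivAt (fun t : ℝ => t - 1) 1 t := fun t => by
    simpa using (hasDerivAt_id t).sub_const 1
  have hd1 : ∀ t, HasDerivAt ℓ (f t - f (t - 1)) t := fun t => by
    rw [hℓe]
    have := (hprim (t - 1)).comp t (hsub t)
    rw [mul_one] at this
    exact (hprim t).sub this
  have hlow : ∀ t, c * (A ^ 10)⁻¹ * wt (L * t) ^ 10 ≤ ℓ t := fun t => by
    have : ∫ s in (t - 1)..t, c * (A ^ 10)⁻¹ * wt (L * t) ^ 10 ≤ ℓ t := by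
      apply intervalIntegral.integral_mono_on (by linarith) (by simp) (hfc.intervalIntegrable _ _)
      intro s hs
      have h1 := wt_mul_le (L := L) (s := t) (t := s) (by rw [abs_le]; constructor <;> linarith [hs.1, hs.2])
      have : wt (L * t) ^ 10 ≤ A ^ 10 * wt (L * s) ^ 10 := by
        rw [← mul_pow]; exact pow_le_pow_left₀ (wt_pos _).le h1 _
      simp only [hf]
      rw [mul_assoc]
      apply mul_le_mul_of_nonneg_left _ hcpos.le
      rwa [inv_mul_le_iff₀ (by positivity)]
    simpa using this
  have hupp : ∀ t, ℓ t ≤ c * A ^ 10 * wt (L * t) ^ 10 := fun t => by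
    have : ℓ t ≤ ∫ s in (t - 1)..t, c * A ^ 10 * wt (L * t) ^ 10 := by
      apply intervalIntegral.integral_mono_on (by linarith) (hfc.intervalIntegrable _ _) (by simp)
      intro s hs
      have h1 := wt_mul_le (L := L) (s := s) (t := t) (by rw [abs_le]; constructor <;> linarith [hs.1, hs.2])
      have : wt (L * s) ^ 10 ≤ A ^ 10 * wt (L * t) ^ 10 := by
        rw [← mul_pow]; exact pow_le_pow_left₀ (wt_pos _).le h1 _
      change c * wt (L * s) ^ 10 ≤ _
      rw [mul_assoc c]
      exact mul_le_mul_of_nonneg_left this hcpos.le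
    simpa using this
  have hpos : ∀ t, 0 < ℓ t := fun t =>
    lt_of_lt_of_le (by have := wt_pos (L * t); positivity) (hlow t)
  set B := (c⁻¹ * A ^ 10) ^ (11 / 10 : ℝ) with hB
  have hBpos : 0 < B := by positivity
  have hw11 : ∀ t, wt (L * t) ^ 11 ≤ B * ℓ t ^ (11 / 10 : ℝ) := fun t => by
    have hw := wt_pos (L * t)
    have h1 : wt (L * t) ^ 10 ≤ c⁻¹ * A ^ 10 * ℓ t := by
      have := hlow t
      rw [mul_assoc] at this
      rw [mul_assoc, le_inv_mul_iff₀ hcpos]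
      calc c * wt (L * t) ^ 10 = A ^ 10 * (c * ((A ^ 10)⁻¹ * wt (L * t) ^ 10)) := by field_simp
        _ ≤ _ := by gcongr
    calc wt (L * t) ^ 11 = (wt (L * t) ^ 10) ^ (11 / 10 : ℝ) := by
          rw [← Real.rpow_natCast, ← Real.rpow_natCast, ← Real.rpow_mul hw.le]; norm_num
      _ ≤ (c⁻¹ * A ^ 10 * ℓ t) ^ (11 / 10 : ℝ) := Real.rpow_le_rpow (by positivity) h1 (by norm_num)
      _ = _ := by rw [Real.mul_rpow (by positivity) (hpos t).le]
  set K := 10 * c * L * A ^ 11 with hK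
  have hKpos : 0 < K := by positivity
  refine ⟨ℓ, fun t => f t - f (t - 1), fun t => f' t - f' (t - 1),
    c * A ^ 10 * 2 ^ 10 + 2 * K * B, by positivity, hd1, fun t => ?_, ?_, hpos, fun x => ?_,
    fun t => ?_, fun t => ?_, fun t => ?_, fun t h => ?_⟩
  · have := (hfd (t - 1)).comp t (hsub t)
    rw [mul_one] at this
    exact (hfd t).sub this
  · fun_prop
  · have := hfi.hasSum_intervalIntegral (x - 1)
    rw [hfint] at this
    refine this.congr_fun fun n => ?_
    change (∫ s in _.._, f s) = _
    congr 1 <;> ring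
  · calc ℓ t ≤ _ := hupp t
      _ ≤ c * A ^ 10 * (2 / (1 + |t|)) ^ 10 := by
        gcongr
        · exact (wt_pos _).le
        · exact wt_le_div hL1 t
      _ = c * A ^ 10 * 2 ^ 10 / (1 + |t|) ^ 10 := by rw [div_pow]; ring
      _ ≤ _ := by gcongr; linarith [show 0 < 2 * K * B by positivity]
  · have h := Convex.norm_image_sub_le_of_norm_hasDerivWithin_le (f := f) (f' := f')
      (s := Icc (t - 1) t) (C := K * wt (L * t) ^ 11) (x := t - 1) (y := t)
      (fun s _ => (hfd s).hasDerivWithinAt)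
      (fun s hs => hf'b s t (by rw [abs_le]; constructor <;> linarith [hs.1, hs.2]))
      (convex_Icc _ _) ⟨le_rfl, by linarith⟩ ⟨by linarith, le_rfl⟩
    simp only [Real.norm_eq_abs, sub_sub_cancel, abs_one, mul_one] at h
    have hl := hpos t
    calc |f t - f (t - 1)| ≤ K * wt (L * t) ^ 11 := h
      _ ≤ K * (B * ℓ t ^ (11 / 10 : ℝ)) := by gcongr; exact hw11 t
      _ ≤ _ := by
        rw [← mul_assoc]; gcongr
        nlinarith [show 0 < K * B by positivity, show 0 < c * A ^ 10 by positivity]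
  · have hl := hpos t
    calc |f' t - f' (t - 1)| ≤ |f' t| + |f' (t - 1)| := abs_sub _ _
      _ ≤ K * wt (L * t) ^ 11 + K * wt (L * t) ^ 11 :=
        add_le_add (hf'b t t (by simp)) (hf'b _ t (by simp))
      _ = 2 * K * wt (L * t) ^ 11 := by ring
      _ ≤ 2 * K * (B * ℓ t ^ (11 / 10 : ℝ)) := by gcongr; exact hw11 t
      _ ≤ _ := by
        rw [← mul_assoc]; gcongr
        nlinarith [show 0 < c * A ^ 10 by positivity]
  · have hsb : ∀ s ∈ Icc (t - 1) t, q * (1 + |t|) ≤ |s| := fun s hs => by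
      rw [hq, div_mul_eq_mul_div, div_le_iff₀ (by positivity)]
      rcases h with h | h
      · have h1 : |t| ≤ |s| := by
          rw [abs_of_nonpos (by linarith), abs_of_nonpos (by linarith [hs.2])]; linarith [hs.2]
        have h2 : d ≤ |s| := by rw [abs_of_nonpos (by linarith [hs.2])]; linarith [hs.2]
        nlinarith
      · rw [abs_of_nonneg (show 0 ≤ t by linarith), abs_of_nonneg (by linarith [hs.1])]
        nlinarith [hs.1, hs.2]
    have hup : ∀ s ∈ Icc (t - 1) t, f s ≤ c * ((L * (q * (1 + |t|))) ^ 10)⁻¹ := fun s hs => by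
      change c * wt (L * s) ^ 10 ≤ _
      gcongr
      rw [wt_pow_ten]
      have h1 : (L * (q * (1 + |t|))) ^ 2 ≤ 1 + (L * s) ^ 2 := by
        have : L * (q * (1 + |t|)) ≤ |L * s| := by
          rw [abs_mul, abs_of_pos hLpos]; gcongr; exact hsb s hs
        have h0 : 0 ≤ L * (q * (1 + |t|)) := by positivity
        nlinarith [sq_abs (L * s)]
      gcongr
      calc (L * (q * (1 + |t|))) ^ 10 = ((L * (q * (1 + |t|))) ^ 2) ^ 5 := by ring
        _ ≤ _ := by gcongr
    have : ℓ t ≤ ∫ s in (t - 1)..t, c * ((L * (q * (1 + |t|))) ^ 10)⁻¹ :=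
      intervalIntegral.integral_mono_on (by linarith) (hfc.intervalIntegrable _ _) (by simp) hup
    rw [intervalIntegral.integral_const] at this
    simp only [sub_sub_cancel, one_smul] at this
    refine this.trans ?_
    rw [mul_pow, mul_pow, mul_inv, mul_inv, ← mul_assoc, ← mul_assoc, ← div_eq_mul_inv]
    gcongr
    rw [div_le_iff₀ hε] at hL
    calc c * (L ^ 10)⁻¹ * (q ^ 10)⁻¹ = (Z⁻¹ * (q ^ 10)⁻¹) * (L ^ 9)⁻¹ := by
          rw [hc]; field_simp
      _ ≤ (L * ε) * L⁻¹ := by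
          have : L ≤ L ^ 9 := le_self_pow₀ hL1 (by norm_num)
          gcongr
      _ = ε := by field_simp

/-- The `1`-periodic size `|sin (π y)|`, comparable to the distance from `y` to `ℤ`. -/
noncomputable def sn (y : ℝ) : ℝ := |Real.sin (Real.pi * y)|

lemma sn_nonneg (y : ℝ) : 0 ≤ sn y := abs_nonneg _
lemma sn_le_one (y : ℝ) : sn y ≤ 1 := Real.abs_sin_le_one _
lemma sn_neg (y : ℝ) : sn (-y) = sn y := by simp [sn]
lemma sn_zero : sn 0 = 0 := by simp [sn]
lemma sn_sub_comm (x y : ℝ) : sn (x - y) = sn (y - x) := by rw [← sn_neg, neg_sub]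

lemma sn_add_int (y : ℝ) (n : ℤ) : sn (y + n) = sn y := by
  unfold sn
  rw [mul_add, mul_comm Real.pi (n : ℝ), Real.sin_add_int_mul_pi, abs_mul, abs_zpow]
  simp

lemma sn_add_le (x y : ℝ) : sn (x + y) ≤ sn x + sn y := by
  unfold sn
  rw [mul_add, Real.sin_add]
  refine (abs_add_le _ _).trans ?_
  rw [abs_mul, abs_mul]
  have h1 := Real.abs_cos_le_one (Real.pi * x)
  have h2 := Real.abs_cos_le_one (Real.pi * y)
  nlinarith [abs_nonneg (Real.sin (Real.pi * x)), abs_nonneg (Real.sin (Real.pi * y))]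

lemma sn_le_mul_abs (y : ℝ) : sn y ≤ 4 * |y| := by
  unfold sn
  refine Real.abs_sin_le_abs.trans ?_
  rw [abs_mul, abs_of_pos Real.pi_pos]
  gcongr
  exact Real.pi_le_four

lemma sn_mono {x y : ℝ} (h : |x| ≤ |y|) (hy : |y| ≤ 1 / 2) : sn x ≤ sn y := by
  have key : ∀ z : ℝ, |z| ≤ 1 / 2 → sn z = Real.sin (Real.pi * |z|) := fun z hz => by
    have h0 : 0 ≤ Real.sin (Real.pi * |z|) := Real.sin_nonneg_of_nonneg_of_le_pi
      (by positivity) (by nlinarith [Real.pi_pos, abs_nonneg z])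
    rcases abs_cases z with ⟨h1, _⟩ | ⟨h1, _⟩
    · rw [h1] at h0 ⊢; exact abs_of_nonneg h0
    · rw [h1] at h0 ⊢; rw [← sn_neg]; exact abs_of_nonneg h0
  rw [key x (h.trans hy), key y hy]
  apply Real.sin_le_sin_of_le_of_le_pi_div_two
  · nlinarith [Real.pi_pos, abs_nonneg x]
  · nlinarith [Real.pi_pos, abs_nonneg x]
  · gcongr

lemma min_le_sn {x : ℝ} (h0 : 0 ≤ x) (h1 : x ≤ 1) : min x (1 - x) ≤ sn x := by
  have key : ∀ z : ℝ, 0 ≤ z → z ≤ 1 / 2 → z ≤ sn z := fun z hz hz' => by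
    have := Real.mul_le_sin (x := Real.pi * z) (by positivity) (by nlinarith [Real.pi_pos])
    have h2 : 2 / Real.pi * (Real.pi * z) = 2 * z := by field_simp
    rw [h2] at this
    exact le_trans (by linarith) (this.trans (le_abs_self _))
  rcases le_total x (1 / 2) with h | h
  · exact (min_le_left _ _).trans (key x h0 h)
  · refine (min_le_right _ _).trans ((key (1 - x) (by linarith) (by linarith)).trans ?_)
    have := sn_add_int (-x) 1
    rw [sn_neg] at this
    rw [← this]; push_cast; rw [neg_add_eq_sub]

lemma continuous_sn : Continuous sn := by unfold sn; fun_prop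

/-- Summable weights on `ℤ`. -/
noncomputable def iw (n : ℤ) : ℝ := ((1 + |(n : ℝ)|) ^ 2)⁻¹

lemma iw_pos (n : ℤ) : 0 < iw n := by unfold iw; positivity

lemma summable_iw : Summable iw := by
  have h : Summable fun n : ℕ => ((1 + (n : ℝ)) ^ 2)⁻¹ := by
    have := (summable_nat_add_iff 1).2 (Real.summable_nat_pow_inv.2 (one_lt_two))
    refine this.congr fun n => ?_
    push_cast; rw [add_comm]
  apply Summable.of_nat_of_neg
  · refine h.congr fun n => ?_
    simp [iw]
  · refine h.congr fun n => ?_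
    simp [iw]

lemma one_add_abs_int_le (x : ℝ) (n : ℤ) : 1 + |(n : ℝ)| ≤ (1 + |x|) * (1 + |x + n|) := by
  have : |(n : ℝ)| ≤ |x + n| + |x| := by
    calc |(n : ℝ)| = |(x + n) - x| := by ring_nf
      _ ≤ _ := abs_sub _ _
  nlinarith [abs_nonneg x, abs_nonneg (x + n), mul_nonneg (abs_nonneg x) (abs_nonneg (x + n))]

section wsum
variable {h h' : ℝ → ℝ} {C B A : ℝ} {c : ℤ → ℝ}

lemma wsum_term_le (hb : ∀ t, |h t| ≤ C / (1 + |t|) ^ 10) (hc : ∀ n, |c n| ≤ B * (1 + |(n : ℝ)|))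
    {x : ℝ} (hx : |x| ≤ A) (n : ℤ) :
    ‖h (x + n) * c n‖ ≤ C * B * (1 + A) ^ 10 * iw n := by
  have hA : 0 ≤ A := (abs_nonneg x).trans hx
  have hC : 0 ≤ C := by have := (abs_nonneg _).trans (hb 0); simpa using this
  have hB : 0 ≤ B := by have := (abs_nonneg _).trans (hc 0); simpa using this
  rw [Real.norm_eq_abs, abs_mul]
  have h1 := one_add_abs_int_le x n
  have h2 : (1 + |(n : ℝ)|) ^ 10 ≤ ((1 + A) * (1 + |x + n|)) ^ 10 := by
    gcongr; refine h1.trans ?_; gcongr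
  have h3 : (1 : ℝ) ≤ 1 + |(n : ℝ)| := by simp
  calc |h (x + n)| * |c n| ≤ C / (1 + |x + n|) ^ 10 * (B * (1 + |(n : ℝ)|)) := by
        gcongr
        · exact hb _
        · exact hc n
    _ ≤ C * (1 + A) ^ 10 / (1 + |(n : ℝ)|) ^ 10 * (B * (1 + |(n : ℝ)|)) := by
        gcongr ?_ * _
        rw [div_le_div_iff₀ (by positivity) (by positivity), mul_assoc, ← mul_pow]
        gcongr
    _ = C * B * (1 + A) ^ 10 * ((1 + |(n : ℝ)|) ^ 9)⁻¹ := by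
        have : (1 + |(n : ℝ)|) ≠ 0 := by positivity
        field_simp
    _ ≤ _ := by
        unfold iw
        gcongr
        norm_num

lemma summable_wsum (hb : ∀ t, |h t| ≤ C / (1 + |t|) ^ 10)
    (hc : ∀ n, |c n| ≤ B * (1 + |(n : ℝ)|)) (x : ℝ) : Summable fun n : ℤ => h (x + n) * c n :=
  Summable.of_norm_bounded (summable_iw.mul_left _) (wsum_term_le hb hc (le_refl |x|))

lemma continuous_wsum (hcont : Continuous h) (hb : ∀ t, |h t| ≤ C / (1 + |t|) ^ 10)
    (hc : ∀ n, |c n| ≤ B * (1 + |(n : ℝ)|)) : Continuous fun x => ∑' n : ℤ, h (x + n) * c n := by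
  rw [continuous_iff_continuousAt]
  intro x
  have : ContinuousOn (fun x => ∑' n : ℤ, h (x + n) * c n) (Icc (-(|x| + 1)) (|x| + 1)) :=
    continuousOn_tsum (fun n => by fun_prop) (summable_iw.mul_left _)
      (fun n y hy => wsum_term_le hb hc (abs_le.2 hy) n)
  exact this.continuousAt (Icc_mem_nhds (by linarith [neg_abs_le x]) (by linarith [le_abs_self x]))

lemma hasDerivAt_wsum (hd : ∀ t, HasDerivAt h (h' t) t) (hb : ∀ t, |h t| ≤ C / (1 + |t|) ^ 10)
    (hb' : ∀ t, |h' t| ≤ C / (1 + |t|) ^ 10)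
    (hc : ∀ n, |c n| ≤ B * (1 + |(n : ℝ)|)) (x : ℝ) :
    HasDerivAt (fun x => ∑' n : ℤ, h (x + n) * c n) (∑' n : ℤ, h' (x + n) * c n) x := by
  refine hasDerivAt_tsum_of_isPreconnected (summable_iw.mul_left _)
    (t := Ioo (-(|x| + 1)) (|x| + 1)) isOpen_Ioo isPreconnected_Ioo (fun n y _ => ?_)
    (fun n y hy => wsum_term_le hb' hc (abs_le.2 (Ioo_subset_Icc_self hy)) n)
    (y₀ := x) ?_ (summable_wsum hb hc x) ?_
  · have h1 : HasDerivAt (fun y : ℝ => y + n) 1 y := (hasDerivAt_id y).add_const _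
    have := (hd (y + n)).comp y h1
    rw [mul_one] at this
    exact this.mul_const _
  all_goals exact ⟨by linarith [neg_abs_le x], by linarith [le_abs_self x]⟩

lemma wsum_shift (x : ℝ) : ∑' n : ℤ, h (x + 1 + n) * c n = ∑' n : ℤ, h (x + n) * c (n - 1) := by
  rw [← (Equiv.subRight (1 : ℤ)).tsum_eq fun n : ℤ => h (x + 1 + n) * c n]
  refine tsum_congr fun n => ?_
  simp only [Equiv.subRight_apply]
  congr 2; push_cast; ring

end wsum

/-- The two one-sided floor functions. -/
noncomputable def fl (s : Bool) (t : ℝ) : ℤ := if s then ⌊t⌋ else ⌈t⌉ - 1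

lemma fl_bounds (s : Bool) (t : ℝ) : t - 1 ≤ fl s t ∧ fl s t ≤ t := by
  cases s
  · simp only [fl, Bool.false_eq_true, if_false]; push_cast
    exact ⟨by linarith [Int.le_ceil t], by linarith [Int.ceil_lt_add_one t]⟩
  · simp only [fl, if_true]
    exact ⟨by linarith [Int.lt_floor_add_one t], Int.floor_le t⟩

lemma fl_add_int (s : Bool) (t : ℝ) (m : ℤ) : fl s (t + m) = fl s t + m := by
  cases s <;> simp [fl] <;> ring

lemma fl_le_of_lt {t t' : ℝ} (h : t < t') (s s' : Bool) : fl s t ≤ fl s' t' := by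
  have h1 : (⌊t⌋ : ℝ) < ⌈t'⌉ := (Int.floor_le t).trans_lt (h.trans_le (Int.le_ceil t'))
  have h1 : ⌊t⌋ < ⌈t'⌉ := by exact_mod_cast h1
  have h2 := Int.floor_mono h.le
  have h3 := Int.ceil_mono h.le
  have h4 : ⌈t⌉ ≤ ⌊t⌋ + 1 := Int.ceil_le_floor_add_one t
  cases s <;> cases s' <;> simp [fl] <;> omega

lemma fl_false_le (t : ℝ) (s : Bool) : fl false t ≤ fl s t := by
  have h4 : ⌈t⌉ ≤ ⌊t⌋ + 1 := Int.ceil_le_floor_add_one t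
  cases s <;> simp [fl]; omega

lemma fl_le_true (t : ℝ) (s : Bool) : fl s t ≤ fl true t := by
  have h4 : ⌈t⌉ ≤ ⌊t⌋ + 1 := Int.ceil_le_floor_add_one t
  cases s <;> simp [fl]; omega

lemma fl_true_le_succ (t : ℝ) (s : Bool) : fl true t ≤ fl s t + 1 := by
  have h4 : (⌊t⌋ : ℝ) ≤ ⌈t⌉ := (Int.floor_le t).trans (Int.le_ceil t)
  have h4 : ⌊t⌋ ≤ ⌈t⌉ := by exact_mod_cast h4
  cases s <;> simp [fl]; omega

/-- A concentrated `C²` partition of unity, see `exists_bump`. -/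
structure Bump (d ε : ℝ) where
  l : ℝ → ℝ
  l' : ℝ → ℝ
  l'' : ℝ → ℝ
  C : ℝ
  C_pos : 0 < C
  hasDerivAt_l : ∀ t, HasDerivAt l (l' t) t
  hasDerivAt_l' : ∀ t, HasDerivAt l' (l'' t) t
  continuous_l'' : Continuous l''
  pos : ∀ t, 0 < l t
  hasSum : ∀ x, HasSum (fun n : ℤ => l (x + n)) 1
  decay : ∀ t, l t ≤ C / (1 + |t|) ^ 10
  l'_le : ∀ t, |l' t| ≤ C * l t ^ (11 / 10 : ℝ)
  l''_le : ∀ t, |l'' t| ≤ C * l t ^ (11 / 10 : ℝ)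
  tail : ∀ t, t ≤ -d ∨ 1 + d ≤ t → l t ≤ ε / (1 + |t|) ^ 10

lemma nonempty_bump {d ε : ℝ} (hd : 0 < d) (hε : 0 < ε) : Nonempty (Bump d ε) := by
  obtain ⟨l, l', l'', C, h⟩ := exists_bump hd hε
  exact ⟨⟨l, l', l'', C, h.1, h.2.1, h.2.2.1, h.2.2.2.1, h.2.2.2.2.1, h.2.2.2.2.2.1,
    h.2.2.2.2.2.2.1, h.2.2.2.2.2.2.2.1, h.2.2.2.2.2.2.2.2.1, h.2.2.2.2.2.2.2.2.2⟩⟩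

/-- Coefficients of the leaf with label `i`. -/
noncomputable def cf (i : Bool × ℝ) (n : ℤ) : ℝ := fl i.1 (i.2 - n * √2)

lemma abs_cf_le (i : Bool × ℝ) (n : ℤ) : |cf i n| ≤ (|i.2| + 3) * (1 + |(n : ℝ)|) := by
  obtain ⟨h1, h2⟩ := fl_bounds i.1 (i.2 - n * √2)
  have h3 : |(n : ℝ) * √2| ≤ |(n : ℝ)| * 2 := by
    rw [abs_mul]; gcongr
    rw [abs_of_nonneg (by positivity), Real.sqrt_le_left (by norm_num)]; norm_num
  have h4 := abs_le.1 h3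
  have h5 := neg_abs_le i.2
  have h6 := le_abs_self i.2
  unfold cf
  rw [abs_le]
  constructor <;> nlinarith [abs_nonneg (n : ℝ), abs_nonneg i.2,
    mul_nonneg (abs_nonneg i.2) (abs_nonneg (n : ℝ))]

lemma cf_add_int (s : Bool) (θ : ℝ) (m n : ℤ) : cf (s, θ + m) n = cf (s, θ) n + m := by
  unfold cf
  simp only
  rw [show θ + m - n * √2 = (θ - n * √2) + m by ring, fl_add_int]; push_cast; ring

lemma cf_sub_one (s : Bool) (θ : ℝ) (n : ℤ) : cf (s, θ) (n - 1) = cf (s, θ + √2) n := by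
  unfold cf
  simp only
  congr 2; push_cast; ring

/-- Up to an integer, two coefficient sequences differ by zeros and ones, with constant sign. -/
lemma cf_compare (i j : Bool × ℝ) : ∃ m : ℤ, (∀ n, cf j n + m - cf i n = 0 ∨ cf j n + m - cf i n = 1) ∨
    (∀ n, cf i n - (cf j n + m) = 0 ∨ cf i n - (cf j n + m) = 1) := by
  obtain ⟨s, θ⟩ := i
  obtain ⟨s', θ'⟩ := j
  have key : ∀ a b : ℤ, a ≤ b → b ≤ a + 1 → (b : ℝ) - a = 0 ∨ (b : ℝ) - a = 1 := fun a b h1 h2 => by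
    rcases h1.eq_or_lt with h | h
    · left; rw [h]; simp
    · right; rw [show b = a + 1 by omega]; push_cast; ring
  refine ⟨-⌊θ' - θ⌋, ?_⟩
  have h0 := Int.floor_le (θ' - θ)
  have h1 := Int.lt_floor_add_one (θ' - θ)
  set m : ℤ := -⌊θ' - θ⌋ with hm
  have hm' : (m : ℝ) = -⌊θ' - θ⌋ := by rw [hm]; push_cast; rfl
  have hcf : ∀ n, cf (s', θ') n + m = (fl s' (θ' + m - n * √2) : ℝ) := fun n => by
    rw [← cf_add_int]; rfl
  simp only [hcf]
  have hi : ∀ n, cf (s, θ) n = (fl s (θ - n * √2) : ℝ) := fun n => rfl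
  simp only [hi]
  rcases (show θ ≤ θ' + m by linarith).eq_or_lt with h | h
  · rw [← h]
    cases s
    · left; intro n
      apply key _ _ (fl_false_le _ _)
      have := fl_true_le_succ (θ - n * √2) false
      exact (fl_le_true _ _).trans this
    · right; intro n
      exact key _ _ (fl_le_true _ _) (fl_true_le_succ _ _)
  · left; intro n
    apply key _ _ (fl_le_of_lt (by linarith) _ _)
    have := fl_add_int s (θ - n * √2) 1
    rw [← this]
    apply fl_le_of_lt
    push_cast; linarith

namespace Bump
variable {d ε : ℝ} (b : Bump d ε)

lemma le_one (t : ℝ) : b.l t ≤ 1 := by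
  have := le_hasSum (b.hasSum t) 0 (fun n _ => (b.pos _).le)
  simpa using this

lemma rpow_le (t : ℝ) : b.l t ^ (11 / 10 : ℝ) ≤ b.l t := by
  have := Real.rpow_le_rpow_of_exponent_ge (b.pos t) (b.le_one t) (show (1 : ℝ) ≤ 11 / 10 by norm_num)
  rwa [Real.rpow_one] at this

lemma abs_l_le (t : ℝ) : |b.l t| ≤ (b.C + b.C ^ 2) / (1 + |t|) ^ 10 := by
  rw [abs_of_pos (b.pos t)]
  refine (b.decay t).trans ?_
  gcongr
  nlinarith [b.C_pos]

lemma abs_le_of_le {h : ℝ → ℝ} (hh : ∀ t, |h t| ≤ b.C * b.l t ^ (11 / 10 : ℝ)) (t : ℝ) :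
    |h t| ≤ (b.C + b.C ^ 2) / (1 + |t|) ^ 10 := by
  have h1 := b.C_pos
  calc |h t| ≤ b.C * b.l t := (hh t).trans (by gcongr; exact b.rpow_le t)
    _ ≤ b.C * (b.C / (1 + |t|) ^ 10) := by gcongr; exact b.decay t
    _ = b.C ^ 2 / (1 + |t|) ^ 10 := by ring
    _ ≤ _ := by gcongr; linarith

/-- The leaf functions. -/
noncomputable def Y (i : Bool × ℝ) (x : ℝ) : ℝ := ∑' n : ℤ, b.l (x + n) * cf i n
/-- Slopes of the leaves. -/
noncomputable def v (i : Bool × ℝ) (x : ℝ) : ℝ := ∑' n : ℤ, b.l' (x + n) * cf i n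
/-- Derivatives of the slopes of the leaves. -/
noncomputable def v' (i : Bool × ℝ) (x : ℝ) : ℝ := ∑' n : ℤ, b.l'' (x + n) * cf i n

lemma hasDerivAt_Y (i : Bool × ℝ) (x : ℝ) : HasDerivAt (b.Y i) (b.v i x) x :=
  hasDerivAt_wsum b.hasDerivAt_l b.abs_l_le (b.abs_le_of_le b.l'_le) (abs_cf_le i) x

lemma hasDerivAt_v (i : Bool × ℝ) (x : ℝ) : HasDerivAt (b.v i) (b.v' i x) x :=
  hasDerivAt_wsum b.hasDerivAt_l' (b.abs_le_of_le b.l'_le) (b.abs_le_of_le b.l''_le) (abs_cf_le i) x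

lemma continuous_v' (i : Bool × ℝ) : Continuous (b.v' i) :=
  continuous_wsum b.continuous_l'' (b.abs_le_of_le b.l''_le) (abs_cf_le i)

lemma one_le_weight (n : ℤ) : |((fun _ => 1 : ℤ → ℝ) n)| ≤ 1 * (1 + |(n : ℝ)|) := by simp

lemma tsum_l (x : ℝ) : ∑' n : ℤ, b.l (x + n) = 1 := (b.hasSum x).tsum_eq

lemma tsum_l' (x : ℝ) : ∑' n : ℤ, b.l' (x + n) = 0 := by
  have h := hasDerivAt_wsum b.hasDerivAt_l b.abs_l_le (b.abs_le_of_le b.l'_le) one_le_weight x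
  simp only [mul_one, b.tsum_l] at h
  exact h.unique (hasDerivAt_const x 1)

lemma tsum_l'' (x : ℝ) : ∑' n : ℤ, b.l'' (x + n) = 0 := by
  have h := hasDerivAt_wsum b.hasDerivAt_l' (b.abs_le_of_le b.l'_le) (b.abs_le_of_le b.l''_le)
    one_le_weight x
  simp only [mul_one, b.tsum_l'] at h
  exact h.unique (hasDerivAt_const x 0)

lemma Y_x_add_one (s : Bool) (θ x : ℝ) : b.Y (s, θ) (x + 1) = b.Y (s, θ + √2) x := by
  unfold Y; rw [wsum_shift]; simp only [cf_sub_one]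
lemma v_x_add_one (s : Bool) (θ x : ℝ) : b.v (s, θ) (x + 1) = b.v (s, θ + √2) x := by
  unfold v; rw [wsum_shift]; simp only [cf_sub_one]

lemma tsum_add_const {h : ℝ → ℝ} {C B : ℝ} {c : ℤ → ℝ} (hb : ∀ t, |h t| ≤ C / (1 + |t|) ^ 10)
    (hc : ∀ n, |c n| ≤ B * (1 + |(n : ℝ)|)) (x a : ℝ) :
    ∑' n : ℤ, h (x + n) * (c n + a) = ∑' n : ℤ, h (x + n) * c n + (∑' n : ℤ, h (x + n)) * a := by
  rw [← tsum_mul_right, ← (summable_wsum hb hc x).tsum_add]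
  · simp only [mul_add]
  · have := (summable_wsum hb one_le_weight x).mul_right a
    simpa using this

lemma Y_add_int (s : Bool) (θ x : ℝ) (m : ℤ) : b.Y (s, θ + m) x = b.Y (s, θ) x + m := by
  unfold Y; simp only [cf_add_int]
  rw [tsum_add_const b.abs_l_le (abs_cf_le _), b.tsum_l, one_mul]
lemma v_add_int (s : Bool) (θ x : ℝ) (m : ℤ) : b.v (s, θ + m) x = b.v (s, θ) x := by
  unfold v; simp only [cf_add_int]
  rw [tsum_add_const (b.abs_le_of_le b.l'_le) (abs_cf_le _), b.tsum_l', zero_mul, add_zero]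

lemma abs_tsum_le_rpow {h : ℝ → ℝ} (hh : ∀ t, |h t| ≤ b.C * b.l t ^ (11 / 10 : ℝ)) {e : ℤ → ℝ}
    (he : ∀ n, e n = 0 ∨ e n = 1) (x : ℝ) :
    |∑' n : ℤ, h (x + n) * e n| ≤ b.C * (∑' n : ℤ, b.l (x + n) * e n) ^ (11 / 10 : ℝ) := by
  have hC := b.C_pos
  have hw : ∀ n, |e n| ≤ 1 * (1 + |(n : ℝ)|) := fun n => by
    rcases he n with h | h <;> rw [h] <;> simp <;> positivity
  have hs := summable_wsum b.abs_l_le hw x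
  have hs' := summable_wsum (b.abs_le_of_le hh) hw x
  have h0 : ∀ n : ℤ, 0 ≤ b.l (x + n) * e n := fun n => by
    have := (b.pos (x + n)).le
    rcases he n with h | h <;> rw [h] <;> simp [this]
  set D := ∑' n : ℤ, b.l (x + n) * e n with hD
  have hD0 : 0 ≤ D := tsum_nonneg h0
  have ht : ∀ n : ℤ, ‖h (x + n) * e n‖ ≤ b.C * D ^ (1 / 10 : ℝ) * (b.l (x + n) * e n) := fun n => by
    have hle : b.l (x + n) * e n ≤ D := hs.le_tsum n (fun m _ => h0 m)
    rcases he n with h1 | h1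
    · rw [h1]; simp
    · rw [h1, mul_one] at hle
      rw [h1, mul_one, mul_one]
      refine (hh _).trans ?_
      rw [mul_assoc]
      gcongr
      rw [show (11 / 10 : ℝ) = 1 / 10 + 1 by norm_num, Real.rpow_add_one (b.pos _).ne']
      have := (b.pos (x + n)).le
      gcongr
  calc |∑' n : ℤ, h (x + n) * e n| ≤ ∑' n : ℤ, ‖h (x + n) * e n‖ := norm_tsum_le_tsum_norm hs'.norm
    _ ≤ ∑' n : ℤ, b.C * D ^ (1 / 10 : ℝ) * (b.l (x + n) * e n) :=
        hs'.norm.tsum_le_tsum ht (hs.mul_left _)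
    _ = b.C * D ^ (1 / 10 : ℝ) * D := by rw [tsum_mul_left]
    _ = _ := by
        rw [mul_assoc, show (11 / 10 : ℝ) = 1 / 10 + 1 by norm_num,
          Real.rpow_add_one' hD0 (by norm_num)]

lemma abs_tsum_le_sn {h : ℝ → ℝ} (hh : ∀ t, |h t| ≤ b.C * b.l t ^ (11 / 10 : ℝ))
    (hsum : ∀ x, ∑' n : ℤ, h (x + n) = 0) {e : ℤ → ℝ} (he : ∀ n, e n = 0 ∨ e n = 1) (x : ℝ) :
    |∑' n : ℤ, h (x + n) * e n| ≤ b.C * sn (∑' n : ℤ, b.l (x + n) * e n) ^ (11 / 10 : ℝ) := by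
  have hC := b.C_pos
  have hw : ∀ n, |e n| ≤ 1 * (1 + |(n : ℝ)|) := fun n => by
    rcases he n with h | h <;> rw [h] <;> simp <;> positivity
  have hw2 : ∀ n, |-e n| ≤ 1 * (1 + |(n : ℝ)|) := fun n => by rw [abs_neg]; exact hw n
  have he2 : ∀ n, -e n + 1 = 0 ∨ -e n + 1 = 1 := fun n => by
    rcases he n with h | h <;> rw [h] <;> norm_num
  have h1 := b.abs_tsum_le_rpow hh he x
  have h2 := b.abs_tsum_le_rpow hh he2 x
  rw [tsum_add_const b.abs_l_le hw2, tsum_add_const (b.abs_le_of_le hh) hw2, hsum, b.tsum_l] at h2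
  simp only [mul_neg, tsum_neg, zero_mul, add_zero, abs_neg, one_mul] at h2
  set D := ∑' n : ℤ, b.l (x + n) * e n with hD
  have hD0 : 0 ≤ D := tsum_nonneg fun n => by
    have := (b.pos (x + n)).le
    rcases he n with h | h <;> rw [h] <;> simp [this]
  have hD1 : 0 ≤ 1 - D := by
    have : 0 ≤ ∑' n : ℤ, b.l (x + n) * (-e n + 1) := tsum_nonneg fun n => by
      have := (b.pos (x + n)).le
      rcases he2 n with h | h <;> rw [h] <;> simp [this]
    rw [tsum_add_const b.abs_l_le hw2, b.tsum_l] at this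
    simp only [mul_neg, tsum_neg, one_mul] at this
    linarith
  have hm := min_le_sn hD0 (by linarith)
  rcases min_choice D (1 - D) with h | h <;> rw [h] at hm
  · exact h1.trans (by gcongr)
  · refine h2.trans ?_
    have h5 : -D + 1 ≤ sn D := by linarith
    have h6 : 0 ≤ -D + 1 := by linarith
    gcongr

lemma abs_sub_le_sn {h : ℝ → ℝ} (hh : ∀ t, |h t| ≤ b.C * b.l t ^ (11 / 10 : ℝ))
    (hsum : ∀ x, ∑' n : ℤ, h (x + n) = 0) (i j : Bool × ℝ) (x : ℝ) :
    |∑' n : ℤ, h (x + n) * cf i n - ∑' n : ℤ, h (x + n) * cf j n| ≤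
      b.C * sn (b.Y i x - b.Y j x) ^ (11 / 10 : ℝ) := by
  have key : ∀ (g : ℝ → ℝ) (C : ℝ) (m : ℤ), (∀ t, |g t| ≤ C / (1 + |t|) ^ 10) →
      ∑' n : ℤ, g (x + n) * (cf j n + m - cf i n) =
      ∑' n : ℤ, g (x + n) * cf j n + (∑' n : ℤ, g (x + n)) * m - ∑' n : ℤ, g (x + n) * cf i n := by
    intro g C m hg
    rw [← tsum_add_const hg (abs_cf_le j), ← Summable.tsum_sub]
    · simp only [mul_sub]
    · have h1 := (summable_wsum hg one_le_weight x).mul_right (m : ℝ)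
      simp only [mul_one] at h1
      simpa only [mul_add] using (summable_wsum hg (abs_cf_le j) x).add h1
    · exact summable_wsum hg (abs_cf_le i) x
  obtain ⟨m, hm⟩ := cf_compare i j
  have k1 := key b.l _ m b.abs_l_le
  have k2 := key h _ m (b.abs_le_of_le hh)
  rw [hsum, zero_mul, add_zero] at k2
  rw [b.tsum_l, one_mul] at k1
  have e1 : sn (b.Y i x - b.Y j x) = sn (∑' n : ℤ, b.l (x + n) * (cf j n + m - cf i n)) := by
    rw [k1, sn_sub_comm, ← sn_add_int _ m]; unfold Y; congr 1; ring
  rw [abs_sub_comm, ← k2, e1]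
  rcases hm with hm | hm
  · exact b.abs_tsum_le_sn hh hsum hm x
  · have := b.abs_tsum_le_sn hh hsum hm x
    rw [← sn_neg, ← tsum_neg, ← abs_neg, ← tsum_neg] at this
    simp only [← mul_neg, neg_sub] at this
    exact this

end Bump

lemma sqrt_two_bounds : 1 ≤ √2 ∧ √2 ≤ 3 / 2 := by
  constructor
  · rw [Real.one_le_sqrt]; norm_num
  · rw [Real.sqrt_le_left (by norm_num)]; norm_num

/-- `√2` is badly approximable. -/
lemma sqrt_two_badly_approximable {n : ℤ} (hn : n ≠ 0) (j : ℤ) :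
    1 / (4 * |(n : ℝ)|) ≤ |n * √2 - j| := by
  have hn1 : (1 : ℝ) ≤ |(n : ℝ)| := by exact_mod_cast Int.one_le_abs hn
  by_contra! h
  have h1 : (1 : ℝ) ≤ |n * √2 - j| * |n * √2 + j| := by
    rw [← abs_mul]
    have e : (n * √2 - j) * (n * √2 + j) = ((2 * n ^ 2 - j ^ 2 : ℤ) : ℝ) := by
      push_cast
      nlinarith [Real.sq_sqrt (show (0 : ℝ) ≤ 2 by norm_num)]
    rw [e]
    have : (2 * n ^ 2 - j ^ 2 : ℤ) ≠ 0 := by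
      intro h0
      have h3 : ((n : ℝ) * √2 - j) * (n * √2 + j) = 0 := by rw [e, h0]; simp
      have hirr := (irrational_sqrt_two.intCast_mul hn)
      rcases mul_eq_zero.1 h3 with h3 | h3
      · exact hirr ⟨j, by push_cast; linarith⟩
      · exact hirr ⟨-j, by push_cast; linarith⟩
    exact_mod_cast Int.one_le_abs this
  have h2 : |(n : ℝ) * √2 - j| ≤ 1 / 4 := by
    refine h.le.trans ?_
    rw [div_le_div_iff₀ (by positivity) (by norm_num)]; linarith
  have h3 : |(n : ℝ) * √2 + j| ≤ 13 / 4 * |(n : ℝ)| := by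
    have : |(n : ℝ) * √2 + j| ≤ |2 * (n * √2)| + |(n : ℝ) * √2 - j| := by
      have := abs_sub (2 * ((n : ℝ) * √2)) (n * √2 - j)
      refine le_trans (le_of_eq ?_) this
      congr 1; ring
    rw [abs_mul, abs_mul, abs_of_nonneg (Real.sqrt_nonneg 2), abs_of_pos (zero_lt_two' ℝ)] at this
    nlinarith [sqrt_two_bounds.2]
  have h4 : |(n : ℝ) * √2 - j| * |(n : ℝ) * √2 + j| ≤
      1 / (4 * |(n : ℝ)|) * (13 / 4 * |(n : ℝ)|) := by gcongr
  have h5 : 1 / (4 * |(n : ℝ)|) * (13 / 4 * |(n : ℝ)|) = 13 / 16 := by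
    field_simp; norm_num
  linarith

namespace Bump
variable {d ε : ℝ} (b : Bump d ε)

lemma shift_int {F : Bool × ℝ → ℝ → ℝ} (hF : ∀ s θ x, F (s, θ) (x + 1) = F (s, θ + √2) x)
    (s : Bool) (θ x : ℝ) (n : ℤ) : F (s, θ) (x + n) = F (s, θ + n * √2) x := by
  induction n generalizing θ with
  | zero => simp
  | succ k ih =>
    have := hF s θ (x + (k : ℤ))
    push_cast at this ih ⊢
    rw [show x + ((k : ℝ) + 1) = x + k + 1 by ring, this, ih]; congr 2; ring
  | pred k ih =>
    have := hF s (θ - √2) (x + ((-k - 1 : ℤ) : ℝ))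
    push_cast at this ih ⊢
    rw [show θ - √2 + √2 = θ by ring] at this
    rw [← this, show x + (-(k : ℝ) - 1) + 1 = x + -k by ring, ih, show θ - √2 + -k * √2 = θ + (-k - 1) * √2 by ring]

lemma exists_bound {h : ℝ → ℝ} (hh : ∀ t, |h t| ≤ b.C * b.l t ^ (11 / 10 : ℝ))
    (hsum : ∀ x, ∑' n : ℤ, h (x + n) = 0) (hc : Continuous h) :
    ∃ B, ∀ i x, |∑' n : ℤ, h (x + n) * cf i n| ≤ B := by
  have hcont : Continuous fun x => ∑' n : ℤ, h (x + n) * cf (true, 0) n :=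
    continuous_wsum hc (b.abs_le_of_le hh) (abs_cf_le _)
  obtain ⟨B, hB⟩ := (isCompact_Icc (a := (0 : ℝ)) (b := 1)).exists_bound_of_continuousOn
    hcont.continuousOn
  refine ⟨B + b.C, fun i x => ?_⟩
  have e := shift_int (F := fun i x => ∑' n : ℤ, h (x + n) * cf i n)
    (fun s θ x => by rw [wsum_shift]; simp only [cf_sub_one]) i.1 i.2 (Int.fract x) ⌊x⌋
  rw [Int.fract_add_floor] at e
  rw [show (i.1, i.2) = i from rfl] at e
  rw [e]
  have h1 := hB (Int.fract x) ⟨Int.fract_nonneg x, (Int.fract_lt_one x).le⟩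
  have h2 := b.abs_sub_le_sn hh hsum (i.1, i.2 + ⌊x⌋ * √2) (true, 0) (Int.fract x)
  have h3 : b.C * sn (b.Y (i.1, i.2 + ⌊x⌋ * √2) (Int.fract x) - b.Y (true, 0) (Int.fract x))
      ^ (11 / 10 : ℝ) ≤ b.C * 1 := by
    have := b.C_pos
    gcongr
    exact Real.rpow_le_one (sn_nonneg _) (sn_le_one _) (by norm_num)
  rw [Real.norm_eq_abs] at h1
  have h4 := abs_sub_abs_le_abs_sub (∑' n : ℤ, h (Int.fract x + n) * cf (i.1, i.2 + ⌊x⌋ * √2) n)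
    (∑' n : ℤ, h (Int.fract x + n) * cf (true, 0) n)
  linarith

lemma cf_eq_near (s : Bool) (θ₀ : ℝ) {N : ℕ} (hN : 1 ≤ N) :
    ∃ a : ℝ, ∀ θ ∈ Ioo a (a + 1 / (16 * N)), |θ - θ₀| ≤ 1 ∧
      ∀ n : ℤ, |n| ≤ N → cf (true, θ) n = cf (s, θ₀) n := by
  have hN' : (1 : ℝ) ≤ N := by exact_mod_cast hN
  set δ : ℝ := 1 / (16 * N) with hδ
  have hδ0 : 0 < δ := by positivity
  have hδ1 : δ ≤ 1 / 16 := by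
    rw [hδ]; gcongr; linarith
  by_contra! hcon
  obtain ⟨θ, hθ, h⟩ := hcon θ₀
  obtain ⟨n, hn, h1⟩ := h (by rw [abs_le]; constructor <;> linarith [hθ.1, hθ.2])
  obtain ⟨θ', hθ', h'⟩ := hcon (θ₀ - δ)
  obtain ⟨n', hn', h1'⟩ := h' (by rw [abs_le]; constructor <;> linarith [hθ'.1, hθ'.2])
  unfold cf at h1 h1'
  simp only [ne_eq, Int.cast_inj] at h1 h1'
  have h2 := fl_le_of_lt (show θ₀ - n * √2 < θ - n * √2 by linarith [hθ.1]) s true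
  have h2' := fl_le_of_lt (show θ' - n' * √2 < θ₀ - n' * √2 by linarith [hθ'.2]) true s
  have h3 : (fl s (θ₀ - n * √2) : ℝ) + 1 ≤ fl true (θ - n * √2) := by
    exact_mod_cast lt_of_le_of_ne h2 (Ne.symm h1)
  have h3' : (fl true (θ' - n' * √2) : ℝ) + 1 ≤ fl s (θ₀ - n' * √2) := by
    exact_mod_cast lt_of_le_of_ne h2' h1'
  have b1 := fl_bounds true (θ - n * √2)
  have b2 := fl_bounds true (θ' - n' * √2)
  have b3 := fl_bounds s (θ₀ - n * √2)
  have b4 := fl_bounds s (θ₀ - n' * √2)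
  by_cases hnn : n = n'
  · subst hnn
    linarith [hθ.2, hθ'.1]
  · have h5 := sqrt_two_badly_approximable (sub_ne_zero.2 hnn)
      (fl s (θ₀ - n' * √2) - fl s (θ₀ - n * √2) - 1)
    push_cast at h5
    have h6 : |((n : ℝ) - n') * √2 - (fl s (θ₀ - n' * √2) - fl s (θ₀ - n * √2) - 1)| < 2 * δ := by
      rw [abs_lt]
      constructor
      · linarith [hθ.2, hθ'.1]
      · linarith [hθ.2, hθ'.1]
    have h7 : |(n : ℝ) - n'| ≤ 2 * N := by
      have a1 : |(n : ℝ)| ≤ N := by exact_mod_cast hn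
      have a2 : |(n' : ℝ)| ≤ N := by exact_mod_cast hn'
      linarith [abs_sub (n : ℝ) n']
    have h8 : 0 < |(n : ℝ) - n'| := abs_pos.2 (sub_ne_zero.2 (by exact_mod_cast hnn))
    have h9 : 2 * δ ≤ 1 / (4 * |(n : ℝ) - n'|) := by
      rw [hδ, mul_one_div, div_le_div_iff₀ (by positivity) (by positivity)]
      linarith
    linarith

lemma abs_cf_sub_le (i j : Bool × ℝ) (n : ℤ) : |cf i n - cf j n| ≤ |i.2 - j.2| + 2 := by
  have h1 := fl_bounds i.1 (i.2 - n * √2)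
  have h2 := fl_bounds j.1 (j.2 - n * √2)
  unfold cf
  have := neg_abs_le (i.2 - j.2)
  have := le_abs_self (i.2 - j.2)
  rw [abs_le]; constructor <;> linarith

lemma exists_close_Icc : ∃ c > 0, ∀ i, ∀ x ∈ Icc (0 : ℝ) 1, ∀ ρ, 0 < ρ → ρ ≤ 1 →
    ∃ a, ∀ θ ∈ Ioo a (a + c * ρ ^ (1 / 8 : ℝ)), sn (b.Y (true, θ) x - b.Y i x) ≤ ρ := by
  have hC := b.C_pos
  set S := ∑' n, iw n with hS
  have hS0 : 0 ≤ S := tsum_nonneg fun n => (iw_pos n).le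
  set K := 4 * (3 * b.C * 2 ^ 10 * S) with hK
  have hK0 : 0 ≤ K := by positivity
  refine ⟨1 / (32 * (1 + K)), by positivity, fun i x hx ρ h0 h1 => ?_⟩
  set r := ρ ^ (1 / 8 : ℝ) with hr
  have hr0 : 0 < r := Real.rpow_pos_of_pos h0 _
  have hr1 : r ≤ 1 := Real.rpow_le_one h0.le h1 (by norm_num)
  have hr8 : r ^ 8 = ρ := by
    rw [hr, ← Real.rpow_natCast, ← Real.rpow_mul h0.le]; norm_num
  set N := ⌈(1 + K) / r⌉₊ with hN
  have hge : (1 + K) / r ≤ N := Nat.le_ceil _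
  have hlt : (N : ℝ) < (1 + K) / r + 1 := Nat.ceil_lt_add_one (by positivity)
  have h1r : 1 ≤ (1 + K) / r := by rw [le_div_iff₀ hr0]; linarith
  have hN1 : 1 ≤ N := by exact_mod_cast h1r.trans hge
  have hNp : (0 : ℝ) < N := by exact_mod_cast hN1
  obtain ⟨a, ha⟩ := cf_eq_near i.1 i.2 hN1
  refine ⟨a, fun θ hθ => ?_⟩
  have hθ' : θ ∈ Ioo a (a + 1 / (16 * N)) := by
    refine ⟨hθ.1, hθ.2.trans_le ?_⟩
    gcongr a + ?_
    rw [div_mul_eq_mul_div, one_mul, div_le_div_iff₀ (by positivity) (by positivity)]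
    have : r * N ≤ 2 * (1 + K) := by
      have : (N : ℝ) ≤ 2 * ((1 + K) / r) := by linarith
      calc r * N ≤ r * (2 * ((1 + K) / r)) := by gcongr
        _ = 2 * (1 + K) := by field_simp
    linarith
  obtain ⟨g1, g2⟩ := ha θ hθ'
  have hs1 := summable_wsum b.abs_l_le (abs_cf_le (true, θ)) x
  have hs2 := summable_wsum b.abs_l_le (abs_cf_le i) x
  have hterm : ∀ n : ℤ, ‖b.l (x + n) * cf (true, θ) n - b.l (x + n) * cf i n‖ ≤
      3 * b.C * 2 ^ 10 * (1 / (1 + K) * r) ^ 8 * iw n := fun n => by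
    by_cases hn : |n| ≤ N
    · rw [g2 n hn]; simp; have := (iw_pos n).le; positivity
    · have hn' : (N : ℝ) ≤ 1 + |(n : ℝ)| := by
        have : (N : ℤ) ≤ |n| := by omega
        have : (N : ℝ) ≤ |(n : ℝ)| := by exact_mod_cast this
        linarith
      rw [← mul_sub, norm_mul, Real.norm_eq_abs, Real.norm_eq_abs, abs_of_pos (b.pos _)]
      have e1 := abs_cf_sub_le (true, θ) i n
      have e2 : 1 + |(n : ℝ)| ≤ 2 * (1 + |x + n|) := by
        refine (one_add_abs_int_le x n).trans ?_
        gcongr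
        rw [abs_of_nonneg hx.1]; linarith [hx.2]
      have e3 : (1 + |(n : ℝ)|) ^ 10 ≤ 2 ^ 10 * (1 + |x + n|) ^ 10 := by
        rw [← mul_pow]; gcongr
      have e4 : b.l (x + n) ≤ b.C * 2 ^ 10 / (1 + |(n : ℝ)|) ^ 10 := by
        refine (b.decay _).trans ?_
        rw [div_le_div_iff₀ (by positivity) (by positivity)]
        nlinarith
      have e5 : 1 / (1 + |(n : ℝ)|) ≤ 1 / (1 + K) * r := by
        have : (1 + K) / r ≤ 1 + |(n : ℝ)| := hge.trans hn'
        calc 1 / (1 + |(n : ℝ)|) ≤ 1 / ((1 + K) / r) := by gcongr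
          _ = _ := by field_simp
      calc b.l (x + n) * |cf (true, θ) n - cf i n| ≤
          (b.C * 2 ^ 10 / (1 + |(n : ℝ)|) ^ 10) * 3 := by
            gcongr
            linarith
        _ = 3 * b.C * 2 ^ 10 * (1 / (1 + |(n : ℝ)|)) ^ 8 * iw n := by
            unfold iw; field_simp
        _ ≤ _ := by
            have := (iw_pos n).le
            gcongr
  have hmain : |b.Y (true, θ) x - b.Y i x| ≤ 3 * b.C * 2 ^ 10 * (1 / (1 + K) * r) ^ 8 * S := by
    unfold Y
    rw [← hs1.tsum_sub hs2, hS, ← tsum_mul_left]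
    exact tsum_of_norm_bounded (summable_iw.mul_left _).hasSum hterm
  refine (sn_le_mul_abs _).trans ?_
  calc 4 * |b.Y (true, θ) x - b.Y i x| ≤ 4 * (3 * b.C * 2 ^ 10 * (1 / (1 + K) * r) ^ 8 * S) := by
        gcongr
    _ = K * (1 / (1 + K)) ^ 8 * ρ := by rw [mul_pow, hr8, hK]; ring
    _ ≤ 1 * ρ := by
        gcongr
        rw [one_div, inv_pow, ← div_eq_mul_inv, div_le_one (by positivity)]
        calc K ≤ 1 + K := by linarith
          _ ≤ (1 + K) ^ 8 := le_self_pow₀ (by linarith) (by norm_num)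
    _ = ρ := one_mul _

lemma exists_close : ∃ c > 0, ∀ i x ρ, 0 < ρ → ρ ≤ 1 →
    ∃ a, ∀ θ ∈ Ioo a (a + c * ρ ^ (1 / 8 : ℝ)), sn (b.Y (true, θ) x - b.Y i x) ≤ ρ := by
  obtain ⟨c, hc, h⟩ := b.exists_close_Icc
  refine ⟨c, hc, fun i x ρ h0 h1 => ?_⟩
  obtain ⟨a, ha⟩ := h (i.1, i.2 + ⌊x⌋ * √2) (Int.fract x)
    ⟨Int.fract_nonneg x, (Int.fract_lt_one x).le⟩ ρ h0 h1
  refine ⟨a - ⌊x⌋ * √2, fun θ hθ => ?_⟩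
  have := ha (θ + ⌊x⌋ * √2) ⟨by linarith [hθ.1], by linarith [hθ.2]⟩
  rw [← shift_int b.Y_x_add_one, ← shift_int b.Y_x_add_one] at this
  rwa [Int.fract_add_floor] at this

lemma Y_le_of_lt (s s' : Bool) {θ θ' : ℝ} (h : θ < θ') (x : ℝ) : b.Y (s, θ) x ≤ b.Y (s', θ') x := by
  refine (summable_wsum b.abs_l_le (abs_cf_le _) x).tsum_le_tsum (fun n => ?_)
    (summable_wsum b.abs_l_le (abs_cf_le _) x)
  have := (b.pos (x + n)).le
  gcongr
  unfold cf
  exact Int.cast_le.2 (fl_le_of_lt (by simpa using h) s s')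

lemma Y_lt_of_lt (s s' : Bool) {θ θ' : ℝ} (h : θ < θ') (x : ℝ) : b.Y (s, θ) x < b.Y (s', θ') x := by
  have hd : Dense (AddSubgroup.closure {1, √2} : Set ℝ) := by
    rw [dense_addSubgroupClosure_pair_iff]
    simpa using irrational_sqrt_two
  obtain ⟨z, hz, hz'⟩ := hd.exists_between h
  obtain ⟨k, n, hkn⟩ := AddSubgroup.mem_closure_pair.1 hz
  simp only [zsmul_eq_mul, mul_one] at hkn
  refine (summable_wsum b.abs_l_le (abs_cf_le _) x).tsum_lt_tsum (i := n) (fun n => ?_) ?_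
    (summable_wsum b.abs_l_le (abs_cf_le _) x)
  · have := (b.pos (x + n)).le
    gcongr
    unfold cf
    exact Int.cast_le.2 (fl_le_of_lt (by simpa using h) s s')
  · have := (b.pos (x + n))
    gcongr
    unfold cf
    have e1 := fl_bounds s (θ - n * √2)
    have e2 := fl_bounds s' (θ' - n * √2)
    simp only
    have e3 : (fl s (θ - n * √2) : ℝ) < k := by linarith [hz'.1]
    have e4 : (k : ℝ) < fl s' (θ' - n * √2) + 1 := by linarith [hz'.2]
    have e3 : fl s (θ - n * √2) < k := by exact_mod_cast e3
    have e4 : k < fl s' (θ' - n * √2) + 1 := by exact_mod_cast e4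
    exact_mod_cast (show fl s (θ - n * √2) < fl s' (θ' - n * √2) by omega)

lemma not_closed (i : Bool × ℝ) (x : ℝ) (j n : ℤ) (h : b.Y i (x + j) = b.Y i x + n) : j = 0 := by
  obtain ⟨s, θ⟩ := i
  rw [shift_int b.Y_x_add_one, ← Y_add_int] at h
  have h2 : θ + j * √2 = θ + n := by
    rcases lt_trichotomy (θ + j * √2) (θ + n) with h1 | h1 | h1
    · exact absurd h (b.Y_lt_of_lt s s h1 x).ne
    · exact h1
    · exact absurd h (b.Y_lt_of_lt s s h1 x).ne'
  by_contra hj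
  exact irrational_sqrt_two.intCast_mul hj ⟨n, by push_cast; linarith⟩

lemma tendsto_Y {θ : ℝ} {s : Bool} {S : Set ℝ} (x : ℝ)
    (h : ∀ n : ℤ, ∀ᶠ t in 𝓝[S] θ, cf (true, t) n = cf (s, θ) n) :
    Tendsto (fun t => b.Y (true, t) x) (𝓝[S] θ) (𝓝 (b.Y (s, θ) x)) := by
  have hC := b.C_pos
  refine tendsto_tsum_of_dominated_convergence
    (bound := fun n => (b.C + b.C ^ 2) * (|θ| + 4) * (1 + |x|) ^ 10 * iw n) (summable_iw.mul_left _)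
    (fun n => ?_) ?_
  · exact (tendsto_const_nhds.congr' ((h n).mono fun t ht => by simp only [ht]))
  · have : ∀ᶠ t in 𝓝[S] θ, |t - θ| < 1 :=
      nhdsWithin_le_nhds (Metric.ball_mem_nhds θ one_pos)
    refine this.mono fun t ht n => ?_
    refine wsum_term_le (B := |θ| + 4) b.abs_l_le (fun n => ?_) le_rfl n
    refine (abs_cf_le _ n).trans ?_
    have := abs_sub_abs_le_abs_sub t θ
    have h3 : |t| + 3 ≤ |θ| + 4 := by linarith
    exact mul_le_mul_of_nonneg_right h3 (by positivity)

lemma tendsto_Y_left (θ x : ℝ) :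
    Tendsto (fun t => b.Y (true, t) x) (𝓝[<] θ) (𝓝 (b.Y (false, θ) x)) := by
  refine b.tendsto_Y x fun n => ?_
  have h1 := Int.le_ceil (θ - n * √2)
  have h2 := Int.ceil_lt_add_one (θ - n * √2)
  have : ∀ᶠ t in 𝓝[<] θ, θ - (θ - n * √2 - (⌈θ - n * √2⌉ - 1)) < t :=
    nhdsWithin_le_nhds (lt_mem_nhds (by linarith))
  filter_upwards [this, self_mem_nhdsWithin] with t h3 (h4 : t < θ)
  unfold cf fl
  simp only [if_true, Bool.false_eq_true, if_false, Int.cast_inj]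
  rw [Int.floor_eq_iff]
  push_cast
  constructor <;> linarith

lemma tendsto_Y_right (θ x : ℝ) :
    Tendsto (fun t => b.Y (true, t) x) (𝓝[>] θ) (𝓝 (b.Y (true, θ) x)) := by
  refine b.tendsto_Y x fun n => ?_
  have h1 := Int.floor_le (θ - n * √2)
  have h2 := Int.lt_floor_add_one (θ - n * √2)
  have : ∀ᶠ t in 𝓝[>] θ, t < θ + (⌊θ - n * √2⌋ + 1 - (θ - n * √2)) :=
    nhdsWithin_le_nhds (gt_mem_nhds (by linarith))
  filter_upwards [this, self_mem_nhdsWithin] with t h3 (h4 : θ < t)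
  unfold cf fl
  simp only [if_true, Int.cast_inj]
  rw [Int.floor_eq_iff]
  constructor <;> linarith

lemma exists_nearest (x y : ℝ) : ∃ i, ∀ j, sn (y - b.Y i x) ≤ sn (y - b.Y j x) := by
  set A := {θ | y ≤ b.Y (true, θ) x} with hA
  have hYn : ∀ n : ℤ, b.Y (true, (n : ℝ)) x = b.Y (true, 0) x + n := fun n => by
    rw [← b.Y_add_int, zero_add]
  have hne : A.Nonempty := by
    refine ⟨(⌈y - b.Y (true, 0) x⌉ : ℤ), ?_⟩
    rw [hA, mem_ofPred_eq]
    rw [hYn]; linarith [Int.le_ceil (y - b.Y (true, 0) x)]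
  have hbd : BddBelow A := by
    refine ⟨((⌊y - b.Y (true, 0) x⌋ - 1 : ℤ) : ℝ), fun θ hθ => ?_⟩
    by_contra! h
    have := b.Y_le_of_lt true true h x
    rw [hYn] at this
    push_cast at this
    have h2 : y ≤ b.Y (true, θ) x := hθ
    linarith [Int.floor_le (y - b.Y (true, 0) x)]
  set t := sInf A with ht
  have h1 : y ≤ b.Y (true, t) x := by
    refine ge_of_tendsto (b.tendsto_Y_right t x) ?_
    filter_upwards [self_mem_nhdsWithin] with θ (hθ : t < θ)
    obtain ⟨θ', h3, h4⟩ := exists_lt_of_csInf_lt hne hθ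
    exact le_trans h3 (b.Y_le_of_lt true true h4 x)
  have h2 : b.Y (false, t) x ≤ y := by
    refine le_of_tendsto (b.tendsto_Y_left t x) ?_
    filter_upwards [self_mem_nhdsWithin] with θ (hθ : θ < t)
    by_contra! h3
    exact absurd (csInf_le hbd (show θ ∈ A from h3.le)) (not_le.2 hθ)
  have h3 : b.Y (true, t) x ≤ b.Y (false, t) x + 1 := by
    have := b.Y_add_int false t x 1
    push_cast at this
    rw [← this]
    exact b.Y_le_of_lt _ _ (by linarith) x
  have hgap : ∀ j, b.Y j x ≤ b.Y (false, t) x ∨ b.Y (true, t) x ≤ b.Y j x := by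
    rintro ⟨s, θ⟩
    rcases lt_trichotomy θ t with h | h | h
    · left; exact b.Y_le_of_lt _ _ h x
    · subst h; cases s <;> simp
    · right; exact b.Y_le_of_lt _ _ h x
  have hfin : ∀ i, |y - b.Y i x| ≤ y - b.Y (false, t) x → |y - b.Y i x| ≤ b.Y (true, t) x - y →
      ∀ j, sn (y - b.Y i x) ≤ sn (y - b.Y j x) := by
    intro i hi1 hi2 ⟨s, θ⟩
    have hr := abs_sub_round (y - b.Y (s, θ) x)
    set m := round (y - b.Y (s, θ) x) with hm
    have e : sn (y - b.Y (s, θ) x) = sn (y - b.Y (s, θ) x - m) := by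
      rw [← sn_add_int _ (-m)]; push_cast; rfl
    rw [e]
    refine sn_mono ?_ hr
    have hY := b.Y_add_int s θ x m
    rcases hgap (s, θ + m) with h | h
    · rw [hY] at h
      exact le_trans (by linarith) (le_abs_self _)
    · rw [hY] at h
      exact le_trans (by linarith) (neg_le_abs _)
  rcases le_total (y - b.Y (false, t) x) (b.Y (true, t) x - y) with h | h
  · refine ⟨(false, t), hfin _ ?_ ?_⟩ <;> rw [abs_of_nonneg (by linarith)]
    linarith
  · refine ⟨(true, t), hfin _ ?_ ?_⟩ <;> rw [abs_of_nonpos (by linarith)] <;> linarith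

lemma measurable_wsum_cf {h : ℝ → ℝ} (hc : Continuous h) :
    Measurable fun p : ℝ × ℝ => ∑' n : ℤ, h (p.2 + n) * cf (true, p.1) n := by
  refine Measurable.tsum fun n => ?_
  refine Measurable.mul ?_ ?_
  · exact hc.measurable.comp (by fun_prop)
  · unfold cf fl
    simp only [if_true]
    have h1 : Measurable fun p : ℝ × ℝ => ⌊p.1 - n * √2⌋ := Int.measurable_floor.comp (by fun_prop)
    exact (measurable_of_countable (fun k : ℤ => (k : ℝ))).comp h1

end Bump

/-- A Denjoy type lamination of the torus: the leaves are the graphs of the functions `Y i`, and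
`Y (true, θ)` is a family of leaves carrying the transverse measure `dθ`. -/
structure Lam where
  Y : Bool × ℝ → ℝ → ℝ
  v : Bool × ℝ → ℝ → ℝ
  v' : Bool × ℝ → ℝ → ℝ
  B : ℝ
  B_pos : 0 < B
  c : ℝ
  c_pos : 0 < c
  hasDerivAt_Y : ∀ i x, HasDerivAt (Y i) (v i x) x
  hasDerivAt_v : ∀ i x, HasDerivAt (v i) (v' i x) x
  continuous_v' : ∀ i, Continuous (v' i)
  abs_v_le : ∀ i x, |v i x| ≤ B
  abs_v'_le : ∀ i x, |v' i x| ≤ B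
  v_sub_le : ∀ i j x, |v i x - v j x| ≤ B * sn (Y i x - Y j x) ^ (11 / 10 : ℝ)
  v'_sub_le : ∀ i j x, |v' i x - v' j x| ≤ B * sn (Y i x - Y j x) ^ (11 / 10 : ℝ)
  Y_x_add_one : ∀ s θ x, Y (s, θ) (x + 1) = Y (s, θ + √2) x
  v_x_add_one : ∀ s θ x, v (s, θ) (x + 1) = v (s, θ + √2) x
  Y_add_one : ∀ s θ x, Y (s, θ + 1) x = Y (s, θ) x + 1
  v_add_one : ∀ s θ x, v (s, θ + 1) x = v (s, θ) x
  close : ∀ i x ρ, 0 < ρ → ρ ≤ 1 →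
    ∃ a, ∀ θ ∈ Ioo a (a + c * ρ ^ (1 / 8 : ℝ)), sn (Y (true, θ) x - Y i x) ≤ ρ
  nearest : ∀ x y, ∃ i, ∀ j, sn (y - Y i x) ≤ sn (y - Y j x)
  location : ∀ i x y, sn (y - Y i x) ≤ 1 / 10 → 4 * sn x ^ 2 * sn y ^ 2 ≤ 1 / 2
  not_closed : ∀ i x (j n : ℤ), Y i (x + j) = Y i x + n → j = 0
  measurable_Y : Measurable fun p : ℝ × ℝ => Y (true, p.1) p.2
  measurable_v : Measurable fun p : ℝ × ℝ => v (true, p.1) p.2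
  measurable_v' : Measurable fun p : ℝ × ℝ => v' (true, p.1) p.2

lemma Bump.location {ε : ℝ} (b : Bump (8 / 100) ε) (hε0 : 0 < ε)
    (hε : ε * (2 ^ 11 * ∑' n, iw n) ≤ 1 / 100) (i : Bool × ℝ) (x y : ℝ)
    (h : sn (y - b.Y i x) ≤ 1 / 10) : 4 * sn x ^ 2 * sn y ^ 2 ≤ 1 / 2 := by
  have e0 := shift_int b.Y_x_add_one i.1 i.2 (Int.fract x) ⌊x⌋
  rw [Int.fract_add_floor, Prod.mk.eta] at e0
  have e1 : sn x = sn (Int.fract x) := by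
    rw [← sn_add_int (Int.fract x) ⌊x⌋, Int.fract_add_floor]
  rw [e0] at h
  rw [e1]
  generalize (i.1, i.2 + ⌊x⌋ * √2) = i at h
  have hx0 := Int.fract_nonneg x
  have hx1 := Int.fract_lt_one x
  generalize Int.fract x = x at *
  have hy := sn_le_one y
  have hyn := sn_nonneg y
  have hxn := sn_nonneg x
  by_cases hsx : sn x ≤ 35 / 100
  · calc 4 * sn x ^ 2 * sn y ^ 2 ≤ 4 * (35 / 100) ^ 2 * 1 ^ 2 := by gcongr
      _ ≤ 1 / 2 := by norm_num
  · push Not at hsx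
    have h1 := sn_le_mul_abs x
    have h2 := sn_le_mul_abs (x - 1)
    rw [show x - 1 = x + ((-1 : ℤ) : ℝ) by push_cast; ring, sn_add_int] at h2
    push_cast at h2
    rw [abs_of_nonneg hx0] at h1
    rw [abs_of_neg (by linarith)] at h2
    have h3 : |b.Y i x - fl i.1 i.2| ≤ ε * 2 ^ 11 * ∑' n, iw n := by
      have hs := summable_wsum b.abs_l_le (abs_cf_le i) x
      have hs1 := (summable_wsum b.abs_l_le one_le_weight x).mul_right (cf i 0)
      simp only [mul_one] at hs1
      have e2 : b.Y i x - fl i.1 i.2 = ∑' n : ℤ, (b.l (x + n) * cf i n - b.l (x + n) * cf i 0) := by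
        rw [hs.tsum_sub hs1, tsum_mul_right, b.tsum_l, one_mul]
        unfold Y
        congr 2
        simp
      rw [e2, ← tsum_mul_left, ← Real.norm_eq_abs]
      refine tsum_of_norm_bounded (summable_iw.mul_left _).hasSum fun n => ?_
      rw [← mul_sub, norm_mul, Real.norm_eq_abs, Real.norm_eq_abs, abs_of_pos (b.pos _)]
      by_cases hn : n = 0
      · subst hn; simp; have := (iw_pos 0).le; positivity
      · have hlt : b.l (x + n) ≤ ε / (1 + |x + n|) ^ 10 := by
          apply b.tail
          rcases lt_or_gt_of_ne hn with h | h
          · left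
            have : (n : ℝ) ≤ -1 := by exact_mod_cast (show n ≤ -1 by omega)
            linarith
          · right
            have : (1 : ℝ) ≤ n := by exact_mod_cast (show 1 ≤ n by omega)
            linarith
        have e2 : 1 + |(n : ℝ)| ≤ 2 * (1 + |x + n|) := by
          refine (one_add_abs_int_le x n).trans ?_
          gcongr
          rw [abs_of_nonneg hx0]; linarith
        have e3 : (1 + |(n : ℝ)|) ^ 10 ≤ 2 ^ 10 * (1 + |x + n|) ^ 10 := by
          rw [← mul_pow]; gcongr
        have e4 : b.l (x + n) ≤ ε * 2 ^ 10 / (1 + |(n : ℝ)|) ^ 10 := by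
          refine hlt.trans ?_
          rw [div_le_div_iff₀ (by positivity) (by positivity)]
          nlinarith
        have e5 : |cf i n - cf i 0| ≤ 2 * (1 + |(n : ℝ)|) := by
          have h1 := fl_bounds i.1 (i.2 - n * √2)
          have h2 := fl_bounds i.1 (i.2 - (0 : ℤ) * √2)
          have h4 := neg_abs_le (n : ℝ)
          have h5 := le_abs_self (n : ℝ)
          have h6 : |(n : ℝ) * √2| ≤ 3 / 2 * |(n : ℝ)| := by
            rw [abs_mul, abs_of_nonneg (Real.sqrt_nonneg 2)]
            nlinarith [sqrt_two_bounds.2, abs_nonneg (n : ℝ)]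
          have h7 := abs_le.1 h6
          have h8 := abs_nonneg (n : ℝ)
          unfold cf
          simp only [Int.cast_zero, zero_mul] at h2 ⊢
          rw [abs_le]
          constructor <;> linarith
        calc b.l (x + n) * |cf i n - cf i 0| ≤
            ε * 2 ^ 10 / (1 + |(n : ℝ)|) ^ 10 * (2 * (1 + |(n : ℝ)|)) := by gcongr
          _ = ε * 2 ^ 11 * (1 / (1 + |(n : ℝ)|) ^ 7 * iw n) := by
            unfold iw; field_simp
          _ ≤ ε * 2 ^ 11 * (1 * iw n) := by
            have := (iw_pos n).le
            gcongr
            rw [div_le_one (by positivity)]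
            exact one_le_pow₀ (by linarith [abs_nonneg (n : ℝ)])
          _ = _ := by ring
    have h4 : sn (b.Y i x) ≤ 4 / 100 := by
      have := sn_le_mul_abs (b.Y i x - fl i.1 i.2)
      have e : sn (b.Y i x - fl i.1 i.2) = sn (b.Y i x) := by
        rw [← sn_add_int (b.Y i x) (-fl i.1 i.2)]; push_cast; rfl
      rw [e] at this
      linarith
    have h5 : sn y ≤ 14 / 100 := by
      have := sn_add_le (y - b.Y i x) (b.Y i x)
      rw [sub_add_cancel] at this
      linarith
    calc 4 * sn x ^ 2 * sn y ^ 2 ≤ 4 * 1 ^ 2 * (14 / 100) ^ 2 := by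
          gcongr
          exact sn_le_one x
      _ ≤ 1 / 2 := by norm_num

lemma nonempty_lam : Nonempty Lam := by
  have hS : 0 ≤ ∑' n, iw n := tsum_nonneg fun n => (iw_pos n).le
  set ε : ℝ := 1 / (100 * (2 ^ 11 * ∑' n, iw n + 1)) with hε
  have hε0 : 0 < ε := by positivity
  have hε1 : ε * (2 ^ 11 * ∑' n, iw n) ≤ 1 / 100 := by
    rw [hε, div_mul_eq_mul_div, div_le_div_iff₀ (by positivity) (by positivity)]
    linarith
  obtain ⟨b⟩ := nonempty_bump (show (0 : ℝ) < 8 / 100 by norm_num) hε0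
  obtain ⟨B1, hB1⟩ := b.exists_bound b.l'_le b.tsum_l' (by
    exact continuous_iff_continuousAt.2 fun t => (b.hasDerivAt_l' t).continuousAt)
  obtain ⟨B2, hB2⟩ := b.exists_bound b.l''_le b.tsum_l'' b.continuous_l''
  obtain ⟨c, hc, hclose⟩ := b.exists_close
  have hB0 : b.C ≤ max b.C (max B1 B2) := le_max_left _ _
  have hcl : Continuous b.l := continuous_iff_continuousAt.2 fun t => (b.hasDerivAt_l t).continuousAt
  have hcl' : Continuous b.l' :=
    continuous_iff_continuousAt.2 fun t => (b.hasDerivAt_l' t).continuousAt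
  exact ⟨{
    Y := b.Y
    v := b.v
    v' := b.v'
    B := max b.C (max B1 B2)
    B_pos := b.C_pos.trans_le hB0
    c := c
    c_pos := hc
    hasDerivAt_Y := b.hasDerivAt_Y
    hasDerivAt_v := b.hasDerivAt_v
    continuous_v' := b.continuous_v'
    abs_v_le := fun i x => (hB1 i x).trans (by simp)
    abs_v'_le := fun i x => (hB2 i x).trans (by simp)
    v_sub_le := fun i j x => (b.abs_sub_le_sn b.l'_le b.tsum_l' i j x).trans
      (mul_le_mul_of_nonneg_right hB0 (Real.rpow_nonneg (sn_nonneg _) _))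
    v'_sub_le := fun i j x => (b.abs_sub_le_sn b.l''_le b.tsum_l'' i j x).trans
      (mul_le_mul_of_nonneg_right hB0 (Real.rpow_nonneg (sn_nonneg _) _))
    Y_x_add_one := b.Y_x_add_one
    v_x_add_one := b.v_x_add_one
    Y_add_one := fun s θ x => by simpa using b.Y_add_int s θ x 1
    v_add_one := fun s θ x => by simpa using b.v_add_int s θ x 1
    close := hclose
    nearest := b.exists_nearest
    location := b.location hε0 hε1
    not_closed := b.not_closed
    measurable_Y := Bump.measurable_wsum_cf hcl
    measurable_v := Bump.measurable_wsum_cf hcl'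
    measurable_v' := Bump.measurable_wsum_cf b.continuous_l'' }⟩

lemma hasDerivAt_max_sq (x : ℝ) : HasDerivAt (fun x : ℝ => (max x 0) ^ 2) (2 * max x 0) x := by
  rcases lt_trichotomy x 0 with h | h | h
  · rw [max_eq_right h.le, mul_zero]
    refine (hasDerivAt_const x (0 : ℝ)).congr_of_eventuallyEq ?_
    filter_upwards [gt_mem_nhds h] with y (hy : y < 0)
    rw [max_eq_right hy.le]; norm_num
  · subst h
    rw [max_self, mul_zero, hasDerivAt_iff_isLittleO_nhds_zero]
    simp only [zero_add, max_self, smul_zero, sub_zero, ne_eq, OfNat.ofNat_ne_zero,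
      not_false_eq_true, zero_pow]
    have h1 : (fun h : ℝ => h ^ 2) =o[𝓝 0] fun h => h := Asymptotics.isLittleO_pow_id one_lt_two
    refine Asymptotics.IsBigO.trans_isLittleO (Asymptotics.IsBigO.of_bound 1 ?_) h1
    refine Eventually.of_forall fun y => ?_
    rw [one_mul, Real.norm_eq_abs, Real.norm_eq_abs, abs_of_nonneg (by positivity),
      abs_of_nonneg (by positivity), sq_le_sq]
    rcases max_choice y 0 with h | h <;> rw [h]
    simp
  · rw [max_eq_left h.le]
    have := hasDerivAt_pow 2 x
    simp only [Nat.cast_ofNat, Nat.add_one_sub_one, pow_one] at this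
    refine this.congr_of_eventuallyEq ?_
    filter_upwards [lt_mem_nhds h] with y (hy : 0 < y)
    rw [max_eq_left hy.le]

/-- The radial kernel, as a function of the squared distance. -/
noncomputable def kf (t₀ t : ℝ) : ℝ := t ^ (-(3 / 4) : ℝ) * (max (1 - t / t₀) 0) ^ 2
/-- The derivative of `kf`. -/
noncomputable def kf' (t₀ t : ℝ) : ℝ :=
  -(3 / 4) * t ^ (-(7 / 4) : ℝ) * (max (1 - t / t₀) 0) ^ 2 -
    2 / t₀ * t ^ (-(3 / 4) : ℝ) * max (1 - t / t₀) 0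

section
variable {t₀ t : ℝ}

lemma hasDerivAt_kf (ht : t ≠ 0) : HasDerivAt (kf t₀) (kf' t₀ t) t := by
  have h1 := Real.hasDerivAt_rpow_const (x := t) (p := (-(3 / 4) : ℝ)) (Or.inl ht)
  have h2 : HasDerivAt (fun t : ℝ => 1 - t / t₀) (-(1 / t₀)) t := by
    simpa using ((hasDerivAt_id t).div_const t₀).const_sub 1
  have h3 := (hasDerivAt_max_sq (1 - t / t₀)).comp t h2
  refine (h1.mul h3).congr_deriv ?_
  unfold kf'
  rw [show (-(3 / 4) - 1 : ℝ) = -(7 / 4) by norm_num]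
  simp only [Function.comp]
  ring

lemma kf_nonneg (ht : 0 ≤ t) : 0 ≤ kf t₀ t := by
  unfold kf; have := Real.rpow_nonneg ht (-(3 / 4) : ℝ); positivity

lemma max_one_sub_le_one (h0 : 0 < t₀) (ht : 0 ≤ t) : max (1 - t / t₀) 0 ≤ 1 := by
  have : 0 ≤ t / t₀ := by positivity
  exact max_le (by linarith) zero_le_one

lemma kf_eq_zero (h0 : 0 < t₀) (h : t₀ ≤ t) : kf t₀ t = 0 := by
  unfold kf
  rw [max_eq_right (by rw [sub_nonpos, one_le_div h0]; exact h)]; simp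

lemma kf'_eq_zero (h0 : 0 < t₀) (h : t₀ ≤ t) : kf' t₀ t = 0 := by
  unfold kf'
  rw [max_eq_right (by rw [sub_nonpos, one_le_div h0]; exact h)]; simp

lemma sq_rpow {r : ℝ} (hr : 0 ≤ r) (p : ℝ) : (r ^ 2) ^ p = r ^ (2 * p) := by
  rw [← Real.rpow_natCast, ← Real.rpow_mul hr]; norm_num

lemma kf_sq_le {r : ℝ} (h0 : 0 < t₀) (hr : 0 ≤ r) : kf t₀ (r ^ 2) ≤ r ^ (-(3 / 2) : ℝ) := by
  unfold kf
  rw [sq_rpow hr]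
  have h1 := max_one_sub_le_one h0 (sq_nonneg r)
  have h2 := Real.rpow_nonneg hr (-(3 / 2) : ℝ)
  rw [show (2 * -(3 / 4) : ℝ) = -(3 / 2) by norm_num]
  calc _ ≤ r ^ (-(3 / 2) : ℝ) * 1 ^ 2 := by gcongr
    _ = _ := by ring

lemma le_kf_sq {r : ℝ} (h0 : 0 < t₀) (hr : 0 ≤ r) (h : r ^ 2 ≤ t₀ / 2) :
    1 / 4 * r ^ (-(3 / 2) : ℝ) ≤ kf t₀ (r ^ 2) := by
  unfold kf
  rw [sq_rpow hr]
  have h2 := Real.rpow_nonneg hr (-(3 / 2) : ℝ)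
  rw [show (2 * -(3 / 4) : ℝ) = -(3 / 2) by norm_num]
  have : 1 / 2 ≤ max (1 - r ^ 2 / t₀) 0 := by
    refine le_max_of_le_left ?_
    have : r ^ 2 / t₀ ≤ 1 / 2 := by rw [div_le_iff₀ h0]; linarith
    linarith
  calc 1 / 4 * r ^ (-(3 / 2) : ℝ) = r ^ (-(3 / 2) : ℝ) * (1 / 2) ^ 2 := by ring
    _ ≤ _ := by gcongr

lemma abs_kf'_mul_le (h0 : 0 < t₀) (h1 : t₀ ≤ 1) (ht : 0 < t) :
    |kf' t₀ t| * t ≤ kf t₀ t + 2 / t₀ := by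
  rcases le_total t₀ t with h | h
  · rw [kf'_eq_zero h0 h, kf_eq_zero h0 h]; simp; positivity
  · unfold kf kf'
    have hm0 : 0 ≤ max (1 - t / t₀) 0 := le_max_right _ _
    have hm := max_one_sub_le_one h0 ht.le
    set m := max (1 - t / t₀) 0
    have e1 : t ^ (-(7 / 4) : ℝ) * t = t ^ (-(3 / 4) : ℝ) := by
      rw [← Real.rpow_add_one ht.ne']; norm_num
    have e2 : t ^ (-(3 / 4) : ℝ) * t = t ^ (1 / 4 : ℝ) := by
      rw [← Real.rpow_add_one ht.ne']; norm_num
    have e3 : t ^ (1 / 4 : ℝ) ≤ 1 := Real.rpow_le_one ht.le (h.trans h1) (by norm_num)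
    have p1 := Real.rpow_nonneg ht.le (-(3 / 4) : ℝ)
    have p2 := Real.rpow_nonneg ht.le (-(7 / 4) : ℝ)
    have p3 := Real.rpow_nonneg ht.le (1 / 4 : ℝ)
    have e4 : |-(3 / 4) * t ^ (-(7 / 4) : ℝ) * m ^ 2 - 2 / t₀ * t ^ (-(3 / 4) : ℝ) * m| =
        3 / 4 * t ^ (-(7 / 4) : ℝ) * m ^ 2 + 2 / t₀ * t ^ (-(3 / 4) : ℝ) * m := by
      rw [abs_of_nonpos]
      · ring
      · have : 0 ≤ 3 / 4 * t ^ (-(7 / 4) : ℝ) * m ^ 2 + 2 / t₀ * t ^ (-(3 / 4) : ℝ) * m := by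
          positivity
        linarith
    rw [e4, add_mul, show 3 / 4 * t ^ (-(7 / 4) : ℝ) * m ^ 2 * t =
      3 / 4 * (t ^ (-(7 / 4) : ℝ) * t) * m ^ 2 by ring, e1, show 2 / t₀ * t ^ (-(3 / 4) : ℝ) * m * t =
      2 / t₀ * ((t ^ (-(3 / 4) : ℝ) * t) * m) by ring, e2]
    gcongr
    · have : 0 ≤ t ^ (-(3 / 4) : ℝ) * m ^ 2 := by positivity
      linarith
    · have : t ^ (1 / 4 : ℝ) * m ≤ 1 * 1 := by gcongr
      calc 2 / t₀ * (t ^ (1 / 4 : ℝ) * m) ≤ 2 / t₀ * (1 * 1) := by gcongr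
        _ = _ := by ring

lemma kf_mul_rpow_le {r ρ s : ℝ} (h0 : 0 < t₀) (hr : 0 < r) (hρ : 0 < ρ) (hs : 0 ≤ s)
    (hs' : s ≤ 3 / 2) : kf t₀ (r ^ 2) * r ^ s ≤ ρ ^ s * kf t₀ (r ^ 2) + ρ ^ (s - 3 / 2) := by
  have hk : 0 ≤ kf t₀ (r ^ 2) := kf_nonneg (sq_nonneg r)
  have p1 := Real.rpow_nonneg hρ.le (s - 3 / 2)
  have p2 := Real.rpow_nonneg hρ.le s
  rcases le_total r ρ with h | h
  · have := Real.rpow_le_rpow hr.le h hs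
    nlinarith
  · have h2 : kf t₀ (r ^ 2) * r ^ s ≤ r ^ (s - 3 / 2) := by
      calc kf t₀ (r ^ 2) * r ^ s ≤ r ^ (-(3 / 2) : ℝ) * r ^ s := by
            gcongr; exact kf_sq_le h0 hr.le
        _ = r ^ (s - 3 / 2) := by rw [← Real.rpow_add hr]; congr 1; ring
    have h3 := Real.rpow_le_rpow_of_nonpos hρ h (show s - 3 / 2 ≤ 0 by linarith)
    have : 0 ≤ ρ ^ s * kf t₀ (r ^ 2) := by positivity
    linarith

lemma continuousAt_kf (ht : t ≠ 0) : ContinuousAt (kf t₀) t := (hasDerivAt_kf ht).continuousAt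

lemma continuousAt_kf' (ht : t ≠ 0) : ContinuousAt (kf' t₀) t := by
  unfold kf'
  have h1 : ContinuousAt (fun t : ℝ => t ^ (-(7 / 4) : ℝ)) t :=
    Real.continuousAt_rpow_const _ _ (Or.inl ht)
  have h2 : ContinuousAt (fun t : ℝ => t ^ (-(3 / 4) : ℝ)) t :=
    Real.continuousAt_rpow_const _ _ (Or.inl ht)
  have h3 : ContinuousAt (fun t : ℝ => max (1 - t / t₀) 0) t := by fun_prop
  exact ((continuousAt_const.mul h1).mul (h3.pow 2)).sub ((continuousAt_const.mul h2).mul h3)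

lemma measurable_kf : Measurable (kf t₀) := by unfold kf; fun_prop
lemma measurable_kf' : Measurable (kf' t₀) := by unfold kf'; fun_prop

end

section

/-- The parameter measure. -/
noncomputable abbrev pm : Measure ℝ := volume.restrict (Ioc 0 1)

instance : IsProbabilityMeasure pm := ⟨by simp⟩

/-- A family of subsets of `E`, described by distance functions `r i`, containing the
family `r (true, θ)` carrying the measure `dθ`, together with a weight `w`. -/
structure Geo (E : Type*) [NormedAddCommGroup E] [NormedSpace ℝ E] where
  r : Bool × ℝ → E → ℝ
  D : Bool × ℝ → E → E →L[ℝ] ℝ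
  w : E → ℝ
  w' : E → E →L[ℝ] ℝ
  B : ℝ
  c : ℝ
  t₀ : ℝ
  B_pos : 0 < B
  c_pos : 0 < c
  c_le_one : c ≤ 1
  t₀_pos : 0 < t₀
  t₀_le_one : t₀ ≤ 1
  r_nonneg : ∀ i p, 0 ≤ r i p
  r_sub_le : ∀ i p q, |r i p - r i q| ≤ B * ‖p - q‖
  hasFDerivAt_sq : ∀ i p, HasFDerivAt (fun p => r i p ^ 2) (D i p) p
  norm_D_le : ∀ i p, ‖D i p‖ ≤ B * r i p
  continuous_D : ∀ i, Continuous (D i)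
  hasFDerivAt_w : ∀ p, HasFDerivAt w (w' p) p
  continuous_w' : Continuous w'
  w_pos : ∀ p, 0 < w p
  w_le : ∀ p, w p ≤ B
  norm_w'_le : ∀ p, ‖w' p‖ ≤ B
  r_add_one : ∀ θ p, r (true, θ + 1) p = r (true, θ) p
  close : ∀ i p ρ, 0 < ρ → ρ ≤ 1 →
    ∃ a, ∀ θ ∈ Ioo a (a + c * ρ ^ (1 / 8 : ℝ)), r (true, θ) p ≤ r i p + ρ
  nearest : ∀ p, ∃ i, ∀ j, r i p ≤ r j p
  measurable_r : ∀ p, Measurable fun θ => r (true, θ) p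
  measurable_D : ∀ p, StronglyMeasurable fun θ => D (true, θ) p

/-- Functions on the members of the family, varying in a Hölder way across the family. -/
structure Sec {E : Type*} [NormedAddCommGroup E] [NormedSpace ℝ E] (G : Geo E) where
  u : Bool × ℝ → E → ℝ
  u' : Bool × ℝ → E → E →L[ℝ] ℝ
  A : ℝ
  A_pos : 0 < A
  hasFDerivAt_u : ∀ i p, HasFDerivAt (u i) (u' i p) p
  continuous_u' : ∀ i, Continuous (u' i)
  abs_u_le : ∀ i p, |u i p| ≤ A
  norm_u'_le : ∀ i p, ‖u' i p‖ ≤ A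
  u_sub_le : ∀ i j p, |u i p - u j p| ≤ A * (G.r i p + G.r j p) ^ (11 / 10 : ℝ)
  u'_sub_le : ∀ i j p, ‖u' i p - u' j p‖ ≤ A * (G.r i p + G.r j p) ^ (11 / 10 : ℝ)
  measurable_u : ∀ p, StronglyMeasurable fun θ => u (true, θ) p
  measurable_u' : ∀ p, StronglyMeasurable fun θ => u' (true, θ) p

variable {E : Type*} [NormedAddCommGroup E] [NormedSpace ℝ E]

namespace Geo
variable (G : Geo E)

/-- The index of a nearest member. -/
noncomputable def near (p : E) : Bool × ℝ := (G.nearest p).choose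
/-- The distance to the union of the family. -/
noncomputable def R (p : E) : ℝ := G.r (G.near p) p
lemma R_le (p : E) (j : Bool × ℝ) : G.R p ≤ G.r j p := (G.nearest p).choose_spec j
lemma R_nonneg (p : E) : 0 ≤ G.R p := G.r_nonneg _ _
lemma r_near_le (p : E) (j : Bool × ℝ) : G.r (G.near p) p ≤ G.r j p := G.R_le p j

lemma R_sub_le (p q : E) : G.R p - G.R q ≤ G.B * ‖p - q‖ := by
  have h1 := G.R_le p (G.near q)
  have h2 := (abs_le.1 (G.r_sub_le (G.near q) p q)).2
  unfold R at *
  linarith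

lemma continuous_r (i : Bool × ℝ) : Continuous (G.r i) := by
  have hB := G.B_pos
  refine LipschitzWith.continuous (K := ⟨G.B, hB.le⟩) (LipschitzWith.of_dist_le_mul fun p q => ?_)
  rw [Real.dist_eq, dist_eq_norm]; exact G.r_sub_le i p q

lemma continuous_R : Continuous G.R := by
  have hB := G.B_pos
  refine LipschitzWith.continuous (K := ⟨G.B, hB.le⟩) (LipschitzWith.of_dist_le_mul fun p q => ?_)
  rw [Real.dist_eq, dist_eq_norm, abs_le]
  refine ⟨?_, G.R_sub_le p q⟩
  have := G.R_sub_le q p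
  rw [norm_sub_rev] at this
  change -(G.B * ‖p - q‖) ≤ _
  linarith

/-- The kernel. -/
noncomputable def k (p : E) (θ : ℝ) : ℝ := kf G.t₀ (G.r (true, θ) p ^ 2)
/-- The derivative of the profile of the kernel. -/
noncomputable def k' (p : E) (θ : ℝ) : ℝ := kf' G.t₀ (G.r (true, θ) p ^ 2)

lemma k_nonneg (p : E) (θ : ℝ) : 0 ≤ G.k p θ := kf_nonneg (sq_nonneg _)
lemma measurable_k (p : E) : Measurable (G.k p) := measurable_kf.comp ((G.measurable_r p).pow_const 2)
lemma measurable_k' (p : E) : Measurable (G.k' p) :=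
  measurable_kf'.comp ((G.measurable_r p).pow_const 2)

lemma k_le {p : E} {δ : ℝ} (hδ : 0 < δ) (h : δ ≤ G.R p) (θ : ℝ) :
    G.k p θ ≤ δ ^ (-(3 / 2) : ℝ) := by
  have h1 : δ ≤ G.r (true, θ) p := h.trans (G.R_le p _)
  refine (kf_sq_le G.t₀_pos (hδ.le.trans h1)).trans ?_
  exact Real.rpow_le_rpow_of_nonpos hδ h1 (by norm_num)

lemma abs_k'_le {p : E} {δ : ℝ} (hδ : 0 < δ) (h : δ ≤ G.R p) (θ : ℝ) :
    |G.k' p θ| ≤ (δ ^ (-(3 / 2) : ℝ) + 2 / G.t₀) / δ ^ 2 := by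
  have h1 : δ ≤ G.r (true, θ) p := h.trans (G.R_le p _)
  have h2 := abs_kf'_mul_le G.t₀_pos G.t₀_le_one (t := G.r (true, θ) p ^ 2)
    (pow_pos (hδ.trans_le h1) 2)
  have h3 := G.k_le hδ h θ
  rw [le_div_iff₀ (by positivity)]
  calc |G.k' p θ| * δ ^ 2 ≤ |G.k' p θ| * G.r (true, θ) p ^ 2 := by gcongr
    _ ≤ G.k p θ + 2 / G.t₀ := h2
    _ ≤ _ := by gcongr

lemma integrable_k {p : E} (h : 0 < G.R p) : Integrable (G.k p) pm :=
  Integrable.of_bound (G.measurable_k p).aestronglyMeasurable (G.R p ^ (-(3 / 2) : ℝ))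
    (Eventually.of_forall fun θ => by
      rw [Real.norm_of_nonneg (G.k_nonneg p θ)]; exact G.k_le h le_rfl θ)

/-- The total mass of the kernel. -/
noncomputable def M (p : E) : ℝ := ∫ θ, G.k p θ ∂pm

lemma M_nonneg (p : E) : 0 ≤ G.M p := integral_nonneg fun θ => G.k_nonneg p θ

lemma wM_pos (p : E) : 0 < G.w p + G.M p := add_pos_of_pos_of_nonneg (G.w_pos p) (G.M_nonneg p)

lemma norm_integral_le_of_le {X : Type*} [NormedAddCommGroup X] [NormedSpace ℝ X] {p : E}
    (h : 0 < G.R p) {F : ℝ → X} {a b : ℝ} (hF : ∀ θ, ‖F θ‖ ≤ a * G.k p θ + b) :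
    ‖∫ θ, F θ ∂pm‖ ≤ a * G.M p + b := by
  have h1 := (G.integrable_k h).const_mul a
  refine (norm_integral_le_of_norm_le (h1.add (integrable_const b))
    (Eventually.of_forall hF)).trans (le_of_eq ?_)
  simp only [Pi.add_apply]
  rw [integral_add h1 (integrable_const b), integral_const_mul]
  simp [M]

/-- The constant function. -/
noncomputable def one : Sec G where
  u := fun _ _ => 1
  u' := fun _ _ => 0
  A := 1
  A_pos := one_pos
  hasFDerivAt_u := fun _ _ => hasFDerivAt_const _ _
  continuous_u' := fun _ => continuous_const
  abs_u_le := fun _ _ => by simp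
  norm_u'_le := fun _ _ => by simp
  u_sub_le := fun i j p => by
    have := Real.rpow_nonneg (add_nonneg (G.r_nonneg i p) (G.r_nonneg j p)) (11 / 10 : ℝ)
    simpa using this
  u'_sub_le := fun i j p => by
    have := Real.rpow_nonneg (add_nonneg (G.r_nonneg i p) (G.r_nonneg j p)) (11 / 10 : ℝ)
    simpa using this
  measurable_u := fun _ => stronglyMeasurable_const
  measurable_u' := fun _ => stronglyMeasurable_const

end Geo

namespace Sec
variable {G : Geo E} (s : Sec G)

/-- The integrated function. -/
noncomputable def N (p : E) : ℝ := ∫ θ, G.k p θ * s.u (true, θ) p ∂pm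

/-- The derivative of the integrand of `N`. -/
noncomputable def dF (p : E) (θ : ℝ) : E →L[ℝ] ℝ :=
  G.k p θ • s.u' (true, θ) p + s.u (true, θ) p • (G.k' p θ • G.D (true, θ) p)

/-- The derivative of `N`. -/
noncomputable def dN (p : E) : E →L[ℝ] ℝ := ∫ θ, s.dF p θ ∂pm

lemma stronglyMeasurable_F (p : E) : StronglyMeasurable fun θ => G.k p θ * s.u (true, θ) p :=
  (G.measurable_k p).stronglyMeasurable.mul (s.measurable_u p)

lemma stronglyMeasurable_dF (p : E) : StronglyMeasurable (s.dF p) :=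
  ((G.measurable_k p).stronglyMeasurable.smul (s.measurable_u' p)).add
    ((s.measurable_u p).smul ((G.measurable_k' p).stronglyMeasurable.smul (G.measurable_D p)))

lemma integrable_F {p : E} (h : 0 < G.R p) :
    Integrable (fun θ => G.k p θ * s.u (true, θ) p) pm := by
  refine Integrable.of_bound (s.stronglyMeasurable_F p).aestronglyMeasurable
    (G.R p ^ (-(3 / 2) : ℝ) * s.A) (Eventually.of_forall fun θ => ?_)
  rw [norm_mul, Real.norm_of_nonneg (G.k_nonneg p θ)]
  have := G.k_le h le_rfl θ
  have := s.abs_u_le (true, θ) p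
  have := G.k_nonneg p θ
  rw [Real.norm_eq_abs]
  gcongr

lemma hasFDerivAt_F {p : E} (h : 0 < G.R p) (θ : ℝ) :
    HasFDerivAt (fun p => G.k p θ * s.u (true, θ) p) (s.dF p θ) p := by
  have h1 : HasFDerivAt (fun p => G.k p θ) (G.k' p θ • G.D (true, θ) p) p :=
    (hasDerivAt_kf (pow_pos (h.trans_le (G.R_le p (true, θ))) 2).ne').comp_hasFDerivAt p
      (G.hasFDerivAt_sq (true, θ) p)
  exact h1.mul (s.hasFDerivAt_u _ p)

lemma continuousAt_dF {p : E} (h : 0 < G.R p) (θ : ℝ) : ContinuousAt (fun p => s.dF p θ) p := by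
  have h0 : G.r (true, θ) p ^ 2 ≠ 0 := (pow_pos (h.trans_le (G.R_le p (true, θ))) 2).ne'
  have h1 : ContinuousAt (fun p => G.r (true, θ) p ^ 2) p := ((G.continuous_r _).pow 2).continuousAt
  have h2 : ContinuousAt (fun p => G.k p θ) p :=
    ContinuousAt.comp (f := fun p => G.r (true, θ) p ^ 2) (continuousAt_kf h0) h1
  have h3 : ContinuousAt (fun p => G.k' p θ) p :=
    ContinuousAt.comp (f := fun p => G.r (true, θ) p ^ 2) (continuousAt_kf' h0) h1
  have h4 : ContinuousAt (s.u (true, θ)) p := (s.hasFDerivAt_u _ p).continuousAt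
  exact (h2.smul (s.continuous_u' _).continuousAt).add
    (h4.smul (h3.smul (G.continuous_D _).continuousAt))

lemma exists_norm_dF_le {p : E} (h : 0 < G.R p) :
    ∃ C, ∀ᶠ q in 𝓝 p, 0 < G.R q ∧ ∀ θ, ‖s.dF q θ‖ ≤ C := by
  set δ := G.R p / 2 with hδ
  have hδ0 : 0 < δ := by positivity
  have hB := G.B_pos
  have hA := s.A_pos
  have ht := G.t₀_pos
  -- the derivative `D` vanishes outside the support of the kernel
  refine ⟨δ ^ (-(3 / 2) : ℝ) * s.A +
    s.A * ((δ ^ (-(3 / 2) : ℝ) + 2 / G.t₀) / δ ^ 2 * G.B), ?_⟩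
  filter_upwards [G.continuous_R.continuousAt.eventually (lt_mem_nhds (show δ < G.R p by linarith))]
    with q hq
  refine ⟨hδ0.trans hq, fun θ => ?_⟩
  have h1 := G.k_le hδ0 hq.le θ
  have h2 := G.abs_k'_le hδ0 hq.le θ
  have h3 := s.abs_u_le (true, θ) q
  have h4 := s.norm_u'_le (true, θ) q
  have h5 := G.norm_D_le (true, θ) q
  have h6 := G.k_nonneg q θ
  have h7 : ‖G.k' q θ • G.D (true, θ) q‖ ≤ (δ ^ (-(3 / 2) : ℝ) + 2 / G.t₀) / δ ^ 2 * G.B := by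
    rw [norm_smul, Real.norm_eq_abs]
    rcases le_total (G.r (true, θ) q) 1 with hr | hr
    · have h8 : ‖G.D (true, θ) q‖ ≤ G.B := h5.trans (by nlinarith)
      gcongr
    · have : G.k' q θ = 0 := kf'_eq_zero ht (by nlinarith [G.t₀_le_one])
      rw [this, abs_zero, zero_mul]
      positivity
  calc ‖s.dF q θ‖ ≤ ‖G.k q θ • s.u' (true, θ) q‖ +
      ‖s.u (true, θ) q • (G.k' q θ • G.D (true, θ) q)‖ := norm_add_le _ _
    _ ≤ _ := by
      rw [norm_smul, norm_smul (s.u (true, θ) q), Real.norm_of_nonneg h6, Real.norm_eq_abs]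
      gcongr

lemma hasFDerivAt_N {p : E} (h : 0 < G.R p) : HasFDerivAt s.N (s.dN p) p := by
  obtain ⟨C, hC⟩ := s.exists_norm_dF_le h
  exact hasFDerivAt_integral_of_dominated_of_fderiv_le (bound := fun _ => C) hC
    (Eventually.of_forall fun q => (s.stronglyMeasurable_F q).aestronglyMeasurable)
    (s.integrable_F h) (s.stronglyMeasurable_dF p).aestronglyMeasurable
    (Eventually.of_forall fun θ q hq => hq.2 θ) (integrable_const C)
    (Eventually.of_forall fun θ q hq => s.hasFDerivAt_F hq.1 θ)

lemma continuousAt_dN {p : E} (h : 0 < G.R p) : ContinuousAt s.dN p := by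
  obtain ⟨C, hC⟩ := s.exists_norm_dF_le h
  exact continuousAt_of_dominated (bound := fun _ => C)
    (Eventually.of_forall fun q => (s.stronglyMeasurable_dF q).aestronglyMeasurable)
    (hC.mono fun q hq => Eventually.of_forall hq.2) (integrable_const C)
    (Eventually.of_forall fun θ => s.continuousAt_dF h θ)

lemma integrable_dF {p : E} (h : 0 < G.R p) : Integrable (s.dF p) pm := by
  obtain ⟨C, hC⟩ := s.exists_norm_dF_le h
  exact Integrable.of_bound (s.stronglyMeasurable_dF p).aestronglyMeasurable C
    (Eventually.of_forall hC.self_of_nhds.2)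

/-- The averaged function. -/
noncomputable def f (p : E) : ℝ :=
  if G.R p = 0 then s.u (G.near p) p else s.N p / (G.w p + G.M p)

/-- The derivative of the averaged function. -/
noncomputable def f' (p : E) : E →L[ℝ] ℝ :=
  if G.R p = 0 then s.u' (G.near p) p
  else (G.w p + G.M p)⁻¹ • (s.dN p - s.f p • (G.w' p + G.one.dN p))

lemma one_N : G.one.N = G.M := by
  ext p; simp [N, Geo.M, Geo.one]

lemma f_off {p : E} (h : 0 < G.R p) : s.f p = s.N p / (G.w p + G.M p) := by
  unfold f; rw [if_neg h.ne']

lemma f'_off {p : E} (h : 0 < G.R p) :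
    s.f' p = (G.w p + G.M p)⁻¹ • (s.dN p - s.f p • (G.w' p + G.one.dN p)) := by
  unfold f'; rw [if_neg h.ne']

lemma hasFDerivAt_f_off {p : E} (h : 0 < G.R p) : HasFDerivAt s.f (s.f' p) p := by
  have hM : HasFDerivAt G.M (G.one.dN p) p := by
    have := G.one.hasFDerivAt_N h
    rwa [one_N] at this
  have h1 := (s.hasFDerivAt_N h).mul (((hasDerivAt_inv (G.wM_pos p).ne').comp_hasFDerivAt p
    ((G.hasFDerivAt_w p).add hM)))
  have h2 : s.f =ᶠ[𝓝 p] fun q => s.N q * (G.w q + G.M q)⁻¹ := by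
    filter_upwards [G.continuous_R.continuousAt.eventually (lt_mem_nhds h)] with q hq
    rw [s.f_off hq, div_eq_mul_inv]
  refine (h1.congr_of_eventuallyEq h2).congr_fderiv ?_
  rw [s.f'_off h, s.f_off h]
  ext x
  have := (G.wM_pos p).ne'
  simp only [FunLike.coe_add, FunLike.coe_smul, FunLike.coe_sub, Pi.add_apply, Pi.smul_apply,
    Pi.sub_apply, smul_eq_mul, Function.comp]
  field_simp
  ring

lemma continuousAt_f'_off {p : E} (h : 0 < G.R p) : ContinuousAt s.f' p := by
  have hM : HasFDerivAt G.M (G.one.dN p) p := by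
    have := G.one.hasFDerivAt_N h
    rwa [one_N] at this
  have h2 : (fun q => (G.w q + G.M q)⁻¹ • (s.dN q - s.f q • (G.w' q + G.one.dN q))) =ᶠ[𝓝 p] s.f' := by
    filter_upwards [G.continuous_R.continuousAt.eventually (lt_mem_nhds h)] with q hq
    rw [s.f'_off hq]
  refine ContinuousAt.congr ?_ h2
  exact (((G.hasFDerivAt_w p).continuousAt.add hM.continuousAt).inv₀ (G.wM_pos p).ne').smul
    ((s.continuousAt_dN h).sub ((s.hasFDerivAt_f_off h).continuousAt.smul
      (G.continuous_w'.continuousAt.add (G.one.continuousAt_dN h))))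

end Sec

end

section

variable {E : Type*} [NormedAddCommGroup E] [NormedSpace ℝ E]

namespace Geo
variable (G : Geo E)

lemma integral_k_eq (p : E) (a : ℝ) : G.M p = ∫ θ in a..a + 1, G.k p θ := by
  have hp : Function.Periodic (G.k p) 1 := fun θ => by unfold k; rw [G.r_add_one]
  rw [hp.intervalIntegral_add_eq a 0, zero_add, intervalIntegral.integral_of_le zero_le_one]
  rfl

lemma rpow_le_mass {p : E} (h : 0 < G.R p) (h1 : G.R p ≤ Real.sqrt (G.t₀ / 2) / 2) :
    G.R p ^ (-(11 / 8) : ℝ) ≤ 12 / G.c * G.M p := by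
  set R := G.R p with hR
  have hc := G.c_pos
  have ht := G.t₀_pos
  have hs : Real.sqrt (G.t₀ / 2) ≤ 1 := Real.sqrt_le_one.2 (by linarith [G.t₀_le_one])
  have hR1 : R ≤ 1 := by linarith
  obtain ⟨a, ha⟩ := G.close (G.near p) p R h hR1
  have hl0 : 0 < R ^ (1 / 8 : ℝ) := Real.rpow_pos_of_pos h _
  have hl1 : R ^ (1 / 8 : ℝ) ≤ 1 := Real.rpow_le_one h.le hR1 (by norm_num)
  have hcl : G.c * R ^ (1 / 8 : ℝ) ≤ 1 := by
    have := G.c_le_one; nlinarith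
  have hk : ∀ θ ∈ Ioo a (a + G.c * R ^ (1 / 8 : ℝ)), 1 / 12 * R ^ (-(3 / 2) : ℝ) ≤ G.k p θ := by
    intro θ hθ
    have h2 : G.r (true, θ) p ≤ 2 * R := by
      have := ha θ hθ
      change _ ≤ R + R at this
      linarith
    have h3 : 0 < G.r (true, θ) p := h.trans_le (G.R_le p _)
    have h4 : G.r (true, θ) p ^ 2 ≤ G.t₀ / 2 := by
      calc G.r (true, θ) p ^ 2 ≤ Real.sqrt (G.t₀ / 2) ^ 2 := by gcongr; linarith
        _ = _ := Real.sq_sqrt (by positivity)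
    refine le_trans ?_ (le_kf_sq ht h3.le h4)
    have h5 : (2 * R) ^ (-(3 / 2) : ℝ) ≤ G.r (true, θ) p ^ (-(3 / 2) : ℝ) :=
      Real.rpow_le_rpow_of_nonpos h3 h2 (by norm_num)
    rw [Real.mul_rpow (by norm_num) h.le] at h5
    have h6 : (1 / 3 : ℝ) ≤ 2 ^ (-(3 / 2) : ℝ) := by
      have e : ((2 : ℝ) ^ (-(3 / 2) : ℝ)) ^ 2 = 1 / 8 := by
        rw [← Real.rpow_natCast, ← Real.rpow_mul (by norm_num)]
        norm_num
      have := Real.rpow_nonneg (show (0 : ℝ) ≤ 2 by norm_num) (-(3 / 2) : ℝ)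
      nlinarith
    have h7 := Real.rpow_nonneg h.le (-(3 / 2) : ℝ)
    nlinarith
  have h_int : IntervalIntegrable (G.k p) volume a (a + 1) := by
    rw [intervalIntegrable_iff]
    refine Measure.integrableOn_of_bounded (M := R ^ (-(3 / 2) : ℝ)) (by simp)
      (G.measurable_k p).aestronglyMeasurable (Eventually.of_forall fun θ => ?_)
    rw [Real.norm_of_nonneg (G.k_nonneg p θ)]; exact G.k_le h le_rfl θ
  have h1' : 1 / 12 * R ^ (-(3 / 2) : ℝ) * (G.c * R ^ (1 / 8 : ℝ)) ≤ G.M p := by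
    rw [G.integral_k_eq p a]
    have h8 : ∫ θ in a..a + G.c * R ^ (1 / 8 : ℝ), 1 / 12 * R ^ (-(3 / 2) : ℝ) ≤
        ∫ θ in a..a + G.c * R ^ (1 / 8 : ℝ), G.k p θ := by
      refine intervalIntegral.integral_mono_on_of_le_Ioo (by nlinarith [mul_pos hc hl0])
        intervalIntegrable_const (h_int.mono_set ?_) hk
      rw [uIcc_of_le (by nlinarith [mul_pos hc hl0]), uIcc_of_le (by linarith)]
      exact Icc_subset_Icc le_rfl (by linarith)
    have h9 : ∫ θ in a..a + G.c * R ^ (1 / 8 : ℝ), G.k p θ ≤ ∫ θ in a..a + 1, G.k p θ :=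
      intervalIntegral.integral_mono_interval le_rfl (by nlinarith [mul_pos hc hl0])
        (by linarith) (Eventually.of_forall fun θ => G.k_nonneg p θ) h_int
    refine le_trans (le_of_eq ?_) (h8.trans h9)
    rw [intervalIntegral.integral_const, smul_eq_mul]; ring
  have e : R ^ (-(11 / 8) : ℝ) = R ^ (-(3 / 2) : ℝ) * R ^ (1 / 8 : ℝ) := by
    rw [← Real.rpow_add h]; norm_num
  rw [e, div_mul_eq_mul_div, le_div_iff₀ hc]
  nlinarith

lemma k_mul_rpow_le {p : E} (h : 0 < G.R p) (θ : ℝ) {s : ℝ} (hs : 0 ≤ s) (hs' : s ≤ 3 / 2) :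
    G.k p θ * G.r (true, θ) p ^ s ≤
      G.R p ^ (23 / 25 * s) * G.k p θ + G.R p ^ (23 / 25 * (s - 3 / 2)) := by
  have := kf_mul_rpow_le (t₀ := G.t₀) G.t₀_pos (h.trans_le (G.R_le p (true, θ)))
    (Real.rpow_pos_of_pos h (23 / 25)) hs hs'
  rwa [← Real.rpow_mul h.le, ← Real.rpow_mul h.le] at this

end Geo

namespace Sec
variable {G : Geo E} (s : Sec G)

lemma u_sub_le' {p : E} {i : Bool × ℝ} (hi : ∀ j, G.r i p ≤ G.r j p) (j : Bool × ℝ) :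
    |s.u j p - s.u i p| ≤ 3 * s.A * G.r j p ^ (11 / 10 : ℝ) := by
  have hA := s.A_pos
  have h0 := G.r_nonneg i p
  have h1 := G.r_nonneg j p
  calc |s.u j p - s.u i p| ≤ s.A * (G.r j p + G.r i p) ^ (11 / 10 : ℝ) := s.u_sub_le j i p
    _ ≤ s.A * (2 * G.r j p) ^ (11 / 10 : ℝ) := by
        gcongr; linarith [hi j]
    _ ≤ s.A * (3 * G.r j p ^ (11 / 10 : ℝ)) := by
        rw [Real.mul_rpow (by norm_num) h1]
        gcongr
        have := Real.rpow_le_rpow_of_exponent_le (show (1 : ℝ) ≤ 2 by norm_num)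
          (show (11 / 10 : ℝ) ≤ 3 / 2 by norm_num)
        refine this.trans ?_
        have e : ((2 : ℝ) ^ (3 / 2 : ℝ)) ^ 2 = 8 := by
          rw [← Real.rpow_natCast, ← Real.rpow_mul (by norm_num)]; norm_num
        nlinarith [Real.rpow_nonneg (show (0 : ℝ) ≤ 2 by norm_num) (3 / 2 : ℝ)]
    _ = _ := by ring

lemma u'_sub_le' {p : E} {i : Bool × ℝ} (hi : ∀ j, G.r i p ≤ G.r j p) (j : Bool × ℝ) :
    ‖s.u' j p - s.u' i p‖ ≤ 3 * s.A * G.r j p ^ (11 / 10 : ℝ) := by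
  have hA := s.A_pos
  have h0 := G.r_nonneg i p
  have h1 := G.r_nonneg j p
  calc ‖s.u' j p - s.u' i p‖ ≤ s.A * (G.r j p + G.r i p) ^ (11 / 10 : ℝ) := s.u'_sub_le j i p
    _ ≤ s.A * (2 * G.r j p) ^ (11 / 10 : ℝ) := by
        gcongr; linarith [hi j]
    _ ≤ s.A * (3 * G.r j p ^ (11 / 10 : ℝ)) := by
        rw [Real.mul_rpow (by norm_num) h1]
        gcongr
        have := Real.rpow_le_rpow_of_exponent_le (show (1 : ℝ) ≤ 2 by norm_num)
          (show (11 / 10 : ℝ) ≤ 3 / 2 by norm_num)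
        refine this.trans ?_
        have e : ((2 : ℝ) ^ (3 / 2 : ℝ)) ^ 2 = 8 := by
          rw [← Real.rpow_natCast, ← Real.rpow_mul (by norm_num)]; norm_num
        nlinarith [Real.rpow_nonneg (show (0 : ℝ) ≤ 2 by norm_num) (3 / 2 : ℝ)]
    _ = _ := by ring

/-- The threshold below which the estimates hold. -/
noncomputable def _root_.Seifert.Geo.r₁ (G : Geo E) : ℝ := Real.sqrt (G.t₀ / 2) / 2

lemma _root_.Seifert.Geo.r₁_pos (G : Geo E) : 0 < G.r₁ := by
  have := G.t₀_pos; unfold Geo.r₁; positivity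

lemma _root_.Seifert.Geo.r₁_le_one (G : Geo E) : G.r₁ ≤ 1 := by
  have hs : Real.sqrt (G.t₀ / 2) ≤ 1 := Real.sqrt_le_one.2 (by linarith [G.t₀_le_one])
  unfold Geo.r₁; linarith

/-- The constant in the estimate of the averaged function. -/
noncomputable def C₁ : ℝ := 3 * s.A + (3 * s.A + s.A * G.B) * (12 / G.c)

lemma C₁_pos : 0 < s.C₁ := by
  have := s.A_pos; have := G.B_pos; have := G.c_pos; unfold C₁; positivity

lemma abs_f_sub_le_pos {p : E} (h : 0 < G.R p) (h1 : G.R p ≤ G.r₁) {i : Bool × ℝ}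
    (hi : ∀ j, G.r i p ≤ G.r j p) : |s.f p - s.u i p| ≤ s.C₁ * G.R p ^ (1007 / 1000 : ℝ) := by
  have hA := s.A_pos
  have hB := G.B_pos
  have hc := G.c_pos
  have hR1 : G.R p ≤ 1 := h1.trans G.r₁_le_one
  have hmass := G.rpow_le_mass h h1
  have hM := G.M_nonneg p
  have hw := G.w_pos p
  have hJ := G.wM_pos p
  set e := G.R p ^ (1007 / 1000 : ℝ) with he
  have e0 : 0 < e := Real.rpow_pos_of_pos h _
  have e1 : G.R p ^ (-(46 / 125) : ℝ) = e * G.R p ^ (-(11 / 8) : ℝ) := by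
    rw [he, ← Real.rpow_add h]; norm_num
  have e2 : 1 ≤ G.R p ^ (-(46 / 125) : ℝ) :=
    Real.one_le_rpow_of_pos_of_le_one_of_nonpos h hR1 (by norm_num)
  have e3 : G.R p ^ (-(46 / 125) : ℝ) ≤ e * (12 / G.c * G.M p) := by rw [e1]; gcongr
  have e4 : G.R p ^ (253 / 250 : ℝ) ≤ e := Real.rpow_le_rpow_of_exponent_ge h hR1 (by norm_num)
  have h_int : ∫ θ, G.k p θ * (s.u (true, θ) p - s.u i p) ∂pm = s.N p - G.M p * s.u i p := by
    simp only [mul_sub]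
    rw [integral_sub (s.integrable_F h) ((G.integrable_k h).mul_const _), integral_mul_const]
    rfl
  have hb : ‖∫ θ, G.k p θ * (s.u (true, θ) p - s.u i p) ∂pm‖ ≤
      (3 * s.A * e) * G.M p + 3 * s.A * G.R p ^ (-(46 / 125) : ℝ) := by
    refine G.norm_integral_le_of_le h fun θ => ?_
    have hk := G.k_nonneg p θ
    rw [norm_mul, Real.norm_of_nonneg hk, Real.norm_eq_abs]
    have h2 := G.k_mul_rpow_le h θ (s := 11 / 10) (by norm_num) (by norm_num)
    rw [show (23 / 25 * (11 / 10) : ℝ) = 253 / 250 by norm_num,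
      show (23 / 25 * (11 / 10 - 3 / 2) : ℝ) = -(46 / 125) by norm_num] at h2
    calc G.k p θ * |s.u (true, θ) p - s.u i p|
        ≤ G.k p θ * (3 * s.A * G.r (true, θ) p ^ (11 / 10 : ℝ)) := by
          gcongr; exact s.u_sub_le' hi _
      _ = 3 * s.A * (G.k p θ * G.r (true, θ) p ^ (11 / 10 : ℝ)) := by ring
      _ ≤ 3 * s.A * (e * G.k p θ + G.R p ^ (-(46 / 125) : ℝ)) := by
          gcongr; exact h2.trans (by gcongr)
      _ = _ := by ring
  rw [h_int] at hb
  have hwu : |G.w p * s.u i p| ≤ s.A * G.B * G.R p ^ (-(46 / 125) : ℝ) := by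
    rw [abs_mul, abs_of_pos hw]
    calc G.w p * |s.u i p| ≤ G.B * s.A := by
          gcongr
          · exact G.w_le p
          · exact s.abs_u_le i p
      _ ≤ s.A * G.B * G.R p ^ (-(46 / 125) : ℝ) := by nlinarith [mul_pos hA hB]
  have key : (G.w p + G.M p) * (s.f p - s.u i p) =
      (s.N p - G.M p * s.u i p) - G.w p * s.u i p := by
    rw [s.f_off h]; field_simp; ring
  have h5 : (G.w p + G.M p) * |s.f p - s.u i p| ≤ (G.w p + G.M p) * (s.C₁ * e) := by
    rw [← abs_of_pos hJ, ← abs_mul, abs_of_pos hJ, key]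
    calc _ ≤ |s.N p - G.M p * s.u i p| + |G.w p * s.u i p| := abs_sub _ _
      _ ≤ (3 * s.A * e) * G.M p + (3 * s.A + s.A * G.B) * (e * (12 / G.c * G.M p)) := by
          rw [← Real.norm_eq_abs (s.N p - _)]
          have : (3 * s.A + s.A * G.B) * G.R p ^ (-(46 / 125) : ℝ) ≤
            (3 * s.A + s.A * G.B) * (e * (12 / G.c * G.M p)) := by gcongr
          linarith
      _ = G.M p * (s.C₁ * e) := by unfold C₁; ring
      _ ≤ (G.w p + G.M p) * (s.C₁ * e) := by
          have := s.C₁_pos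
          gcongr; linarith
  exact le_of_mul_le_mul_left h5 hJ

/-- The constant in the estimate of the derivative of the averaged function. -/
noncomputable def C₂ : ℝ :=
  (3 * s.A + 3 * s.A * G.B + G.B * s.C₁) + (3 * s.A + 3 * s.A * G.B +
    2 * G.B / G.t₀ * (3 * s.A + s.C₁) + (s.A + s.C₁) * G.B + G.B * s.A) * (12 / G.c)

lemma C₂_pos : 0 < s.C₂ := by
  have := s.A_pos; have := G.B_pos; have := G.c_pos; have := s.C₁_pos; have := G.t₀_pos
  unfold C₂; positivity

set_option maxHeartbeats 1000000 in
lemma norm_f'_sub_le_pos {p : E} (h : 0 < G.R p) (h1 : G.R p ≤ G.r₁) {i : Bool × ℝ}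
    (hi : ∀ j, G.r i p ≤ G.r j p) : ‖s.f' p - s.u' i p‖ ≤ s.C₂ * G.R p ^ (7 / 1000 : ℝ) := by
  have hA := s.A_pos
  have hB := G.B_pos
  have hc := G.c_pos
  have ht := G.t₀_pos
  have hC := s.C₁_pos
  have hR1 : G.R p ≤ 1 := h1.trans G.r₁_le_one
  have hmass := G.rpow_le_mass h h1
  have hM := G.M_nonneg p
  have hw := G.w_pos p
  have hJ := G.wM_pos p
  have hf := s.abs_f_sub_le_pos h h1 hi
  set e := G.R p ^ (1007 / 1000 : ℝ) with he
  set d := G.R p ^ (7 / 1000 : ℝ) with hd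
  set Q := G.R p ^ (-(171 / 125) : ℝ) with hQ
  have e0 : 0 < e := Real.rpow_pos_of_pos h _
  have d0 : 0 < d := Real.rpow_pos_of_pos h _
  have d1 : d ≤ 1 := Real.rpow_le_one h.le hR1 (by norm_num)
  have e1' : e ≤ 1 := Real.rpow_le_one h.le hR1 (by norm_num)
  have hed : e = G.R p * d := by
    rw [he, hd]; nth_rw 2 [← Real.rpow_one (G.R p)]; rw [← Real.rpow_add h]; norm_num
  have e1 : Q = d * G.R p ^ (-(11 / 8) : ℝ) := by
    rw [hQ, hd, ← Real.rpow_add h]; norm_num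
  have e2 : 1 ≤ Q := Real.one_le_rpow_of_pos_of_le_one_of_nonpos h hR1 (by norm_num)
  have e3 : Q ≤ d * (12 / G.c * G.M p) := by rw [e1]; gcongr
  have e4 : G.R p ^ (23 / 250 : ℝ) ≤ d := Real.rpow_le_rpow_of_exponent_ge h hR1 (by norm_num)
  have e5 : G.R p ^ (-(161 / 125) : ℝ) ≤ Q := Real.rpow_le_rpow_of_exponent_ge h hR1 (by norm_num)
  have hui : |s.u i p| ≤ s.A := s.abs_u_le i p
  have hfb : |s.f p| ≤ s.A + s.C₁ := by
    have : s.C₁ * e ≤ s.C₁ := by nlinarith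
    calc |s.f p| = |(s.f p - s.u i p) + s.u i p| := by ring_nf
      _ ≤ _ := (abs_add_le _ _).trans (by linarith)
  set F : ℝ → E →L[ℝ] ℝ := fun θ => G.k p θ • (s.u' (true, θ) p - s.u' i p) +
    (s.u (true, θ) p - s.f p) • (G.k' p θ • G.D (true, θ) p) with hF
  have hFe : F = fun θ => s.dF p θ - G.k p θ • s.u' i p - s.f p • G.one.dF p θ := by
    ext θ x
    simp only [hF, dF, Geo.one, FunLike.coe_add, FunLike.coe_smul, FunLike.coe_sub, Pi.add_apply,
      Pi.smul_apply, Pi.sub_apply, smul_eq_mul, FunLike.coe_zero, Pi.zero_apply]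
    ring
  have h_int : ∫ θ, F θ ∂pm = s.dN p - G.M p • s.u' i p - s.f p • G.one.dN p := by
    have i1 := s.integrable_dF h
    have i2 : Integrable (fun θ => G.k p θ • s.u' i p) pm := (G.integrable_k h).smul_const _
    have i3 : Integrable (fun θ => s.f p • G.one.dF p θ) pm := (G.one.integrable_dF h).smul (s.f p)
    have i4 : Integrable (fun θ => s.dF p θ - G.k p θ • s.u' i p) pm := i1.sub i2
    rw [hFe, integral_sub i4 i3, integral_sub i1 i2, integral_smul_const, integral_smul]
    rfl
  have hb : ‖∫ θ, F θ ∂pm‖ ≤ ((3 * s.A + 3 * s.A * G.B + G.B * s.C₁) * d) * G.M p +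
      (3 * s.A + 3 * s.A * G.B + 2 * G.B / G.t₀ * (3 * s.A + s.C₁)) * Q := by
    refine G.norm_integral_le_of_le h fun θ => ?_
    have hk := G.k_nonneg p θ
    set r := G.r (true, θ) p with hr
    have hrp : 0 < r := h.trans_le (G.R_le p _)
    rcases le_total G.t₀ (r ^ 2) with h2 | h2
    · have a1 : G.k p θ = 0 := kf_eq_zero ht h2
      have a2 : G.k' p θ = 0 := kf'_eq_zero ht h2
      have : F θ = 0 := by simp only [hF]; rw [a1, a2]; simp
      rw [this, norm_zero, a1, mul_zero, zero_add]
      positivity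
    have hr1 : r ≤ 1 := by
      have := G.t₀_le_one
      nlinarith
    have h3 := G.k_mul_rpow_le h θ (s := 1 / 10) (by norm_num) (by norm_num)
    rw [show (23 / 25 * (1 / 10) : ℝ) = 23 / 250 by norm_num,
      show (23 / 25 * (1 / 10 - 3 / 2) : ℝ) = -(161 / 125) by norm_num] at h3
    have h3' : G.k p θ * r ^ (1 / 10 : ℝ) ≤ d * G.k p θ + Q := h3.trans (by gcongr)
    have p1 : 0 ≤ r ^ (1 / 10 : ℝ) := Real.rpow_nonneg hrp.le _
    have p2 : r ^ (1 / 10 : ℝ) ≤ 1 := Real.rpow_le_one hrp.le hr1 (by norm_num)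
    have p3 : r ^ (11 / 10 : ℝ) = r * r ^ (1 / 10 : ℝ) := by
      nth_rw 2 [← Real.rpow_one r]; rw [← Real.rpow_add hrp]; norm_num
    have h4 : |s.u (true, θ) p - s.f p| ≤ r * (3 * s.A * r ^ (1 / 10 : ℝ) + s.C₁ * d) := by
      have a1 := s.u_sub_le' hi (true, θ)
      rw [← hr, p3] at a1
      have a2 : e ≤ r * d := by rw [hed]; gcongr; exact G.R_le p _
      have a3 : s.C₁ * e ≤ s.C₁ * (r * d) := by gcongr
      have a4 : |s.u (true, θ) p - s.f p| ≤ |s.u (true, θ) p - s.u i p| + |s.f p - s.u i p| := by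
        rw [abs_sub_comm (s.f p)]; exact abs_sub_le _ _ _
      nlinarith
    have h5 : r * (|G.k' p θ| * ‖G.D (true, θ) p‖) ≤ G.B * (G.k p θ + 2 / G.t₀) := by
      have a1 := abs_kf'_mul_le ht G.t₀_le_one (t := r ^ 2) (by positivity)
      have a2 : ‖G.D (true, θ) p‖ ≤ G.B * r := G.norm_D_le _ _
      calc r * (|G.k' p θ| * ‖G.D (true, θ) p‖) ≤ r * (|G.k' p θ| * (G.B * r)) := by gcongr
        _ = G.B * (|G.k' p θ| * r ^ 2) := by ring
        _ ≤ _ := by gcongr; exact a1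
    have h6 : ‖(s.u (true, θ) p - s.f p) • (G.k' p θ • G.D (true, θ) p)‖ ≤
        (3 * s.A * r ^ (1 / 10 : ℝ) + s.C₁ * d) * (G.B * (G.k p θ + 2 / G.t₀)) := by
      rw [norm_smul, norm_smul, Real.norm_eq_abs, Real.norm_eq_abs]
      calc _ ≤ (r * (3 * s.A * r ^ (1 / 10 : ℝ) + s.C₁ * d)) * (|G.k' p θ| * ‖G.D (true, θ) p‖) := by
            gcongr
        _ = (3 * s.A * r ^ (1 / 10 : ℝ) + s.C₁ * d) * (r * (|G.k' p θ| * ‖G.D (true, θ) p‖)) := by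
            ring
        _ ≤ _ := by gcongr
    have h7 : ‖G.k p θ • (s.u' (true, θ) p - s.u' i p)‖ ≤ 3 * s.A * (G.k p θ * r ^ (1 / 10 : ℝ)) := by
      rw [norm_smul, Real.norm_of_nonneg hk]
      have a1 := s.u'_sub_le' hi (true, θ)
      rw [← hr, p3] at a1
      calc _ ≤ G.k p θ * (3 * s.A * (r * r ^ (1 / 10 : ℝ))) := by gcongr
        _ ≤ G.k p θ * (3 * s.A * (1 * r ^ (1 / 10 : ℝ))) := by gcongr
        _ = _ := by ring
    calc ‖F θ‖ ≤ _ := norm_add_le _ _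
      _ ≤ 3 * s.A * (G.k p θ * r ^ (1 / 10 : ℝ)) +
          (3 * s.A * r ^ (1 / 10 : ℝ) + s.C₁ * d) * (G.B * (G.k p θ + 2 / G.t₀)) := by gcongr
      _ = (3 * s.A + 3 * s.A * G.B) * (G.k p θ * r ^ (1 / 10 : ℝ)) + G.B * s.C₁ * d * G.k p θ +
          2 * G.B / G.t₀ * (3 * s.A * r ^ (1 / 10 : ℝ) + s.C₁ * d) * 1 := by ring
      _ ≤ (3 * s.A + 3 * s.A * G.B) * (d * G.k p θ + Q) + G.B * s.C₁ * d * G.k p θ +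
          2 * G.B / G.t₀ * (3 * s.A * 1 + s.C₁ * 1) * Q := by gcongr
      _ = _ := by ring
  rw [h_int] at hb
  have h8 : ‖s.f p • G.w' p‖ ≤ (s.A + s.C₁) * G.B * Q := by
    rw [norm_smul, Real.norm_eq_abs]
    have := G.norm_w'_le p
    calc |s.f p| * ‖G.w' p‖ ≤ (s.A + s.C₁) * G.B := by gcongr
      _ ≤ _ := le_mul_of_one_le_right (by positivity) e2
  have h9 : ‖G.w p • s.u' i p‖ ≤ G.B * s.A * Q := by
    rw [norm_smul, Real.norm_of_nonneg hw.le]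
    have := G.w_le p
    have := s.norm_u'_le i p
    calc G.w p * ‖s.u' i p‖ ≤ G.B * s.A := by gcongr
      _ ≤ _ := le_mul_of_one_le_right (by positivity) e2
  have key : (G.w p + G.M p) • (s.f' p - s.u' i p) =
      (s.dN p - G.M p • s.u' i p - s.f p • G.one.dN p) - s.f p • G.w' p - G.w p • s.u' i p := by
    rw [s.f'_off h, smul_sub, smul_inv_smul₀ hJ.ne']
    module
  have h10 : (G.w p + G.M p) * ‖s.f' p - s.u' i p‖ ≤ (G.w p + G.M p) * (s.C₂ * d) := by
    rw [← Real.norm_of_nonneg hJ.le, ← norm_smul, key, Real.norm_of_nonneg hJ.le]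
    calc _ ≤ ‖s.dN p - G.M p • s.u' i p - s.f p • G.one.dN p‖ + ‖s.f p • G.w' p‖ +
          ‖G.w p • s.u' i p‖ := (norm_sub_le _ _).trans (by gcongr; exact norm_sub_le _ _)
      _ ≤ ((3 * s.A + 3 * s.A * G.B + G.B * s.C₁) * d) * G.M p +
          (3 * s.A + 3 * s.A * G.B + 2 * G.B / G.t₀ * (3 * s.A + s.C₁) +
            (s.A + s.C₁) * G.B + G.B * s.A) * Q := by linarith
      _ ≤ ((3 * s.A + 3 * s.A * G.B + G.B * s.C₁) * d) * G.M p +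
          (3 * s.A + 3 * s.A * G.B + 2 * G.B / G.t₀ * (3 * s.A + s.C₁) +
            (s.A + s.C₁) * G.B + G.B * s.A) * (d * (12 / G.c * G.M p)) := by gcongr
      _ = G.M p * (s.C₂ * d) := by unfold C₂; ring
      _ ≤ (G.w p + G.M p) * (s.C₂ * d) := by
          have := s.C₂_pos
          gcongr; linarith
  exact le_of_mul_le_mul_left h10 hJ

lemma u_eq_of_r_eq_zero {p : E} {i j : Bool × ℝ} (hi : G.r i p = 0) (hj : G.r j p = 0) :
    s.u i p = s.u j p := by
  have := s.u_sub_le i j p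
  rw [hi, hj, add_zero, Real.zero_rpow (by norm_num), mul_zero] at this
  exact sub_eq_zero.1 (abs_nonpos_iff.1 this)

lemma u'_eq_of_r_eq_zero {p : E} {i j : Bool × ℝ} (hi : G.r i p = 0) (hj : G.r j p = 0) :
    s.u' i p = s.u' j p := by
  have := s.u'_sub_le i j p
  rw [hi, hj, add_zero, Real.zero_rpow (by norm_num), mul_zero] at this
  exact sub_eq_zero.1 (norm_le_zero_iff.1 this)

lemma R_eq_zero {p : E} {i : Bool × ℝ} (hi : G.r i p = 0) : G.R p = 0 :=
  le_antisymm (hi ▸ G.R_le p i) (G.R_nonneg p)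

/-- The averaged function agrees with the sections on the family. -/
lemma f_eq {p : E} {i : Bool × ℝ} (hi : G.r i p = 0) : s.f p = s.u i p := by
  have h := R_eq_zero hi
  unfold f
  rw [if_pos h]; exact s.u_eq_of_r_eq_zero h hi

lemma f'_eq {p : E} {i : Bool × ℝ} (hi : G.r i p = 0) : s.f' p = s.u' i p := by
  have h := R_eq_zero hi
  unfold f'
  rw [if_pos h]; exact s.u'_eq_of_r_eq_zero h hi

lemma abs_f_sub_le {p : E} (h1 : G.R p ≤ G.r₁) :
    |s.f p - s.u (G.near p) p| ≤ s.C₁ * G.R p ^ (1007 / 1000 : ℝ) := by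
  rcases (G.R_nonneg p).eq_or_lt with h | h
  · rw [s.f_eq (i := G.near p) h.symm, sub_self, abs_zero]
    exact mul_nonneg s.C₁_pos.le (Real.rpow_nonneg (G.R_nonneg p) _)
  · exact s.abs_f_sub_le_pos h h1 (G.r_near_le p)

lemma norm_f'_sub_le {p : E} (h1 : G.R p ≤ G.r₁) :
    ‖s.f' p - s.u' (G.near p) p‖ ≤ s.C₂ * G.R p ^ (7 / 1000 : ℝ) := by
  rcases (G.R_nonneg p).eq_or_lt with h | h
  · rw [s.f'_eq (i := G.near p) h.symm, sub_self, norm_zero]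
    exact mul_nonneg s.C₂_pos.le (Real.rpow_nonneg (G.R_nonneg p) _)
  · exact s.norm_f'_sub_le_pos h h1 (G.r_near_le p)

lemma R_le_of_eq_zero {p : E} (h : G.R p = 0) (q : E) : G.R q ≤ G.B * ‖q - p‖ := by
  have := G.R_sub_le q p; linarith

lemma r_le_of_eq_zero {p : E} (h : G.R p = 0) (q : E) :
    G.r (G.near p) q ≤ G.B * ‖q - p‖ := by
  have := (abs_le.1 (G.r_sub_le (G.near p) q p)).2
  have e : G.r (G.near p) p = 0 := h
  linarith

lemma tendsto_mul_rpow (p : E) {a C : ℝ} (ha : 0 < a) :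
    Tendsto (fun q : E => C * (‖q - p‖) ^ a) (𝓝 p) (𝓝 0) := by
  have h : ContinuousAt (fun q : E => C * (‖q - p‖) ^ a) p :=
    continuousAt_const.mul ((continuous_id.sub continuous_const).norm.continuousAt.rpow_const
      (Or.inr ha.le))
  have := h.tendsto
  simpa [Real.zero_rpow ha.ne'] using this

lemma eventually_R_le {p : E} (h : G.R p = 0) : ∀ᶠ q in 𝓝 p, G.R q ≤ G.r₁ :=
  (G.continuous_R.continuousAt.eventually (gt_mem_nhds (by rw [h]; exact G.r₁_pos))).mono
    fun _ hq => hq.le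

lemma hasFDerivAt_f_on {p : E} (h : G.R p = 0) : HasFDerivAt s.f (s.f' p) p := by
  set i := G.near p with hi
  have hri : G.r i p = 0 := h
  have hA := s.A_pos
  have hB := G.B_pos
  have hC := s.C₁_pos
  rw [s.f'_eq hri]
  have h1 := s.hasFDerivAt_u i p
  have h2 : HasFDerivAt (fun q => s.f q - s.u i q) (0 : E →L[ℝ] ℝ) p := by
    rw [hasFDerivAt_iff_isLittleO]
    have e0 : s.f p - s.u i p = 0 := by rw [s.f_eq hri, sub_self]
    simp only [e0, sub_zero, FunLike.coe_zero, Pi.zero_apply]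
    have hb : (fun q => s.f q - s.u i q) =O[𝓝 p] fun q => ‖q - p‖ ^ (7 / 1000 : ℝ) * ‖q - p‖ := by
      refine Asymptotics.IsBigO.of_bound (s.C₁ * G.B ^ (1007 / 1000 : ℝ) +
        s.A * (2 * G.B) ^ (11 / 10 : ℝ)) ?_
      filter_upwards [eventually_R_le h, Metric.ball_mem_nhds p one_pos] with q hq hq1
      rw [Metric.mem_ball, dist_eq_norm] at hq1
      have hn := norm_nonneg (q - p)
      have a1 := R_le_of_eq_zero h q
      have a2 := r_le_of_eq_zero h q
      have a3 := s.abs_f_sub_le hq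
      have a4 := s.u_sub_le (G.near q) i q
      have en : ‖q - p‖ ^ (7 / 1000 : ℝ) * ‖q - p‖ = ‖q - p‖ ^ (1007 / 1000 : ℝ) := by
        nth_rw 2 [← Real.rpow_one ‖q - p‖]
        rw [← Real.rpow_add_of_nonneg hn (by norm_num) (by norm_num)]; norm_num
      have a5 : G.R q ^ (1007 / 1000 : ℝ) ≤ G.B ^ (1007 / 1000 : ℝ) * ‖q - p‖ ^ (1007 / 1000 : ℝ) := by
        rw [← Real.mul_rpow hB.le hn]
        exact Real.rpow_le_rpow (G.R_nonneg q) a1 (by norm_num)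
      have a6 : (G.r (G.near q) q + G.r i q) ^ (11 / 10 : ℝ) ≤
          (2 * G.B) ^ (11 / 10 : ℝ) * ‖q - p‖ ^ (1007 / 1000 : ℝ) := by
        calc _ ≤ (2 * G.B * ‖q - p‖) ^ (11 / 10 : ℝ) := by
              refine Real.rpow_le_rpow (add_nonneg (G.r_nonneg _ _) (G.r_nonneg _ _)) ?_ (by norm_num)
              have : G.r (G.near q) q = G.R q := rfl
              rw [this]; linarith
          _ = (2 * G.B) ^ (11 / 10 : ℝ) * ‖q - p‖ ^ (11 / 10 : ℝ) :=
              Real.mul_rpow (by positivity) hn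
          _ ≤ _ := by
              gcongr ?_ * ?_
              rcases hn.eq_or_lt with h0 | h0
              · rw [← h0, Real.zero_rpow (by norm_num), Real.zero_rpow (by norm_num)]
              · exact Real.rpow_le_rpow_of_exponent_ge h0 hq1.le (by norm_num)
      rw [en, Real.norm_eq_abs, Real.norm_of_nonneg (Real.rpow_nonneg hn _)]
      calc |s.f q - s.u i q| ≤ |s.f q - s.u (G.near q) q| + |s.u (G.near q) q - s.u i q| :=
            abs_sub_le _ _ _
        _ ≤ s.C₁ * (G.B ^ (1007 / 1000 : ℝ) * ‖q - p‖ ^ (1007 / 1000 : ℝ)) +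
            s.A * ((2 * G.B) ^ (11 / 10 : ℝ) * ‖q - p‖ ^ (1007 / 1000 : ℝ)) :=
            add_le_add (a3.trans (by gcongr)) (a4.trans (by gcongr))
        _ = _ := by ring
    refine hb.trans_isLittleO ?_
    have hl : (fun q : E => ‖q - p‖ ^ (7 / 1000 : ℝ)) =o[𝓝 p] fun _ => (1 : ℝ) := by
      rw [Asymptotics.isLittleO_one_iff]
      simpa using tendsto_mul_rpow p (C := 1) (show (0 : ℝ) < 7 / 1000 by norm_num)
    have := hl.mul_isBigO (Asymptotics.isBigO_refl (fun q : E => ‖q - p‖) (𝓝 p))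
    simpa using this.trans_isBigO (by simpa using (Asymptotics.isBigO_refl (fun q : E => q - p) (𝓝 p)).norm_left)
  have h3 : HasFDerivAt (fun q => (s.f q - s.u i q) + s.u i q) (0 + s.u' i p) p := h2.add h1
  simpa using h3

lemma continuousAt_f'_on {p : E} (h : G.R p = 0) : ContinuousAt s.f' p := by
  set i := G.near p with hi
  have hri : G.r i p = 0 := h
  have hA := s.A_pos
  have hB := G.B_pos
  have hC := s.C₂_pos
  have h1 := (s.continuous_u' i).continuousAt (x := p)
  have h2 : Tendsto (fun q => s.f' q - s.u' i q) (𝓝 p) (𝓝 0) := by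
    have hl : Tendsto (fun q => s.C₂ * G.B ^ (7 / 1000 : ℝ) * ‖q - p‖ ^ (7 / 1000 : ℝ) +
        s.A * (2 * G.B) ^ (11 / 10 : ℝ) * ‖q - p‖ ^ (11 / 10 : ℝ)) (𝓝 p) (𝓝 0) := by
      simpa using (tendsto_mul_rpow p (C := s.C₂ * G.B ^ (7 / 1000 : ℝ))
        (show (0 : ℝ) < 7 / 1000 by norm_num)).add (tendsto_mul_rpow p
        (C := s.A * (2 * G.B) ^ (11 / 10 : ℝ)) (show (0 : ℝ) < 11 / 10 by norm_num))
    refine squeeze_zero_norm' ?_ hl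
    filter_upwards [eventually_R_le h] with q hq
    have hn := norm_nonneg (q - p)
    have a1 := R_le_of_eq_zero h q
    have a2 := r_le_of_eq_zero h q
    have a3 := s.norm_f'_sub_le hq
    have a4 := s.u'_sub_le (G.near q) i q
    have a5 : G.R q ^ (7 / 1000 : ℝ) ≤ G.B ^ (7 / 1000 : ℝ) * ‖q - p‖ ^ (7 / 1000 : ℝ) := by
      rw [← Real.mul_rpow hB.le hn]
      exact Real.rpow_le_rpow (G.R_nonneg q) a1 (by norm_num)
    have a6 : (G.r (G.near q) q + G.r i q) ^ (11 / 10 : ℝ) ≤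
        (2 * G.B) ^ (11 / 10 : ℝ) * ‖q - p‖ ^ (11 / 10 : ℝ) := by
      rw [← Real.mul_rpow (by positivity) hn]
      refine Real.rpow_le_rpow (add_nonneg (G.r_nonneg _ _) (G.r_nonneg _ _)) ?_ (by norm_num)
      have : G.r (G.near q) q = G.R q := rfl
      rw [this]; linarith
    calc ‖s.f' q - s.u' i q‖ ≤ ‖s.f' q - s.u' (G.near q) q‖ + ‖s.u' (G.near q) q - s.u' i q‖ :=
          norm_sub_le_norm_sub_add_norm_sub _ _ _
      _ ≤ s.C₂ * (G.B ^ (7 / 1000 : ℝ) * ‖q - p‖ ^ (7 / 1000 : ℝ)) +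
          s.A * ((2 * G.B) ^ (11 / 10 : ℝ) * ‖q - p‖ ^ (11 / 10 : ℝ)) :=
          add_le_add (a3.trans (by gcongr)) (a4.trans (by gcongr))
      _ = _ := by ring
  have h3 := h2.add h1.tendsto
  have e : s.f' p = s.u' i p := s.f'_eq hri
  unfold ContinuousAt
  simpa [e] using h3

lemma hasFDerivAt_f (p : E) : HasFDerivAt s.f (s.f' p) p := by
  rcases (G.R_nonneg p).eq_or_lt with h | h
  · exact s.hasFDerivAt_f_on h.symm
  · exact s.hasFDerivAt_f_off h

lemma continuous_f' : Continuous s.f' := continuous_iff_continuousAt.2 fun p => by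
  rcases (G.R_nonneg p).eq_or_lt with h | h
  · exact s.continuousAt_f'_on h.symm
  · exact s.continuousAt_f'_off h

/-- The averaged function is continuously differentiable. -/
theorem contDiff_f : ContDiff ℝ 1 s.f :=
  contDiff_one_iff_hasFDerivAt.2 ⟨s.f', s.continuous_f', s.hasFDerivAt_f⟩

end Sec

end

section symmetry
variable {E : Type*} [NormedAddCommGroup E] [NormedSpace ℝ E] {G : Geo E}

lemma integral_pm_add {X : Type*} [NormedAddCommGroup X] [NormedSpace ℝ X] {F : ℝ → X}
    (hF : Function.Periodic F 1) (a : ℝ) : ∫ θ, F (θ + a) ∂pm = ∫ θ, F θ ∂pm := by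
  have h : ∀ F : ℝ → X, ∫ θ, F θ ∂pm = ∫ θ in (0 : ℝ)..1, F θ := fun F => by
    rw [intervalIntegral.integral_of_le zero_le_one]
  rw [h, h, intervalIntegral.integral_comp_add_right, add_comm 1 a]
  simpa using hF.intervalIntegral_add_eq (0 + a) 0

/-- Invariance of the averaged function under a symmetry of the family. -/
lemma Sec.f_symm (s : Sec G) (τ : E → E) (a : ℝ)
    (hr : ∀ b θ p, G.r (b, θ) (τ p) = G.r (b, θ + a) p)
    (hu : ∀ b θ p, s.u (b, θ) (τ p) = s.u (b, θ + a) p)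
    (hu1 : ∀ θ p, s.u (true, θ + 1) p = s.u (true, θ) p)
    (hw : ∀ p, G.w (τ p) = G.w p) (p : E) : s.f (τ p) = s.f p ∧ G.M (τ p) = G.M p := by
  have hk : ∀ p θ, G.k (τ p) θ = G.k p (θ + a) := fun p θ => by unfold Geo.k; rw [hr]
  have hk1 : ∀ p, Function.Periodic (G.k p) 1 := fun p θ => by unfold Geo.k; rw [G.r_add_one]
  have hM : G.M (τ p) = G.M p := by
    unfold Geo.M; simp_rw [hk]; exact integral_pm_add (hk1 p) a
  refine ⟨?_, hM⟩
  have hN : s.N (τ p) = s.N p := by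
    unfold Sec.N; simp_rw [hk, hu]
    refine integral_pm_add (F := fun θ => G.k p θ * s.u (true, θ) p) (fun θ => ?_) a
    simp only; rw [hk1, hu1]
  have hR : G.R p = 0 ↔ G.R (τ p) = 0 := by
    have h1 : G.R (τ p) ≤ G.R p := by
      refine (G.R_le (τ p) ((G.near p).1, (G.near p).2 - a)).trans (le_of_eq ?_)
      rw [hr, sub_add_cancel]; rfl
    have h2 : G.R p ≤ G.R (τ p) := by
      refine (G.R_le p ((G.near (τ p)).1, (G.near (τ p)).2 + a)).trans (le_of_eq ?_)
      rw [← hr]; rfl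
    rw [le_antisymm h1 h2]
  rcases (G.R_nonneg p).eq_or_lt with h | h
  · have h' : G.R (τ p) = 0 := hR.1 h.symm
    have e : G.r (G.near (τ p)) (τ p) = 0 := h'
    rw [s.f_eq e]
    rcases hn : G.near (τ p) with ⟨b, θ⟩
    rw [hn, hr] at e
    rw [hu, s.f_eq e]
  · have h' : 0 < G.R (τ p) := lt_of_le_of_ne (G.R_nonneg _) fun h0 => h.ne' (hR.2 h0.symm)
    rw [s.f_off h, s.f_off h', hN, hM, hw]

lemma Sec.abs_f_le_one_off (s : Sec G) (hs : s = G.one) {p : E} (h : 0 < G.R p) :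
    0 ≤ s.f p ∧ s.f p < 1 := by
  rw [s.f_off h, hs, Sec.one_N]
  have := G.w_pos p
  have := G.M_nonneg p
  have := G.wM_pos p
  exact ⟨by positivity, by rw [div_lt_one ‹_›]; linarith⟩

end symmetry

/-- The model space. -/
abbrev Q := ℝ × ℝ × ℝ

/-- A density on the two-torus. -/
structure Den where
  w : ℝ × ℝ → ℝ
  contDiff : ContDiff ℝ 1 w
  pos : ∀ p, 0 < w p
  add_x : ∀ x y, w (x + 1, y) = w (x, y)
  add_y : ∀ x y, w (x, y + 1) = w (x, y)

lemma exists_bound_of_periodic {X : Type*} [NormedAddCommGroup X] {F : ℝ × ℝ → X}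
    (hF : Continuous F) (hx : ∀ x y, F (x + 1, y) = F (x, y)) (hy : ∀ x y, F (x, y + 1) = F (x, y)) :
    ∃ B, ∀ p, ‖F p‖ ≤ B := by
  have hx' : ∀ y, Function.Periodic (fun x => F (x, y)) 1 := fun y x => hx x y
  have hy' : ∀ x, Function.Periodic (fun y => F (x, y)) 1 := fun x y => hy x y
  obtain ⟨B, hB⟩ := (isCompact_Icc (a := ((0 : ℝ), (0 : ℝ))) (b := (1, 1))).exists_bound_of_continuousOn
    hF.continuousOn
  refine ⟨B, fun p => ?_⟩
  have e : F p = F (Int.fract p.1, Int.fract p.2) := by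
    have h1 := (hx' p.2).sub_int_mul_eq ⌊p.1⌋ (x := p.1)
    have h2 := (hy' (Int.fract p.1)).sub_int_mul_eq ⌊p.2⌋ (x := p.2)
    simp only [mul_one] at h1 h2
    unfold Int.fract at *
    rw [h2, h1]
  rw [e]
  refine hB _ ⟨⟨Int.fract_nonneg _, Int.fract_nonneg _⟩, ⟨(Int.fract_lt_one _).le, (Int.fract_lt_one _).le⟩⟩

namespace Den
variable (d : Den)

lemma exists_bound : ∃ B, 0 < B ∧ (∀ p, d.w p ≤ B) ∧ ∀ p, ‖fderiv ℝ d.w p‖ ≤ B := by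
  obtain ⟨B1, h1⟩ := exists_bound_of_periodic d.contDiff.continuous d.add_x d.add_y
  have hc : Continuous (fderiv ℝ d.w) := d.contDiff.continuous_fderiv one_ne_zero
  obtain ⟨B2, h2⟩ := exists_bound_of_periodic hc
    (fun x y => by
      have := fderiv_comp_add_right (𝕜 := ℝ) (f := d.w) (x := (x, y)) ((1 : ℝ), (0 : ℝ))
      have e : (fun p : ℝ × ℝ => d.w (p + (1, 0))) = d.w := by
        ext p; obtain ⟨a, b⟩ := p
        simpa using d.add_x a b
      rw [e] at this
      rw [this]; simp)
    (fun x y => by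
      have := fderiv_comp_add_right (𝕜 := ℝ) (f := d.w) (x := (x, y)) ((0 : ℝ), (1 : ℝ))
      have e : (fun p : ℝ × ℝ => d.w (p + (0, 1))) = d.w := by
        ext p; obtain ⟨a, b⟩ := p
        simpa using d.add_y a b
      rw [e] at this
      rw [this]; simp)
  have hB1 : 0 < B1 := lt_of_lt_of_le (norm_pos_iff.2 (d.pos (0, 0)).ne') (h1 _)
  exact ⟨max B1 B2, lt_max_of_lt_left hB1, fun p => (le_abs_self _).trans ((h1 p).trans (le_max_left _ _)),
    fun p => (h2 p).trans (le_max_right _ _)⟩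

/-- A common bound for the density and its derivative. -/
noncomputable def B : ℝ := d.exists_bound.choose
lemma B_pos : 0 < d.B := d.exists_bound.choose_spec.1
lemma w_le (p : ℝ × ℝ) : d.w p ≤ d.B := d.exists_bound.choose_spec.2.1 p
lemma norm_fderiv_le (p : ℝ × ℝ) : ‖fderiv ℝ d.w p‖ ≤ d.B := d.exists_bound.choose_spec.2.2 p

end Den

/-- The first two coordinates. -/
noncomputable def prXY : Q →L[ℝ] ℝ × ℝ :=
  (ContinuousLinearMap.fst ℝ ℝ (ℝ × ℝ)).prod
    ((ContinuousLinearMap.fst ℝ ℝ ℝ).comp (ContinuousLinearMap.snd ℝ ℝ (ℝ × ℝ)))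
/-- The coordinate `x`. -/
noncomputable def dX : Q →L[ℝ] ℝ := ContinuousLinearMap.fst ℝ ℝ (ℝ × ℝ)
/-- The coordinate `y`. -/
noncomputable def dY : Q →L[ℝ] ℝ :=
  (ContinuousLinearMap.fst ℝ ℝ ℝ).comp (ContinuousLinearMap.snd ℝ ℝ (ℝ × ℝ))
/-- The coordinate `z`. -/
noncomputable def dZ : Q →L[ℝ] ℝ :=
  (ContinuousLinearMap.snd ℝ ℝ ℝ).comp (ContinuousLinearMap.snd ℝ ℝ (ℝ × ℝ))

@[simp] lemma prXY_apply (p : Q) : prXY p = (p.1, p.2.1) := rfl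
@[simp] lemma dX_apply (p : Q) : dX p = p.1 := rfl
@[simp] lemma dY_apply (p : Q) : dY p = p.2.1 := rfl
@[simp] lemma dZ_apply (p : Q) : dZ p = p.2.2 := rfl

lemma abs_fst_le (p : Q) : |p.1| ≤ ‖p‖ := norm_fst_le p
lemma abs_snd_fst_le (p : Q) : |p.2.1| ≤ ‖p‖ := (norm_fst_le p.2).trans (norm_snd_le p)
lemma abs_snd_snd_le (p : Q) : |p.2.2| ≤ ‖p‖ := (norm_snd_le p.2).trans (norm_snd_le p)

lemma norm_prXY_le : ‖prXY‖ ≤ 1 := ContinuousLinearMap.opNorm_le_bound _ zero_le_one fun p => by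
  rw [one_mul, prXY_apply, Prod.norm_def]
  exact max_le (abs_fst_le p) (abs_snd_fst_le p)
lemma norm_dX_le : ‖dX‖ ≤ 1 := ContinuousLinearMap.opNorm_le_bound _ zero_le_one fun p => by
  rw [one_mul]; exact abs_fst_le p
lemma norm_dY_le : ‖dY‖ ≤ 1 := ContinuousLinearMap.opNorm_le_bound _ zero_le_one fun p => by
  rw [one_mul]; exact abs_snd_fst_le p
lemma norm_dZ_le : ‖dZ‖ ≤ 1 := ContinuousLinearMap.opNorm_le_bound _ zero_le_one fun p => by
  rw [one_mul]; exact abs_snd_snd_le p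

namespace Lam
variable (L : Lam)

/-- The distance to a leaf. -/
noncomputable def r (i : Bool × ℝ) (p : Q) : ℝ :=
  ‖(⟨Real.sin (Real.pi * (p.2.1 - L.Y i p.1)), p.2.2⟩ : ℂ)‖

lemma r_sq (i : Bool × ℝ) (p : Q) :
    L.r i p ^ 2 = Real.sin (Real.pi * (p.2.1 - L.Y i p.1)) ^ 2 + p.2.2 ^ 2 := by
  unfold r; rw [Complex.sq_norm, Complex.normSq_mk]; ring

lemma r_sq' (i : Bool × ℝ) (p : Q) : L.r i p ^ 2 = sn (p.2.1 - L.Y i p.1) ^ 2 + p.2.2 ^ 2 := by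
  rw [r_sq, sn, sq_abs]

lemma r_nonneg (i : Bool × ℝ) (p : Q) : 0 ≤ L.r i p := norm_nonneg _

lemma sn_le_r (i : Bool × ℝ) (p : Q) : sn (p.2.1 - L.Y i p.1) ≤ L.r i p :=
  abs_le_of_sq_le_sq' (by rw [r_sq']; nlinarith [sq_nonneg p.2.2]) (L.r_nonneg i p) |>.2

lemma abs_z_le_r (i : Bool × ℝ) (p : Q) : |p.2.2| ≤ L.r i p :=
  abs_le_of_sq_le_sq (by rw [r_sq']; nlinarith [sq_nonneg (sn (p.2.1 - L.Y i p.1))]) (L.r_nonneg i p)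

lemma r_eq_zero {i : Bool × ℝ} {p : Q} : L.r i p = 0 ↔ sn (p.2.1 - L.Y i p.1) = 0 ∧ p.2.2 = 0 := by
  constructor
  · intro h
    have h1 := L.r_sq' i p
    rw [h] at h1
    constructor <;> nlinarith [sq_nonneg (sn (p.2.1 - L.Y i p.1)), sq_nonneg p.2.2]
  · rintro ⟨h1, h2⟩
    have := L.r_sq' i p
    rw [h1, h2] at this
    simpa using this

lemma abs_Y_sub_le (i : Bool × ℝ) (x x' : ℝ) : |L.Y i x - L.Y i x'| ≤ L.B * |x - x'| := by
  have := Convex.norm_image_sub_le_of_norm_hasDerivWithin_le (f := L.Y i) (f' := L.v i) (C := L.B)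
    (s := univ) (x := x') (y := x) (fun x _ => (L.hasDerivAt_Y i x).hasDerivWithinAt)
    (fun x _ => L.abs_v_le i x) convex_univ (mem_univ _) (mem_univ _)
  simpa using this

lemma r_sub_le (i : Bool × ℝ) (p q : Q) : |L.r i p - L.r i q| ≤ (4 * (1 + L.B) + 1) * ‖p - q‖ := by
  have hB := L.B_pos
  refine (abs_norm_sub_norm_le _ _).trans ?_
  refine (Complex.norm_le_abs_re_add_abs_im _).trans ?_
  simp only [Complex.sub_re, Complex.sub_im]
  have h1 : |p.1 - q.1| ≤ ‖p - q‖ := abs_fst_le (p - q)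
  have h2 : |p.2.1 - q.2.1| ≤ ‖p - q‖ := abs_snd_fst_le (p - q)
  have h3 : |p.2.2 - q.2.2| ≤ ‖p - q‖ := abs_snd_snd_le (p - q)
  have h4 : |Real.sin (Real.pi * (p.2.1 - L.Y i p.1)) - Real.sin (Real.pi * (q.2.1 - L.Y i q.1))| ≤
      |Real.pi * (p.2.1 - L.Y i p.1) - Real.pi * (q.2.1 - L.Y i q.1)| := by
    have := Real.lipschitzWith_sin.dist_le_mul (Real.pi * (p.2.1 - L.Y i p.1))
      (Real.pi * (q.2.1 - L.Y i q.1))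
    simpa [Real.dist_eq] using this
  have h5 : |Real.pi * (p.2.1 - L.Y i p.1) - Real.pi * (q.2.1 - L.Y i q.1)| ≤
      4 * ((1 + L.B) * ‖p - q‖) := by
    rw [← mul_sub, abs_mul, abs_of_pos Real.pi_pos]
    have h6 := L.abs_Y_sub_le i p.1 q.1
    have h7 : |p.2.1 - L.Y i p.1 - (q.2.1 - L.Y i q.1)| ≤ |p.2.1 - q.2.1| + |L.Y i p.1 - L.Y i q.1| := by
      rw [show p.2.1 - L.Y i p.1 - (q.2.1 - L.Y i q.1) = (p.2.1 - q.2.1) - (L.Y i p.1 - L.Y i q.1) by ring]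
      exact abs_sub _ _
    have h8 : L.B * |p.1 - q.1| ≤ L.B * ‖p - q‖ := by gcongr
    gcongr
    · exact Real.pi_le_four
    · linarith
  linarith

/-- The derivative of the squared distance. -/
noncomputable def D (i : Bool × ℝ) (p : Q) : Q →L[ℝ] ℝ :=
  (2 * Real.sin (Real.pi * (p.2.1 - L.Y i p.1)) * (Real.cos (Real.pi * (p.2.1 - L.Y i p.1)) *
    Real.pi)) • (dY - L.v i p.1 • dX) + (2 * p.2.2) • dZ

lemma hasFDerivAt_sub_Y (i : Bool × ℝ) (p : Q) :
    HasFDerivAt (fun p : Q => p.2.1 - L.Y i p.1) (dY - L.v i p.1 • dX) p :=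
  (dY.hasFDerivAt (x := p)).sub ((L.hasDerivAt_Y i p.1).comp_hasFDerivAt p (dX.hasFDerivAt (x := p)))

lemma hasFDerivAt_sq (i : Bool × ℝ) (p : Q) : HasFDerivAt (fun p => L.r i p ^ 2) (L.D i p) p := by
  have h1 := L.hasFDerivAt_sub_Y i p
  have h2 := ((Real.hasDerivAt_sin (Real.pi * (p.2.1 - L.Y i p.1))).comp_hasFDerivAt p
    (h1.const_mul Real.pi)).pow 2
  have h3 := (dZ.hasFDerivAt (x := p)).pow 2
  have h4 := h2.add h3
  have e : (fun p => L.r i p ^ 2) = fun p : Q =>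
      Real.sin (Real.pi * (p.2.1 - L.Y i p.1)) ^ 2 + p.2.2 ^ 2 := by ext p; exact L.r_sq i p
  rw [e]
  refine h4.congr_fderiv ?_
  ext q
  all_goals
    simp [D]
    try ring

lemma norm_D_le (i : Bool × ℝ) (p : Q) : ‖L.D i p‖ ≤ (8 * (1 + L.B) + 2) * L.r i p := by
  have hB := L.B_pos
  have h1 := L.sn_le_r i p
  have h2 := L.abs_z_le_r i p
  have h3 : ‖dY - L.v i p.1 • dX‖ ≤ 1 + L.B := by
    refine (norm_sub_le _ _).trans (add_le_add norm_dY_le ?_)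
    rw [norm_smul]
    calc _ ≤ L.B * 1 := by
          gcongr
          · exact L.abs_v_le i _
          · exact norm_dX_le
      _ = _ := mul_one _
  have h4 : |Real.cos (Real.pi * (p.2.1 - L.Y i p.1))| ≤ 1 := Real.abs_cos_le_one _
  calc ‖L.D i p‖ ≤ |2 * Real.sin (Real.pi * (p.2.1 - L.Y i p.1)) * (Real.cos (Real.pi * (p.2.1 - L.Y i p.1)) *
    Real.pi)| * (1 + L.B) + |2 * p.2.2| * 1 := by
        refine (norm_add_le _ _).trans ?_
        rw [norm_smul, norm_smul]
        gcongr
        · exact le_rfl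
        · exact le_rfl
        · exact norm_dZ_le
    _ = 2 * sn (p.2.1 - L.Y i p.1) * (|Real.cos (Real.pi * (p.2.1 - L.Y i p.1))| * Real.pi) * (1 + L.B)
        + 2 * |p.2.2| := by
        simp only [abs_mul, sn, abs_of_pos Real.pi_pos]; norm_num
    _ ≤ 2 * L.r i p * (1 * 4) * (1 + L.B) + 2 * L.r i p := by
        have := sn_nonneg (p.2.1 - L.Y i p.1)
        have := Real.pi_le_four
        have := Real.pi_pos
        have := L.r_nonneg i p
        have h5 : |Real.cos (Real.pi * (p.2.1 - L.Y i p.1))| * Real.pi ≤ 1 * 4 := by gcongr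
        gcongr
    _ = _ := by ring

lemma continuous_Y (i : Bool × ℝ) : Continuous (L.Y i) :=
  continuous_iff_continuousAt.2 fun x => (L.hasDerivAt_Y i x).continuousAt
lemma continuous_v (i : Bool × ℝ) : Continuous (L.v i) :=
  continuous_iff_continuousAt.2 fun x => (L.hasDerivAt_v i x).continuousAt

lemma continuous_D (i : Bool × ℝ) : Continuous (L.D i) := by
  have := L.continuous_Y i
  have := L.continuous_v i
  unfold D; fun_prop

/-- The family of leaves as subsets of the model space. -/
noncomputable def geo (d : Den) (t₀ : ℝ) (h0 : 0 < t₀) (h1 : t₀ ≤ 1) : Geo Q where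
  r := L.r
  D := L.D
  w := fun p => d.w (p.1, p.2.1)
  w' := fun p => (fderiv ℝ d.w (p.1, p.2.1)).comp prXY
  B := (8 * (1 + L.B) + 2) + d.B
  c := min L.c 1
  t₀ := t₀
  B_pos := by have := L.B_pos; have := d.B_pos; positivity
  c_pos := lt_min L.c_pos one_pos
  c_le_one := min_le_right _ _
  t₀_pos := h0
  t₀_le_one := h1
  r_nonneg := L.r_nonneg
  r_sub_le := fun i p q => (L.r_sub_le i p q).trans (by
    have := L.B_pos; have := d.B_pos
    exact mul_le_mul_of_nonneg_right (by linarith) (norm_nonneg _))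
  hasFDerivAt_sq := L.hasFDerivAt_sq
  norm_D_le := fun i p => (L.norm_D_le i p).trans (by
    have := d.B_pos; have := L.r_nonneg i p
    exact mul_le_mul_of_nonneg_right (by linarith) this)
  continuous_D := L.continuous_D
  hasFDerivAt_w := fun p =>
    ((d.contDiff.differentiable one_ne_zero) (p.1, p.2.1)).hasFDerivAt.comp p (prXY.hasFDerivAt (x := p))
  continuous_w' := by
    have hc : Continuous (fderiv ℝ d.w) := d.contDiff.continuous_fderiv one_ne_zero
    have : Continuous fun p : Q => fderiv ℝ d.w (p.1, p.2.1) := hc.comp (by fun_prop)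
    fun_prop
  w_pos := fun p => d.pos _
  w_le := fun p => (d.w_le _).trans (by have := L.B_pos; linarith)
  norm_w'_le := fun p => by
    have := L.B_pos; have := d.B_pos
    calc _ ≤ ‖fderiv ℝ d.w (p.1, p.2.1)‖ * ‖prXY‖ := ContinuousLinearMap.opNorm_comp_le _ _
      _ ≤ d.B * 1 := by gcongr; exacts [d.norm_fderiv_le _, norm_prXY_le]
      _ ≤ _ := by linarith
  r_add_one := fun θ p => by
    refine (sq_eq_sq₀ (L.r_nonneg _ _) (L.r_nonneg _ _)).1 ?_
    rw [L.r_sq, L.r_sq, L.Y_add_one]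
    have e : Real.pi * (p.2.1 - (L.Y (true, θ) p.1 + 1)) =
      Real.pi * (p.2.1 - L.Y (true, θ) p.1) - Real.pi := by ring
    rw [e, Real.sin_sub_pi, neg_sq]
  close := fun i p ρ hρ hρ1 => by
    obtain ⟨a, ha⟩ := L.close i p.1 ρ hρ hρ1
    refine ⟨a, fun θ hθ => ?_⟩
    have h1 := ha θ ⟨hθ.1, hθ.2.trans_le (by
      have := Real.rpow_nonneg hρ.le (1 / 8 : ℝ)
      gcongr; exact min_le_left _ _)⟩
    have h2 := sn_add_le (p.2.1 - L.Y i p.1) (L.Y i p.1 - L.Y (true, θ) p.1)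
    rw [sub_add_sub_cancel, sn_sub_comm (L.Y i p.1)] at h2
    have h3 := L.sn_le_r i p
    have h4 := sn_nonneg (p.2.1 - L.Y i p.1)
    have h5 := sn_nonneg (p.2.1 - L.Y (true, θ) p.1)
    have h6 := L.r_nonneg i p
    refine abs_le_of_sq_le_sq' ?_ (by linarith) |>.2
    rw [L.r_sq']
    have := L.r_sq' i p
    nlinarith
  nearest := fun p => by
    obtain ⟨i, hi⟩ := L.nearest p.1 p.2.1
    refine ⟨i, fun j => ?_⟩
    have h4 := sn_nonneg (p.2.1 - L.Y i p.1)
    refine abs_le_of_sq_le_sq' ?_ (L.r_nonneg j p) |>.2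
    rw [L.r_sq', L.r_sq']
    nlinarith [hi j]
  measurable_r := fun p => by
    have : Measurable fun θ => L.Y (true, θ) p.1 := L.measurable_Y.comp (by fun_prop : Measurable fun θ : ℝ => (θ, p.1))
    unfold r
    have h : ∀ θ : ℝ, (⟨Real.sin (Real.pi * (p.2.1 - L.Y (true, θ) p.1)), p.2.2⟩ : ℂ) =
      (Real.sin (Real.pi * (p.2.1 - L.Y (true, θ) p.1)) : ℂ) + (p.2.2 : ℂ) * Complex.I := fun θ => by
        apply Complex.ext <;> simp [- Complex.ofReal_sin]
    simp_rw [h]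
    fun_prop
  measurable_D := fun p => by
    have h1 : Measurable fun θ => L.Y (true, θ) p.1 := L.measurable_Y.comp (by fun_prop : Measurable fun θ : ℝ => (θ, p.1))
    have h2 : Measurable fun θ => L.v (true, θ) p.1 := L.measurable_v.comp (by fun_prop : Measurable fun θ : ℝ => (θ, p.1))
    unfold D
    refine Measurable.stronglyMeasurable ?_
    fun_prop

/-- The slopes of the leaves. -/
noncomputable def slope (d : Den) (t₀ : ℝ) (h0 : 0 < t₀) (h1 : t₀ ≤ 1) : Sec (L.geo d t₀ h0 h1) where
  u := fun i p => L.v i p.1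
  u' := fun i p => L.v' i p.1 • dX
  A := L.B
  A_pos := L.B_pos
  hasFDerivAt_u := fun i p => (L.hasDerivAt_v i p.1).comp_hasFDerivAt p (dX.hasFDerivAt (x := p))
  continuous_u' := fun i => by
    have := L.continuous_v' i
    fun_prop
  abs_u_le := fun i p => L.abs_v_le i _
  norm_u'_le := fun i p => by
    rw [norm_smul]
    have := L.B_pos
    calc _ ≤ L.B * 1 := by
          gcongr
          · exact L.abs_v'_le i _
          · exact norm_dX_le
      _ = _ := mul_one _
  u_sub_le := fun i j p => (L.v_sub_le i j p.1).trans (by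
    have := L.B_pos
    have h1 := sn_nonneg (L.Y i p.1 - L.Y j p.1)
    gcongr
    have h2 := sn_add_le (L.Y i p.1 - p.2.1) (p.2.1 - L.Y j p.1)
    rw [sub_add_sub_cancel, sn_sub_comm (L.Y i p.1) p.2.1] at h2
    exact h2.trans (add_le_add (L.sn_le_r i p) (L.sn_le_r j p)))
  u'_sub_le := fun i j p => by
    have hB := L.B_pos
    have h1 := sn_nonneg (L.Y i p.1 - L.Y j p.1)
    have e : L.v' i p.1 • dX - L.v' j p.1 • dX = (L.v' i p.1 - L.v' j p.1) • dX := (sub_smul _ _ _).symm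
    rw [e, norm_smul, Real.norm_eq_abs]
    calc _ ≤ (L.B * sn (L.Y i p.1 - L.Y j p.1) ^ (11 / 10 : ℝ)) * 1 := by
          gcongr
          · exact L.v'_sub_le i j p.1
          · exact norm_dX_le
      _ ≤ _ := by
          rw [mul_one]
          gcongr
          have h2 := sn_add_le (L.Y i p.1 - p.2.1) (p.2.1 - L.Y j p.1)
          rw [sub_add_sub_cancel, sn_sub_comm (L.Y i p.1) p.2.1] at h2
          exact h2.trans (add_le_add (L.sn_le_r i p) (L.sn_le_r j p))
  measurable_u := fun p => (L.measurable_v.comp (by fun_prop : Measurable fun θ : ℝ => (θ, p.1))).stronglyMeasurable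
  measurable_u' := fun p => by
    have h2 : Measurable fun θ => L.v' (true, θ) p.1 := L.measurable_v'.comp (by fun_prop : Measurable fun θ : ℝ => (θ, p.1))
    exact (h2.stronglyMeasurable).smul_const _

end Lam

section flow
variable {E : Type*} [NormedAddCommGroup E] [NormedSpace ℝ E]

/-- A global flow of a bounded Lipschitz vector field. -/
structure Flow (X : E → E) where
  K : NNReal
  lip : LipschitzWith K X
  B : ℝ
  norm_le : ∀ x, ‖X x‖ ≤ B
  φ : ℝ → E → E
  zero : ∀ x, φ 0 x = x
  hasDerivAt : ∀ x t, HasDerivAt (fun s => φ s x) (X (φ t x)) t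

lemma eq_of_hasDerivAt {K : NNReal} {X : E → E} (hX : LipschitzWith K X) {γ δ : ℝ → E}
    (hγ : ∀ t, HasDerivAt γ (X (γ t)) t) (hδ : ∀ t, HasDerivAt δ (X (δ t)) t) {t₀ : ℝ}
    (h : γ t₀ = δ t₀) : γ = δ :=
  ODE_solution_unique_univ (v := fun _ => X) (s := fun _ => univ) (K := K)
    (fun _ => hX.lipschitzOnWith) (fun t => ⟨hγ t, mem_univ _⟩) (fun t => ⟨hδ t, mem_univ _⟩) h

lemma exists_solution [CompleteSpace E] {K : NNReal} {X : E → E} (hX : LipschitzWith K X) {B : ℝ}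
    (hB : ∀ x, ‖X x‖ ≤ B) (x : E) :
    ∃ γ : ℝ → E, γ 0 = x ∧ ∀ t, HasDerivAt γ (X (γ t)) t := by
  have hB0 : 0 ≤ B := (norm_nonneg _).trans (hB 0)
  have h : ∀ n : ℕ, ∃ γ : ℝ → E, γ 0 = x ∧ ∀ t ∈ Icc (-(n : ℝ)) n,
      HasDerivWithinAt γ (X (γ t)) (Icc (-(n : ℝ)) n) t := by
    intro n
    have h0 : (0 : ℝ) ∈ Icc (-(n : ℝ)) n := by constructor <;> simp
    have hp : IsPicardLindelof (fun _ => X) (⟨0, h0⟩ : Icc (-(n : ℝ)) n) x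
        (⟨B, hB0⟩ * n) 0 ⟨B, hB0⟩ K :=
      { lipschitzOnWith := fun _ _ => hX.lipschitzOnWith
        continuousOn := fun _ _ => continuousOn_const
        norm_le := fun _ _ x _ => hB x
        mul_max_le := by simp; exact le_rfl }
    exact hp.exists_eq_forall_mem_Icc_hasDerivWithinAt₀
  choose γ h0 hγ using h
  have hγ' : ∀ n : ℕ, ∀ t ∈ Ioo (-(n : ℝ)) n, HasDerivAt (γ n) (X (γ n t)) t := fun n t ht =>
    (hγ n t (Ioo_subset_Icc_self ht)).hasDerivAt (Icc_mem_nhds ht.1 ht.2)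
  have huniq : ∀ m n : ℕ, m ≤ n → ∀ t ∈ Ioo (-(m : ℝ)) m, γ m t = γ n t := by
    intro m n hmn t ht
    have hc : (m : ℝ) ≤ n := Nat.cast_le.2 hmn
    exact ODE_solution_unique_of_mem_Ioo (v := fun _ => X) (s := fun _ => univ) (K := K)
      (a := -m) (b := m) (t₀ := 0)
      (fun _ _ => hX.lipschitzOnWith) ⟨by linarith [ht.1, ht.2], by linarith [ht.1, ht.2]⟩
      (fun t ht => ⟨hγ' m t ht, mem_univ _⟩)
      (fun t ht => ⟨hγ' n t ⟨by linarith [ht.1], by linarith [ht.2]⟩, mem_univ _⟩)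
      (by rw [h0, h0]) ht
  refine ⟨fun t => γ (⌈|t|⌉₊ + 1) t, h0 _, fun t => ?_⟩
  have hmem : ∀ s, |s| ≤ |t| + 1 → s ∈ Ioo (-((⌈|t|⌉₊ + 2 : ℕ) : ℝ)) ((⌈|t|⌉₊ + 2 : ℕ) : ℝ) := fun s hs => by
    have := Nat.le_ceil |t|
    push_cast
    rw [mem_Ioo, ← abs_lt]; linarith
  have hs : ∀ s : ℝ, s ∈ Ioo (-((⌈|s|⌉₊ + 1 : ℕ) : ℝ)) ((⌈|s|⌉₊ + 1 : ℕ) : ℝ) := fun s => by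
    have := Nat.le_ceil |s|
    push_cast
    rw [mem_Ioo, ← abs_lt]; linarith
  have key : ∀ s, |s| ≤ |t| + 1 → γ (⌈|s|⌉₊ + 1) s = γ (⌈|t|⌉₊ + 2) s := fun s hst => by
    refine huniq _ _ ?_ s (hs s)
    have : ⌈|s|⌉₊ ≤ ⌈|t|⌉₊ + 1 := by
      rw [← Nat.ceil_add_one (abs_nonneg t)]; exact Nat.ceil_mono hst
    omega
  have hd := hγ' (⌈|t|⌉₊ + 2) t (hmem t (by linarith))
  rw [← key t (by linarith)] at hd
  refine hd.congr_of_eventuallyEq ?_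
  have : ∀ᶠ s in 𝓝 t, |s| < |t| + 1 := (continuous_abs.tendsto t).eventually_lt_const (by linarith)
  filter_upwards [this] with s hs'
  exact key s hs'.le

lemma nonempty_flow [CompleteSpace E] {K : NNReal} {X : E → E} (hX : LipschitzWith K X) {B : ℝ}
    (hB : ∀ x, ‖X x‖ ≤ B) : Nonempty (Flow X) := by
  choose γ h0 hγ using exists_solution hX hB
  exact ⟨⟨K, hX, B, hB, fun t x => γ x t, h0, hγ⟩⟩

namespace Flow
variable {X : E → E} (Φ : Flow X)

lemma B_nonneg : 0 ≤ Φ.B := (norm_nonneg _).trans (Φ.norm_le 0)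

lemma eq {γ : ℝ → E} (hγ : ∀ t, HasDerivAt γ (X (γ t)) t) (t : ℝ) : γ t = Φ.φ t (γ 0) :=
  congrFun (eq_of_hasDerivAt Φ.lip hγ (Φ.hasDerivAt (γ 0)) (t₀ := 0) (Φ.zero _).symm) t

lemma hasDerivAt_shift {γ : ℝ → E} (hγ : ∀ t, HasDerivAt γ (X (γ t)) t) (a : ℝ) (t : ℝ) :
    HasDerivAt (fun s => γ (s + a)) (X (γ (t + a))) t :=
  (hγ (t + a)).comp_add_const t a

lemma add (s t : ℝ) (x : E) : Φ.φ (s + t) x = Φ.φ s (Φ.φ t x) := by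
  have := Φ.eq (hasDerivAt_shift (Φ.hasDerivAt x) t) s
  simpa using this

lemma neg_apply (t : ℝ) (x : E) : Φ.φ (-t) (Φ.φ t x) = x := by
  rw [← Φ.add, neg_add_cancel, Φ.zero]

lemma apply_neg (t : ℝ) (x : E) : Φ.φ t (Φ.φ (-t) x) = x := by
  rw [← Φ.add, add_neg_cancel, Φ.zero]

lemma dist_le (x y : E) {t : ℝ} (ht : 0 ≤ t) :
    dist (Φ.φ t x) (Φ.φ t y) ≤ dist x y * Real.exp (Φ.K * t) := by
  have hc : ∀ x, Continuous fun s => Φ.φ s x := fun x =>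
    continuous_iff_continuousAt.2 fun t => (Φ.hasDerivAt x t).continuousAt
  have := dist_le_of_trajectories_ODE (v := fun _ => X) (K := Φ.K) (f := fun s => Φ.φ s x)
    (g := fun s => Φ.φ s y) (a := 0) (b := t) (δ := dist x y) (fun _ => Φ.lip) (hc x).continuousOn
    (fun s _ => (Φ.hasDerivAt x s).hasDerivWithinAt) (hc y).continuousOn
    (fun s _ => (Φ.hasDerivAt y s).hasDerivWithinAt) (by rw [Φ.zero, Φ.zero]) t ⟨ht, le_rfl⟩
  simpa using this

/-- The flow of the opposite field. -/
def rev : Flow (fun x => - X x) where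
  K := Φ.K
  lip := by
    refine LipschitzWith.of_dist_le_mul fun x y => ?_
    rw [dist_neg_neg]; exact Φ.lip.dist_le_mul x y
  B := Φ.B
  norm_le := fun x => by rw [norm_neg]; exact Φ.norm_le x
  φ := fun t => Φ.φ (-t)
  zero := fun x => by rw [neg_zero, Φ.zero]
  hasDerivAt := fun x t => by
    have := (Φ.hasDerivAt x (-t)).scomp t (hasDerivAt_neg t)
    simpa [Function.comp_def] using this

lemma lipschitz (t : ℝ) : LipschitzWith (Real.toNNReal (Real.exp (Φ.K * |t|))) (Φ.φ t) := by
  refine LipschitzWith.of_dist_le_mul fun x y => ?_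
  rw [Real.coe_toNNReal _ (Real.exp_pos _).le, mul_comm]
  rcases le_total 0 t with h | h
  · rw [abs_of_nonneg h]; exact Φ.dist_le x y h
  · rw [abs_of_nonpos h]
    have := Φ.rev.dist_le x y (t := -t) (by linarith)
    simpa [rev] using this

lemma continuous (t : ℝ) : Continuous (Φ.φ t) := (Φ.lipschitz t).continuous

lemma dist_time_le (x : E) (s t : ℝ) : dist (Φ.φ s x) (Φ.φ t x) ≤ Φ.B * |s - t| := by
  have := Convex.norm_image_sub_le_of_norm_hasDerivWithin_le (f := fun s => Φ.φ s x)
    (f' := fun s => X (Φ.φ s x)) (C := Φ.B)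
    (s := univ) (x := t) (y := s) (fun s _ => (Φ.hasDerivAt x s).hasDerivWithinAt)
    (fun s _ => Φ.norm_le _) convex_univ (mem_univ _) (mem_univ _)
  simpa [dist_eq_norm] using this

lemma continuous_time (x : E) : Continuous fun t => Φ.φ t x :=
  continuous_iff_continuousAt.2 fun t => (Φ.hasDerivAt x t).continuousAt

/-- The time-`t` map as a homeomorphism. -/
def homeo (t : ℝ) : E ≃ₜ E where
  toFun := Φ.φ t
  invFun := Φ.φ (-t)
  left_inv := Φ.neg_apply t
  right_inv := Φ.apply_neg t
  continuous_toFun := Φ.continuous t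
  continuous_invFun := Φ.continuous (-t)

end Flow
end flow

section measure
variable {E : Type*} [NormedAddCommGroup E] [NormedSpace ℝ E] [FiniteDimensional ℝ E]
  [MeasurableSpace E] [BorelSpace E]

lemma ext_of_integral_lipschitz [Nontrivial E] (μ ν : Measure E) [IsFiniteMeasureOnCompacts μ]
    [IsFiniteMeasureOnCompacts ν]
    (h : ∀ (K : NNReal) (g : E → ℝ), LipschitzWith K g → HasCompactSupport g →
      ∫ x, g x ∂μ = ∫ x, g x ∂ν) : μ = ν := by
  have : ProperSpace E := FiniteDimensional.proper ℝ E
  have : SecondCountableTopology E := inferInstance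
  refine Measure.OuterRegular.ext_isOpen_isBounded fun U hU hb => ?_
  have hne : (Uᶜ).Nonempty := by
    rw [nonempty_compl]; rintro rfl
    exact NormedSpace.unbounded_univ ℝ E hb
  let g : ℕ → E → ℝ := fun n x => min 1 (n * Metric.infDist x Uᶜ)
  have hgc : ∀ n, Continuous (g n) := fun n =>
    continuous_const.min (continuous_const.mul (Metric.continuous_infDist_pt _))
  have hlip : ∀ n : ℕ, LipschitzWith n (g n) := fun n => by
    refine LipschitzWith.const_min ?_ 1
    refine LipschitzWith.of_dist_le_mul fun x y => ?_
    have := (Metric.lipschitz_infDist_pt (Uᶜ : Set E)).dist_le_mul x y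
    rw [Real.dist_eq] at *
    rw [← mul_sub, abs_mul, Nat.abs_cast]
    simp only [NNReal.coe_one, one_mul] at this
    simp only [NNReal.coe_natCast]
    gcongr
  have h0 : ∀ n x, x ∉ U → g n x = 0 := fun n x hx => by
    have : Metric.infDist x Uᶜ = 0 := Metric.infDist_zero_of_mem hx
    simp [g, this]
  have hcl : IsCompact (closure U) := hb.isCompact_closure
  have hcs : ∀ n, HasCompactSupport (g n) := fun n =>
    HasCompactSupport.intro hcl fun x hx => h0 n x fun hx' => hx (subset_closure hx')
  have hnn : ∀ n x, 0 ≤ g n x := fun n x => le_min zero_le_one (mul_nonneg n.cast_nonneg Metric.infDist_nonneg)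
  have key : ∀ (m : Measure E) [IsFiniteMeasureOnCompacts m],
      Tendsto (fun n => ∫ x, g n x ∂m) atTop (𝓝 (m.real U)) := by
    intro m _
    have hfin : m U ≠ ⊤ := ((measure_mono subset_closure).trans_lt hcl.measure_lt_top).ne
    have e : m.real U = ∫ x, U.indicator (fun _ => (1 : ℝ)) x ∂m := by
      rw [integral_indicator_const _ hU.measurableSet]; simp
    rw [e]
    refine tendsto_integral_of_dominated_convergence (U.indicator fun _ => 1)
      (fun n => (hgc n).aestronglyMeasurable)
      ((integrable_indicator_iff hU.measurableSet).2 (integrableOn_const hfin)) (fun n => Eventually.of_forall fun x => ?_)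
      (Eventually.of_forall fun x => ?_)
    · rw [Real.norm_of_nonneg (hnn n x)]
      by_cases hx : x ∈ U
      · rw [indicator_of_mem hx]; exact min_le_left _ _
      · rw [indicator_of_notMem hx, h0 n x hx]
    · by_cases hx : x ∈ U
      · rw [indicator_of_mem hx]
        have hpos : 0 < Metric.infDist x Uᶜ :=
          (hU.isClosed_compl.notMem_iff_infDist_pos hne).1 (fun h' => h' hx)
        obtain ⟨N, hN⟩ := exists_nat_gt (1 / Metric.infDist x Uᶜ)
        refine tendsto_const_nhds.congr' ?_
        filter_upwards [eventually_ge_atTop N] with n hn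
        have : (N : ℝ) ≤ n := Nat.cast_le.2 hn
        rw [div_lt_iff₀ hpos] at hN
        refine (min_eq_left ?_).symm
        nlinarith
      · rw [indicator_of_notMem hx]
        simp [h0 _ x hx]
  have h1 := key μ
  have h2 := key ν
  simp_rw [fun n : ℕ => h n (g n) (hlip n) (hcs n)] at h1
  have := tendsto_nhds_unique h1 h2
  have f1 : μ U ≠ ⊤ := ((measure_mono subset_closure).trans_lt hcl.measure_lt_top).ne
  have f2 : ν U ≠ ⊤ := ((measure_mono subset_closure).trans_lt hcl.measure_lt_top).ne
  exact (measureReal_eq_measureReal_iff f1 f2).1 this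

namespace Flow
variable {X : E → E} (Φ : Flow X)

lemma hasDerivAt_integral (ν : Measure E) [IsFiniteMeasureOnCompacts ν] (hν : ν ≪ Measure.addHaar)
    {K : NNReal} {g : E → ℝ} (hg : LipschitzWith K g) (hc : HasCompactSupport g) :
    HasDerivAt (fun s => ∫ x, g (Φ.φ s x) ∂ν) (∫ x, fderiv ℝ g x (X x) ∂ν) 0 := by
  have : ProperSpace E := FiniteDimensional.proper ℝ E
  have hB := Φ.B_nonneg
  set S := Metric.cthickening Φ.B (tsupport g) with hS
  have hSc : IsCompact S := hc.isCompact.cthickening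
  have hout : ∀ x ∉ S, ∀ s : ℝ, |s| ≤ 1 → g (Φ.φ s x) = 0 := by
    intro x hx s hs
    by_contra h
    refine hx (Metric.mem_cthickening_of_dist_le x (Φ.φ s x) _ _ (subset_tsupport _ h) ?_)
    have := Φ.dist_time_le x 0 s
    rw [Φ.zero, zero_sub, abs_neg] at this
    nlinarith
  have hae : ∀ᵐ x ∂ν, DifferentiableAt ℝ g x := hν.ae_le hg.ae_differentiableAt
  have hder : ∀ᵐ x ∂ν, HasDerivAt (fun s => g (Φ.φ s x)) (fderiv ℝ g x (X x)) 0 := by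
    filter_upwards [hae] with x hx
    have h1 := Φ.hasDerivAt x 0
    rw [Φ.zero] at h1
    have h2 : HasFDerivAt g (fderiv ℝ g x) (Φ.φ 0 x) := by rw [Φ.zero]; exact hx.hasFDerivAt
    exact h2.comp_hasDerivAt 0 h1
  refine (hasDerivAt_integral_of_dominated_loc_of_lip (𝕜 := ℝ) (bound := S.indicator fun _ => K * Φ.B)
    (s := Metric.ball 0 1) (Metric.ball_mem_nhds _ one_pos)
    (Eventually.of_forall fun s => (hg.continuous.comp (Φ.continuous s)).aestronglyMeasurable)
    ?_ ?_ (Eventually.of_forall fun x => ?_) ?_ hder).2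
  · have e : g ∘ Φ.φ 0 = g := by ext x; rw [Function.comp_apply, Φ.zero]
    rw [e]
    exact hg.continuous.integrable_of_hasCompactSupport hc
  · exact (isBoundedBilinearMap_apply.continuous.comp_stronglyMeasurable
      ((measurable_fderiv ℝ g).stronglyMeasurable.prodMk
        Φ.lip.continuous.stronglyMeasurable)).aestronglyMeasurable
  · refine LipschitzOnWith.of_dist_le_mul fun s hs t ht => ?_
    rw [Real.coe_nnabs]
    by_cases hx : x ∈ S
    · rw [indicator_of_mem hx, abs_of_nonneg (by positivity)]
      refine (hg.dist_le_mul _ _).trans ?_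
      rw [mul_assoc]
      exact mul_le_mul_of_nonneg_left (Φ.dist_time_le x s t) K.2
    · have hs' : |s| ≤ 1 := by simpa using (mem_ball_zero_iff.1 hs).le
      have ht' : |t| ≤ 1 := by simpa using (mem_ball_zero_iff.1 ht).le
      simp [hout x hx s hs', hout x hx t ht', indicator_of_notMem hx]
  · exact (integrable_indicator_iff hSc.measurableSet).2 (integrableOn_const hSc.measure_lt_top.ne)

/-- A field which is divergence-free in the weak sense preserves the measure. -/
theorem measurePreserving [Nontrivial E] (ν : Measure E) [IsFiniteMeasureOnCompacts ν] (hν : ν ≪ Measure.addHaar)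
    (h : ∀ (K : NNReal) (g : E → ℝ), LipschitzWith K g → HasCompactSupport g →
      ∫ x, fderiv ℝ g x (X x) ∂ν = 0) (t : ℝ) : MeasurePreserving (Φ.φ t) ν ν := by
  have hcomp : ∀ {g : E → ℝ}, HasCompactSupport g → ∀ t, HasCompactSupport fun x => g (Φ.φ t x) :=
    fun hc t => hc.comp_homeomorph (Φ.homeo t)
  have key : ∀ (K : NNReal) (g : E → ℝ), LipschitzWith K g → HasCompactSupport g →
      ∀ t, ∫ x, g (Φ.φ t x) ∂ν = ∫ x, g x ∂ν := by
    intro K g hg hc t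
    have hd : ∀ t, HasDerivAt (fun s => ∫ x, g (Φ.φ s x) ∂ν) 0 t := by
      intro t
      have h1 := Φ.hasDerivAt_integral ν hν (hg.comp (Φ.lipschitz t)) (hcomp hc t)
      rw [h _ _ (hg.comp (Φ.lipschitz t)) (hcomp hc t)] at h1
      have h2 : HasDerivAt (fun s => ∫ x, g (Φ.φ t (Φ.φ (s - t) x)) ∂ν) 0 t := by
        have := HasDerivAt.comp_sub_const (x := t) (a := t) (f := fun s => ∫ x, g (Φ.φ t (Φ.φ s x)) ∂ν) (f' := 0)
          (by rw [sub_self]; exact h1)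
        exact this
      refine h2.congr_of_eventuallyEq (Eventually.of_forall fun s => ?_)
      simp only [← Φ.add, add_sub_cancel]
    have := is_const_of_deriv_eq_zero (fun t => (hd t).differentiableAt) (fun t => (hd t).deriv) t 0
    simpa only [Φ.zero] using this
  refine ⟨(Φ.continuous t).measurable, ?_⟩
  have : IsFiniteMeasureOnCompacts (Measure.map (Φ.φ t) ν) := ⟨fun S hS => by
    rw [Measure.map_apply (Φ.continuous t).measurable hS.measurableSet]
    exact ((Φ.homeo t).isCompact_preimage.2 hS).measure_lt_top⟩
  refine ext_of_integral_lipschitz _ _ fun K g hg hc => ?_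
  rw [integral_map (Φ.continuous t).measurable.aemeasurable hg.continuous.aestronglyMeasurable]
  exact key K g hg hc t

end Flow
end measure

lemma sn_eq_zero_iff {y : ℝ} : sn y = 0 ↔ ∃ n : ℤ, y = n := by
  unfold sn
  rw [abs_eq_zero, Real.sin_eq_zero_iff]
  constructor
  · rintro ⟨n, hn⟩
    exact ⟨n, mul_left_cancel₀ Real.pi_ne_zero (by rw [← hn]; ring)⟩
  · rintro ⟨n, rfl⟩
    exact ⟨n, mul_comm _ _⟩

/-- The data of a model plug. -/
structure Mod where
  L : Lam
  d : Den
  b : ℝ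
  b_pos : 0 < b

namespace Mod
variable (m : Mod)

/-- The height of the upper leaves. -/
noncomputable def b0 : ℝ := 2 * m.b / 3
/-- The width of the support of the perturbation. -/
noncomputable def ρ : ℝ := min (m.b / 4) (1 / 20)

lemma ρ_pos : 0 < m.ρ := by have := m.b_pos; unfold ρ; positivity
lemma ρ_le : m.ρ ≤ m.b / 4 := min_le_left _ _
lemma ρ_le' : m.ρ ≤ 1 / 20 := min_le_right _ _
lemma ρ_sq_le : m.ρ ^ 2 ≤ 1 := by have := m.ρ_pos; have := m.ρ_le'; nlinarith
lemma b0_pos : 0 < m.b0 := by have := m.b_pos; unfold b0; positivity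
lemma b0_lt : m.b0 < m.b := by have := m.b_pos; unfold b0; linarith

/-- The family of leaves. -/
noncomputable def G : Geo Q := m.L.geo m.d (m.ρ ^ 2) (pow_pos m.ρ_pos 2) m.ρ_sq_le
/-- The slopes of the leaves. -/
noncomputable def S : Sec m.G := m.L.slope m.d (m.ρ ^ 2) (pow_pos m.ρ_pos 2) m.ρ_sq_le
/-- The horizontal component of the local field. -/
noncomputable def f1 : Q → ℝ := m.G.one.f
/-- The vertical component of the local field. -/
noncomputable def f2 : Q → ℝ := m.S.f

lemma r_shift (b : Bool) (θ : ℝ) (p : Q) (n : ℤ) :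
    m.G.r (b, θ) (p.1, p.2.1 + n, p.2.2) = m.G.r (b, θ) p := by
  change m.L.r _ _ = m.L.r _ _
  refine (sq_eq_sq₀ (m.L.r_nonneg _ _) (m.L.r_nonneg _ _)).1 ?_
  rw [m.L.r_sq', m.L.r_sq']
  dsimp only
  rw [add_sub_right_comm, sn_add_int]

lemma symm_x (s : Sec m.G) (hu : ∀ b θ (p : Q), s.u (b, θ) (p.1 + 1, p.2) = s.u (b, θ + √2) p)
    (hu1 : ∀ θ p, s.u (true, θ + 1) p = s.u (true, θ) p) (p : Q) :
    s.f (p.1 + 1, p.2) = s.f p ∧ m.G.M (p.1 + 1, p.2) = m.G.M p := by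
  refine s.f_symm (fun p => (p.1 + 1, p.2)) √2 (fun b θ p => ?_) hu hu1 (fun p => m.d.add_x _ _) p
  change m.L.r _ _ = m.L.r _ _
  refine (sq_eq_sq₀ (m.L.r_nonneg _ _) (m.L.r_nonneg _ _)).1 ?_
  rw [m.L.r_sq', m.L.r_sq']
  dsimp only
  rw [m.L.Y_x_add_one]

lemma symm_y (s : Sec m.G) (hu : ∀ b θ (p : Q), s.u (b, θ) (p.1, p.2.1 + 1, p.2.2) = s.u (b, θ) p)
    (hu1 : ∀ θ p, s.u (true, θ + 1) p = s.u (true, θ) p) (p : Q) :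
    s.f (p.1, p.2.1 + 1, p.2.2) = s.f p ∧ m.G.M (p.1, p.2.1 + 1, p.2.2) = m.G.M p := by
  refine s.f_symm (fun p => (p.1, p.2.1 + 1, p.2.2)) 0 (fun b θ p => ?_)
    (fun b θ p => by rw [add_zero, hu]) hu1 (fun p => m.d.add_y _ _) p
  have := m.r_shift b θ p 1
  rw [add_zero, ← this]; norm_num

lemma symm_z (s : Sec m.G) (hu : ∀ b θ (p : Q), s.u (b, θ) (p.1, p.2.1, -p.2.2) = s.u (b, θ) p)
    (hu1 : ∀ θ p, s.u (true, θ + 1) p = s.u (true, θ) p) (p : Q) :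
    s.f (p.1, p.2.1, -p.2.2) = s.f p ∧ m.G.M (p.1, p.2.1, -p.2.2) = m.G.M p := by
  refine s.f_symm (fun p => (p.1, p.2.1, -p.2.2)) 0 (fun b θ p => ?_)
    (fun b θ p => by rw [add_zero, hu]) hu1 (fun p => rfl) p
  rw [add_zero]
  change m.L.r _ _ = m.L.r _ _
  refine (sq_eq_sq₀ (m.L.r_nonneg _ _) (m.L.r_nonneg _ _)).1 ?_
  rw [m.L.r_sq', m.L.r_sq', neg_sq]

lemma f1_x (x y z : ℝ) : m.f1 (x + 1, y, z) = m.f1 (x, y, z) :=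
  (m.symm_x m.G.one (fun _ _ _ => rfl) (fun _ _ => rfl) (x, y, z)).1
lemma f1_y (x y z : ℝ) : m.f1 (x, y + 1, z) = m.f1 (x, y, z) :=
  (m.symm_y m.G.one (fun _ _ _ => rfl) (fun _ _ => rfl) (x, y, z)).1
lemma f1_z (x y z : ℝ) : m.f1 (x, y, -z) = m.f1 (x, y, z) :=
  (m.symm_z m.G.one (fun _ _ _ => rfl) (fun _ _ => rfl) (x, y, z)).1
lemma f2_x (x y z : ℝ) : m.f2 (x + 1, y, z) = m.f2 (x, y, z) :=
  (m.symm_x m.S (fun _ _ _ => m.L.v_x_add_one _ _ _) (fun _ _ => m.L.v_add_one _ _ _) (x, y, z)).1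
lemma f2_y (x y z : ℝ) : m.f2 (x, y + 1, z) = m.f2 (x, y, z) :=
  (m.symm_y m.S (fun _ _ _ => rfl) (fun _ _ => m.L.v_add_one _ _ _) (x, y, z)).1
lemma f2_z (x y z : ℝ) : m.f2 (x, y, -z) = m.f2 (x, y, z) :=
  (m.symm_z m.S (fun _ _ _ => rfl) (fun _ _ => m.L.v_add_one _ _ _) (x, y, z)).1
lemma M_x (x y z : ℝ) : m.G.M (x + 1, y, z) = m.G.M (x, y, z) :=
  (m.symm_x m.G.one (fun _ _ _ => rfl) (fun _ _ => rfl) (x, y, z)).2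
lemma M_y (x y z : ℝ) : m.G.M (x, y + 1, z) = m.G.M (x, y, z) :=
  (m.symm_y m.G.one (fun _ _ _ => rfl) (fun _ _ => rfl) (x, y, z)).2

lemma abs_z_le_R (p : Q) : |p.2.2| ≤ m.G.R p := m.L.abs_z_le_r _ p

lemma k_eq_zero {p : Q} (h : m.ρ ≤ m.G.R p) (θ : ℝ) : m.G.k p θ = 0 := by
  unfold Geo.k
  refine kf_eq_zero (pow_pos m.ρ_pos 2) ?_
  have := h.trans (m.G.R_le p (true, θ))
  exact pow_le_pow_left₀ m.ρ_pos.le this 2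

lemma M_eq_zero {p : Q} (h : m.ρ ≤ m.G.R p) : m.G.M p = 0 := by
  unfold Geo.M; simp [m.k_eq_zero h]

lemma f_eq_zero (s : Sec m.G) {p : Q} (h : m.ρ ≤ m.G.R p) : s.f p = 0 := by
  rw [s.f_off (m.ρ_pos.trans_le h), Sec.N]
  simp [m.k_eq_zero h]

lemma f1_eq_zero {x y z : ℝ} (h : m.ρ ≤ |z|) : m.f1 (x, y, z) = 0 :=
  m.f_eq_zero _ (h.trans (m.abs_z_le_R (x, y, z)))
lemma f2_eq_zero {x y z : ℝ} (h : m.ρ ≤ |z|) : m.f2 (x, y, z) = 0 :=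
  m.f_eq_zero _ (h.trans (m.abs_z_le_R (x, y, z)))

/-- The model field. -/
noncomputable def W (p : Q) : Q :=
  (m.f1 (p.1, p.2.1, p.2.2 + m.b0) - m.f1 (p.1, p.2.1, p.2.2 - m.b0),
    m.f2 (p.1, p.2.1, p.2.2 + m.b0) - m.f2 (p.1, p.2.1, p.2.2 - m.b0),
    1 - m.f1 (p.1, p.2.1, p.2.2 + m.b0) - m.f1 (p.1, p.2.1, p.2.2 - m.b0))

lemma contDiff_W : ContDiff ℝ 1 m.W := by
  have h1 : ContDiff ℝ 1 m.f1 := m.G.one.contDiff_f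
  have h2 : ContDiff ℝ 1 m.f2 := m.S.contDiff_f
  unfold W
  fun_prop

lemma W_x (x y z : ℝ) : m.W (x + 1, y, z) = m.W (x, y, z) := by unfold W; simp [f1_x, f2_x]
lemma W_y (x y z : ℝ) : m.W (x, y + 1, z) = m.W (x, y, z) := by unfold W; simp [f1_y, f2_y]

/-- The reflection reverses the field. -/
lemma W_refl (x y z : ℝ) :
    m.W (x, y, -z) = (-(m.W (x, y, z)).1, -(m.W (x, y, z)).2.1, (m.W (x, y, z)).2.2) := by
  have e1 : -z + m.b0 = -(z - m.b0) := by ring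
  have e2 : -z - m.b0 = -(z + m.b0) := by ring
  unfold W
  simp only [e1, e2, f1_z, f2_z]
  refine Prod.ext (by simp) (Prod.ext (by simp) ?_)
  simp only; ring

lemma W_of_nonneg {x y z : ℝ} (hz : 0 ≤ z) :
    m.W (x, y, z) = (- m.f1 (x, y, z - m.b0), - m.f2 (x, y, z - m.b0), 1 - m.f1 (x, y, z - m.b0)) := by
  have h : m.ρ ≤ |z + m.b0| := by
    have := m.ρ_le; have := m.b_pos
    rw [abs_of_nonneg (by have := m.b0_pos; linarith)]
    unfold b0; linarith
  unfold W
  simp [m.f1_eq_zero h, m.f2_eq_zero h]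

lemma W_of_nonpos {x y z : ℝ} (hz : z ≤ 0) :
    m.W (x, y, z) = (m.f1 (x, y, z + m.b0), m.f2 (x, y, z + m.b0), 1 - m.f1 (x, y, z + m.b0)) := by
  have h : m.ρ ≤ |z - m.b0| := by
    have := m.ρ_le; have := m.b_pos
    rw [abs_of_nonpos (by have := m.b0_pos; linarith)]
    unfold b0; linarith
  unfold W
  simp [m.f1_eq_zero h, m.f2_eq_zero h]

/-- The support of the perturbation is contained in this set. -/
def C : Set Q := {p | 4 * sn p.1 ^ 2 * sn p.2.1 ^ 2 ≤ 1 / 2 ∧ |p.2.2| ≤ m.b}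

lemma mem_C {p : Q} : p ∈ m.C ↔ 4 * sn p.1 ^ 2 * sn p.2.1 ^ 2 ≤ 1 / 2 ∧ |p.2.2| ≤ m.b := Iff.rfl

lemma ρ_le_R {x y z : ℝ} (h : ¬ 4 * sn x ^ 2 * sn y ^ 2 ≤ 1 / 2) : m.ρ ≤ m.G.R (x, y, z) := by
  by_contra! h1
  have h2 := m.L.sn_le_r (m.G.near (x, y, z)) (x, y, z)
  have h3 : m.L.r (m.G.near (x, y, z)) (x, y, z) < m.ρ := h1
  have := m.ρ_le'
  exact h (m.L.location (m.G.near (x, y, z)) x y (by dsimp only at h2; linarith))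

lemma W_off {p : Q} (h : p ∉ m.C) : m.W p = (0, 0, 1) := by
  obtain ⟨x, y, z⟩ := p
  have hρ := m.ρ_le; have hb := m.b_pos
  by_cases h1 : 4 * sn x ^ 2 * sn y ^ 2 ≤ 1 / 2
  · have h2 : m.b < |z| := by
      by_contra! h2; exact h ⟨h1, h2⟩
    have h3 := abs_sub_abs_le_abs_sub z m.b0
    have h4 := abs_sub_abs_le_abs_sub z (-m.b0)
    rw [abs_neg, sub_neg_eq_add] at h4
    rw [abs_of_pos m.b0_pos] at h3 h4
    unfold b0 at h3 h4
    have h5 : m.ρ ≤ |z + m.b0| := by unfold b0; linarith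
    have h6 : m.ρ ≤ |z - m.b0| := by unfold b0; linarith
    unfold W
    simp [m.f1_eq_zero h5, m.f2_eq_zero h5, m.f1_eq_zero h6, m.f2_eq_zero h6]
  · have h2 : ∀ (s : Sec m.G) (z : ℝ), s.f (x, y, z) = 0 := fun s z => m.f_eq_zero s (m.ρ_le_R h1)
    unfold W f1 f2
    simp [h2]

lemma f1_nonneg (p : Q) : 0 ≤ m.f1 p ∧ m.f1 p ≤ 1 := by
  rcases (m.G.R_nonneg p).eq_or_lt with h | h
  · have e : m.G.r (m.G.near p) p = 0 := h.symm
    have : m.f1 p = 1 := m.G.one.f_eq e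
    rw [this]; norm_num
  · have := m.G.one.abs_f_le_one_off rfl h
    exact ⟨this.1, this.2.le⟩

/-- The invariant leaves. -/
def Λ : Set Q := {p | ∃ i, sn (p.2.1 - m.L.Y i p.1) = 0 ∧ (p.2.2 = -m.b0 ∨ p.2.2 = m.b0)}

lemma f1_eq_one {x y z : ℝ} (h : m.f1 (x, y, z) = 1) : ∃ i, sn (y - m.L.Y i x) = 0 ∧ z = 0 := by
  rcases (m.G.R_nonneg (x, y, z)).eq_or_lt with h1 | h1
  · exact ⟨_, (m.L.r_eq_zero (p := (x, y, z))).1 h1.symm⟩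
  · exact absurd h (m.G.one.abs_f_le_one_off rfl h1).2.ne

lemma Wz_nonneg (p : Q) : 0 ≤ (m.W p).2.2 := by
  obtain ⟨x, y, z⟩ := p
  rcases le_total 0 z with h | h
  · rw [m.W_of_nonneg h]; have := (m.f1_nonneg (x, y, z - m.b0)).2; simpa using this
  · rw [m.W_of_nonpos h]; have := (m.f1_nonneg (x, y, z + m.b0)).2; simpa using this

lemma Wz_eq_zero {p : Q} (h : (m.W p).2.2 = 0) : p ∈ m.Λ := by
  obtain ⟨x, y, z⟩ := p
  rcases le_total 0 z with hz | hz
  · rw [m.W_of_nonneg hz] at h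
    obtain ⟨i, h1, h2⟩ := m.f1_eq_one (sub_eq_zero.1 h).symm
    exact ⟨i, h1, Or.inr (by simp only; linarith)⟩
  · rw [m.W_of_nonpos hz] at h
    obtain ⟨i, h1, h2⟩ := m.f1_eq_one (sub_eq_zero.1 h).symm
    exact ⟨i, h1, Or.inl (by simp only; linarith)⟩

lemma Wz_pos {p : Q} (h : p ∉ m.Λ) : 0 < (m.W p).2.2 :=
  lt_of_le_of_ne (m.Wz_nonneg p) fun h1 => h (m.Wz_eq_zero h1.symm)

lemma f_leaf (s : Sec m.G) (i : Bool × ℝ) (x : ℝ) (k : ℤ) :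
    s.f (x, m.L.Y i x + k, 0) = s.u i (x, m.L.Y i x + k, 0) := by
  refine s.f_eq ((m.L.r_eq_zero).2 ⟨?_, rfl⟩)
  simp only [add_sub_cancel_left]
  exact sn_eq_zero_iff.2 ⟨k, rfl⟩

lemma W_leaf_neg (i : Bool × ℝ) (x : ℝ) (k : ℤ) :
    m.W (x, m.L.Y i x + k, -m.b0) = (1, m.L.v i x, 0) := by
  rw [m.W_of_nonpos (by linarith [m.b0_pos]), neg_add_cancel, f1, f2, m.f_leaf, m.f_leaf]
  simp [S, Lam.slope, Geo.one]

lemma W_leaf_pos (i : Bool × ℝ) (x : ℝ) (k : ℤ) :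
    m.W (x, m.L.Y i x + k, m.b0) = (-1, -m.L.v i x, 0) := by
  rw [m.W_of_nonneg m.b0_pos.le, sub_self, f1, f2, m.f_leaf, m.f_leaf]
  simp [S, Lam.slope, Geo.one]

/-- The orbits on the invariant leaves. -/
lemma leaf_orbit {p : Q} (hp : p ∈ m.Λ) : ∃ (i : Bool × ℝ) (k : ℤ) (σ : ℝ), (σ = 1 ∨ σ = -1) ∧
    p = (p.1, m.L.Y i p.1 + k, -σ * m.b0) ∧
    ∀ t : ℝ, HasDerivAt (fun t => ((p.1 + σ * t, m.L.Y i (p.1 + σ * t) + k, -σ * m.b0) : Q))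
      (m.W (p.1 + σ * t, m.L.Y i (p.1 + σ * t) + k, -σ * m.b0)) t := by
  obtain ⟨x, y, z⟩ := p
  obtain ⟨i, h1, h2⟩ := hp
  obtain ⟨k, hk⟩ := sn_eq_zero_iff.1 h1
  have hd : ∀ σ t : ℝ, HasDerivAt (fun t => ((x + σ * t, m.L.Y i (x + σ * t) + k, -σ * m.b0) : Q))
      (σ, m.L.v i (x + σ * t) * σ, 0) t := by
    intro σ t
    have h3 : HasDerivAt (fun t : ℝ => x + σ * t) σ t := by
      simpa using ((hasDerivAt_id t).const_mul σ).const_add x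
    have h4 := ((m.L.hasDerivAt_Y i (x + σ * t)).comp t h3).add_const (k : ℝ)
    exact h3.prodMk (h4.prodMk (hasDerivAt_const t _))
  simp only at hk h2
  rcases h2 with rfl | rfl
  · refine ⟨i, k, 1, Or.inl rfl, by simp only [neg_mul, one_mul, ← hk]; ext <;> simp, fun t => ?_⟩
    have := hd 1 t
    simp only [neg_mul, one_mul, mul_one] at *
    rwa [m.W_leaf_neg]
  · refine ⟨i, k, -1, Or.inr rfl, by simp only [neg_mul, one_mul, ← hk]; ext <;> simp, fun t => ?_⟩
    have := hd (-1) t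
    simp only [neg_mul, one_mul, mul_one, neg_neg, mul_neg] at *
    rwa [m.W_leaf_pos]

lemma exists_bound {X : Type*} [NormedAddCommGroup X] {F : Q → X} (hF : Continuous F)
    (hx : ∀ x y z, F (x + 1, y, z) = F (x, y, z)) (hy : ∀ x y z, F (x, y + 1, z) = F (x, y, z))
    {c : X} (hz : ∀ x y z, m.b < |z| → F (x, y, z) = c) : ∃ B, ∀ p, ‖F p‖ ≤ B := by
  have hx' : ∀ y z, Function.Periodic (fun x => F (x, y, z)) 1 := fun y z x => hx x y z
  have hy' : ∀ x z, Function.Periodic (fun y => F (x, y, z)) 1 := fun x z y => hy x y z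
  obtain ⟨B, hB⟩ := (isCompact_Icc (a := ((0 : ℝ), (0 : ℝ), -m.b)) (b := (1, 1, m.b))).exists_bound_of_continuousOn
    hF.continuousOn
  refine ⟨max B ‖c‖, fun p => ?_⟩
  have e : F p = F (Int.fract p.1, Int.fract p.2.1, p.2.2) := by
    have h1 := (hx' p.2.1 p.2.2).sub_int_mul_eq ⌊p.1⌋ (x := p.1)
    have h2 := (hy' (Int.fract p.1) p.2.2).sub_int_mul_eq ⌊p.2.1⌋ (x := p.2.1)
    simp only [mul_one] at h1 h2
    unfold Int.fract at *
    rw [h2, h1]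
  by_cases h : m.b < |p.2.2|
  · rw [e, hz _ _ _ h]; exact le_max_right _ _
  · have h3 := abs_le.1 (not_lt.1 h)
    rw [e]
    refine (hB _ ?_).trans (le_max_left _ _)
    exact ⟨⟨Int.fract_nonneg _, Int.fract_nonneg _, h3.1⟩,
      ⟨(Int.fract_lt_one _).le, (Int.fract_lt_one _).le, h3.2⟩⟩

lemma exists_bound_W : ∃ B, ∀ p, ‖m.W p‖ ≤ B :=
  m.exists_bound m.contDiff_W.continuous m.W_x m.W_y (c := (0, 0, 1))
    fun _ _ _ h => m.W_off fun h1 => h.not_ge h1.2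

lemma fderiv_add (v : Q) (h : ∀ p, m.W (p + v) = m.W p) (p : Q) :
    fderiv ℝ m.W (p + v) = fderiv ℝ m.W p := by
  have := fderiv_comp_add_right (𝕜 := ℝ) (f := m.W) (x := p) v
  rw [← this]; simp_rw [h]

lemma exists_lipschitz_W : ∃ K, LipschitzWith K m.W := by
  obtain ⟨B, hB⟩ := m.exists_bound (F := fderiv ℝ m.W) (c := 0) (m.contDiff_W.continuous_fderiv one_ne_zero)
    (fun x y z => by
      have := m.fderiv_add (1, 0, 0) (fun p => by obtain ⟨x, y, z⟩ := p; simp [m.W_x]) (x, y, z)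
      simpa using this)
    (fun x y z => by
      have := m.fderiv_add (0, 1, 0) (fun p => by obtain ⟨x, y, z⟩ := p; simp [m.W_y]) (x, y, z)
      simpa using this)
    (fun x y z h => by
      have : m.W =ᶠ[𝓝 (x, y, z)] fun _ => (0, 0, 1) := by
        have ho : IsOpen {p : Q | m.b < |p.2.2|} := isOpen_lt continuous_const (by fun_prop)
        filter_upwards [ho.mem_nhds h] with p hp
        exact m.W_off fun h1 => not_lt_of_ge h1.2 hp
      rw [this.fderiv_eq]; simp)
  exact ⟨B.toNNReal, lipschitzWith_of_nnnorm_fderiv_le (m.contDiff_W.differentiable one_ne_zero) fun p => by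
    rw [← NNReal.coe_le_coe, coe_nnnorm]
    exact (hB p).trans (Real.le_coe_toNNReal B)⟩

/-- The flow of the model field. -/
noncomputable def Φ : Flow m.W :=
  (nonempty_flow m.exists_lipschitz_W.choose_spec m.exists_bound_W.choose_spec).some

end Mod

namespace Mod
variable (m : Mod)

/-- An integer translation. -/
def tr (j n : ℤ) : Q := (j, n, 0)

lemma add_tr_of_periodic {X : Type*} {F : Q → X} (hx : ∀ x y z, F (x + 1, y, z) = F (x, y, z))
    (hy : ∀ x y z, F (x, y + 1, z) = F (x, y, z)) (p : Q) (j n : ℤ) : F (p + tr j n) = F p := by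
  obtain ⟨x, y, z⟩ := p
  have hx' : ∀ y z, Function.Periodic (fun x => F (x, y, z)) 1 := fun y z x => hx x y z
  have hy' : ∀ x z, Function.Periodic (fun y => F (x, y, z)) 1 := fun x z y => hy x y z
  have h1 := (hx' (y + n) z).int_mul j x
  have h2 := (hy' x z).int_mul n y
  simp only [mul_one] at h1 h2
  simp only [tr, Prod.mk_add_mk, add_zero]
  rw [h1, h2]

lemma W_tr (p : Q) (j n : ℤ) : m.W (p + tr j n) = m.W p := add_tr_of_periodic m.W_x m.W_y p j n

lemma φ_tr (t : ℝ) (p : Q) (j n : ℤ) : m.Φ.φ t (p + tr j n) = m.Φ.φ t p + tr j n := by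
  have := m.Φ.eq (γ := fun t => m.Φ.φ t p + tr j n) (fun t => by
    rw [m.W_tr]; exact (m.Φ.hasDerivAt p t).add_const _) t
  rw [this, m.Φ.zero]

/-- The reflection. -/
def refl (p : Q) : Q := (p.1, p.2.1, -p.2.2)

lemma φ_refl (t : ℝ) (p : Q) : m.Φ.φ t (refl p) = refl (m.Φ.φ (-t) p) := by
  have := m.Φ.eq (γ := fun t => refl (m.Φ.φ (-t) p)) (fun t => by
    have h := m.Φ.rev.hasDerivAt p t
    change HasDerivAt (fun s => m.Φ.φ (-s) p) (- m.W (m.Φ.φ (-t) p)) t at h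
    have h1 : HasDerivAt (fun s => (m.Φ.φ (-s) p).1) (- m.W (m.Φ.φ (-t) p)).1 t := h.fst
    have h2 : HasDerivAt (fun s => (m.Φ.φ (-s) p).2.1) (- m.W (m.Φ.φ (-t) p)).2.1 t := h.snd.fst
    have h3 : HasDerivAt (fun s => (m.Φ.φ (-s) p).2.2) (- m.W (m.Φ.φ (-t) p)).2.2 t := h.snd.snd
    have e : m.W (refl (m.Φ.φ (-t) p)) = ((-m.W (m.Φ.φ (-t) p)).1, (-m.W (m.Φ.φ (-t) p)).2.1,
        -(-m.W (m.Φ.φ (-t) p)).2.2) := by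
      generalize m.Φ.φ (-t) p = q
      obtain ⟨x, y, z⟩ := q
      change m.W (x, y, -z) = _
      rw [m.W_refl]
      simp
    rw [e]
    exact h1.prodMk (h2.prodMk h3.fun_neg)) t
  rw [this, neg_zero, m.Φ.zero]

lemma hasDerivAt_z (p : Q) (t : ℝ) :
    HasDerivAt (fun t => (m.Φ.φ t p).2.2) (m.W (m.Φ.φ t p)).2.2 t :=
  (m.Φ.hasDerivAt p t).snd.snd

lemma monotone_z (p : Q) : Monotone fun t => (m.Φ.φ t p).2.2 :=
  monotone_of_deriv_nonneg (fun t => (m.hasDerivAt_z p t).differentiableAt) fun t => by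
    rw [(m.hasDerivAt_z p t).deriv]; exact m.Wz_nonneg _

lemma continuous_z (p : Q) : Continuous fun t => (m.Φ.φ t p).2.2 :=
  (m.Φ.continuous_time p).snd.snd

lemma leaf_flow {p : Q} (hp : p ∈ m.Λ) : ∃ (i : Bool × ℝ) (k : ℤ) (σ : ℝ), (σ = 1 ∨ σ = -1) ∧
    p = (p.1, m.L.Y i p.1 + k, -σ * m.b0) ∧
    ∀ t, m.Φ.φ t p = (p.1 + σ * t, m.L.Y i (p.1 + σ * t) + k, -σ * m.b0) := by
  obtain ⟨i, k, σ, h1, h2, h3⟩ := m.leaf_orbit hp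
  refine ⟨i, k, σ, h1, h2, fun t => ?_⟩
  rw [m.Φ.eq h3 t]
  simp only [mul_zero, add_zero]
  rw [← h2]

lemma leaf_z {p : Q} (hp : p ∈ m.Λ) (t : ℝ) : (m.Φ.φ t p).2.2 = p.2.2 := by
  obtain ⟨i, k, σ, -, h2, h3⟩ := m.leaf_flow hp
  rw [h3, h2]

lemma leaf_abs_z {p : Q} (hp : p ∈ m.Λ) : |p.2.2| < m.b := by
  obtain ⟨i, -, h | h⟩ := hp <;> rw [h] <;> have := m.b0_pos <;> have := m.b0_lt
  · rw [abs_neg, abs_of_pos ‹_›]; assumption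
  · rw [abs_of_pos ‹_›]; assumption

/-- No orbit closes up modulo integer translations. -/
theorem not_closed {p : Q} {T : ℝ} (hT : 0 < T) (j n : ℤ) : m.Φ.φ T p ≠ p + tr j n := by
  intro h
  have hz : (m.Φ.φ T p).2.2 = p.2.2 := by rw [h]; simp [tr]
  have hc : ∀ t ∈ Icc 0 T, (m.Φ.φ t p).2.2 = p.2.2 := fun t ht => by
    have h1 := m.monotone_z p ht.1
    have h2 := m.monotone_z p ht.2
    simp only [m.Φ.zero] at h1 h2
    linarith
  have hd : (m.W p).2.2 = 0 := by
    have h1 := (m.hasDerivAt_z p 0).hasDerivWithinAt (s := Icc 0 T)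
    rw [m.Φ.zero] at h1
    have h2 : HasDerivWithinAt (fun t => (m.Φ.φ t p).2.2) 0 (Icc 0 T) 0 :=
      (hasDerivWithinAt_const 0 _ p.2.2).congr hc (hc 0 ⟨le_rfl, hT.le⟩)
    exact ((uniqueDiffOn_Icc hT) 0 ⟨le_rfl, hT.le⟩).eq_deriv _ h1 h2
  obtain ⟨i, k, σ, h1, h2, h3⟩ := m.leaf_flow (m.Wz_eq_zero hd)
  rw [h3] at h
  have e1 := congrArg Prod.fst h
  have e2 := congrArg (fun p : Q => p.2.1) h
  have e3 := congrArg (fun p : Q => p.2.1) h2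
  simp only [tr, Prod.fst_add, Prod.snd_add] at e1 e2 e3
  have e4 : σ * T = j := by linarith
  rw [e4] at e2
  have := m.L.not_closed i p.1 j n (by linarith)
  rw [this] at e4
  rcases h1 with rfl | rfl <;> simp at e4 <;> linarith

lemma W_far {p : Q} (h : m.b ≤ |p.2.2|) : m.W p = (0, 0, 1) := by
  obtain ⟨x, y, z⟩ := p
  simp only at h
  have hρ := m.ρ_le; have hb := m.b_pos
  have h3 := abs_sub_abs_le_abs_sub z m.b0
  have h4 := abs_sub_abs_le_abs_sub z (-m.b0)
  rw [abs_neg, sub_neg_eq_add] at h4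
  rw [abs_of_pos m.b0_pos] at h3 h4
  unfold b0 at h3 h4
  have h5 : m.ρ ≤ |z + m.b0| := by unfold b0; linarith
  have h6 : m.ρ ≤ |z - m.b0| := by unfold b0; linarith
  unfold W
  simp [m.f1_eq_zero h5, m.f2_eq_zero h5, m.f1_eq_zero h6, m.f2_eq_zero h6]

/-- The base of the plug. -/
def F : Set (ℝ × ℝ) := {p | 4 * sn p.1 ^ 2 * sn p.2 ^ 2 ≤ 1 / 2}

/-- The projection to the base. -/
def xy (p : Q) : ℝ × ℝ := (p.1, p.2.1)

lemma mem_C_iff {p : Q} : p ∈ m.C ↔ xy p ∈ F ∧ |p.2.2| ≤ m.b := Iff.rfl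

lemma φ_off {p : Q} (h : xy p ∉ F) (t : ℝ) : m.Φ.φ t p = p + (0, 0, t) := by
  have := m.Φ.eq (γ := fun t => p + (0, 0, t)) (fun t => by
    rw [m.W_off (fun h1 => h (by simpa [xy, F, C] using h1.1))]
    exact ((hasDerivAt_const t (0 : ℝ)).prodMk
      ((hasDerivAt_const t (0 : ℝ)).prodMk (hasDerivAt_id t))).const_add p) t
  rw [this, show ((0 : ℝ), (0 : ℝ), (0 : ℝ)) = 0 from rfl, add_zero]

lemma xy_mem_F_iff (p : Q) (t : ℝ) : xy (m.Φ.φ t p) ∈ F ↔ xy p ∈ F := by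
  have key : ∀ p t, xy (m.Φ.φ t p) ∈ F → xy p ∈ F := fun p t h => by
    by_contra h1
    rw [m.φ_off h1] at h
    exact h1 (by simpa [xy] using h)
  exact ⟨key p t, fun h => key (m.Φ.φ t p) (-t) (by rwa [m.Φ.neg_apply])⟩

lemma const_of_deriv {f : ℝ → Q} (hf : ∀ t, 0 ≤ t → HasDerivAt f 0 t) {t : ℝ} (ht : 0 ≤ t) :
    f t = f 0 :=
  constant_of_has_deriv_right_zero (a := 0) (b := t)
    (fun s hs => (hf s hs.1).continuousAt.continuousWithinAt)
    (fun s hs => (hf s hs.1).hasDerivWithinAt) t ⟨ht, le_rfl⟩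

lemma hasDerivAt_vert (t : ℝ) : HasDerivAt (fun t : ℝ => ((0, 0, t) : Q)) (0, 0, 1) t :=
  (hasDerivAt_const t (0 : ℝ)).prodMk ((hasDerivAt_const t (0 : ℝ)).prodMk (hasDerivAt_id t))

lemma φ_below {p : Q} (h : p.2.2 ≤ -m.b) {t : ℝ} (ht : 0 ≤ t) :
    m.Φ.φ (-t) p = p - (0, 0, t) := by
  have := const_of_deriv (f := fun t => m.Φ.φ (-t) p + (0, 0, t)) (fun t ht => by
    have h1 := m.Φ.rev.hasDerivAt p t
    change HasDerivAt (fun s => m.Φ.φ (-s) p) (- m.W (m.Φ.φ (-t) p)) t at h1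
    have h2 : (m.Φ.φ (-t) p).2.2 ≤ -m.b := by
      have := m.monotone_z p (show -t ≤ 0 by linarith)
      simp only [m.Φ.zero] at this
      linarith
    rw [m.W_far (by rw [le_abs]; right; linarith)] at h1
    have h3 := h1.fun_add (hasDerivAt_vert t)
    rwa [neg_add_cancel] at h3) ht
  simp only [neg_zero, m.Φ.zero] at this
  rw [show ((0 : ℝ), (0 : ℝ), (0 : ℝ)) = 0 from rfl, add_zero] at this
  exact eq_sub_of_add_eq this

/-- The points whose backward orbits leave the plug. -/
def Esc (q : Q) : Prop := ∃ s : ℝ, (m.Φ.φ (-s) q).2.2 ≤ -m.b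

open Classical in
/-- The point of the base at which the orbit enters the plug. -/
noncomputable def P (q : Q) : ℝ × ℝ := if h : m.Esc q then xy (m.Φ.φ (-h.choose) q) else 0

lemma P_eq {q : Q} {s : ℝ} (h : (m.Φ.φ (-s) q).2.2 ≤ -m.b) : m.P q = xy (m.Φ.φ (-s) q) := by
  have hE : m.Esc q := ⟨s, h⟩
  have key : ∀ s s', s ≤ s' → (m.Φ.φ (-s) q).2.2 ≤ -m.b → xy (m.Φ.φ (-s') q) = xy (m.Φ.φ (-s) q) := by
    intro s s' hs h
    have := m.φ_below h (t := s' - s) (by linarith)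
    rw [← m.Φ.add] at this
    rw [show -s' = -(s' - s) + -s by ring, this]
    simp [xy]
  unfold P
  rw [dif_pos hE]
  rcases le_total hE.choose s with h1 | h1
  · exact (key _ _ h1 hE.choose_spec).symm
  · exact key _ _ h1 h

lemma esc_φ {q : Q} (h : m.Esc q) (t : ℝ) : m.Esc (m.Φ.φ t q) := by
  obtain ⟨s, hs⟩ := h
  refine ⟨s + t, ?_⟩
  rwa [← m.Φ.add, show -(s + t) + t = -s by ring]

lemma P_φ {q : Q} (h : m.Esc q) (t : ℝ) : m.P (m.Φ.φ t q) = m.P q := by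
  obtain ⟨s, hs⟩ := h
  have e : m.Φ.φ (-(s + t)) (m.Φ.φ t q) = m.Φ.φ (-s) q := by
    rw [← m.Φ.add, show -(s + t) + t = -s by ring]
  rw [m.P_eq hs, m.P_eq (by rwa [e]), e]

lemma esc_tr {q : Q} (h : m.Esc q) (j n : ℤ) : m.Esc (q + tr j n) := by
  obtain ⟨s, hs⟩ := h
  exact ⟨s, by rw [m.φ_tr]; simpa [tr] using hs⟩

lemma P_tr {q : Q} (h : m.Esc q) (j n : ℤ) : m.P (q + tr j n) = m.P q + ((j : ℝ), (n : ℝ)) := by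
  obtain ⟨s, hs⟩ := h
  rw [m.P_eq hs, m.P_eq (s := s) (by rw [m.φ_tr]; simpa [tr] using hs), m.φ_tr]
  simp [xy, tr]

lemma P_mem_F {q : Q} (h : m.Esc q) : m.P q ∈ F ↔ xy q ∈ F := by
  obtain ⟨s, hs⟩ := h
  rw [m.P_eq hs, m.xy_mem_F_iff]

lemma P_of_le {q : Q} (h : q.2.2 ≤ -m.b) : m.P q = xy q := by
  have := m.P_eq (q := q) (s := 0) (by rwa [neg_zero, m.Φ.zero])
  rwa [neg_zero, m.Φ.zero] at this

lemma P_of_ge {q : Q} (h : m.b ≤ q.2.2) (hE : m.Esc q) : m.P q = xy q := by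
  obtain ⟨s, hs⟩ := hE
  have hb := m.b_pos
  have hs' := hs
  have hs0 : 0 ≤ s := by
    by_contra! hs0
    have := m.monotone_z q (show 0 ≤ -s by linarith)
    simp only [m.Φ.zero] at this
    linarith
  obtain ⟨t, -, ht⟩ := intermediate_value_Icc (a := -s) (b := 0) (by linarith)
    (m.continuous_z q).continuousOn (show (0 : ℝ) ∈ Icc _ _ by
      constructor
      · linarith
      · simp only [m.Φ.zero]; linarith)
  simp only at ht
  have e : refl (m.Φ.φ t q) = m.Φ.φ t q := by
    unfold refl; rw [ht, neg_zero, ← ht]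
  have h1 := m.φ_refl t (m.Φ.φ t q)
  rw [e, m.Φ.neg_apply, ← m.Φ.add] at h1
  have h2 := m.P_eq (q := q) (s := -(t + t)) (by rw [neg_neg, h1]; simpa [refl] using h)
  rw [h2, neg_neg, h1]
  rfl

lemma P_off {q : Q} (h : xy q ∉ F) : m.P q = xy q := by
  have e := m.φ_off h (-(q.2.2 + m.b))
  rw [m.P_eq (s := q.2.2 + m.b) (by rw [e]; simp), e]
  simp [xy]

lemma P_of_notMem_C {q : Q} (h : q ∉ m.C) (hE : m.Esc q) : m.P q = xy q := by
  by_cases h1 : xy q ∈ F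
  · have h2 : m.b < |q.2.2| := by
      by_contra! h2; exact h ⟨h1, h2⟩
    rcases lt_abs.1 h2 with h3 | h3
    · exact m.P_of_ge h3.le hE
    · exact m.P_of_le (by linarith)
  · exact m.P_off h1

lemma Wz_pos_of_esc {q : Q} (h : m.Esc q) : 0 < (m.W q).2.2 := by
  refine m.Wz_pos fun h1 => ?_
  obtain ⟨s, hs⟩ := h
  rw [m.leaf_z h1] at hs
  have := (abs_lt.1 (m.leaf_abs_z h1)).1
  linarith

lemma bwd_mem_C {q : Q} (hq : q ∈ m.C) (h : ¬ m.Esc q) {s : ℝ} (hs : 0 ≤ s) :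
    m.Φ.φ (-s) q ∈ m.C := by
  refine ⟨(m.xy_mem_F_iff q _).2 hq.1, ?_⟩
  have h1 : -m.b < (m.Φ.φ (-s) q).2.2 := by
    by_contra! h1; exact h ⟨s, h1⟩
  have h2 := m.monotone_z q (show -s ≤ 0 by linarith)
  simp only [m.Φ.zero] at h2
  have := (abs_le.1 hq.2).2
  exact abs_le.2 ⟨h1.le, by linarith⟩

lemma exists_uniform (h : ∀ x y, ∃ t, 0 < (m.Φ.φ t (x, y, -m.b)).2.2) :
    ∃ S : ℝ, 0 ≤ S ∧ ∀ x y, 0 < (m.Φ.φ S (x, y, -m.b)).2.2 := by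
  have hc : ∀ n : ℕ, Continuous fun p : ℝ × ℝ => (m.Φ.φ n (p.1, p.2, -m.b)).2.2 := fun n => by
    have := m.Φ.continuous n
    fun_prop
  obtain ⟨n, hn⟩ := (isCompact_Icc (a := ((0 : ℝ), (0 : ℝ))) (b := (1, 1))).elim_directed_cover
    (fun n : ℕ => {p : ℝ × ℝ | 0 < (m.Φ.φ n (p.1, p.2, -m.b)).2.2})
    (fun n => isOpen_lt continuous_const (hc n)) (fun p _ => by
      obtain ⟨t, ht⟩ := h p.1 p.2
      obtain ⟨n, hn⟩ := exists_nat_ge t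
      exact mem_iUnion.2 ⟨n, ht.trans_le (m.monotone_z _ hn)⟩)
    (Monotone.directed_le fun a b hab p hp =>
      lt_of_lt_of_le (show 0 < (m.Φ.φ a (p.1, p.2, -m.b)).2.2 from hp)
        (m.monotone_z _ (Nat.cast_le.2 hab)))
  refine ⟨n, Nat.cast_nonneg n, fun x y => ?_⟩
  have h1 : (Int.fract x, Int.fract y) ∈ Icc ((0 : ℝ), (0 : ℝ)) (1, 1) :=
    ⟨⟨Int.fract_nonneg _, Int.fract_nonneg _⟩, ⟨(Int.fract_lt_one _).le, (Int.fract_lt_one _).le⟩⟩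
  have h2 : 0 < (m.Φ.φ n (Int.fract x, Int.fract y, -m.b)).2.2 := hn h1
  have e : ((x, y, -m.b) : Q) = (Int.fract x, Int.fract y, -m.b) + tr ⌊x⌋ ⌊y⌋ := by
    simp [tr]
  rw [e, m.φ_tr]
  simpa [tr] using h2

/-- Some orbit entering the plug never leaves it. -/
theorem exists_trapped : ∃ p : ℝ × ℝ, p ∈ F ∧ ∀ t, 0 ≤ t → m.Φ.φ t (p.1, p.2, -m.b) ∈ m.C := by
  have hb := m.b_pos
  suffices h : ∃ x y, ∀ t, (m.Φ.φ t (x, y, -m.b)).2.2 ≤ 0 by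
    obtain ⟨x, y, h⟩ := h
    have hF : (x, y) ∈ F := by
      by_contra h1
      have := h (m.b + 1)
      rw [m.φ_off (p := (x, y, -m.b)) h1] at this
      simp at this
      linarith
    refine ⟨(x, y), hF, fun t ht => ⟨(m.xy_mem_F_iff (x, y, -m.b) t).2 hF, ?_⟩⟩
    have h2 := m.monotone_z (x, y, -m.b) ht
    simp only [m.Φ.zero] at h2
    have := h t
    exact abs_le.2 ⟨h2, by linarith⟩
  by_contra! hne
  obtain ⟨S, hS, hpos⟩ := m.exists_uniform hne
  have hup : ∀ p : Q, p.2.2 = -m.b → ∀ t, S ≤ t → 0 < (m.Φ.φ t p).2.2 := by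
    rintro ⟨x, y, z⟩ rfl t ht
    exact (hpos x y).trans_le (m.monotone_z _ ht)
  have hconv : IsPreconnected {p : Q | p.2.2 ≤ 0} := by
    refine Convex.isPreconnected ?_
    exact convex_halfSpace_le (IsLinearMap.mk (by simp) (by simp)) 0
  have hc : ∀ t, Continuous fun p : Q => (m.Φ.φ t p).2.2 := fun t => (m.Φ.continuous t).snd.snd
  obtain ⟨p, hp, hp1, hp2⟩ := hconv {p | -m.b < (m.Φ.φ (-S) p).2.2} {p | (m.Φ.φ (-(S + 1)) p).2.2 < -m.b}
    (isOpen_lt continuous_const (hc _)) (isOpen_lt (hc _) continuous_const)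
    (fun p hp => by
      have hp : p.2.2 ≤ 0 := hp
      rcases lt_trichotomy (m.Φ.φ (-(S + 1)) p).2.2 (-m.b) with h | h | h
      · exact Or.inr h
      · have := hup _ h (S + 1) (by linarith)
        rw [m.Φ.apply_neg] at this
        linarith
      · exact Or.inl (h.trans_le (m.monotone_z p (show -(S + 1) ≤ -S by linarith))))
    (by
      have hΛ : (0, m.L.Y (true, 0) 0, -m.b0) ∈ m.Λ :=
        ⟨(true, 0), by simp [sn_zero], Or.inl rfl⟩
      refine ⟨_, (show (0, m.L.Y (true, 0) 0, -m.b0) ∈ {p : Q | p.2.2 ≤ 0} from ?_), ?_⟩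
      · have := m.b0_pos
        change -m.b0 ≤ 0; linarith
      · change -m.b < (m.Φ.φ (-S) _).2.2
        rw [m.leaf_z hΛ]
        have := m.b0_lt; simpa using this)
    (by
      refine ⟨(0, 0, -(2 * m.b)), (show -(2 * m.b) ≤ 0 by linarith), ?_⟩
      change (m.Φ.φ (-(S + 1)) (0, 0, -(2 * m.b))).2.2 < -m.b
      have h2 := m.monotone_z (0, 0, -(2 * m.b)) (show -(S + 1) ≤ 0 by linarith)
      simp only [m.Φ.zero] at h2
      linarith)
  have hp : p.2.2 ≤ 0 := hp
  have hp1 : -m.b < (m.Φ.φ (-S) p).2.2 := hp1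
  have hp2 : (m.Φ.φ (-(S + 1)) p).2.2 < -m.b := hp2
  obtain ⟨t, ht, ht'⟩ := intermediate_value_Icc (a := -(S + 1)) (b := -S) (by linarith)
    (m.continuous_z p).continuousOn (show -m.b ∈ Icc _ _ from ⟨hp2.le, hp1.le⟩)
  have := hup _ ht' (-t) (by linarith [ht.2])
  rw [m.Φ.neg_apply] at this
  linarith

end Mod

/-- A cube. -/
def box (A : ℝ) : Set Q := Icc (-A) A ×ˢ (Icc (-A) A ×ˢ Icc (-A) A)

lemma measurableSet_box (A : ℝ) : MeasurableSet (box A) :=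
  measurableSet_Icc.prod (measurableSet_Icc.prod measurableSet_Icc)

lemma mem_box {A : ℝ} {p : Q} : p ∈ box A ↔ |p.1| ≤ A ∧ |p.2.1| ≤ A ∧ |p.2.2| ≤ A := by
  unfold box; simp only [mem_prod, mem_Icc, abs_le]

lemma volume_box_lt_top (A : ℝ) : volume (box A) < ⊤ :=
  (isCompact_Icc.prod (isCompact_Icc.prod isCompact_Icc)).measure_lt_top

lemma subset_box_of_isCompact {K : Set Q} (hK : IsCompact K) : ∃ A, 0 ≤ A ∧ K ⊆ box A := by
  obtain ⟨A, hA⟩ := hK.isBounded.exists_norm_le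
  refine ⟨max A 0, le_max_right _ _, fun p hp => mem_box.2 ?_⟩
  have := (hA p hp).trans (le_max_left A 0)
  exact ⟨(abs_fst_le p).trans this, (abs_snd_fst_le p).trans this, (abs_snd_snd_le p).trans this⟩

/-- The straightened kernel. -/
noncomputable def kk (t₀ : ℝ) (p : Q) : ℝ := kf t₀ (sn p.2.1 ^ 2 + p.2.2 ^ 2)

lemma measurable_kk (t₀ : ℝ) : Measurable (kk t₀) := by
  have := continuous_sn.measurable
  exact measurable_kf.comp (by fun_prop)

lemma intervalIntegrable_abs_rpow (a b : ℝ) :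
    IntervalIntegrable (fun z : ℝ => |z| ^ (-(3 / 4) : ℝ)) volume a b := by
  have h1 : ∀ a b, IntervalIntegrable (fun z : ℝ => z ^ (-(3 / 4) : ℝ)) volume a b := fun a b =>
    intervalIntegral.intervalIntegrable_rpow' (by norm_num)
  have h2 : IntervalIntegrable (fun z : ℝ => (-z) ^ (-(3 / 4) : ℝ)) volume a b := by
    have := (IntervalIntegrable.iff_comp_neg (by simp)).1 (h1 (-a) (-b))
    simpa using this
  refine ((h1 a b).norm.add h2.norm).mono_fun
    (by fun_prop : Measurable fun z : ℝ => |z| ^ (-(3 / 4) : ℝ)).aestronglyMeasurable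
    (Eventually.of_forall fun z => ?_)
  have e : ‖|z| ^ (-(3 / 4) : ℝ)‖ = |z| ^ (-(3 / 4) : ℝ) := Real.norm_of_nonneg (by positivity)
  change ‖|z| ^ (-(3 / 4) : ℝ)‖ ≤ _
  rw [e]
  refine le_trans ?_ (Real.le_norm_self _)
  change _ ≤ ‖z ^ (-(3 / 4) : ℝ)‖ + ‖(-z) ^ (-(3 / 4) : ℝ)‖
  rcases le_total 0 z with h | h
  · rw [abs_of_nonneg h]
    exact (Real.le_norm_self _).trans (le_add_of_nonneg_right (norm_nonneg _))
  · rw [abs_of_nonpos h]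
    exact (Real.le_norm_self _).trans (le_add_of_nonneg_left (norm_nonneg _))

lemma intervalIntegrable_sn_rpow (a b : ℝ) :
    IntervalIntegrable (fun y : ℝ => sn y ^ (-(3 / 4) : ℝ)) volume a b := by
  have hp : Function.Periodic (fun y : ℝ => sn y ^ (-(3 / 4) : ℝ)) 1 := fun y => by
    have := sn_add_int y 1
    push_cast at this
    simp only [this]
  have h1 : ∀ a b, IntervalIntegrable (fun z : ℝ => |z| ^ (-(3 / 4) : ℝ)) volume a b :=
    intervalIntegrable_abs_rpow
  have h2 : IntervalIntegrable (fun z : ℝ => |z - 1| ^ (-(3 / 4) : ℝ)) volume 0 (0 + 1) := by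
    have := (h1 (0 - 1) (0 + 1 - 1)).comp_sub_right 1
    simpa using this
  refine hp.intervalIntegrable one_ne_zero (t := 0) ?_ a b
  have hm := continuous_sn.measurable
  refine ((h1 0 (0 + 1)).add h2).mono_fun
    (by fun_prop : Measurable fun y : ℝ => sn y ^ (-(3 / 4) : ℝ)).aestronglyMeasurable ?_
  rw [uIoc_of_le (by norm_num), EventuallyLE, ae_restrict_iff' measurableSet_Ioc]
  have hne : ∀ᵐ y : ℝ, y ≠ 1 := by simp [ae_iff]
  filter_upwards [hne] with y hy hy'
  have e : ‖sn y ^ (-(3 / 4) : ℝ)‖ = sn y ^ (-(3 / 4) : ℝ) :=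
    Real.norm_of_nonneg (Real.rpow_nonneg (sn_nonneg _) _)
  rw [e]
  refine le_trans ?_ (Real.le_norm_self _)
  change _ ≤ |y| ^ (-(3 / 4) : ℝ) + |y - 1| ^ (-(3 / 4) : ℝ)
  have y0 : 0 < y := hy'.1
  have y1 : y < 1 := lt_of_le_of_ne (by simpa using hy'.2) hy
  have hl := min_le_sn y0.le y1.le
  rw [abs_of_pos y0, abs_of_neg (by linarith)]
  have p1 : 0 ≤ y ^ (-(3 / 4) : ℝ) := by positivity
  have p2 : 0 ≤ (-(y - 1)) ^ (-(3 / 4) : ℝ) := Real.rpow_nonneg (by linarith) _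
  rcases le_total y (1 - y) with h | h
  · rw [min_eq_left h] at hl
    exact (Real.rpow_le_rpow_of_nonpos y0 hl (by norm_num)).trans (le_add_of_nonneg_right p2)
  · rw [min_eq_right h] at hl
    have := Real.rpow_le_rpow_of_nonpos (by linarith) hl (by norm_num : (-(3 / 4) : ℝ) ≤ 0)
    rw [show -(y - 1) = 1 - y by ring] at p2 ⊢
    linarith

lemma integrableOn_kk {t₀ : ℝ} (h0 : 0 < t₀) (A : ℝ) : IntegrableOn (kk t₀) (box A) := by
  rcases lt_or_ge A 0 with hA | hA
  · have : box A = ∅ := by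
      ext p; simp only [mem_box, mem_empty_iff_false, iff_false, not_and]
      intro h; have := abs_nonneg p.1; linarith
    rw [this]; exact integrableOn_empty
  have hA' : -A ≤ A := by linarith
  have i1 : IntegrableOn (fun y : ℝ => sn y ^ (-(3 / 4) : ℝ)) (Icc (-A) A) :=
    (intervalIntegrable_iff_integrableOn_Icc_of_le hA' (by simp)).1
      (intervalIntegrable_sn_rpow (-A) A)
  have i2 : IntegrableOn (fun y : ℝ => |y| ^ (-(3 / 4) : ℝ)) (Icc (-A) A) :=
    (intervalIntegrable_iff_integrableOn_Icc_of_le hA' (by simp)).1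
      (intervalIntegrable_abs_rpow (-A) A)
  have i0 : IntegrableOn (fun _ : ℝ => (1 : ℝ)) (Icc (-A) A) :=
    integrableOn_const (by simp)
  have i3 := i0.mul_prod (i1.mul_prod i2)
  rw [Measure.prod_restrict, Measure.prod_restrict] at i3
  refine Integrable.mono' i3 (measurable_kk t₀).aestronglyMeasurable ?_
  refine ae_restrict_of_ae ?_
  have hz : ∀ᵐ z : ℝ, z ≠ 0 := by simp [ae_iff]
  have hy : ∀ᵐ y : ℝ, sn y ≠ 0 := by
    have : {y : ℝ | ¬ sn y ≠ 0} = range (fun n : ℤ => (n : ℝ)) := by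
      ext y; simp only [not_not, mem_ofPred_eq, sn_eq_zero_iff, mem_range, eq_comm (a := y)]
    rw [ae_iff, this]
    exact (countable_range _).measure_zero _
  have h1 : ∀ᵐ p : Q, p.2.2 ≠ 0 :=
    Measure.quasiMeasurePreserving_snd.ae (Measure.quasiMeasurePreserving_snd.ae hz)
  have h2 : ∀ᵐ p : Q, sn p.2.1 ≠ 0 :=
    Measure.quasiMeasurePreserving_snd.ae (Measure.quasiMeasurePreserving_fst.ae hy)
  filter_upwards [h1, h2] with p hz hy
  have s0 : 0 < sn p.2.1 := lt_of_le_of_ne (sn_nonneg _) (Ne.symm hy)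
  have z0 : 0 < |p.2.2| := abs_pos.2 hz
  have hk : 0 ≤ kk t₀ p := kf_nonneg (by positivity)
  rw [Real.norm_of_nonneg hk, one_mul, ← Real.mul_rpow s0.le z0.le]
  have hle : sn p.2.1 * |p.2.2| ≤ sn p.2.1 ^ 2 + p.2.2 ^ 2 := by
    rw [← sq_abs p.2.2]; nlinarith [sq_nonneg (sn p.2.1 - |p.2.2|), sq_nonneg (sn p.2.1 + |p.2.2|)]
  refine le_trans ?_ (Real.rpow_le_rpow_of_nonpos (by positivity) hle (by norm_num))
  have hq : 0 ≤ sn p.2.1 ^ 2 + p.2.2 ^ 2 := by positivity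
  unfold kk kf
  have h1 := max_one_sub_le_one h0 hq
  have h2 := Real.rpow_nonneg hq (-(3 / 4) : ℝ)
  calc _ ≤ (sn p.2.1 ^ 2 + p.2.2 ^ 2) ^ (-(3 / 4) : ℝ) * 1 ^ 2 := by gcongr
    _ = _ := by ring

namespace Mod
variable (m : Mod)

lemma k_def (p : Q) (θ : ℝ) : m.G.k p θ = kf (m.ρ ^ 2) (m.L.r (true, θ) p ^ 2) := rfl

lemma k_eq (p : Q) (θ : ℝ) (n : ℤ) :
    m.G.k p θ = kk (m.ρ ^ 2) (p.1, p.2.1 + (n - m.L.Y (true, θ) p.1), p.2.2) := by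
  rw [m.k_def, m.L.r_sq']
  unfold kk
  dsimp only
  rw [show p.2.1 + (n - m.L.Y (true, θ) p.1) = p.2.1 - m.L.Y (true, θ) p.1 + n by ring, sn_add_int]

lemma measurable_uncurry_k : Measurable fun q : ℝ × Q => m.G.k q.2 q.1 := by
  have e : (fun q : ℝ × Q => m.G.k q.2 q.1) = fun q => kk (m.ρ ^ 2)
      (q.2.1, q.2.2.1 + ((0 : ℤ) - m.L.Y (true, q.1) q.2.1), q.2.2.2) := by
    funext q; exact m.k_eq q.2 q.1 0
  rw [e]
  have h : Measurable fun q : ℝ × Q => m.L.Y (true, q.1) q.2.1 :=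
    m.L.measurable_Y.comp (by fun_prop : Measurable fun q : ℝ × Q => (q.1, q.2.1))
  exact (measurable_kk _).comp (by fun_prop)

lemma measurable_k_left (θ : ℝ) : Measurable fun p => m.G.k p θ := by
  have := m.measurable_uncurry_k.comp (measurable_prodMk_left (x := θ))
  exact this

instance : (volume : Measure Q).IsAddHaarMeasure :=
  Measure.prod.instIsAddHaarMeasure (volume : Measure ℝ) (volume : Measure (ℝ × ℝ))

/-- A vertical shear preserves volume. -/
lemma measurePreserving_shear (s : ℝ) {c : ℝ → ℝ} (hc : Measurable c) :
    MeasurePreserving (fun p : Q => ((p.1 + s, p.2.1 + c p.1, p.2.2) : Q)) volume volume := by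
  refine MeasurePreserving.skew_product (f := fun x : ℝ => x + s)
    (g := fun x (q : ℝ × ℝ) => (q.1 + c x, q.2)) (measurePreserving_add_right _ s) ?_ ?_
  · unfold Function.uncurry; fun_prop
  · refine Eventually.of_forall fun x => ?_
    exact ((measurePreserving_add_right volume (c x)).prod (MeasurePreserving.id volume)).map_eq

lemma exists_lintegral_k_le (A : ℝ) : ∃ C : NNReal, ∀ θ : ℝ,
    ∫⁻ p in box A, ENNReal.ofReal (m.G.k p θ) ≤ C := by
  set A' := |A| + (1 + m.L.B * |A|) with hA'
  have hi := integrableOn_kk (pow_pos m.ρ_pos 2) A'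
  have hlt : ∫⁻ p in box A', ENNReal.ofReal (kk (m.ρ ^ 2) p) < ⊤ := hi.lintegral_lt_top
  refine ⟨(∫⁻ p in box A', ENNReal.ofReal (kk (m.ρ ^ 2) p)).toNNReal, fun θ => ?_⟩
  rw [ENNReal.coe_toNNReal hlt.ne]
  set Y := m.L.Y (true, θ) with hY
  set n : ℤ := ⌊Y 0⌋ with hn
  set S : Q → Q := fun p => (p.1 + 0, p.2.1 + (n - Y p.1), p.2.2) with hS
  have hSm : MeasurePreserving S volume volume :=
    measurePreserving_shear 0 (c := fun x => n - Y x)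
      (measurable_const.sub (m.L.continuous_Y _).measurable)
  have hB := m.L.B_pos
  have hbox : ∀ p ∈ box A, S p ∈ box A' := by
    intro p hp
    obtain ⟨h1, h2, h3⟩ := mem_box.1 hp
    have hAA := le_abs_self A
    have hpos : 0 ≤ m.L.B * |A| := by positivity
    refine mem_box.2 ⟨?_, ?_, ?_⟩
    · change |p.1 + 0| ≤ _; rw [add_zero]; linarith
    · change |p.2.1 + (n - Y p.1)| ≤ _
      have e1 : |Y p.1 - Y 0| ≤ m.L.B * |A| := by
        refine (m.L.abs_Y_sub_le _ _ _).trans ?_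
        rw [sub_zero]; exact mul_le_mul_of_nonneg_left (h1.trans hAA) hB.le
      have e2 : |(n : ℝ) - Y 0| ≤ 1 := by
        rw [abs_le]; constructor
        · have := Int.lt_floor_add_one (Y 0); linarith
        · have := Int.floor_le (Y 0); linarith
      have e3 : p.2.1 + (n - Y p.1) = p.2.1 + ((n - Y 0) - (Y p.1 - Y 0)) := by ring
      rw [e3]
      refine (abs_add_le _ _).trans ?_
      have := abs_sub (n - Y 0) (Y p.1 - Y 0)
      linarith
    · change |p.2.2| ≤ _; linarith
  calc ∫⁻ p in box A, ENNReal.ofReal (m.G.k p θ)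
      = ∫⁻ p, (box A).indicator (fun p => ENNReal.ofReal (m.G.k p θ)) p :=
        (lintegral_indicator (measurableSet_box A) _).symm
    _ ≤ ∫⁻ p, (box A').indicator (fun p => ENNReal.ofReal (kk (m.ρ ^ 2) p)) (S p) := by
        refine lintegral_mono fun p => ?_
        by_cases hp : p ∈ box A
        · rw [indicator_of_mem hp, indicator_of_mem (hbox p hp), m.k_eq p θ n]
          change _ ≤ ENNReal.ofReal (kk (m.ρ ^ 2) (p.1 + 0, _, _))
          rw [add_zero]
        · rw [indicator_of_notMem hp]; exact bot_le
    _ = ∫⁻ p, (box A').indicator (fun p => ENNReal.ofReal (kk (m.ρ ^ 2) p)) p :=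
        hSm.lintegral_comp (((measurable_kk _).ennreal_ofReal).indicator (measurableSet_box A'))
    _ = _ := lintegral_indicator (measurableSet_box A') _

lemma integrable_uncurry_k (A : ℝ) :
    Integrable (fun q : ℝ × Q => m.G.k q.2 q.1) (pm.prod (volume.restrict (box A))) := by
  obtain ⟨C, hC⟩ := m.exists_lintegral_k_le A
  have : IsFiniteMeasure (volume.restrict (box A)) :=
    ⟨by rw [Measure.restrict_apply_univ]; exact volume_box_lt_top A⟩
  refine ⟨m.measurable_uncurry_k.aestronglyMeasurable, ?_⟩
  rw [hasFiniteIntegral_iff_ofReal (Eventually.of_forall fun q => m.G.k_nonneg _ _),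
    lintegral_prod _ m.measurable_uncurry_k.ennreal_ofReal.aemeasurable]
  refine (lintegral_mono (g := fun _ => (C : ENNReal)) fun θ => hC θ).trans_lt ?_
  rw [lintegral_const, measure_univ, mul_one]
  exact ENNReal.coe_lt_top

lemma integrableOn_k (A θ : ℝ) : IntegrableOn (fun p => m.G.k p θ) (box A) := by
  obtain ⟨C, hC⟩ := m.exists_lintegral_k_le A
  refine ⟨(m.measurable_k_left θ).aestronglyMeasurable, ?_⟩
  rw [hasFiniteIntegral_iff_ofReal (Eventually.of_forall fun q => m.G.k_nonneg _ _)]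
  exact (hC θ).trans_lt ENNReal.coe_lt_top

lemma integrableOn_M (A : ℝ) : IntegrableOn m.G.M (box A) :=
  Integrable.integral_prod_right (f := fun q : ℝ × Q => m.G.k q.2 q.1) (m.integrable_uncurry_k A)

lemma measurable_M : Measurable m.G.M := by
  have h : StronglyMeasurable fun q : Q × ℝ => m.G.k q.1 q.2 :=
    (m.measurable_uncurry_k.comp measurable_swap).stronglyMeasurable
  exact (StronglyMeasurable.integral_prod_right' h).measurable

/-- The field along the leaves with a given parameter. -/
noncomputable def leafField (θ : ℝ) (p : Q) : Q := (1, m.L.v (true, θ) p.1, 0)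

lemma lipschitz_leafField (θ : ℝ) :
    LipschitzWith ⟨m.L.B, m.L.B_pos.le⟩ (m.leafField θ) := by
  have hB := m.L.B_pos
  refine LipschitzWith.of_dist_le_mul fun p q => ?_
  rw [dist_eq_norm, dist_eq_norm]
  change ‖((1 : ℝ), m.L.v (true, θ) p.1, (0 : ℝ)) - (1, m.L.v (true, θ) q.1, 0)‖ ≤ m.L.B * _
  have h : |m.L.v (true, θ) p.1 - m.L.v (true, θ) q.1| ≤ m.L.B * |p.1 - q.1| := by
    have := Convex.norm_image_sub_le_of_norm_hasDerivWithin_le (s := univ) (C := m.L.B)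
      (fun x _ => (m.L.hasDerivAt_v (true, θ) x).hasDerivWithinAt)
      (fun x _ => m.L.abs_v'_le _ x) convex_univ (mem_univ q.1) (mem_univ p.1)
    exact this
  have h2 := abs_fst_le (p - q)
  rw [Prod.mk_sub_mk, Prod.mk_sub_mk, Prod.norm_mk, Prod.norm_mk, sub_self, sub_self, norm_zero]
  have h3 : 0 ≤ m.L.B * ‖p - q‖ := by positivity
  refine max_le h3 (max_le ?_ h3)
  exact h.trans (by gcongr; exact h2)

lemma norm_leafField_le (θ : ℝ) (p : Q) : ‖m.leafField θ p‖ ≤ 1 + m.L.B := by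
  have hB := m.L.B_pos
  unfold leafField
  rw [Prod.norm_mk, Prod.norm_mk, norm_zero, norm_one]
  have := m.L.abs_v_le (true, θ) p.1
  refine max_le (by linarith) (max_le ?_ (by positivity))
  rw [Real.norm_eq_abs]; linarith

/-- The weighted leaf field is weakly divergence free. -/
lemma integral_leafField (θ : ℝ) {K : NNReal} {g : Q → ℝ} (hg : LipschitzWith K g)
    (hc : HasCompactSupport g) : ∫ p, m.G.k p θ * fderiv ℝ g p (m.leafField θ p) = 0 := by
  obtain ⟨Ψ⟩ := nonempty_flow (m.lipschitz_leafField θ) (m.norm_leafField_le θ)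
  set Y := m.L.Y (true, θ) with hY
  have hΨ : ∀ s p, Ψ.φ s p = (p.1 + s, p.2.1 + (Y (p.1 + s) - Y p.1), p.2.2) := by
    intro s p
    have := Ψ.eq (γ := fun s => ((p.1 + s, p.2.1 + (Y (p.1 + s) - Y p.1), p.2.2) : Q)) (fun t => ?_) s
    · simpa using this.symm
    · have h1 : HasDerivAt (fun s : ℝ => p.1 + s) 1 t := (hasDerivAt_id t).const_add _
      have h2 : HasDerivAt (fun s : ℝ => Y (p.1 + s)) (m.L.v (true, θ) (p.1 + t)) t := by
        have := (m.L.hasDerivAt_Y (true, θ) (p.1 + t)).comp t h1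
        rwa [mul_one] at this
      exact h1.prodMk (((h2.sub_const _).const_add _).prodMk (hasDerivAt_const t _))
  have hkm := m.measurable_k_left θ
  have hkΨ : ∀ s p, m.G.k (Ψ.φ s p) θ = m.G.k p θ := by
    intro s p
    rw [hΨ, m.k_def, m.k_def, m.L.r_sq', m.L.r_sq']
    dsimp only
    rw [← hY, show p.2.1 + (Y (p.1 + s) - Y p.1) - Y (p.1 + s) = p.2.1 - Y p.1 by ring]
  have hmp : ∀ s, MeasurePreserving (Ψ.φ s) (volume : Measure Q) volume := by
    intro s
    have hYm : Measurable Y := (m.L.continuous_Y _).measurable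
    have := measurePreserving_shear s (c := fun x => Y (x + s) - Y x) (by fun_prop)
    have e : Ψ.φ s = _ := funext (hΨ s)
    rw [e]; exact this
  set ν : Measure Q := volume.withDensity fun p => ENNReal.ofReal (m.G.k p θ) with hν
  have : IsFiniteMeasureOnCompacts ν := ⟨fun K hK => by
    obtain ⟨A, -, hA⟩ := subset_box_of_isCompact hK
    refine (measure_mono hA).trans_lt ?_
    rw [hν, withDensity_apply _ (measurableSet_box A)]
    exact (m.integrableOn_k A θ).lintegral_lt_top⟩
  have h_int : ∀ f : Q → ℝ, ∫ p, f p ∂ν = ∫ p, m.G.k p θ * f p := by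
    intro f
    rw [hν, integral_withDensity_eq_integral_toReal_smul hkm.ennreal_ofReal (by simp)]
    refine integral_congr_ae (Eventually.of_forall fun p => ?_)
    simp only [smul_eq_mul, ENNReal.toReal_ofReal (m.G.k_nonneg p θ)]
  have hac : ν ≪ Measure.addHaar :=
    (withDensity_absolutelyContinuous _ _).trans
      (Measure.absolutelyContinuous_isAddHaarMeasure (volume : Measure Q) Measure.addHaar)
  have hd := Ψ.hasDerivAt_integral ν hac hg hc
  have hconst : (fun s => ∫ x, g (Ψ.φ s x) ∂ν) = fun _ => ∫ x, g x ∂ν := by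
    funext s
    rw [h_int, h_int]
    rw [← (hmp s).integral_comp (Ψ.homeo s).measurableEmbedding (fun p => m.G.k p θ * g p)]
    simp only [hkΨ]
  rw [hconst] at hd
  rw [← h_int]
  exact hd.unique (hasDerivAt_const _ _)

end Mod

lemma fderiv_apply_Q (g : Q → ℝ) (p v : Q) :
    fderiv ℝ g p v = v.1 * fderiv ℝ g p (1, 0, 0) + v.2.1 * fderiv ℝ g p (0, 1, 0) +
      v.2.2 * fderiv ℝ g p (0, 0, 1) := by
  have : v = v.1 • ((1, 0, 0) : Q) + v.2.1 • (0, 1, 0) + v.2.2 • (0, 0, 1) := by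
    ext <;> simp
  conv_lhs => rw [this]
  simp only [map_add, map_smul, smul_eq_mul]

lemma norm_fderiv_apply_le {E : Type*} [NormedAddCommGroup E] [NormedSpace ℝ E] {K : NNReal}
    {g : E → ℝ} (hg : LipschitzWith K g) {v : E} (hv : ‖v‖ ≤ 1) (p : E) : |fderiv ℝ g p v| ≤ K := by
  have h1 : ‖fderiv ℝ g p‖ ≤ K := norm_fderiv_le_of_lipschitz ℝ hg
  refine ((fderiv ℝ g p).le_opNorm v).trans ?_
  have := norm_nonneg (fderiv ℝ g p)
  nlinarith [norm_nonneg v]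

lemma exists_fderiv_eq_zero {g : Q → ℝ} (hc : HasCompactSupport g) :
    ∃ A, 0 ≤ A ∧ ∀ p ∉ box A, fderiv ℝ g p = 0 := by
  obtain ⟨A, h0, hA⟩ := subset_box_of_isCompact hc.isCompact
  refine ⟨A, h0, fun p hp => ?_⟩
  have := support_fderiv_subset ℝ (f := g)
  by_contra h
  exact hp (hA (this h))

namespace Mod
variable (m : Mod)

lemma measurable_uncurry_v : Measurable fun q : ℝ × Q => m.L.v (true, q.1) q.2.1 :=
  m.L.measurable_v.comp (by fun_prop : Measurable fun q : ℝ × Q => (q.1, q.2.1))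

lemma ae_ne (c : ℝ) : ∀ᵐ p : Q, p.2.2 ≠ c := by
  have hz : ∀ᵐ z : ℝ, z ≠ c := by simp [ae_iff]
  exact Measure.quasiMeasurePreserving_snd.ae (Measure.quasiMeasurePreserving_snd.ae hz)

lemma integral_current {K : NNReal} {g : Q → ℝ} (hg : LipschitzWith K g)
    (hc : HasCompactSupport g) :
    Integrable (fun p => m.G.M p * fderiv ℝ g p (1, 0, 0) + m.S.N p * fderiv ℝ g p (0, 1, 0)) ∧
    ∫ p, (m.G.M p * fderiv ℝ g p (1, 0, 0) + m.S.N p * fderiv ℝ g p (0, 1, 0)) = 0 := by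
  have hB := m.L.B_pos
  have n1 : ‖((1, 0, 0) : Q)‖ ≤ 1 := by simp [Prod.norm_mk]
  have n2 : ‖((0, 1, 0) : Q)‖ ≤ 1 := by simp [Prod.norm_mk]
  have ma : Measurable fun p => fderiv ℝ g p (1, 0, 0) := measurable_fderiv_apply_const ℝ g _
  have mb : Measurable fun p => fderiv ℝ g p (0, 1, 0) := measurable_fderiv_apply_const ℝ g _
  have la := norm_fderiv_apply_le hg n1
  have lb := norm_fderiv_apply_le hg n2
  obtain ⟨A, hA0, hA⟩ := exists_fderiv_eq_zero hc
  set a := fun p => fderiv ℝ g p (1, 0, 0) with ha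
  set b := fun p => fderiv ℝ g p (0, 1, 0) with hb
  set F : ℝ × Q → ℝ := fun q => m.G.k q.2 q.1 * (a q.2 + m.L.v (true, q.1) q.2.1 * b q.2) with hF
  have mF : Measurable F :=
    m.measurable_uncurry_k.mul ((ma.comp measurable_snd).add
      (m.measurable_uncurry_v.mul (mb.comp measurable_snd)))
  have hFi : Integrable F (pm.prod volume) := by
    have h1 := (m.integrable_uncurry_k A).const_mul (K * (1 + m.L.B))
    have e : pm.prod (volume.restrict (box A)) = (pm.prod volume).restrict (univ ×ˢ box A) := by
      rw [← Measure.prod_restrict, Measure.restrict_univ]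
    have hs : MeasurableSet (univ ×ˢ box A : Set (ℝ × Q)) :=
      MeasurableSet.univ.prod (measurableSet_box A)
    rw [e] at h1
    have h2 := (integrable_indicator_iff hs).2 h1
    refine h2.mono' mF.aestronglyMeasurable (Eventually.of_forall fun q => ?_)
    by_cases hq : q.2 ∈ box A
    · rw [indicator_of_mem (show q ∈ univ ×ˢ box A from ⟨mem_univ _, hq⟩), hF]
      simp only [Real.norm_eq_abs, abs_mul, abs_of_nonneg (m.G.k_nonneg q.2 q.1)]
      rw [mul_comm]
      refine mul_le_mul_of_nonneg_right ?_ (m.G.k_nonneg q.2 q.1)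
      refine (abs_add_le _ _).trans ?_
      rw [abs_mul]
      have := mul_le_mul (m.L.abs_v_le (true, q.1) q.2.1) (lb q.2) (abs_nonneg _) hB.le
      have := la q.2
      change |a q.2| + _ ≤ _
      nlinarith
    · have : a q.2 = 0 := by rw [ha]; simp only [hA q.2 hq]; rfl
      have h' : b q.2 = 0 := by rw [hb]; simp only [hA q.2 hq]; rfl
      rw [indicator_of_notMem (fun h => hq h.2), hF]
      simp only [this, h']; simp
  have hin : ∀ᵐ p : Q, ∫ θ, F (θ, p) ∂pm = m.G.M p * a p + m.S.N p * b p := by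
    filter_upwards [ae_ne 0] with p hp
    have hR : 0 < m.G.R p := (abs_pos.2 hp).trans_le (m.abs_z_le_R p)
    have i1 : Integrable (fun θ => m.G.k p θ * a p) pm := (m.G.integrable_k hR).mul_const _
    have i2 : Integrable (fun θ => m.G.k p θ * m.L.v (true, θ) p.1 * b p) pm :=
      (m.S.integrable_F hR).mul_const (b p)
    have e : ∀ θ, F (θ, p) = m.G.k p θ * a p + m.G.k p θ * m.L.v (true, θ) p.1 * b p := fun θ => by
      rw [hF]; ring
    simp_rw [e]
    rw [integral_add i1 i2, integral_mul_const, integral_mul_const]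
    rfl
  refine ⟨?_, ?_⟩
  · exact (Integrable.integral_prod_right hFi).congr hin
  · rw [← integral_congr_ae hin]
    have hsw := integral_integral_swap (f := fun (θ : ℝ) (p : Q) => F (θ, p)) (μ := pm)
      (ν := volume) hFi
    rw [← hsw]
    refine (integral_congr_ae (Eventually.of_forall fun θ => ?_)).trans (integral_zero _ _)
    refine Eq.trans ?_ (m.integral_leafField θ hg hc)
    refine integral_congr_ae (Eventually.of_forall fun p => ?_)
    change m.G.k p θ * (a p + m.L.v (true, θ) p.1 * b p) = m.G.k p θ * _
    rw [fderiv_apply_Q g p (m.leafField θ p)]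
    unfold leafField
    simp only [zero_mul, one_mul, add_zero]
    rfl

/-- The vertical shift. -/
def up (s : ℝ) : Q := (0, 0, s)

lemma integral_current_shift (s : ℝ) {K : NNReal} {g : Q → ℝ} (hg : LipschitzWith K g)
    (hc : HasCompactSupport g) :
    Integrable (fun p => m.G.M (p + up s) * fderiv ℝ g p (1, 0, 0) +
      m.S.N (p + up s) * fderiv ℝ g p (0, 1, 0)) ∧
    ∫ p, (m.G.M (p + up s) * fderiv ℝ g p (1, 0, 0) +
      m.S.N (p + up s) * fderiv ℝ g p (0, 1, 0)) = 0 := by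
  have hg' : LipschitzWith K fun p => g (p + -up s) := by
    refine LipschitzWith.of_dist_le_mul fun p q => (hg.dist_le_mul _ _).trans ?_
    rw [dist_add_right]
  have hc' : HasCompactSupport fun p => g (p + -up s) :=
    hc.comp_homeomorph (Homeomorph.addRight (-up s))
  obtain ⟨h1, h2⟩ := m.integral_current hg' hc'
  have e : ∀ p, fderiv ℝ (fun p => g (p + -up s)) p = fderiv ℝ g (p + -up s) := fun p =>
    fderiv_comp_add_right _
  simp_rw [e] at h1 h2
  refine ⟨?_, ?_⟩
  · have := h1.comp_add_right (up s)
    simpa only [add_neg_cancel_right] using this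
  · rw [← integral_add_right_eq_self _ (up s)] at h2
    simpa only [add_neg_cancel_right] using h2

/-- The weight of the model. -/
noncomputable def w (p : Q) : ℝ := m.d.w (p.1, p.2.1)

lemma w_pos (p : Q) : 0 < m.w p := m.d.pos _

lemma continuous_w : Continuous m.w := m.d.contDiff.continuous.comp (by fun_prop)

lemma integral_vertical {K : NNReal} {g : Q → ℝ} (hg : LipschitzWith K g)
    (hc : HasCompactSupport g) :
    Integrable (fun p => m.w p * fderiv ℝ g p (0, 0, 1)) ∧
    ∫ p, m.w p * fderiv ℝ g p (0, 0, 1) = 0 := by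
  have n1 : ‖((0, 0, 1) : Q)‖ ≤ 1 := by simp [Prod.norm_mk]
  have mc : Measurable fun p => fderiv ℝ g p (0, 0, 1) := measurable_fderiv_apply_const ℝ g _
  have lc := norm_fderiv_apply_le hg n1
  obtain ⟨A, hA0, hA⟩ := exists_fderiv_eq_zero hc
  have hB := m.d.B_pos
  have hw : LipschitzWith ⟨m.d.B, hB.le⟩ m.w := by
    have h : LipschitzWith ⟨m.d.B, hB.le⟩ m.d.w :=
      lipschitzWith_of_nnnorm_fderiv_le (m.d.contDiff.differentiable one_ne_zero)
        fun p => m.d.norm_fderiv_le p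
    refine LipschitzWith.of_dist_le_mul fun p q => (h.dist_le_mul _ _).trans ?_
    have : dist (p.1, p.2.1) (q.1, q.2.1) ≤ dist p q := by
      rw [dist_eq_norm, dist_eq_norm, Prod.mk_sub_mk, Prod.norm_mk]
      exact max_le (abs_fst_le (p - q)) (abs_snd_fst_le (p - q))
    gcongr
  refine ⟨?_, ?_⟩
  · have h1 : IntegrableOn (fun _ : Q => m.d.B * (K : ℝ)) (box A) :=
      integrableOn_const (volume_box_lt_top A).ne
    have h2 := (integrable_indicator_iff (measurableSet_box A)).2 h1
    refine h2.mono' (m.continuous_w.measurable.mul mc).aestronglyMeasurable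
      (Eventually.of_forall fun p => ?_)
    by_cases hp : p ∈ box A
    · rw [indicator_of_mem hp, Real.norm_eq_abs, abs_mul, abs_of_pos (m.w_pos p)]
      exact mul_le_mul (m.d.w_le _) (lc p) (abs_nonneg _) hB.le
    · rw [indicator_of_notMem hp, hA p hp]; simp
  · have h := hw.integral_lineDeriv_mul_eq (μ := volume) hg hc (0, 0, -1)
    have e1 : ∀ p, lineDeriv ℝ m.w p (0, 0, -1) = 0 := fun p => by
      unfold lineDeriv
      have : (fun t : ℝ => m.w (p + t • ((0, 0, -1) : Q))) = fun _ => m.w p := by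
        funext t; unfold w; simp
      rw [this, deriv_const]
    simp only [e1, zero_mul, integral_zero] at h
    refine Eq.trans ?_ h.symm
    refine integral_congr_ae ?_
    filter_upwards [hg.ae_differentiableAt] with p hp
    rw [hp.lineDeriv_eq_fderiv, mul_comm]
    simp

/-- The density of the invariant measure of the model field. -/
noncomputable def J (p : Q) : ℝ :=
  m.w p + (m.G.M (p + up m.b0) + m.G.M (p + up (-m.b0)))

lemma w_le_J (p : Q) : m.w p ≤ m.J p :=
  le_add_of_nonneg_right (add_nonneg (m.G.M_nonneg _) (m.G.M_nonneg _))

lemma measurable_J : Measurable m.J := by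
  have h1 := m.measurable_M
  have h2 := m.continuous_w.measurable
  unfold J
  exact h2.add ((h1.comp (measurable_add_const _)).add (h1.comp (measurable_add_const _)))

lemma integrableOn_J (A : ℝ) : IntegrableOn m.J (box A) := by
  have hs : ∀ s, IntegrableOn (fun p => m.G.M (p + up s)) (box A) := fun s => by
    have h1 := (integrable_indicator_iff (measurableSet_box _)).2 (m.integrableOn_M (A + |s|))
    have h2 := (h1.comp_add_right (up s)).integrableOn (s := box A)
    refine h2.congr_fun (fun p hp => ?_) (measurableSet_box A)
    obtain ⟨k1, k2, k3⟩ := mem_box.1 hp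
    have := abs_nonneg s
    refine indicator_of_mem (mem_box.2 ⟨?_, ?_, ?_⟩) _
    · change |p.1 + 0| ≤ _; rw [add_zero]; linarith
    · change |p.2.1 + 0| ≤ _; rw [add_zero]; linarith
    · exact (abs_add_le p.2.2 s).trans (by linarith)
  have hw : IntegrableOn m.w (box A) :=
    m.continuous_w.continuousOn.integrableOn_compact
      (isCompact_Icc.prod (isCompact_Icc.prod isCompact_Icc))
  exact hw.add ((hs _).add (hs _))

lemma add_up (p : Q) (s : ℝ) : p + up s = (p.1, p.2.1, p.2.2 + s) := by
  ext <;> simp [up]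

lemma J_off {p : Q} (h : p ∉ m.C) : m.J p = m.w p := by
  have key : ∀ s, |s| = m.b0 → m.G.M (p + up s) = 0 := by
    intro s hs
    rw [add_up]
    by_cases h1 : 4 * sn p.1 ^ 2 * sn p.2.1 ^ 2 ≤ 1 / 2
    · refine m.M_eq_zero (le_trans ?_ (m.abs_z_le_R _))
      have h2 : m.b < |p.2.2| := by
        by_contra h3; exact h (m.mem_C.2 ⟨h1, not_lt.1 h3⟩)
      change _ ≤ |p.2.2 + s|
      have h3 : |p.2.2| ≤ |p.2.2 + s| + |s| := by
        have := abs_sub (p.2.2 + s) s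
        rwa [add_sub_cancel_right] at this
      have h4 := m.ρ_le
      have := m.b_pos
      rw [hs] at h3; unfold b0 at h3
      linarith
    · exact m.M_eq_zero (m.ρ_le_R h1)
  have hb := m.b0_pos
  unfold J
  rw [key _ (abs_of_pos hb), key _ (by rw [abs_neg, abs_of_pos hb]), add_zero, add_zero]

lemma f_mul (s : Sec m.G) {p : Q} (h : p.2.2 ≠ 0) :
    s.f p * (m.w p + m.G.M p) = s.N p := by
  rw [s.f_off ((abs_pos.2 h).trans_le (m.abs_z_le_R p))]
  exact div_mul_cancel₀ _ (m.G.wM_pos p).ne'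

lemma N_eq_zero (s : Sec m.G) {p : Q} (h : m.ρ ≤ m.G.R p) : s.N p = 0 := by
  unfold Sec.N; simp [m.k_eq_zero h]

lemma W_mul_J {p : Q} (h1 : p.2.2 ≠ m.b0) (h2 : p.2.2 ≠ -m.b0) :
    m.J p • m.W p =
      (m.G.M (p + up m.b0) - m.G.M (p + up (-m.b0)), m.S.N (p + up m.b0) - m.S.N (p + up (-m.b0)),
        m.w p) := by
  have hρ := m.ρ_le
  have hb := m.b_pos
  have hw : ∀ s, m.w (p + up s) = m.w p := fun s => by simp [w, up]
  rcases le_total 0 p.2.2 with h | h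
  · have hR : m.ρ ≤ m.G.R (p + up m.b0) := by
      refine le_trans ?_ (m.abs_z_le_R _)
      rw [add_up]
      change _ ≤ |p.2.2 + m.b0|
      rw [abs_of_nonneg (by have := m.b0_pos; linarith)]
      unfold b0; linarith
    have hz : (p + up (-m.b0)).2.2 ≠ 0 := by
      rw [add_up]; change p.2.2 + -m.b0 ≠ 0
      intro h; exact h1 (by linarith)
    have e1 := m.f_mul m.G.one hz
    have e2 := m.f_mul m.S hz
    rw [hw, Sec.one_N] at e1
    rw [hw] at e2
    have e3 : m.W p = _ := m.W_of_nonneg (x := p.1) (y := p.2.1) h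
    rw [sub_eq_add_neg, ← add_up] at e3
    rw [e3]
    unfold J f1 f2
    rw [m.M_eq_zero hR, m.N_eq_zero _ hR]
    simp only [Prod.smul_mk, smul_eq_mul, zero_add, zero_sub]
    refine Prod.ext ?_ (Prod.ext ?_ ?_)
    · dsimp only; linarith
    · dsimp only; linarith
    · dsimp only; linarith
  · have hR : m.ρ ≤ m.G.R (p + up (-m.b0)) := by
      refine le_trans ?_ (m.abs_z_le_R _)
      rw [add_up]
      change _ ≤ |p.2.2 + -m.b0|
      rw [abs_of_nonpos (by have := m.b0_pos; linarith)]
      unfold b0; linarith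
    have hz : (p + up m.b0).2.2 ≠ 0 := by
      rw [add_up]; change p.2.2 + m.b0 ≠ 0
      intro h; exact h2 (by linarith)
    have e1 := m.f_mul m.G.one hz
    have e2 := m.f_mul m.S hz
    rw [hw, Sec.one_N] at e1
    rw [hw] at e2
    have e3 : m.W p = _ := m.W_of_nonpos (x := p.1) (y := p.2.1) h
    rw [← add_up] at e3
    rw [e3]
    unfold J f1 f2
    rw [m.M_eq_zero hR, m.N_eq_zero _ hR]
    simp only [Prod.smul_mk, smul_eq_mul, add_zero, sub_zero]
    refine Prod.ext ?_ (Prod.ext ?_ ?_)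
    · dsimp only; linarith
    · dsimp only; linarith
    · dsimp only; linarith

/-- The weighted model field is weakly divergence free. -/
theorem integral_fderiv_W {K : NNReal} {g : Q → ℝ} (hg : LipschitzWith K g)
    (hc : HasCompactSupport g) :
    Integrable (fun p => m.J p * fderiv ℝ g p (m.W p)) ∧
    ∫ p, m.J p * fderiv ℝ g p (m.W p) = 0 := by
  obtain ⟨i1, e1⟩ := m.integral_current_shift m.b0 hg hc
  obtain ⟨i2, e2⟩ := m.integral_current_shift (-m.b0) hg hc
  obtain ⟨i3, e3⟩ := m.integral_vertical hg hc
  have h : ∀ᵐ p : Q, m.J p * fderiv ℝ g p (m.W p) =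
      (m.G.M (p + up m.b0) * fderiv ℝ g p (1, 0, 0) +
        m.S.N (p + up m.b0) * fderiv ℝ g p (0, 1, 0)) -
      (m.G.M (p + up (-m.b0)) * fderiv ℝ g p (1, 0, 0) +
        m.S.N (p + up (-m.b0)) * fderiv ℝ g p (0, 1, 0)) + m.w p * fderiv ℝ g p (0, 0, 1) := by
    filter_upwards [ae_ne m.b0, ae_ne (-m.b0)] with p h1 h2
    rw [← smul_eq_mul, ← map_smul, m.W_mul_J h1 h2, fderiv_apply_Q]
    ring
  have i4 := i1.sub i2
  refine ⟨(i4.add i3).congr (h.mono fun p hp => hp.symm), ?_⟩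
  rw [integral_congr_ae h]
  have e4 := integral_add i4 i3
  have e5 := integral_sub i1 i2
  simp only [Pi.sub_apply] at e4
  rw [e4, e5, e1, e2, e3]; simp

end Mod

open Mod (tr xy F)

/-- A fundamental domain of the lattice. -/
def cell : Set Q := {p | (0 ≤ p.1 ∧ p.1 < 1) ∧ (0 ≤ p.2.1 ∧ p.2.1 < 1)}

lemma measurableSet_cell : MeasurableSet cell := by
  unfold cell
  have m1 : Measurable fun p : Q => p.1 := by fun_prop
  have m2 : Measurable fun p : Q => p.2.1 := by fun_prop
  exact ((measurableSet_le measurable_const m1).inter (measurableSet_lt m1 measurable_const)).inter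
    ((measurableSet_le measurable_const m2).inter (measurableSet_lt m2 measurable_const))

/-- The four translations adjacent to the fundamental domain. -/
def quad : Finset (ℤ × ℤ) := {0, -1} ×ˢ {0, -1}

lemma sum_quad {A : Type*} [AddCommMonoid A] (f : ℤ × ℤ → A) :
    ∑ T ∈ quad, f T = (f (0, 0) + f (0, -1)) + (f (-1, 0) + f (-1, -1)) := by
  unfold quad
  rw [Finset.sum_product, Finset.sum_pair (by norm_num), Finset.sum_pair (by norm_num),
    Finset.sum_pair (by norm_num)]

lemma integral_unfold {f : Q → ℝ} (hf : Integrable f)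
    (h : ∀ p, f p ≠ 0 → |p.1| < 1 ∧ |p.2.1| < 1) :
    IntegrableOn (fun p => ∑ T ∈ quad, f (p + tr T.1 T.2)) cell ∧
    ∫ p, f p = ∫ p in cell, ∑ T ∈ quad, f (p + tr T.1 T.2) := by
  have hi : ∀ T ∈ quad, IntegrableOn (fun p => f (p + tr T.1 T.2)) cell := fun T _ =>
    (hf.comp_add_right (tr T.1 T.2)).integrableOn
  refine ⟨integrable_finsetSum _ hi, ?_⟩
  rw [integral_finsetSum _ hi]
  have e1 : ∀ T : ℤ × ℤ, ∫ p in cell, f (p + tr T.1 T.2) =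
      ∫ p, cell.indicator 1 (p - tr T.1 T.2) * f p := fun T => by
    rw [← integral_indicator measurableSet_cell,
      ← integral_add_right_eq_self (fun p => cell.indicator 1 (p - tr T.1 T.2) * f p)
        (tr T.1 T.2)]
    refine integral_congr_ae (Eventually.of_forall fun p => ?_)
    simp only [add_sub_cancel_right]
    by_cases hp : p ∈ cell
    · simp [hp]
    · simp [hp]
  simp_rw [e1]
  have hm : ∀ T : ℤ × ℤ, MeasurableSet {p : Q | p - tr T.1 T.2 ∈ cell} := fun T =>
    measurableSet_cell.preimage (measurable_id.sub_const _)
  have hi' : ∀ T ∈ quad, Integrable (fun p : Q => cell.indicator 1 (p - tr T.1 T.2) * f p) := by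
    intro T _
    refine (hf.indicator (hm T)).congr (Eventually.of_forall fun p => ?_)
    by_cases hp : p - tr T.1 T.2 ∈ cell
    · simp [indicator, hp]
    · simp [indicator, hp]
  rw [← integral_finsetSum _ hi']
  refine integral_congr_ae (Eventually.of_forall fun p => ?_)
  simp only
  rw [← Finset.sum_mul]
  by_cases hp : f p = 0
  · simp [hp]
  obtain ⟨h1, h2⟩ := h p hp
  rw [abs_lt] at h1 h2
  suffices hs : ∑ T ∈ quad, cell.indicator (1 : Q → ℝ) (p - tr T.1 T.2) = 1 by rw [hs, one_mul]
  rw [sum_quad]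
  obtain ⟨x, y, z⟩ := p
  simp only at h1 h2
  simp only [indicator, cell, tr, mem_ofPred_eq, Prod.mk_sub_mk, Pi.one_apply]
  push_cast
  simp only [sub_zero, sub_neg_eq_add]
  rcases le_or_gt 0 x with hx | hx <;> rcases le_or_gt 0 y with hy | hy
  · rw [if_pos ⟨⟨hx, h1.2⟩, hy, h2.2⟩, if_neg (fun h => by linarith [h.2.2]),
      if_neg (fun h => by linarith [h.1.2]), if_neg (fun h => by linarith [h.1.2])]; simp
  · rw [if_neg (fun h => by linarith [h.2.1]),
      if_pos ⟨⟨hx, h1.2⟩, by linarith, by linarith⟩,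
      if_neg (fun h => by linarith [h.1.2]), if_neg (fun h => by linarith [h.1.2])]; simp
  · rw [if_neg (fun h => by linarith [h.1.1]), if_neg (fun h => by linarith [h.1.1]),
      if_pos ⟨⟨by linarith, by linarith⟩, hy, h2.2⟩, if_neg (fun h => by linarith [h.2.2])]; simp
  · rw [if_neg (fun h => by linarith [h.1.1]), if_neg (fun h => by linarith [h.1.1]),
      if_neg (fun h => by linarith [h.2.1]),
      if_pos ⟨⟨by linarith, by linarith⟩, by linarith, by linarith⟩]; simp

lemma lipschitz_mul_of_bounded {E : Type*} [PseudoMetricSpace E] {f g : E → ℝ} {K L A B : NNReal}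
    (hf : LipschitzWith K f) (hg : LipschitzWith L g) (hA : ∀ p, |f p| ≤ A) (hB : ∀ p, |g p| ≤ B) :
    LipschitzWith (A * L + B * K) fun p => f p * g p := by
  refine LipschitzWith.of_dist_le_mul fun p q => ?_
  have h1 := hf.dist_le_mul p q
  have h2 := hg.dist_le_mul p q
  rw [Real.dist_eq] at h1 h2 ⊢
  have e : f p * g p - f q * g q = f p * (g p - g q) + g q * (f p - f q) := by ring
  rw [e]
  refine (abs_add_le _ _).trans ?_
  rw [abs_mul, abs_mul]
  have a1 := mul_le_mul (hA p) h2 (abs_nonneg _) A.2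
  have a2 := mul_le_mul (hB q) h1 (abs_nonneg _) B.2
  push_cast
  calc _ ≤ _ := add_le_add a1 a2
    _ = _ := by ring

/-- The tent function. -/
noncomputable def tent (x : ℝ) : ℝ := max 0 (1 - |x|)

lemma lipschitz_tent : LipschitzWith 1 tent := by
  unfold tent
  refine LipschitzWith.const_max ?_ _
  refine LipschitzWith.of_dist_le_mul fun x y => ?_
  rw [Real.dist_eq, Real.dist_eq, NNReal.coe_one, one_mul]
  rw [show 1 - |x| - (1 - |y|) = |y| - |x| by ring, abs_sub_comm x y]
  exact abs_abs_sub_abs_le_abs_sub _ _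

lemma tent_nonneg (x : ℝ) : 0 ≤ tent x := le_max_left _ _
lemma abs_tent_le (x : ℝ) : |tent x| ≤ 1 := by
  rw [abs_of_nonneg (tent_nonneg x)]
  exact max_le zero_le_one (by linarith [abs_nonneg x])
lemma tent_eq_zero {x : ℝ} (h : 1 ≤ |x|) : tent x = 0 := max_eq_left (by linarith)
lemma tent_add {x : ℝ} (h0 : 0 ≤ x) (h1 : x ≤ 1) : tent x + tent (x - 1) = 1 := by
  unfold tent
  rw [abs_of_nonneg h0, abs_of_nonpos (by linarith), max_eq_right (by linarith),
    max_eq_right (by linarith)]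
  ring

/-- A cutoff, equal to `1` on `[-b, b]`. -/
noncomputable def cut (b z : ℝ) : ℝ := max 0 (min 1 (b + 1 - |z|))

lemma lipschitz_cut (b : ℝ) : LipschitzWith 1 (cut b) := by
  unfold cut
  refine (LipschitzWith.const_min ?_ _).const_max _
  refine LipschitzWith.of_dist_le_mul fun x y => ?_
  rw [Real.dist_eq, Real.dist_eq, NNReal.coe_one, one_mul]
  rw [show b + 1 - |x| - (b + 1 - |y|) = |y| - |x| by ring, abs_sub_comm x y]
  exact abs_abs_sub_abs_le_abs_sub _ _

lemma abs_cut_le (b z : ℝ) : |cut b z| ≤ 1 := by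
  rw [abs_of_nonneg (le_max_left _ _)]
  exact max_le zero_le_one (min_le_left _ _)
lemma cut_eq_zero {b z : ℝ} (h : b + 1 ≤ |z|) : cut b z = 0 :=
  max_eq_left ((min_le_right _ _).trans (by linarith))
lemma cut_eq_one {b z : ℝ} (h : |z| ≤ b) : cut b z = 1 := by
  unfold cut
  rw [min_eq_left (by linarith), max_eq_right zero_le_one]

/-- A cutoff whose translates form a partition of unity near the support of the plug. -/
noncomputable def bumpQ (b : ℝ) (p : Q) : ℝ := (tent p.1 * tent p.2.1) * cut b p.2.2

lemma exists_lipschitz_bumpQ (b : ℝ) : ∃ K, LipschitzWith K (bumpQ b) := by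
  have l1 : LipschitzWith 1 fun p : Q => tent p.1 := by
    have := lipschitz_tent.comp (LipschitzWith.prod_fst (α := ℝ) (β := ℝ × ℝ))
    rw [one_mul] at this; exact this
  have l2 : LipschitzWith 1 fun p : Q => tent p.2.1 := by
    have := lipschitz_tent.comp ((LipschitzWith.prod_fst (α := ℝ) (β := ℝ)).comp
      (LipschitzWith.prod_snd (α := ℝ) (β := ℝ × ℝ)))
    rw [one_mul, one_mul] at this; exact this
  have l3 : LipschitzWith 1 fun p : Q => cut b p.2.2 := by
    have := (lipschitz_cut b).comp ((LipschitzWith.prod_snd (α := ℝ) (β := ℝ)).comp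
      (LipschitzWith.prod_snd (α := ℝ) (β := ℝ × ℝ)))
    rw [one_mul, one_mul] at this; exact this
  have l4 := lipschitz_mul_of_bounded l1 l2 (A := 1) (B := 1) (fun p => abs_tent_le _)
    (fun p => abs_tent_le _)
  refine ⟨_, lipschitz_mul_of_bounded l4 l3 (A := 1) (B := 1) (fun p => ?_)
    (fun p => abs_cut_le b _)⟩
  rw [abs_mul]
  exact mul_le_one₀ (abs_tent_le _) (abs_nonneg _) (abs_tent_le _)

lemma abs_bumpQ_le (b : ℝ) (p : Q) : |bumpQ b p| ≤ 1 := by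
  unfold bumpQ
  rw [abs_mul, abs_mul]
  exact mul_le_one₀ (mul_le_one₀ (abs_tent_le _) (abs_nonneg _) (abs_tent_le _)) (abs_nonneg _)
    (abs_cut_le _ _)

lemma bumpQ_eq_zero {b : ℝ} {p : Q} (h : ¬ (|p.1| < 1 ∧ |p.2.1| < 1 ∧ |p.2.2| < b + 1)) :
    bumpQ b p = 0 := by
  unfold bumpQ
  by_cases h1 : |p.1| < 1
  · by_cases h2 : |p.2.1| < 1
    · rw [cut_eq_zero (not_lt.1 fun h3 => h ⟨h1, h2, h3⟩), mul_zero]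
    · rw [tent_eq_zero (not_lt.1 h2)]; ring
  · rw [tent_eq_zero (not_lt.1 h1)]; ring

lemma sum_bumpQ {b : ℝ} {p : Q} (h : p ∈ cell) (hz : |p.2.2| ≤ b) :
    ∑ T ∈ quad, bumpQ b (p + tr T.1 T.2) = 1 := by
  rw [sum_quad]
  obtain ⟨⟨h1, h2⟩, h3, h4⟩ := h
  have e1 := tent_add h1 h2.le
  have e2 := tent_add h3 h4.le
  obtain ⟨x, y, z⟩ := p
  simp only [bumpQ, tr, Prod.mk_add_mk]
  push_cast
  simp only [add_zero, ← sub_eq_add_neg]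
  rw [cut_eq_one hz]
  simp only at e1 e2
  linear_combination (tent y + tent (y - 1)) * e1 + e2

lemma integrable_bumpQ_support {b : ℝ} : HasCompactSupport (bumpQ b) := by
  refine HasCompactSupport.of_support_subset_isCompact
    (K := Icc (-1) 1 ×ˢ (Icc (-1) 1 ×ˢ Icc (-(b + 1)) (b + 1)))
    (isCompact_Icc.prod (isCompact_Icc.prod isCompact_Icc)) fun p hp => ?_
  have h : |p.1| < 1 ∧ |p.2.1| < 1 ∧ |p.2.2| < b + 1 := by
    by_contra h; exact hp (bumpQ_eq_zero h)
  exact ⟨abs_le.1 h.1.le, abs_le.1 h.2.1.le, abs_le.1 h.2.2.le⟩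

lemma fderiv_eq_zero_of_notMem {g : Q → ℝ} {b : ℝ} {p : Q}
    (hg : ∀ p : Q, ¬ (|p.1| < 1 ∧ |p.2.1| < 1 ∧ |p.2.2| < b + 1) → g p = 0)
    (hp : ¬ (|p.1| < 1 ∧ |p.2.1| < 1)) (hd : DifferentiableAt ℝ g p) (v : Q) (hv : |p.1| ≠ 1)
    (hv' : |p.2.1| ≠ 1) : fderiv ℝ g p v = 0 := by
  have : g =ᶠ[𝓝 p] fun _ => 0 := by
    by_cases h1 : |p.1| < 1
    · have h2 : 1 < |p.2.1| := lt_of_le_of_ne (not_lt.1 fun h => hp ⟨h1, h⟩) (Ne.symm hv')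
      have : ∀ᶠ q : Q in 𝓝 p, 1 < |q.2.1| :=
        (isOpen_lt continuous_const (by fun_prop)).mem_nhds h2
      exact this.mono fun q hq => hg q fun h => by linarith [h.2.1]
    · have h2 : 1 < |p.1| := lt_of_le_of_ne (not_lt.1 h1) (Ne.symm hv)
      have : ∀ᶠ q : Q in 𝓝 p, 1 < |q.1| :=
        (isOpen_lt continuous_const (by fun_prop)).mem_nhds h2
      exact this.mono fun q hq => hg q fun h => by linarith [h.1]
  rw [this.fderiv_eq]; simp

namespace Mod
variable (m : Mod)

lemma J_tr (p : Q) (j n : ℤ) : m.J (p + tr j n) = m.J p := by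
  have hM : ∀ s, m.G.M (p + tr j n + up s) = m.G.M (p + up s) := fun s => by
    rw [add_right_comm]; exact add_tr_of_periodic m.M_x m.M_y _ j n
  have hw : m.w (p + tr j n) = m.w p :=
    add_tr_of_periodic (F := m.w) (fun x y z => m.d.add_x x y) (fun x y z => m.d.add_y x y) p j n
  unfold J
  rw [hM, hM, hw]

lemma w_tr (p : Q) (j n : ℤ) : m.w (p + tr j n) = m.w p :=
  add_tr_of_periodic (F := m.w) (fun x y z => m.d.add_x x y) (fun x y z => m.d.add_y x y) p j n

lemma C_tr {p : Q} {j n : ℤ} : p + tr j n ∈ m.C ↔ p ∈ m.C := by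
  have h := add_tr_of_periodic (F := fun p => p ∈ m.C)
    (fun x y z => by
      have := sn_add_int x 1
      simp only [Int.cast_one] at this
      simp only [mem_C, this])
    (fun x y z => by
      have := sn_add_int y 1
      simp only [Int.cast_one] at this
      simp only [mem_C, this]) p j n
  exact Iff.of_eq h

/-- The defect of the weak divergence equation. -/
noncomputable def defect (g : Q → ℝ) (p : Q) : ℝ :=
  m.J p * fderiv ℝ g p (m.W p) - m.w p * fderiv ℝ g p (0, 0, 1)

lemma defect_off (g : Q → ℝ) {p : Q} (h : p ∉ m.C) : m.defect g p = 0 := by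
  unfold defect; rw [m.J_off h, m.W_off h, sub_self]

lemma defect_tr (g : Q → ℝ) (p : Q) (j n : ℤ) :
    m.defect g (p + tr j n) = m.defect (fun q => g (q + tr j n)) p := by
  unfold defect
  rw [m.J_tr, m.W_tr, m.w_tr, fderiv_comp_add_right]

/-- The weak divergence equation for periodic test functions. -/
theorem integral_defect {K B : NNReal} {h : Q → ℝ} (hK : LipschitzWith K h) (hB : ∀ p, |h p| ≤ B)
    (hp : ∀ p j n, h (p + tr j n) = h p) :
    IntegrableOn (m.defect h) cell ∧ ∫ p in cell, m.defect h p = 0 := by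
  obtain ⟨K', hK'⟩ := exists_lipschitz_bumpQ m.b
  set g : Q → ℝ := fun p => bumpQ m.b p * h p with hg
  have lg : LipschitzWith (1 * K + B * K') g :=
    lipschitz_mul_of_bounded hK' hK (A := 1) (abs_bumpQ_le _) hB
  have cg : HasCompactSupport g := integrable_bumpQ_support.mul_right
  obtain ⟨i1, e1⟩ := m.integral_fderiv_W lg cg
  obtain ⟨i2, e2⟩ := m.integral_vertical lg cg
  set S : Set Q := {p | |p.1| < 1 ∧ |p.2.1| < 1} with hS
  have mS : MeasurableSet S := by
    have m1 : Measurable fun p : Q => |p.1| := by fun_prop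
    have m2 : Measurable fun p : Q => |p.2.1| := by fun_prop
    exact (measurableSet_lt m1 measurable_const).inter (measurableSet_lt m2 measurable_const)
  have i3 : Integrable (m.defect g) := i1.sub i2
  have e3 : ∫ p, m.defect g p = 0 := (integral_sub i1 i2).trans (by rw [e1, e2, sub_zero])
  have hne : ∀ c : ℝ, ∀ᵐ z : ℝ, z ≠ c := fun c => by simp [ae_iff]
  have nx : ∀ c : ℝ, ∀ᵐ p : Q, p.1 ≠ c := fun c =>
    Measure.quasiMeasurePreserving_fst.ae (hne c)
  have ny : ∀ c : ℝ, ∀ᵐ p : Q, p.2.1 ≠ c := fun c =>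
    Measure.quasiMeasurePreserving_snd.ae
      (Measure.quasiMeasurePreserving_fst.ae (hne c))
  have hae : S.indicator (m.defect g) =ᵐ[volume] m.defect g := by
    filter_upwards [nx 1, nx (-1), ny 1, ny (-1), lg.ae_differentiableAt] with p h1 h2 h3 h4 h5
    by_cases hpS : p ∈ S
    · rw [indicator_of_mem hpS]
    · rw [indicator_of_notMem hpS]
      have k1 : |p.1| ≠ 1 := fun h => by
        rcases (abs_eq zero_le_one).1 h with h | h; exacts [h1 h, h2 h]
      have k2 : |p.2.1| ≠ 1 := fun h => by
        rcases (abs_eq zero_le_one).1 h with h | h; exacts [h3 h, h4 h]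
      have key := fun v => fderiv_eq_zero_of_notMem (g := g) (b := m.b) (p := p)
        (fun q hq => by rw [hg]; simp only [bumpQ_eq_zero hq, zero_mul]) hpS h5 v k1 k2
      unfold defect
      rw [key, key]; simp
  obtain ⟨i4, e4⟩ := integral_unfold (i3.congr hae.symm) (fun p hp' => by
    by_contra hpS; exact hp' (indicator_of_notMem (s := S) hpS _))
  have tae : ∀ T : ℤ × ℤ, ∀ᵐ p : Q, DifferentiableAt ℝ (fun q => g (q + tr T.1 T.2)) p := fun T => by
    have : LipschitzWith (1 * K + B * K') fun q => g (q + tr T.1 T.2) :=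
      LipschitzWith.of_dist_le_mul fun p q => (lg.dist_le_mul _ _).trans (by rw [dist_add_right])
    exact this.ae_differentiableAt
  have sae : ∀ T : ℤ × ℤ, ∀ᵐ p : Q, S.indicator (m.defect g) (p + tr T.1 T.2) =
      m.defect g (p + tr T.1 T.2) := fun T =>
    (measurePreserving_add_right volume (tr T.1 T.2)).quasiMeasurePreserving.ae hae
  have tall : ∀ᵐ p : Q, ∀ T : ℤ × ℤ, DifferentiableAt ℝ (fun q => g (q + tr T.1 T.2)) p ∧
      S.indicator (m.defect g) (p + tr T.1 T.2) = m.defect g (p + tr T.1 T.2) :=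
    ae_all_iff.2 fun T => (tae T).and (sae T)
  have hfin : ∀ᵐ p ∂(volume.restrict cell),
      ∑ T ∈ quad, S.indicator (m.defect g) (p + tr T.1 T.2) = m.defect h p := by
    rw [ae_restrict_iff' measurableSet_cell]
    filter_upwards [tall, nx 0, ny 0, ae_ne m.b, ae_ne (-m.b)] with p h1 h2 h3 h4 h5 hcell
    rw [Finset.sum_congr rfl fun T _ => (h1 T).2]
    by_cases hz : |p.2.2| < m.b
    · have hev : (fun q => ∑ T ∈ quad, g (q + tr T.1 T.2)) =ᶠ[𝓝 p] h := by
        have o1 : ∀ᶠ q : Q in 𝓝 p, 0 < q.1 := (isOpen_lt continuous_const (by fun_prop)).mem_nhds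
          (lt_of_le_of_ne hcell.1.1 (Ne.symm h2))
        have o2 : ∀ᶠ q : Q in 𝓝 p, 0 < q.2.1 := (isOpen_lt continuous_const (by fun_prop)).mem_nhds
          (lt_of_le_of_ne hcell.2.1 (Ne.symm h3))
        have o3 : ∀ᶠ q : Q in 𝓝 p, q.1 < 1 := (isOpen_lt (by fun_prop) continuous_const).mem_nhds
          hcell.1.2
        have o4 : ∀ᶠ q : Q in 𝓝 p, q.2.1 < 1 := (isOpen_lt (by fun_prop) continuous_const).mem_nhds
          hcell.2.2
        have o5 : ∀ᶠ q : Q in 𝓝 p, |q.2.2| < m.b :=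
          (isOpen_lt (by fun_prop) continuous_const).mem_nhds hz
        filter_upwards [o1, o2, o3, o4, o5] with q q1 q2 q3 q4 q5
        simp only [hg, hp]
        rw [← Finset.sum_mul, sum_bumpQ ⟨⟨q1.le, q3⟩, q2.le, q4⟩ q5.le, one_mul]
      have hfd : fderiv ℝ h p = ∑ T ∈ quad, fderiv ℝ (fun q => g (q + tr T.1 T.2)) p := by
        rw [← hev.fderiv_eq]
        exact fderiv_fun_sum fun T _ => (h1 T).1
      rw [Finset.sum_congr rfl fun (T : ℤ × ℤ) _ => m.defect_tr g p T.1 T.2]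
      unfold defect
      rw [hfd, Finset.sum_sub_distrib, ← Finset.mul_sum, ← Finset.mul_sum]
      simp only [sum_apply]
    · have hC : p ∉ m.C := fun hC => by
        have := (m.mem_C_iff.1 hC).2
        have h6 : |p.2.2| = m.b := le_antisymm this (not_lt.1 hz)
        rcases (abs_eq m.b_pos.le).1 h6 with h | h; exacts [h4 h, h5 h]
      rw [m.defect_off h hC]
      exact Finset.sum_eq_zero fun T _ => m.defect_off g fun h => hC (m.C_tr.1 h)
  refine ⟨i4.congr hfin, ?_⟩
  rw [← integral_congr_ae hfin, ← e4, integral_congr_ae hae, e3]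

end Mod

open scoped RealInnerProductSpace

/-- The ambient space. -/
abbrev V := EuclideanSpace ℝ (Fin 4)

/-- The cone over a map to the sphere. -/
noncomputable def coneOf (Ψ : Q → V) (x : Q × ℝ) : V := Real.exp x.2 • Ψ x.1

namespace Mod

lemma W_ne_zero (m : Mod) (q : Q) : m.W q ≠ 0 := by
  intro h
  have h2 : q ∈ m.Λ := m.Wz_eq_zero (by rw [h]; rfl)
  obtain ⟨i, k, σ, hσ, h3, h4⟩ := m.leaf_orbit h2
  have h5 := h4 0
  have h6 : HasDerivAt (fun t => q.1 + σ * t) _ 0 := h5.fst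
  have h7 : HasDerivAt (fun t => q.1 + σ * t) (σ * 1) 0 :=
    ((hasDerivAt_id (0 : ℝ)).const_mul σ).const_add _
  have h8 := h6.unique h7
  rw [mul_zero, add_zero, ← h3, h, mul_one] at h8
  rcases hσ with rfl | rfl <;> simp at h8

end Mod

/-- The data needed to insert two copies of the model into an isometric flow of the sphere. -/
structure Ins (m : Mod) where
  A : V →L[ℝ] V
  inner_A : ∀ x, ⟪A x, x⟫ = 0
  A_ne : ∀ x, x ≠ 0 → A x ≠ 0
  integral_A : ∀ (K : NNReal) (g : V → ℝ), LipschitzWith K g → HasCompactSupport g →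
    ∫ z, fderiv ℝ g z (A z) = 0
  R : ℝ → V →L[ℝ] V
  R_zero : ∀ x, R 0 x = x
  norm_R : ∀ t x, ‖R t x‖ = ‖x‖
  hasDerivAt_R : ∀ x t, HasDerivAt (fun s => R s x) (A (R t x)) t
  κ : ℝ
  κ_pos : 0 < κ
  Ψ : Bool → Q → V
  contDiff_Ψ : ∀ j, ContDiff ℝ 2 (Ψ j)
  norm_Ψ : ∀ j q, ‖Ψ j q‖ = 1
  Ψ_tr : ∀ j q k n, Ψ j (q + tr k n) = Ψ j q
  Ψ_up : ∀ j q t, Ψ j (q + (0, 0, t)) = R t (Ψ j q)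
  U : Set Q
  isOpen_U : IsOpen U
  C_subset : m.C ⊆ U
  inj : ∀ j j' q q', q ∈ U → q' ∈ U → Ψ j q = Ψ j' q' → j = j' ∧ ∃ k n, q' = q + tr k n
  hasFDerivAt_cone : ∀ j q σ, q ∈ U → ∃ L : (Q × ℝ) ≃L[ℝ] V,
    HasFDerivAt (coneOf (Ψ j)) (L : Q × ℝ →L[ℝ] V) (q, σ)
  cov : ∀ j (S : Set (Q × ℝ)), MeasurableSet S → S ⊆ U ×ˢ univ → InjOn (coneOf (Ψ j)) S →
    Measure.map (coneOf (Ψ j)) ((volume.restrict S).withDensity fun x =>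
      ENNReal.ofReal (κ * (Real.exp (4 * x.2) * m.w x.1))) = volume.restrict (coneOf (Ψ j) '' S)
  p : ℝ × ℝ
  p_mem : p ∈ F
  trapped : ∀ t, 0 ≤ t → m.Φ.φ t (p.1, p.2, -m.b) ∈ m.C
  axis : ∀ x : V, ‖x‖ = 1 → ∀ T > 0, R T x = x → ∃ j s, R s x = Ψ j (p.1, p.2, -m.b)

namespace Ins
variable {m : Mod} (I : Ins m)

lemma contDiff_cone (j : Bool) : ContDiff ℝ 2 (coneOf (I.Ψ j)) := by
  have := I.contDiff_Ψ j
  unfold coneOf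
  fun_prop

lemma norm_cone (j : Bool) (x : Q × ℝ) : ‖coneOf (I.Ψ j) x‖ = Real.exp x.2 := by
  rw [coneOf, norm_smul, I.norm_Ψ, mul_one, Real.norm_eq_abs, abs_of_pos (Real.exp_pos _)]

lemma cone_inj {j j' : Bool} {x x' : Q × ℝ} (h : coneOf (I.Ψ j) x = coneOf (I.Ψ j') x') :
    x.2 = x'.2 ∧ I.Ψ j x.1 = I.Ψ j' x'.1 := by
  have h1 : x.2 = x'.2 := by
    have := congrArg norm h
    rw [I.norm_cone, I.norm_cone] at this
    exact Real.exp_injective this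
  refine ⟨h1, ?_⟩
  unfold coneOf at h
  rw [h1] at h
  exact smul_right_injective V (Real.exp_pos _).ne' h

/-- The part of the space occupied by the plugs. -/
def coneC : Set V := {z | ∃ jq : Bool × Q, jq.2 ∈ m.C ∧ z = ‖z‖ • I.Ψ jq.1 jq.2}

open Classical in
/-- A function on the space glued from functions on the charts. -/
noncomputable def glue {Y : Type*} [Zero Y] (f : Bool → Q → Y) (z : V) : Y :=
  if h : z ∈ I.coneC then f (Exists.choose h).1 (Exists.choose h).2 else 0

lemma glue_off {Y : Type*} [Zero Y] (f : Bool → Q → Y) {z : V} (h : z ∉ I.coneC) :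
    I.glue f z = 0 := dif_neg h

lemma cone_mem_coneC {j : Bool} {q : Q} (hq : q ∈ I.U) (σ : ℝ) :
    coneOf (I.Ψ j) (q, σ) ∈ I.coneC ↔ q ∈ m.C := by
  constructor
  · rintro ⟨⟨j', q'⟩, h1, h2⟩
    rw [I.norm_cone] at h2
    obtain ⟨-, h3⟩ := I.cone_inj (x := (q, σ)) (x' := (q', σ)) h2
    obtain ⟨-, k, n, h4⟩ := I.inj _ _ _ _ hq (I.C_subset h1) h3
    simp only at h4 h1
    rw [h4] at h1
    exact m.C_tr.1 h1
  · intro h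
    exact ⟨(j, q), h, by rw [I.norm_cone]; rfl⟩

lemma glue_cone {Y : Type*} [Zero Y] {f : Bool → Q → Y}
    (hf : ∀ j q k n, f j (q + tr k n) = f j q) (h0 : ∀ j q, q ∉ m.C → f j q = 0)
    {j : Bool} {q : Q} (hq : q ∈ I.U) (σ : ℝ) : I.glue f (coneOf (I.Ψ j) (q, σ)) = f j q := by
  by_cases h : q ∈ m.C
  · have h' := (I.cone_mem_coneC (j := j) hq σ).2 h
    unfold glue
    rw [dif_pos h']
    obtain ⟨h1, h2⟩ := Exists.choose_spec h'
    generalize Exists.choose h' = jq at h1 h2 ⊢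
    obtain ⟨j', q'⟩ := jq
    rw [I.norm_cone] at h2
    obtain ⟨-, h3⟩ := I.cone_inj (x := (q, σ)) (x' := (q', σ)) h2
    obtain ⟨rfl, k, n, h4⟩ := I.inj _ _ _ _ hq (I.C_subset h1) h3
    simp only at h4 ⊢
    rw [h4, hf]
  · rw [I.glue_off f (fun h' => h ((I.cone_mem_coneC hq σ).1 h')), h0 _ _ h]

lemma isClosed_coneC : IsClosed I.coneC := by
  set K : Set Q := m.C ∩ Icc 0 1 ×ˢ (Icc 0 1 ×ˢ Icc (-m.b) m.b) with hK
  have hC : IsClosed m.C := by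
    have c1 : Continuous fun p : Q => 4 * sn p.1 ^ 2 * sn p.2.1 ^ 2 := by
      have := continuous_sn; fun_prop
    have c2 : Continuous fun p : Q => |p.2.2| := by fun_prop
    exact (isClosed_le c1 continuous_const).inter (isClosed_le c2 continuous_const)
  have hKc : IsCompact K :=
    (isCompact_Icc.prod (isCompact_Icc.prod isCompact_Icc)).inter_left hC
  have : CompactSpace (Bool × K) := by
    have := isCompact_iff_compactSpace.1 hKc
    infer_instance
  have e : I.coneC = Prod.fst '' {x : V × (Bool × K) | x.1 = ‖x.1‖ • I.Ψ x.2.1 x.2.2} := by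
    ext z
    constructor
    · rintro ⟨⟨j, q⟩, h1, h2⟩
      set q' : Q := q + tr (-⌊q.1⌋) (-⌊q.2.1⌋) with hq'
      have hq1 : q'.1 = Int.fract q.1 := by
        simp [hq', tr, Int.fract, sub_eq_add_neg]
      have hq2 : q'.2.1 = Int.fract q.2.1 := by
        simp [hq', tr, Int.fract, sub_eq_add_neg]
      have hq3 : q'.2.2 = q.2.2 := by simp [hq', tr]
      have hm : q' ∈ K := by
        refine ⟨m.C_tr.2 h1, ?_, ?_, ?_⟩
        · rw [hq1]; exact ⟨Int.fract_nonneg _, (Int.fract_lt_one _).le⟩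
        · rw [hq2]; exact ⟨Int.fract_nonneg _, (Int.fract_lt_one _).le⟩
        · rw [hq3]; exact abs_le.1 h1.2
      refine ⟨(z, j, ⟨q', hm⟩), ?_, rfl⟩
      change z = ‖z‖ • I.Ψ j q'
      rw [hq', I.Ψ_tr]; exact h2
    · rintro ⟨⟨z', j, q⟩, h1, rfl⟩
      exact ⟨(j, q), q.2.1, h1⟩
  rw [e]
  refine isClosedMap_fst_of_compactSpace _ (isClosed_eq continuous_fst ?_)
  have hc : Continuous fun x : Bool × Q => I.Ψ x.1 x.2 := by
    rw [continuous_prod_of_discrete_left]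
    exact fun j => (I.contDiff_Ψ j).continuous
  have hc' : Continuous fun x : V × (Bool × K) => I.Ψ x.2.1 x.2.2 :=
    hc.comp (f := fun x : V × (Bool × K) => (x.2.1, (x.2.2 : Q))) (by fun_prop)
  exact (continuous_norm.comp continuous_fst).smul hc'

lemma exists_cone_of_mem {z : V} (hz : z ≠ 0) (h : z ∈ I.coneC) :
    ∃ j q σ, q ∈ m.C ∧ z = coneOf (I.Ψ j) (q, σ) := by
  obtain ⟨⟨j, q⟩, h1, h2⟩ := h
  exact ⟨j, q, Real.log ‖z‖, h1, by
    rw [coneOf, Real.exp_log (norm_pos_iff.2 hz)]; exact h2⟩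

lemma contDiffAt_glue {Y : Type*} [NormedAddCommGroup Y] [NormedSpace ℝ Y] {f : Bool → Q → Y}
    (hf : ∀ j q k n, f j (q + tr k n) = f j q) (h0 : ∀ j q, q ∉ m.C → f j q = 0)
    (hc : ∀ j, ContDiff ℝ 1 (f j)) {z : V} (hz : z ≠ 0) : ContDiffAt ℝ 1 (I.glue f) z := by
  by_cases h : z ∈ I.coneC
  · obtain ⟨j, q, σ, hq, rfl⟩ := I.exists_cone_of_mem hz h
    obtain ⟨L, hL⟩ := I.hasFDerivAt_cone j q σ (I.C_subset hq)
    have c1 : ContDiffAt ℝ 1 (coneOf (I.Ψ j)) (q, σ) :=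
      ((I.contDiff_cone j).of_le one_le_two).contDiffAt
    set G := c1.localInverse hL one_ne_zero with hG
    have hG0 : G (coneOf (I.Ψ j) (q, σ)) = (q, σ) := c1.localInverse_apply_image hL one_ne_zero
    have hGc : ContDiffAt ℝ 1 G (coneOf (I.Ψ j) (q, σ)) := c1.to_localInverse hL one_ne_zero
    have hr : ∀ᶠ z in 𝓝 (coneOf (I.Ψ j) (q, σ)), coneOf (I.Ψ j) (G z) = z :=
      (c1.hasStrictFDerivAt' hL one_ne_zero).eventually_right_inverse
    have hU : ∀ᶠ z in 𝓝 (coneOf (I.Ψ j) (q, σ)), (G z).1 ∈ I.U := by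
      have : Tendsto (fun z => (G z).1) (𝓝 (coneOf (I.Ψ j) (q, σ))) (𝓝 q) := by
        have h1 := hGc.continuousAt.fst
        have h2 : (G (coneOf (I.Ψ j) (q, σ))).1 = q := by rw [hG0]
        have h3 : Tendsto (fun z => (G z).1) (𝓝 (coneOf (I.Ψ j) (q, σ)))
          (𝓝 (G (coneOf (I.Ψ j) (q, σ))).1) := h1
        rwa [h2] at h3
      exact this (I.isOpen_U.mem_nhds (I.C_subset hq))
    have hev : I.glue f =ᶠ[𝓝 (coneOf (I.Ψ j) (q, σ))] fun z => f j (G z).1 := by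
      filter_upwards [hr, hU] with z h1 h2
      conv_lhs => rw [← h1]
      exact I.glue_cone hf h0 h2 _
    refine ContDiffAt.congr_of_eventuallyEq ?_ hev
    exact (hc j).contDiffAt.comp _ hGc.fst
  · have hev : I.glue f =ᶠ[𝓝 z] fun _ => 0 := by
      filter_upwards [I.isClosed_coneC.isOpen_compl.mem_nhds h] with z hz
      exact I.glue_off f hz
    exact contDiffAt_const.congr_of_eventuallyEq hev

lemma fderiv_Ψ_tr (j : Bool) (q : Q) (k n : ℤ) :
    fderiv ℝ (I.Ψ j) (q + tr k n) = fderiv ℝ (I.Ψ j) q := by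
  rw [← fderiv_comp_add_right]
  simp_rw [I.Ψ_tr]

/-- The modification of the base field in the charts. -/
noncomputable def dW (j : Bool) (q : Q) : V := fderiv ℝ (I.Ψ j) q (m.W q - (0, 0, 1))

lemma dW_tr (j : Bool) (q : Q) (k n : ℤ) : I.dW j (q + tr k n) = I.dW j q := by
  unfold dW; rw [I.fderiv_Ψ_tr, m.W_tr]

lemma dW_off (j : Bool) (q : Q) (h : q ∉ m.C) : I.dW j q = 0 := by
  unfold dW; rw [m.W_off h, sub_self, map_zero]

lemma contDiff_dW (j : Bool) : ContDiff ℝ 1 (I.dW j) := by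
  have h1 : ContDiff ℝ 1 (fderiv ℝ (I.Ψ j)) := (I.contDiff_Ψ j).fderiv_right (by norm_num)
  have h2 := m.contDiff_W
  exact h1.clm_apply (h2.sub contDiff_const)

/-- A radial cutoff. -/
noncomputable def η (z : V) : ℝ := (⟨1 / 2, 3 / 4, by norm_num, by norm_num⟩ : ContDiffBump (1 : ℝ)) (‖z‖ ^ 2)

lemma contDiff_η : ContDiff ℝ 2 η := by
  unfold η
  exact (ContDiffBump.contDiff _).comp (contDiff_id.norm_sq ℝ)

lemma η_eq_one {z : V} (h : |‖z‖ ^ 2 - 1| ≤ 1 / 2) : η z = 1 :=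
  ContDiffBump.one_of_mem_closedBall _ (by
    rw [Metric.mem_closedBall, Real.dist_eq]; exact h)

lemma η_eq_zero {z : V} (h : 3 / 4 ≤ |‖z‖ ^ 2 - 1|) : η z = 0 :=
  ContDiffBump.zero_of_le_dist _ (by simpa [Real.dist_eq] using h)

lemma η_sphere {z : V} (h : ‖z‖ = 1) : η z = 1 := η_eq_one (by rw [h]; norm_num)

lemma hasCompactSupport_η : HasCompactSupport η := by
  refine HasCompactSupport.of_support_subset_isCompact (isCompact_closedBall (0 : V) 2) fun z hz => ?_
  rw [mem_closedBall_zero_iff]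
  by_contra! h
  refine hz (η_eq_zero ?_)
  rw [abs_of_nonneg] <;> nlinarith

/-- The vector field with the plugs inserted. -/
noncomputable def X (z : V) : V := η z • (I.A z + ‖z‖ • I.glue I.dW z)

lemma contDiff_X : ContDiff ℝ 1 I.X := by
  rw [contDiff_iff_contDiffAt]
  intro z
  have hη : ContDiff ℝ 1 η := contDiff_η.of_le one_le_two
  by_cases hz : z = 0
  · have hev : I.X =ᶠ[𝓝 z] fun _ => 0 := by
      filter_upwards [Metric.ball_mem_nhds z (ε := 1 / 2) (by norm_num)] with y hy
      rw [hz, mem_ball_zero_iff] at hy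
      have h0 := norm_nonneg y
      unfold X
      rw [η_eq_zero, zero_smul]
      rw [abs_of_nonpos] <;> nlinarith
    exact contDiffAt_const.congr_of_eventuallyEq hev
  · have h1 : ContDiffAt ℝ 1 (I.glue I.dW) z := I.contDiffAt_glue I.dW_tr I.dW_off I.contDiff_dW hz
    exact hη.contDiffAt.smul (I.A.contDiff.contDiffAt.add ((contDiffAt_norm ℝ hz).smul h1))

lemma hasCompactSupport_X : HasCompactSupport I.X := hasCompactSupport_η.smul_right

lemma fderiv_Ψ_z (j : Bool) (q : Q) : fderiv ℝ (I.Ψ j) q (0, 0, 1) = I.A (I.Ψ j q) := by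
  have h1 : HasDerivAt (fun t : ℝ => q + (0, 0, t)) ((0, 0, 1) : Q) 0 :=
    (Mod.hasDerivAt_vert 0).const_add q
  have h2 : HasFDerivAt (I.Ψ j) (fderiv ℝ (I.Ψ j) q) (q + (0, 0, (0 : ℝ))) := by
    have : q + (0, 0, (0 : ℝ)) = q := by ext <;> simp
    rw [this]
    exact ((I.contDiff_Ψ j).differentiable two_ne_zero q).hasFDerivAt
  have h3 := h2.comp_hasDerivAt (0 : ℝ) h1
  have h4 := I.hasDerivAt_R (I.Ψ j q) 0
  rw [I.R_zero] at h4
  refine h3.unique (h4.congr_of_eventuallyEq (Eventually.of_forall fun t => ?_))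
  exact I.Ψ_up j q t

lemma fderiv_Ψ_inner (j : Bool) (q v : Q) : ⟪fderiv ℝ (I.Ψ j) q v, I.Ψ j q⟫ = 0 := by
  have h1 : HasFDerivAt (I.Ψ j) (fderiv ℝ (I.Ψ j) q) q :=
    ((I.contDiff_Ψ j).differentiable two_ne_zero q).hasFDerivAt
  have h2 : HasFDerivAt (fun q => ‖I.Ψ j q‖ ^ 2) _ q := h1.norm_sq
  have h3 : (fun q => ‖I.Ψ j q‖ ^ 2) = fun _ => (1 : ℝ) := by
    funext q; rw [I.norm_Ψ]; norm_num
  rw [h3] at h2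
  have h4 := congrArg (fun L : Q →L[ℝ] ℝ => L v) (h2.unique (hasFDerivAt_const _ _))
  simp at h4
  rw [real_inner_comm]; exact h4

lemma inner_X (z : V) : ⟪I.X z, z⟫ = 0 := by
  unfold X
  rw [inner_smul_left, inner_add_left, inner_smul_left, I.inner_A]
  suffices h : ⟪I.glue I.dW z, z⟫ = 0 by rw [h]; simp
  by_cases h : z ∈ I.coneC
  · obtain ⟨⟨j, q⟩, h1, h2⟩ := h
    simp only at h1 h2
    by_cases hz : z = 0
    · rw [hz, inner_zero_right]
    · have h3 : z = coneOf (I.Ψ j) (q, Real.log ‖z‖) := by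
        rw [coneOf, Real.exp_log (norm_pos_iff.2 hz)]; exact h2
      rw [h3, I.glue_cone I.dW_tr I.dW_off (I.C_subset h1), coneOf, inner_smul_right, dW,
        I.fderiv_Ψ_inner, mul_zero]
  · rw [I.glue_off _ h, inner_zero_left]

lemma X_cone (j : Bool) {q : Q} (hq : q ∈ I.U) (σ : ℝ) :
    I.X (coneOf (I.Ψ j) (q, σ)) =
      η (coneOf (I.Ψ j) (q, σ)) • Real.exp σ • fderiv ℝ (I.Ψ j) q (m.W q) := by
  unfold X
  rw [I.glue_cone I.dW_tr I.dW_off hq, I.norm_cone, dW, map_sub, I.fderiv_Ψ_z]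
  congr 1
  rw [smul_sub, coneOf, map_smul]
  abel

lemma X_sphere (j : Bool) {q : Q} (hq : q ∈ I.U) :
    I.X (I.Ψ j q) = fderiv ℝ (I.Ψ j) q (m.W q) := by
  have := I.X_cone j hq 0
  have e : coneOf (I.Ψ j) (q, 0) = I.Ψ j q := by simp [coneOf]
  rw [e, η_sphere (I.norm_Ψ j q)] at this
  simpa using this

lemma fderiv_Ψ_ne (j : Bool) {q : Q} (hq : q ∈ I.U) {v : Q} (hv : v ≠ 0) :
    fderiv ℝ (I.Ψ j) q v ≠ 0 := by
  obtain ⟨L, hL⟩ := I.hasFDerivAt_cone j q 0 hq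
  have h1 : HasFDerivAt (I.Ψ j) (fderiv ℝ (I.Ψ j) q) q :=
    ((I.contDiff_Ψ j).differentiable two_ne_zero q).hasFDerivAt
  have h2 : HasFDerivAt (fun q : Q => (q, (0 : ℝ))) (ContinuousLinearMap.inl ℝ Q ℝ) q :=
    hasFDerivAt_prodMk_left q 0
  have h3 := hL.comp q h2
  have e : coneOf (I.Ψ j) ∘ (fun q : Q => (q, (0 : ℝ))) = I.Ψ j := by
    funext q; simp [coneOf]
  rw [e] at h3
  rw [h1.unique h3]
  intro h
  have h4 : L (v, 0) = 0 := h
  have h5 := L.injective (h4.trans (map_zero L).symm)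
  exact hv (congrArg Prod.fst h5)

lemma X_off {z : V} (hz : z ∉ I.coneC) : I.X z = η z • I.A z := by
  unfold X; rw [I.glue_off _ hz, smul_zero, add_zero]

lemma X_ne_zero {z : V} (hz : ‖z‖ = 1) : I.X z ≠ 0 := by
  have hz0 : z ≠ 0 := by rw [← norm_pos_iff, hz]; exact one_pos
  by_cases h : z ∈ I.coneC
  · obtain ⟨⟨j, q⟩, h1, h2⟩ := h
    rw [hz, one_smul] at h2
    rw [h2]
    simp only at h1 ⊢
    rw [I.X_sphere j (I.C_subset h1)]
    exact I.fderiv_Ψ_ne j (I.C_subset h1) (m.W_ne_zero q)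
  · rw [I.X_off h, η_sphere hz, one_smul]
    exact I.A_ne z hz0

/-- The flow of the modified field. -/
noncomputable def Φ : Flow I.X := by
  have h1 := I.contDiff_X.lipschitzWith_of_hasCompactSupport I.hasCompactSupport_X one_ne_zero
  have h2 := I.contDiff_X.continuous.bounded_above_of_compact_support I.hasCompactSupport_X
  exact (nonempty_flow h1.choose_spec h2.choose_spec).some

lemma norm_Φ (t : ℝ) (z : V) : ‖I.Φ.φ t z‖ = ‖z‖ := by
  have h : ∀ t, HasDerivAt (fun t => ‖I.Φ.φ t z‖ ^ 2) 0 t := fun t => by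
    have h1 := (I.Φ.hasDerivAt z t).norm_sq
    rw [real_inner_comm, I.inner_X, mul_zero] at h1
    exact h1
  have h2 := is_const_of_deriv_eq_zero (fun t => (h t).differentiableAt) (fun t => (h t).deriv) t 0
  rw [I.Φ.zero] at h2
  exact (pow_left_inj₀ (norm_nonneg _) (norm_nonneg _) two_ne_zero).1 h2

end Ins

namespace Ins
variable {m : Mod} (I : Ins m)

lemma follow {γ : ℝ → V} (hγ : ∀ t, HasDerivAt γ (I.X (γ t)) t) {t₀ : ℝ} {j : Bool} {q : Q}
    (h0 : γ t₀ = I.Ψ j q) {a b : ℝ} (ha : a < 0) (hb : 0 < b)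
    (hU : ∀ s ∈ Ioo a b, m.Φ.φ s q ∈ I.U) {s : ℝ} (hs : s ∈ Ioo a b) :
    γ (t₀ + s) = I.Ψ j (m.Φ.φ s q) := by
  refine ODE_solution_unique_of_mem_Ioo (v := fun _ => I.X) (s := fun _ => univ) (K := I.Φ.K)
    (a := a) (b := b) (t₀ := 0) (f := fun s => γ (t₀ + s)) (g := fun s => I.Ψ j (m.Φ.φ s q))
    (fun _ _ => I.Φ.lip.lipschitzOnWith) ⟨ha, hb⟩
    (fun t ht => ⟨(hγ (t₀ + t)).comp_const_add t₀ t, mem_univ _⟩)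
    (fun t ht => ⟨?_, mem_univ _⟩) ?_ hs
  · rw [I.X_sphere j (hU t ht)]
    exact ((I.contDiff_Ψ j).differentiable two_ne_zero _).hasFDerivAt.comp_hasDerivAt t
      (m.Φ.hasDerivAt q t)
  · simp only [add_zero, m.Φ.zero, h0]

lemma exists_nhds {q : Q} (hq : q ∈ I.U) :
    ∃ δ > 0, ∀ s ∈ Ioo (-δ) δ, m.Φ.φ s q ∈ I.U := by
  have h : ∀ᶠ s in 𝓝 (0 : ℝ), m.Φ.φ s q ∈ I.U :=
    (m.Φ.continuous_time q).continuousAt (I.isOpen_U.mem_nhds (by rwa [m.Φ.zero]))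
  obtain ⟨δ, h1, h2⟩ := Metric.eventually_nhds_iff.1 h
  refine ⟨δ, h1, fun s hs => h2 ?_⟩
  rw [Real.dist_eq, sub_zero, abs_lt]; exact hs

section periodic
variable {γ : ℝ → V} (hγ : ∀ t, HasDerivAt γ (I.X (γ t)) t) {T : ℝ} (hT : 0 < T)
  (hp : ∀ t, γ (t + T) = γ t)
include hγ hT hp

lemma not_trapped_fwd {t₀ : ℝ} {j : Bool} {q : Q} (h0 : γ t₀ = I.Ψ j q)
    (h : ∀ t, 0 ≤ t → m.Φ.φ t q ∈ m.C) : False := by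
  have hq : q ∈ I.U := I.C_subset (by have := h 0 le_rfl; rwa [m.Φ.zero] at this)
  obtain ⟨δ, h1, h2⟩ := I.exists_nhds hq
  have h3 := I.follow hγ h0 (a := -δ) (b := T + 1) (by linarith) (by linarith) (fun s hs => by
    rcases lt_or_ge s 0 with h4 | h4
    · exact h2 s ⟨hs.1, by linarith⟩
    · exact I.C_subset (h s h4)) (s := T) ⟨by linarith, by linarith⟩
  rw [hp, h0] at h3
  obtain ⟨-, k, n, h4⟩ := I.inj _ _ _ _ hq (I.C_subset (h T hT.le)) h3
  exact m.not_closed hT k n h4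

lemma not_trapped_bwd {t₀ : ℝ} {j : Bool} {q : Q} (h0 : γ t₀ = I.Ψ j q)
    (h : ∀ t, 0 ≤ t → m.Φ.φ (-t) q ∈ m.C) : False := by
  have hq : q ∈ I.U := I.C_subset (by have := h 0 le_rfl; rwa [neg_zero, m.Φ.zero] at this)
  obtain ⟨δ, h1, h2⟩ := I.exists_nhds hq
  have h3 := I.follow hγ h0 (a := -(T + 1)) (b := δ) (by linarith) (by linarith) (fun s hs => by
    rcases lt_or_ge s 0 with h4 | h4
    · have := h (-s) (by linarith); rw [neg_neg] at this
      exact I.C_subset this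
    · exact h2 s ⟨by linarith, hs.2⟩) (s := -T) ⟨by linarith, by linarith⟩
  have h5 := hp (t₀ + -T)
  rw [neg_add_cancel_right, h0] at h5
  rw [← h5] at h3
  obtain ⟨-, k, n, h4⟩ := I.inj _ _ _ _ (I.C_subset (h T hT.le)) hq h3.symm
  refine m.not_closed hT (p := m.Φ.φ (-T) q) k n ?_
  rw [m.Φ.apply_neg]
  exact h4

lemma esc_of_mem {t₀ : ℝ} {j : Bool} {q : Q} (h0 : γ t₀ = I.Ψ j q) (hq : q ∈ m.C) : m.Esc q := by
  by_contra h
  exact I.not_trapped_bwd hγ hT hp h0 fun t ht => m.bwd_mem_C hq h ht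

end periodic

open Classical in
/-- The displacement that straightens the orbits which are not trapped backwards. -/
noncomputable def str (j : Bool) (q : Q) : V :=
  if m.Esc q then I.Ψ j ((m.P q).1, (m.P q).2, q.2.2) - I.Ψ j q else 0

lemma str_tr (j : Bool) (q : Q) (k n : ℤ) : I.str j (q + tr k n) = I.str j q := by
  have e : m.Esc (q + tr k n) ↔ m.Esc q := by
    refine ⟨fun h => ?_, fun h => m.esc_tr h k n⟩
    have h1 := m.esc_tr h (-k) (-n)
    have e : q + tr k n + tr (-k) (-n) = q := by ext <;> simp [tr]
    rwa [e] at h1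
  unfold str
  by_cases h : m.Esc q
  · rw [if_pos h, if_pos (e.2 h), m.P_tr h, I.Ψ_tr]
    have : (((m.P q + ((k : ℝ), (n : ℝ))).1, (m.P q + ((k : ℝ), (n : ℝ))).2, (q + tr k n).2.2) : Q) =
        ((m.P q).1, (m.P q).2, q.2.2) + tr k n := by ext <;> simp [tr]
    rw [this, I.Ψ_tr]
  · rw [if_neg h, if_neg (fun h1 => h (e.1 h1))]

lemma str_off (j : Bool) (q : Q) (h : q ∉ m.C) : I.str j q = 0 := by
  unfold str
  split_ifs with h1
  · rw [m.P_of_notMem_C h h1]; exact sub_self _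
  · rfl

/-- The change of speed of the straightened orbits. -/
noncomputable def spd (_ : Bool) (q : Q) : ℝ := (m.W q).2.2 - 1

omit I in
lemma spd_tr (j : Bool) (q : Q) (k n : ℤ) : spd (m := m) j (q + tr k n) = spd (m := m) j q := by
  unfold spd; rw [m.W_tr]

omit I in
lemma spd_off (j : Bool) (q : Q) (h : q ∉ m.C) : spd (m := m) j q = 0 := by
  unfold spd; rw [m.W_off h]; simp

omit I in
lemma contDiff_spd (j : Bool) : ContDiff ℝ 1 (spd (m := m) j) := by
  have h : ContDiff ℝ 1 fun q => (m.W q).2.2 := m.contDiff_W.snd.snd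
  exact h.sub contDiff_const

lemma glue_Ψ {Y : Type*} [Zero Y] {f : Bool → Q → Y}
    (hf : ∀ j q k n, f j (q + tr k n) = f j q) (h0 : ∀ j q, q ∉ m.C → f j q = 0)
    {j : Bool} {q : Q} (hq : q ∈ I.U) : I.glue f (I.Ψ j q) = f j q := by
  have e : coneOf (I.Ψ j) (q, 0) = I.Ψ j q := by simp [coneOf]
  rw [← I.glue_cone hf h0 hq 0, e]

lemma exists_of_mem {z : V} (hz : ‖z‖ = 1) (h : z ∈ I.coneC) : ∃ j q, q ∈ m.C ∧ z = I.Ψ j q := by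
  obtain ⟨⟨j, q⟩, h1, h2⟩ := h
  exact ⟨j, q, h1, by rwa [hz, one_smul] at h2⟩

lemma up_eq (j : Bool) (p : ℝ × ℝ) (z : ℝ) : I.Ψ j (p.1, p.2, z) = I.R z (I.Ψ j (p.1, p.2, 0)) := by
  rw [← I.Ψ_up]; simp

section periodic
variable {γ : ℝ → V} (hγ : ∀ t, HasDerivAt γ (I.X (γ t)) t) (hn : ∀ t, ‖γ t‖ = 1) {T : ℝ}
  (hT : 0 < T) (hp : ∀ t, γ (t + T) = γ t)
include hγ hn hT hp

lemma str_spec (t : ℝ) :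
    (γ t ∉ I.coneC ∧ γ t + I.glue I.str (γ t) = γ t ∧ 1 + I.glue (spd (m := m)) (γ t) = 1) ∨
    ∃ j q, q ∈ m.C ∧ m.Esc q ∧ γ t = I.Ψ j q ∧
      γ t + I.glue I.str (γ t) = I.Ψ j ((m.P q).1, (m.P q).2, q.2.2) ∧
      1 + I.glue (spd (m := m)) (γ t) = (m.W q).2.2 := by
  by_cases h : γ t ∈ I.coneC
  · obtain ⟨j, q, h1, h2⟩ := I.exists_of_mem (hn t) h
    have hE := I.esc_of_mem hγ hT hp h2 h1
    refine Or.inr ⟨j, q, h1, hE, h2, ?_, ?_⟩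
    · rw [h2, I.glue_Ψ I.str_tr I.str_off (I.C_subset h1), str, if_pos hE]; abel
    · rw [h2, I.glue_Ψ spd_tr spd_off (I.C_subset h1), spd]; ring
  · exact Or.inl ⟨h, by rw [I.glue_off _ h, add_zero], by rw [I.glue_off _ h, add_zero]⟩

lemma norm_str (t : ℝ) : ‖γ t + I.glue I.str (γ t)‖ = 1 := by
  rcases I.str_spec hγ hn hT hp t with ⟨-, h, -⟩ | ⟨j, q, -, -, -, h, -⟩
  · rw [h, hn]
  · rw [h, I.norm_Ψ]

lemma spd_pos (t : ℝ) : 0 < 1 + I.glue (spd (m := m)) (γ t) := by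
  rcases I.str_spec hγ hn hT hp t with ⟨-, -, h⟩ | ⟨j, q, -, h1, -, -, h⟩
  · rw [h]; exact one_pos
  · rw [h]; exact m.Wz_pos_of_esc h1

omit hT hp in
lemma continuous_spd : Continuous fun t => 1 + I.glue (spd (m := m)) (γ t) := by
  refine continuous_const.add (continuous_iff_continuousAt.2 fun t => ?_)
  have h0 : γ t ≠ 0 := by rw [← norm_pos_iff, hn]; exact one_pos
  have h1 : ContDiffAt ℝ 1 (I.glue (spd (m := m))) (γ t) :=
    I.contDiffAt_glue spd_tr spd_off contDiff_spd h0
  exact h1.continuousAt.comp (hγ t).continuousAt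

lemma hasDerivAt_str (t : ℝ) : HasDerivAt (fun t => γ t + I.glue I.str (γ t))
    ((1 + I.glue (spd (m := m)) (γ t)) • I.A (γ t + I.glue I.str (γ t))) t := by
  rcases I.str_spec hγ hn hT hp t with ⟨h1, h2, h3⟩ | ⟨j, q, h1, h2, h3, h4, h5⟩
  · rw [h2, h3, one_smul]
    have hd := hγ t
    rw [I.X_off h1, η_sphere (hn t), one_smul] at hd
    refine hd.congr_of_eventuallyEq ?_
    have : ∀ᶠ s in 𝓝 t, γ s ∈ I.coneCᶜ :=
      (hγ t).continuousAt (I.isClosed_coneC.isOpen_compl.mem_nhds h1)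
    filter_upwards [this] with s hs
    rw [I.glue_off _ hs, add_zero]
  · rw [h4, h5]
    obtain ⟨δ, k1, k2⟩ := I.exists_nhds (I.C_subset h1)
    have hz := m.hasDerivAt_z q 0
    rw [m.Φ.zero] at hz
    have hR := I.hasDerivAt_R (I.Ψ j ((m.P q).1, (m.P q).2, 0)) ((m.Φ.φ 0 q).2.2)
    have hd := HasDerivAt.scomp (0 : ℝ) hR hz
    rw [m.Φ.zero, ← I.up_eq j (m.P q)] at hd
    have hd' : HasDerivAt (fun s => I.R ((m.Φ.φ (s - t) q).2.2) (I.Ψ j ((m.P q).1, (m.P q).2, 0)))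
        ((m.W q).2.2 • I.A (I.Ψ j ((m.P q).1, (m.P q).2, q.2.2))) t := by
      have hd2 : HasDerivAt
          (fun s => I.R ((m.Φ.φ s q).2.2) (I.Ψ j ((m.P q).1, (m.P q).2, 0)))
          ((m.W q).2.2 • I.A (I.Ψ j ((m.P q).1, (m.P q).2, q.2.2))) (t - t) := by
        rw [sub_self]; exact hd
      exact hd2.comp_sub_const t t
    refine hd'.congr_of_eventuallyEq ?_
    have hI : ∀ᶠ s in 𝓝 t, s - t ∈ Ioo (-δ) δ := by
      have : Tendsto (fun s => s - t) (𝓝 t) (𝓝 0) := by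
        have hc : Continuous fun s : ℝ => s - t := by fun_prop
        have := hc.tendsto t
        rwa [sub_self] at this
      exact this (Ioo_mem_nhds (by linarith) k1)
    filter_upwards [hI] with s hs
    have e := I.follow hγ h3 (by linarith : -δ < 0) k1 k2 hs
    rw [add_sub_cancel] at e
    have hE := m.esc_φ h2 (s - t)
    rw [e, I.glue_Ψ I.str_tr I.str_off (k2 _ hs), str, if_pos hE, m.P_φ h2, I.up_eq j (m.P q)]
    abel

/-- The modified field has no periodic orbits. -/
theorem no_periodic : False := by
  set δ : ℝ → V := fun t => γ t + I.glue I.str (γ t) with hδ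
  set c : ℝ → ℝ := fun t => 1 + I.glue (spd (m := m)) (γ t) with hc
  have cc : Continuous c := I.continuous_spd hγ hn
  have cp : ∀ t, 0 < c t := I.spd_pos hγ hn hT hp
  have dd : ∀ t, HasDerivAt δ (c t • I.A (δ t)) t := I.hasDerivAt_str hγ hn hT hp
  set τ : ℝ → ℝ := fun t => ∫ s in (0 : ℝ)..t, c s with hτ
  have dτ : ∀ t, HasDerivAt τ (c t) t := fun t =>
    intervalIntegral.integral_hasDerivAt_right (cc.intervalIntegrable _ _)
      (cc.stronglyMeasurableAtFilter _ _) cc.continuousAt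
  have τ0 : τ 0 = 0 := intervalIntegral.integral_same
  have key : ∀ t, δ t = I.R (τ t) (δ 0) := fun t => by
    have hD : ∀ t, HasDerivAt (fun t => ‖δ t - I.R (τ t) (δ 0)‖ ^ 2) 0 t := fun t => by
      have h1 : HasDerivAt (fun t => I.R (τ t) (δ 0)) (c t • I.A (I.R (τ t) (δ 0))) t :=
        HasDerivAt.scomp t (I.hasDerivAt_R (δ 0) (τ t)) (dτ t)
      have h2 := ((dd t).fun_sub h1).norm_sq
      have e : 2 * ⟪δ t - I.R (τ t) (δ 0), c t • I.A (δ t) - c t • I.A (I.R (τ t) (δ 0))⟫ = 0 := by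
        rw [← smul_sub, ← map_sub, inner_smul_right, real_inner_comm, I.inner_A]; ring
      rw [e] at h2; exact h2
    have h2 := is_const_of_deriv_eq_zero (fun t => (hD t).differentiableAt) (fun t => (hD t).deriv) t 0
    simp only [τ0, I.R_zero, sub_self, norm_zero] at h2
    rw [← sub_eq_zero, ← norm_eq_zero]
    exact pow_eq_zero_iff two_ne_zero |>.1 (h2.trans (by norm_num))
  have cT : Function.Periodic c T := fun t => by simp only [hc, hp]
  obtain ⟨t0, -, ht0⟩ := (isCompact_Icc (a := (0 : ℝ)) (b := T)).exists_isMinOn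
    ⟨0, le_rfl, hT.le⟩ cc.continuousOn
  have cl : ∀ t, c t0 ≤ c t := fun t => by
    obtain ⟨s, hs, e⟩ := cT.exists_mem_Ico₀ hT t
    rw [e]; exact ht0 (Ico_subset_Icc_self hs)
  have hmono : Monotone fun t => τ t - c t0 * t := by
    have hd : ∀ t, HasDerivAt (fun t => τ t - c t0 * t) (c t - c t0 * 1) t := fun t =>
      (dτ t).fun_sub ((hasDerivAt_id t).const_mul _)
    refine monotone_of_deriv_nonneg (fun t => (hd t).differentiableAt) fun t => ?_
    rw [(hd t).deriv]; linarith [cl t]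
  have cτ : Continuous τ := continuous_iff_continuousAt.2 fun t => (dτ t).continuousAt
  have hsurj : ∀ s, ∃ t, τ t = s := fun s => by
    have h0 := cp t0
    refine mem_range_of_exists_le_of_exists_ge cτ ⟨-(|s| / c t0), ?_⟩ ⟨|s| / c t0, ?_⟩
    · have := hmono (show -(|s| / c t0) ≤ 0 from neg_nonpos.2 (by positivity))
      simp only [τ0] at this
      have e : c t0 * -(|s| / c t0) = -|s| := by field_simp
      rw [e] at this
      linarith [neg_abs_le s]
    · have := hmono (show 0 ≤ |s| / c t0 by positivity)
      simp only [τ0] at this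
      have e : c t0 * (|s| / c t0) = |s| := by field_simp
      rw [e] at this
      linarith [le_abs_self s]
  have τT : 0 < τ T := by
    have := hmono hT.le
    simp only [τ0] at this
    have := mul_pos (cp t0) hT
    linarith
  have hper : I.R (τ T) (δ 0) = δ 0 := by
    rw [← key]
    have := hp 0
    rw [zero_add] at this
    simp only [hδ, this]
  obtain ⟨j, s, hs⟩ := I.axis (δ 0) (I.norm_str hγ hn hT hp 0) (τ T) τT hper
  obtain ⟨t1, ht1⟩ := hsurj s
  rw [← ht1, ← key] at hs
  have hb := m.b_pos
  have hC : ((I.p.1, I.p.2, -m.b) : Q) ∈ m.C := ⟨I.p_mem, by simp [abs_of_pos hb]⟩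
  refine I.not_trapped_fwd hγ hT hp (t₀ := t1) (j := j) (q := (I.p.1, I.p.2, -m.b)) ?_ I.trapped
  rcases I.str_spec hγ hn hT hp t1 with ⟨h1, h2, h3⟩ | ⟨j', q, h1, h2, h3, h4, h5⟩
  · rw [← h2]; exact hs
  · have h6 : I.Ψ j (I.p.1, I.p.2, -m.b) = I.Ψ j' ((m.P q).1, (m.P q).2, q.2.2) := hs.symm.trans h4
    have hq' : (((m.P q).1, (m.P q).2, q.2.2) : Q) ∈ m.C := ⟨(m.P_mem_F h2).2 h1.1, h1.2⟩
    obtain ⟨rfl, k, n, h7⟩ := I.inj _ _ _ _ (I.C_subset hC) (I.C_subset hq') h6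
    have hz : q.2.2 = -m.b := by
      have := congrArg (fun q : Q => q.2.2) h7
      simpa [tr] using this
    have hP := m.P_of_le hz.le
    rw [hP] at h7
    have h8 : q = (I.p.1, I.p.2, -m.b) + tr k n := h7
    rw [h3, h8, I.Ψ_tr]

end periodic

end Ins

namespace Mod
variable (m : Mod)

lemma isClosed_C : IsClosed m.C := by
  have c1 : Continuous fun p : Q => 4 * sn p.1 ^ 2 * sn p.2.1 ^ 2 := by
    have := continuous_sn; fun_prop
  have c2 : Continuous fun p : Q => |p.2.2| := by fun_prop
  exact (isClosed_le c1 continuous_const).inter (isClosed_le c2 continuous_const)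

/-- A fundamental domain of the plug. -/
def K : Set Q := m.C ∩ cell

lemma measurableSet_K : MeasurableSet m.K := m.isClosed_C.measurableSet.inter measurableSet_cell

lemma K_subset_box : m.K ⊆ box (max 1 m.b) := fun p hp => by
  obtain ⟨⟨-, h1⟩, ⟨h2, h3⟩, h4, h5⟩ := hp
  refine mem_box.2 ⟨?_, ?_, h1.trans (le_max_right _ _)⟩
  · rw [abs_of_nonneg h2]; exact h3.le.trans (le_max_left _ _)
  · rw [abs_of_nonneg h4]; exact h5.le.trans (le_max_left _ _)

lemma integrableOn_K : IntegrableOn m.J m.K := (m.integrableOn_J _).mono_set m.K_subset_box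

lemma exists_tr_mem_cell (q : Q) : ∃ k n, q + tr k n ∈ cell := by
  refine ⟨-⌊q.1⌋, -⌊q.2.1⌋, ?_⟩
  have hq1 : (q + tr (-⌊q.1⌋) (-⌊q.2.1⌋)).1 = Int.fract q.1 := by
    simp [tr, Int.fract, sub_eq_add_neg]
  have hq2 : (q + tr (-⌊q.1⌋) (-⌊q.2.1⌋)).2.1 = Int.fract q.2.1 := by
    simp [tr, Int.fract, sub_eq_add_neg]
  refine ⟨?_, ?_⟩
  · rw [hq1]; exact ⟨Int.fract_nonneg _, Int.fract_lt_one _⟩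
  · rw [hq2]; exact ⟨Int.fract_nonneg _, Int.fract_lt_one _⟩

end Mod

lemma eq_of_mem_cell {q q' : Q} (h : q ∈ cell) (h' : q' ∈ cell) {k n : ℤ} (e : q' = q + tr k n) :
    q' = q := by
  obtain ⟨⟨a1, a2⟩, a3, a4⟩ := h
  obtain ⟨⟨b1, b2⟩, b3, b4⟩ := h'
  have e1 : q'.1 = q.1 + k := by rw [e]; rfl
  have e2 : q'.2.1 = q.2.1 + n := by rw [e]; rfl
  have k0 : k = 0 := by
    have h1 : (-1 : ℝ) < k := by linarith
    have h2 : (k : ℝ) < 1 := by linarith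
    have h1' : -1 < k := by exact_mod_cast h1
    have h2' : k < 1 := by exact_mod_cast h2
    omega
  have n0 : n = 0 := by
    have h1 : (-1 : ℝ) < n := by linarith
    have h2 : (n : ℝ) < 1 := by linarith
    have h1' : -1 < n := by exact_mod_cast h1
    have h2' : n < 1 := by exact_mod_cast h2
    omega
  rw [e, k0, n0]; ext <;> simp [tr]

/-- The derivative of a Lipschitz function along a continuous field with compact support. -/
lemma fderiv_along {Y : V → V} (hY : Continuous Y) (hs : HasCompactSupport Y) {K : NNReal}
    {g : V → ℝ} (hg : LipschitzWith K g) :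
    Measurable (fun z => fderiv ℝ g z (Y z)) ∧ (∃ B, ∀ z, |fderiv ℝ g z (Y z)| ≤ B) ∧
      Integrable fun z => fderiv ℝ g z (Y z) := by
  have h1 : Measurable fun z => fderiv ℝ g z (Y z) :=
    (isBoundedBilinearMap_apply (𝕜 := ℝ) (E := V) (F := ℝ)).continuous.measurable.comp
      ((measurable_fderiv ℝ g).prodMk hY.measurable)
  obtain ⟨B, hB⟩ := hY.bounded_above_of_compact_support hs
  have h2 : ∀ z, |fderiv ℝ g z (Y z)| ≤ K * ‖Y z‖ := fun z => by
    refine ((fderiv ℝ g z).le_opNorm _).trans ?_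
    exact mul_le_mul_of_nonneg_right (norm_fderiv_le_of_lipschitz ℝ hg) (norm_nonneg _)
  refine ⟨h1, ⟨K * B, fun z => (h2 z).trans (mul_le_mul_of_nonneg_left (hB z) K.2)⟩, ?_⟩
  have h3 : Integrable fun z => K * ‖Y z‖ := by
    have := (hY.integrable_of_hasCompactSupport hs (μ := volume)).norm
    exact this.const_mul _
  exact h3.mono' h1.aestronglyMeasurable (Eventually.of_forall h2)

namespace Ins
variable {m : Mod} (I : Ins m)

/-- The fundamental domain of the plug, thickened radially. -/
def S (m : Mod) : Set (Q × ℝ) := m.K ×ˢ Icc (-1) 1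

omit I in
lemma measurableSet_S : MeasurableSet (S m) := m.measurableSet_K.prod measurableSet_Icc

lemma S_subset : S m ⊆ I.U ×ˢ univ := fun _ hx => ⟨I.C_subset hx.1.1, trivial⟩

lemma injOn_S (j : Bool) : InjOn (coneOf (I.Ψ j)) (S m) := fun x hx y hy h => by
  obtain ⟨h1, h2⟩ := I.cone_inj h
  obtain ⟨-, k, n, h3⟩ := I.inj _ _ _ _ (I.C_subset hx.1.1) (I.C_subset hy.1.1) h2
  exact (Prod.ext (eq_of_mem_cell hx.1.2 hy.1.2 h3) h1.symm).symm

/-- The region occupied by a plug. -/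
def D (j : Bool) : Set V := coneOf (I.Ψ j) '' S m

lemma measurableSet_D (j : Bool) : MeasurableSet (I.D j) :=
  measurableSet_S.image_of_continuousOn_injOn (I.contDiff_cone j).continuous.continuousOn
    (I.injOn_S j)

lemma disjoint_D : Disjoint (I.D false) (I.D true) := by
  rw [disjoint_left]
  rintro _ ⟨x, hx, rfl⟩ ⟨y, hy, h⟩
  obtain ⟨-, h2⟩ := I.cone_inj h
  have := (I.inj _ _ _ _ (I.C_subset hy.1.1) (I.C_subset hx.1.1) h2).1
  exact absurd this (by decide)

lemma measurable_cone (j : Bool) : Measurable (coneOf (I.Ψ j)) :=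
  (I.contDiff_cone j).continuous.measurable

/-- The density of the pulled back volume. -/
noncomputable def dn (x : Q × ℝ) : ℝ := I.κ * (Real.exp (4 * x.2) * m.w x.1)

/-- The density of the additional volume. -/
noncomputable def de (x : Q × ℝ) : ℝ := I.κ * (Real.exp (4 * x.2) * (m.J x.1 - m.w x.1))

lemma dn_pos (x : Q × ℝ) : 0 < I.dn x :=
  mul_pos I.κ_pos (mul_pos (Real.exp_pos _) (m.w_pos _))

lemma de_nonneg (x : Q × ℝ) : 0 ≤ I.de x :=
  mul_nonneg I.κ_pos.le (mul_nonneg (Real.exp_pos _).le (sub_nonneg.2 (m.w_le_J _)))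

lemma measurable_dn : Measurable I.dn := by
  have h : Measurable fun x : Q × ℝ => m.w x.1 := m.continuous_w.measurable.comp measurable_fst
  have h2 : Measurable fun x : Q × ℝ => Real.exp (4 * x.2) := by fun_prop
  exact (h2.mul h).const_mul _

lemma measurable_de : Measurable I.de := by
  have h : Measurable fun x : Q × ℝ => m.J x.1 - m.w x.1 :=
    (m.measurable_J.sub m.continuous_w.measurable).comp measurable_fst
  have h2 : Measurable fun x : Q × ℝ => Real.exp (4 * x.2) := by fun_prop
  exact (h2.mul h).const_mul _

lemma restrict_S : volume.restrict (S m) = (volume.restrict m.K).prod (volume.restrict (Icc (-1 : ℝ) 1)) :=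
  (Measure.prod_restrict _ _).symm

lemma integrable_expJ : Integrable (fun x : Q × ℝ => I.κ * (Real.exp (4 * x.2) * m.J x.1))
    (volume.restrict (S m)) := by
  have h1 : Integrable (fun x : Q × ℝ => m.J x.1) (volume.restrict (S m)) := by
    rw [restrict_S]; exact Integrable.comp_fst m.integrableOn_K _
  have h2 : Measurable fun x : Q × ℝ => Real.exp (4 * x.2) := by fun_prop
  refine (h1.bdd_mul (c := Real.exp 4) h2.aestronglyMeasurable ?_).const_mul _
  filter_upwards [ae_restrict_mem measurableSet_S] with x hx
  rw [Real.norm_eq_abs, abs_of_pos (Real.exp_pos _)]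
  exact Real.exp_le_exp.2 (by linarith [hx.2.2])

lemma integrable_dn : Integrable I.dn (volume.restrict (S m)) := by
  refine I.integrable_expJ.mono' I.measurable_dn.aestronglyMeasurable (Eventually.of_forall fun x => ?_)
  rw [Real.norm_eq_abs, abs_of_pos (I.dn_pos x), dn]
  have := m.w_le_J x.1
  have := I.κ_pos
  gcongr

lemma integrable_de : Integrable I.de (volume.restrict (S m)) := by
  refine I.integrable_expJ.mono' I.measurable_de.aestronglyMeasurable (Eventually.of_forall fun x => ?_)
  rw [Real.norm_eq_abs, abs_of_nonneg (I.de_nonneg x), de]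
  have := m.w_pos x.1
  have := I.κ_pos
  gcongr
  linarith

/-- The additional volume in one of the plugs. -/
noncomputable def ex (j : Bool) : Measure V :=
  Measure.map (coneOf (I.Ψ j)) ((volume.restrict (S m)).withDensity fun x => ENNReal.ofReal (I.de x))

/-- The invariant volume on the ambient space. -/
noncomputable def ν : Measure V := volume + (I.ex false + I.ex true)

instance (j : Bool) : IsFiniteMeasure (I.ex j) := by
  have := isFiniteMeasure_withDensity_ofReal I.integrable_de.2
  unfold ex; infer_instance

instance : IsFiniteMeasureOnCompacts I.ν := ⟨fun K hK => by
  rw [ν, Measure.add_apply, Measure.add_apply]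
  exact ENNReal.add_lt_top.2 ⟨hK.measure_lt_top, ENNReal.add_lt_top.2
    ⟨measure_lt_top _ _, measure_lt_top _ _⟩⟩⟩

lemma cov_D (j : Bool) : Measure.map (coneOf (I.Ψ j)) ((volume.restrict (S m)).withDensity fun x =>
    ENNReal.ofReal (I.dn x)) = volume.restrict (I.D j) :=
  I.cov j (S m) measurableSet_S I.S_subset (I.injOn_S j)

lemma map_restrict_ac (j : Bool) : Measure.map (coneOf (I.Ψ j)) (volume.restrict (S m)) ≪ volume := by
  have h1 : volume.restrict (S m) ≪ (volume.restrict (S m)).withDensity fun x =>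
      ENNReal.ofReal (I.dn x) :=
    withDensity_absolutelyContinuous' I.measurable_dn.ennreal_ofReal.aemeasurable
      (Eventually.of_forall fun x => by simpa using I.dn_pos x)
  have h2 := h1.map (I.measurable_cone j)
  rw [I.cov_D] at h2
  exact h2.trans Measure.restrict_le_self.absolutelyContinuous

lemma ν_ac : I.ν ≪ volume := by
  have h : ∀ j, I.ex j ≪ volume := fun j =>
    ((withDensity_absolutelyContinuous _ _).map (I.measurable_cone j)).trans (I.map_restrict_ac j)
  refine Measure.AbsolutelyContinuous.mk fun s hs h0 => ?_
  rw [ν, Measure.add_apply, Measure.add_apply, h0, h false h0, h true h0]; simp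

lemma volume_le_ν (s : Set V) : volume s ≤ I.ν s := by
  rw [ν, Measure.add_apply]; exact le_self_add

lemma integral_D (j : Bool) {f : V → ℝ} (hf : Measurable f) :
    ∫ z in I.D j, f z = ∫ x in S m, I.dn x * f (coneOf (I.Ψ j) x) := by
  rw [← I.cov_D, integral_map (I.measurable_cone j).aemeasurable hf.aestronglyMeasurable,
    integral_withDensity_eq_integral_toReal_smul I.measurable_dn.ennreal_ofReal
      (Eventually.of_forall fun x => ENNReal.ofReal_lt_top)]
  refine integral_congr_ae (Eventually.of_forall fun x => ?_)
  simp only [smul_eq_mul]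
  rw [ENNReal.toReal_ofReal (I.dn_pos x).le]

lemma integral_ex (j : Bool) {f : V → ℝ} (hf : Measurable f) :
    ∫ z, f z ∂(I.ex j) = ∫ x in S m, I.de x * f (coneOf (I.Ψ j) x) := by
  rw [ex, integral_map (I.measurable_cone j).aemeasurable hf.aestronglyMeasurable,
    integral_withDensity_eq_integral_toReal_smul I.measurable_de.ennreal_ofReal
      (Eventually.of_forall fun x => ENNReal.ofReal_lt_top)]
  refine integral_congr_ae (Eventually.of_forall fun x => ?_)
  simp only [smul_eq_mul]
  rw [ENNReal.toReal_ofReal (I.de_nonneg x)]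

end Ins

namespace Ins
variable {m : Mod} (I : Ins m)

/-- The truncated base field. -/
noncomputable def Y (z : V) : V := η z • I.A z

lemma continuous_Y : Continuous I.Y := contDiff_η.continuous.smul I.A.continuous

lemma hasCompactSupport_Y : HasCompactSupport I.Y := hasCompactSupport_η.smul_right

lemma exists_lipschitz_η : ∃ K, LipschitzWith K η :=
  (contDiff_η).lipschitzWith_of_hasCompactSupport hasCompactSupport_η two_ne_zero

lemma fderiv_η (z : V) : fderiv ℝ η z (I.A z) = 0 := by
  set b : ContDiffBump (1 : ℝ) := ⟨1 / 2, 3 / 4, by norm_num, by norm_num⟩ with hb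
  have h1 : HasFDerivAt (fun z : V => ‖z‖ ^ 2) (2 • innerSL ℝ z) z := by
    have := (hasFDerivAt_id z).norm_sq
    simpa using this
  have h2 : HasDerivAt b (deriv b (‖z‖ ^ 2)) (‖z‖ ^ 2) :=
    ((b.contDiff (n := 1)).differentiable one_ne_zero _).hasDerivAt
  have h3 : HasFDerivAt η _ z := h2.comp_hasFDerivAt z h1
  rw [h3.fderiv]
  have : ⟪z, I.A z⟫ = 0 := by rw [real_inner_comm, I.inner_A]
  simp [this]

lemma integral_Y {K : NNReal} {g : V → ℝ} (hg : LipschitzWith K g) (hc : HasCompactSupport g) :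
    ∫ z, fderiv ℝ g z (I.Y z) = 0 := by
  obtain ⟨L, hL⟩ := exists_lipschitz_η
  obtain ⟨B, hB⟩ := hg.continuous.bounded_above_of_compact_support hc
  obtain ⟨B', hB'⟩ := contDiff_η.continuous.bounded_above_of_compact_support hasCompactSupport_η
  have l := lipschitz_mul_of_bounded hL hg (A := B'.toNNReal) (B := B.toNNReal)
    (fun p => (hB' p).trans (Real.le_coe_toNNReal _)) (fun p => (hB p).trans (Real.le_coe_toNNReal _))
  have h := I.integral_A _ _ l hc.mul_left
  rw [← h]
  refine integral_congr_ae ?_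
  filter_upwards [hg.ae_differentiableAt (μ := volume)] with z hz
  have e : fderiv ℝ (fun p => η p * g p) z = η z • fderiv ℝ g z + g z • fderiv ℝ η z :=
    fderiv_fun_mul ((contDiff_η.differentiable two_ne_zero) z) hz
  rw [e]
  simp [Y, I.fderiv_η]

lemma η_cone (j : Bool) (q : Q) (σ : ℝ) : ∃ c, ∀ j q, η (coneOf (I.Ψ j) (q, σ)) = c :=
  ⟨η (coneOf (I.Ψ j) (q, σ)), fun j' q' => by unfold η; rw [I.norm_cone, I.norm_cone]⟩

lemma X_eq_Y {z : V} (h : z ∉ I.D false ∪ I.D true) : I.X z = I.Y z := by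
  by_cases h1 : z ∈ I.coneC
  · by_cases hz : z = 0
    · have : η z = 0 := η_eq_zero (by rw [hz]; norm_num)
      rw [X, Y, this, zero_smul, zero_smul]
    · obtain ⟨j, q, σ, hq, rfl⟩ := I.exists_cone_of_mem hz h1
      have : η (coneOf (I.Ψ j) (q, σ)) = 0 := by
        refine η_eq_zero ?_
        rw [I.norm_cone]
        have hσ : σ ∉ Icc (-1 : ℝ) 1 := fun hσ => h (by
          obtain ⟨k, n, hk⟩ := Mod.exists_tr_mem_cell q
          have : coneOf (I.Ψ j) (q, σ) ∈ I.D j := by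
            refine ⟨(q + tr k n, σ), ⟨⟨m.C_tr.2 hq, hk⟩, hσ⟩, ?_⟩
            simp only [coneOf, I.Ψ_tr]
          cases j
          · exact Or.inl this
          · exact Or.inr this)
        have e1 := Real.add_one_le_exp (1 : ℝ)
        simp only
        rcases lt_or_ge σ (-1) with h3 | h3
        · have h4 : Real.exp σ ≤ 1 / 2 := by
            have h5 : Real.exp σ ≤ Real.exp (-1) := Real.exp_le_exp.2 h3.le
            have h6 : Real.exp (-1) * Real.exp 1 = 1 := by rw [← Real.exp_add]; simp
            nlinarith [Real.exp_pos (-1)]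
          have := Real.exp_pos σ
          rw [abs_of_nonpos] <;> nlinarith
        · have h4 : 1 < σ := by
            by_contra! h4
            exact hσ ⟨h3, h4⟩
          have h5 : Real.exp 1 ≤ Real.exp σ := Real.exp_le_exp.2 h4.le
          rw [abs_of_nonneg] <;> nlinarith
      rw [X, Y, this, zero_smul, zero_smul]
  · exact I.X_off h1

lemma fderiv_Ψ_up (j : Bool) (q v : Q) (t : ℝ) :
    fderiv ℝ (I.Ψ j) (q + (0, 0, t)) v = I.R t (fderiv ℝ (I.Ψ j) q v) := by
  rw [← fderiv_comp_add_right]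
  simp_rw [I.Ψ_up]
  have := (I.R t).hasFDerivAt.comp q ((I.contDiff_Ψ j).differentiable two_ne_zero q).hasFDerivAt
  have h2 : fderiv ℝ (fun q => I.R t (I.Ψ j q)) q = (I.R t).comp (fderiv ℝ (I.Ψ j) q) := this.fderiv
  rw [h2]; rfl

lemma exists_lipschitz_Ψ (j : Bool) : ∃ K, LipschitzWith K (I.Ψ j) := by
  have hc : Continuous (fderiv ℝ (I.Ψ j)) := (I.contDiff_Ψ j).continuous_fderiv two_ne_zero
  have hK : IsCompact (Icc (0 : ℝ) 1 ×ˢ (Icc (0 : ℝ) 1 ×ˢ ({0} : Set ℝ))) :=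
    isCompact_Icc.prod (isCompact_Icc.prod isCompact_singleton)
  obtain ⟨B, hB⟩ := hK.exists_bound_of_continuousOn hc.continuousOn
  refine ⟨B.toNNReal, lipschitzWith_of_nnnorm_fderiv_le ((I.contDiff_Ψ j).differentiable two_ne_zero)
    fun q => ?_⟩
  obtain ⟨k, n, hk⟩ := Mod.exists_tr_mem_cell q
  have h1 := hB ((q + tr k n).1, (q + tr k n).2.1, 0)
    ⟨⟨hk.1.1, hk.1.2.le⟩, ⟨hk.2.1, hk.2.2.le⟩, rfl⟩
  have h2 : q + tr k n = ((q + tr k n).1, (q + tr k n).2.1, (0 : ℝ)) + (0, 0, q.2.2) := by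
    ext <;> simp [tr]
  rw [← NNReal.coe_le_coe, coe_nnnorm]
  refine le_trans ?_ (Real.le_coe_toNNReal B)
  refine le_trans ?_ h1
  rw [← I.fderiv_Ψ_tr j q k n]
  refine (fderiv ℝ (I.Ψ j) (q + tr k n)).opNorm_le_bound (norm_nonneg _) fun v => ?_
  conv_lhs => rw [h2, I.fderiv_Ψ_up, I.norm_R]
  exact (fderiv ℝ (I.Ψ j) ((q + tr k n).1, (q + tr k n).2.1, 0)).le_opNorm v

/-- A test function in a chart. -/
noncomputable def pull (g : V → ℝ) (j : Bool) (σ : ℝ) (q : Q) : ℝ := g (coneOf (I.Ψ j) (q, σ))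

lemma fderiv_pull {g : V → ℝ} {j : Bool} {q : Q} {σ : ℝ}
    (hg : DifferentiableAt ℝ g (coneOf (I.Ψ j) (q, σ))) (v : Q) :
    fderiv ℝ (I.pull g j σ) q v =
      fderiv ℝ g (coneOf (I.Ψ j) (q, σ)) (Real.exp σ • fderiv ℝ (I.Ψ j) q v) := by
  have h1 : HasFDerivAt (fun q => coneOf (I.Ψ j) (q, σ)) (Real.exp σ • fderiv ℝ (I.Ψ j) q) q :=
    (((I.contDiff_Ψ j).differentiable two_ne_zero q).hasFDerivAt).const_smul (Real.exp σ)
  have h2 : HasFDerivAt (I.pull g j σ) _ q := hg.hasFDerivAt.comp q h1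
  rw [h2.fderiv]; rfl

lemma ae_defect {K : NNReal} {g : V → ℝ} (hg : LipschitzWith K g) (j : Bool) :
    ∀ᵐ x ∂(volume.restrict (S m)),
      m.J x.1 * fderiv ℝ g (coneOf (I.Ψ j) x) (I.X (coneOf (I.Ψ j) x)) -
      m.w x.1 * fderiv ℝ g (coneOf (I.Ψ j) x) (I.Y (coneOf (I.Ψ j) x)) =
      η (coneOf (I.Ψ j) x) * m.defect (I.pull g j x.2) x.1 := by
  have h1 : ∀ᵐ z ∂(Measure.map (coneOf (I.Ψ j)) (volume.restrict (S m))), DifferentiableAt ℝ g z :=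
    (I.map_restrict_ac j).ae_le hg.ae_differentiableAt
  filter_upwards [ae_of_ae_map (I.measurable_cone j).aemeasurable h1,
    ae_restrict_mem measurableSet_S] with x hx hS
  obtain ⟨q, σ⟩ := x
  have hU : q ∈ I.U := I.C_subset hS.1.1
  simp only at hx ⊢
  rw [Mod.defect, I.fderiv_pull hx, I.fderiv_pull hx, I.X_cone j hU, Y, map_smul, map_smul,
    smul_eq_mul, smul_eq_mul, I.fderiv_Ψ_z]
  have e : I.A (coneOf (I.Ψ j) (q, σ)) = Real.exp σ • I.A (I.Ψ j q) := by
    rw [coneOf, map_smul]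
  rw [e, (fderiv ℝ g (coneOf (I.Ψ j) (q, σ))).map_smul (η (coneOf (I.Ψ j) (q, σ))), smul_eq_mul]
  ring

lemma integral_plug {K : NNReal} {g : V → ℝ} (hg : LipschitzWith K g) (hc : HasCompactSupport g)
    (j : Bool) :
    ∫ x in S m, I.κ * Real.exp (4 * x.2) *
      (m.J x.1 * fderiv ℝ g (coneOf (I.Ψ j) x) (I.X (coneOf (I.Ψ j) x)) -
      m.w x.1 * fderiv ℝ g (coneOf (I.Ψ j) x) (I.Y (coneOf (I.Ψ j) x))) = 0 := by
  obtain ⟨x1, ⟨x2, hx2⟩, -⟩ := fderiv_along I.contDiff_X.continuous I.hasCompactSupport_X hg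
  obtain ⟨y1, ⟨y2, hy2⟩, -⟩ := fderiv_along I.continuous_Y I.hasCompactSupport_Y hg
  have i1 : Integrable (fun x : Q × ℝ => fderiv ℝ g (coneOf (I.Ψ j) x) (I.X (coneOf (I.Ψ j) x)) *
      (I.κ * (Real.exp (4 * x.2) * m.J x.1))) (volume.restrict (S m)) :=
    I.integrable_expJ.bdd_mul (x1.comp (I.measurable_cone j)).aestronglyMeasurable
      (Eventually.of_forall fun x => hx2 _)
  have i2 : Integrable (fun x : Q × ℝ => fderiv ℝ g (coneOf (I.Ψ j) x) (I.Y (coneOf (I.Ψ j) x)) *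
      I.dn x) (volume.restrict (S m)) :=
    I.integrable_dn.bdd_mul (y1.comp (I.measurable_cone j)).aestronglyMeasurable
      (Eventually.of_forall fun x => hy2 _)
  set f : Q × ℝ → ℝ := fun x => I.κ * Real.exp (4 * x.2) *
      (m.J x.1 * fderiv ℝ g (coneOf (I.Ψ j) x) (I.X (coneOf (I.Ψ j) x)) -
      m.w x.1 * fderiv ℝ g (coneOf (I.Ψ j) x) (I.Y (coneOf (I.Ψ j) x))) with hf
  have i3 : Integrable f (volume.restrict (S m)) := by
    refine (i1.sub i2).congr (Eventually.of_forall fun x => ?_)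
    simp only [hf, Pi.sub_apply, dn]; ring
  have hae : ∀ᵐ x ∂(volume.restrict (S m)), f x = I.κ * Real.exp (4 * x.2) *
      (η (coneOf (I.Ψ j) x) * m.defect (I.pull g j x.2) x.1) := by
    filter_upwards [I.ae_defect hg j] with x hx
    simp only [hf]; rw [hx]
  rw [restrict_S] at i3 hae ⊢
  rw [integral_prod_symm f i3]
  have hsw := (Measure.measurePreserving_swap (μ := volume.restrict (Icc (-1 : ℝ) 1))
    (ν := volume.restrict m.K)).quasiMeasurePreserving.ae hae
  have hsw2 := Measure.ae_ae_of_ae_prod hsw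
  refine integral_eq_zero_of_ae ?_
  filter_upwards [hsw2] with σ hσ
  have hσ' : ∀ᵐ q ∂(volume.restrict m.K), f (q, σ) = I.κ * Real.exp (4 * σ) *
      (η (coneOf (I.Ψ j) (q, σ)) * m.defect (I.pull g j σ) q) := hσ
  rw [integral_congr_ae hσ']
  obtain ⟨c, hcη⟩ := I.η_cone j 0 σ
  simp only [hcη, Pi.zero_apply]
  rw [integral_const_mul, integral_const_mul]
  obtain ⟨L, hL⟩ := I.exists_lipschitz_Ψ j
  obtain ⟨B, hB⟩ := hg.continuous.bounded_above_of_compact_support hc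
  have l1 : LipschitzWith (K * (‖Real.exp σ‖₊ * L)) (I.pull g j σ) :=
    hg.comp ((lipschitzWith_smul (Real.exp σ)).comp hL)
  have h0 := (m.integral_defect l1 (B := B.toNNReal) (fun q => (hB _).trans (Real.le_coe_toNNReal _))
    (fun q k n => by simp only [pull, coneOf, I.Ψ_tr])).2
  have h1 : ∫ q in m.K, m.defect (I.pull g j σ) q = 0 := by
    rw [← h0]
    exact (setIntegral_eq_of_subset_of_forall_sdiff_eq_zero measurableSet_cell
      (inter_subset_right) fun q hq => m.defect_off _ fun h => hq.2 ⟨h, hq.1⟩).symm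
  rw [h1, mul_zero, mul_zero]

theorem integral_X {K : NNReal} {g : V → ℝ} (hg : LipschitzWith K g) (hc : HasCompactSupport g) :
    ∫ z, fderiv ℝ g z (I.X z) ∂I.ν = 0 := by
  obtain ⟨x1, ⟨x2, hx2⟩, x3⟩ := fderiv_along I.contDiff_X.continuous I.hasCompactSupport_X hg
  obtain ⟨y1, ⟨y2, hy2⟩, y3⟩ := fderiv_along I.continuous_Y I.hasCompactSupport_Y hg
  have ie : ∀ j, Integrable (fun z => fderiv ℝ g z (I.X z)) (I.ex j) := fun j =>
    Integrable.of_bound x1.aestronglyMeasurable x2 (Eventually.of_forall hx2)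
  have e1 : ∫ z, fderiv ℝ g z (I.X z) = ∫ z, (fderiv ℝ g z (I.X z) - fderiv ℝ g z (I.Y z)) := by
    rw [integral_sub x3 y3, I.integral_Y hg hc, sub_zero]
  have xy3 : Integrable fun z => fderiv ℝ g z (I.X z) - fderiv ℝ g z (I.Y z) := x3.sub y3
  have e2 : ∫ z, (fderiv ℝ g z (I.X z) - fderiv ℝ g z (I.Y z)) =
      (∫ z in I.D false, (fderiv ℝ g z (I.X z) - fderiv ℝ g z (I.Y z))) +
      ∫ z in I.D true, (fderiv ℝ g z (I.X z) - fderiv ℝ g z (I.Y z)) := by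
    rw [← setIntegral_union I.disjoint_D (I.measurableSet_D true) xy3.integrableOn xy3.integrableOn]
    exact (setIntegral_eq_integral_of_forall_compl_eq_zero fun z hz => by
      rw [I.X_eq_Y hz, sub_self]).symm
  have hm : Measurable fun z => fderiv ℝ g z (I.X z) - fderiv ℝ g z (I.Y z) := x1.sub y1
  have e3 : ∀ j, (∫ z in I.D j, (fderiv ℝ g z (I.X z) - fderiv ℝ g z (I.Y z))) +
      ∫ z, fderiv ℝ g z (I.X z) ∂(I.ex j) = 0 := fun j => by
    rw [I.integral_D j hm, I.integral_ex j x1, ← integral_add, ← I.integral_plug hg hc j]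
    · refine integral_congr_ae (Eventually.of_forall fun x => ?_)
      simp only [dn, de]; ring
    · have : Integrable (fun x : Q × ℝ => (fderiv ℝ g (coneOf (I.Ψ j) x) (I.X (coneOf (I.Ψ j) x)) -
          fderiv ℝ g (coneOf (I.Ψ j) x) (I.Y (coneOf (I.Ψ j) x))) * I.dn x)
          (volume.restrict (S m)) :=
        I.integrable_dn.bdd_mul (c := x2 + y2)
          (hm.comp (I.measurable_cone j)).aestronglyMeasurable
          (Eventually.of_forall fun x => (norm_sub_le _ _).trans (add_le_add (hx2 _) (hy2 _)))
      refine this.congr (Eventually.of_forall fun x => ?_)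
      exact mul_comm _ _
    · have : Integrable (fun x : Q × ℝ => fderiv ℝ g (coneOf (I.Ψ j) x) (I.X (coneOf (I.Ψ j) x)) *
          I.de x) (volume.restrict (S m)) :=
        I.integrable_de.bdd_mul (x1.comp (I.measurable_cone j)).aestronglyMeasurable
          (Eventually.of_forall fun x => hx2 _)
      refine this.congr (Eventually.of_forall fun x => ?_)
      exact mul_comm _ _
  rw [ν, integral_add_measure x3 ((ie false).add_measure (ie true)),
    integral_add_measure (ie false) (ie true), e1, e2]
  linarith [e3 false, e3 true]

lemma measurePreserving_ν (t : ℝ) : MeasurePreserving (I.Φ.φ t) I.ν I.ν := by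
  refine I.Φ.measurePreserving I.ν ?_ (fun K g => I.integral_X) t
  exact I.ν_ac.trans (Measure.absolutelyContinuous_isAddHaarMeasure _ _)

end Ins

/-- The unit sphere. -/
abbrev S3 : Set V := Metric.sphere (0 : V) 1

/-- A measurable extension of the radial projection. -/
noncomputable def rad (z : V) : V := if z = 0 then EuclideanSpace.single 0 1 else ‖z‖⁻¹ • z

lemma norm_rad (z : V) : ‖rad z‖ = 1 := by
  unfold rad
  split_ifs with h
  · simp
  · rw [norm_smul, norm_inv, norm_norm, inv_mul_cancel₀ (norm_ne_zero_iff.2 h)]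

lemma measurable_rad : Measurable rad :=
  Measurable.ite (measurableSet_singleton 0) measurable_const
    (measurable_norm.inv.smul measurable_id)

lemma norm_smul_rad {z : V} (h : z ≠ 0) : z = ‖z‖ • rad z := by
  rw [rad, if_neg h, smul_smul, mul_inv_cancel₀ (norm_ne_zero_iff.2 h), one_smul]

lemma rad_smul {z : V} (hz : ‖z‖ = 1) {r : ℝ} (hr : 0 < r) : rad (r • z) = z := by
  have h : r • z ≠ 0 := by
    rw [← norm_pos_iff, norm_smul, hz, Real.norm_eq_abs, abs_of_pos hr]; linarith
  rw [rad, if_neg h, norm_smul, hz, mul_one, Real.norm_eq_abs, abs_of_pos hr, smul_smul,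
    inv_mul_cancel₀ hr.ne', one_smul]

/-- The radial projection to the sphere. -/
noncomputable def rd (z : V) : S3 := ⟨rad z, by rw [mem_sphere_zero_iff_norm]; exact norm_rad z⟩

lemma measurable_rd : Measurable rd := measurable_rad.subtype_mk

lemma continuousAt_rd {z : V} (h : z ≠ 0) : ContinuousAt rd z := by
  rw [Topology.IsInducing.subtypeVal.continuousAt_iff]
  have h1 : ContinuousAt (fun z : V => ‖z‖⁻¹ • z) z :=
    (continuousAt_id.norm.inv₀ (norm_ne_zero_iff.2 h)).smul continuousAt_id
  refine h1.congr ?_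
  filter_upwards [isOpen_ne.mem_nhds h] with y hy
  exact (if_neg hy).symm

/-- A shell around the sphere. -/
def shell : Set V := {z | |‖z‖ ^ 2 - 1| ≤ 1 / 2}

lemma isClosed_shell : IsClosed shell :=
  isClosed_le (by fun_prop) continuous_const

lemma isCompact_shell : IsCompact shell := by
  refine (isCompact_closedBall (0 : V) 2).of_isClosed_subset isClosed_shell fun z hz => ?_
  rw [mem_closedBall_zero_iff]
  have h : |‖z‖ ^ 2 - 1| ≤ 1 / 2 := hz
  have := (abs_le.1 h).2
  nlinarith

lemma ne_zero_of_mem_shell {z : V} (h : z ∈ shell) : z ≠ 0 := by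
  rintro rfl
  have h : |‖(0 : V)‖ ^ 2 - 1| ≤ 1 / 2 := h
  norm_num at h

namespace Ins
variable {m : Mod} (I : Ins m)

lemma glue_smul {Y : Type*} [Zero Y] {f : Bool → Q → Y}
    (hf : ∀ j q k n, f j (q + tr k n) = f j q) (h0 : ∀ j q, q ∉ m.C → f j q = 0) {r : ℝ}
    (hr : 0 < r) {z : V} (hz : ‖z‖ = 1) : I.glue f (r • z) = I.glue f z := by
  by_cases h : z ∈ I.coneC
  · obtain ⟨j, q, h1, h2⟩ := I.exists_of_mem hz h
    have e : r • z = coneOf (I.Ψ j) (q, Real.log r) := by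
      rw [coneOf, Real.exp_log hr, h2]
    rw [e, I.glue_cone hf h0 (I.C_subset h1), h2, I.glue_Ψ hf h0 (I.C_subset h1)]
  · rw [I.glue_off _ h, I.glue_off]
    rintro ⟨jq, h1, h2⟩
    refine h ⟨jq, h1, ?_⟩
    rw [norm_smul, hz, mul_one, Real.norm_eq_abs, abs_of_pos hr] at h2
    rw [hz, one_smul]
    exact smul_right_injective V hr.ne' h2

lemma X_smul {z : V} (hz : ‖z‖ = 1) {r : ℝ} (hr : 0 < r) (h : r • z ∈ shell) :
    I.X (r • z) = r • I.X z := by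
  have e1 : η (r • z) = 1 := η_eq_one h
  rw [X, X, e1, η_sphere hz, one_smul, one_smul, I.glue_smul I.dW_tr I.dW_off hr hz, norm_smul, hz,
    Real.norm_eq_abs, abs_of_pos hr, map_smul, mul_one, one_smul, smul_add]

lemma shell_smul {y z : V} (h : ‖y‖ = ‖z‖) {r : ℝ} : r • y ∈ shell ↔ r • z ∈ shell := by
  change |‖r • y‖ ^ 2 - 1| ≤ 1 / 2 ↔ |‖r • z‖ ^ 2 - 1| ≤ 1 / 2
  rw [norm_smul, norm_smul, h]

lemma Φ_smul {z : V} (hz : ‖z‖ = 1) {r : ℝ} (hr : 0 < r) (h : r • z ∈ shell) (t : ℝ) :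
    I.Φ.φ t (r • z) = r • I.Φ.φ t z := by
  have := I.Φ.eq (γ := fun t => r • I.Φ.φ t z) (fun t => by
    have hn : ‖I.Φ.φ t z‖ = 1 := by rw [I.norm_Φ, hz]
    rw [I.X_smul hn hr ((shell_smul (I.norm_Φ t z)).2 h)]
    exact (I.Φ.hasDerivAt z t).const_smul r) t
  simp only [I.Φ.zero] at this
  exact this.symm

/-- The flow on the sphere. -/
noncomputable def φ (t : ℝ) (x : S3) : S3 :=
  ⟨I.Φ.φ t x, by
    rw [mem_sphere_zero_iff_norm, I.norm_Φ]; exact mem_sphere_zero_iff_norm.1 x.2⟩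

lemma continuous_φ (t : ℝ) : Continuous (I.φ t) :=
  ((I.Φ.continuous t).comp continuous_subtype_val).subtype_mk _

lemma rd_Φ {z : V} (hz : z ∈ shell) (t : ℝ) : rd (I.Φ.φ t z) = I.φ t (rd z) := by
  have h0 := ne_zero_of_mem_shell hz
  have h1 := norm_smul_rad h0
  have hp : 0 < ‖z‖ := norm_pos_iff.2 h0
  ext1
  change rad (I.Φ.φ t z) = I.Φ.φ t (rad z)
  conv_lhs => rw [h1]
  rw [I.Φ_smul (norm_rad z) hp (by rw [← h1]; exact hz), rad_smul (by rw [I.norm_Φ, norm_rad]) hp]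

/-- The invariant measure on the sphere. -/
noncomputable def μ : Measure S3 := Measure.map rd (I.ν.restrict shell)

instance : IsFiniteMeasure I.μ := by
  have : IsFiniteMeasure (I.ν.restrict shell) := ⟨by
    rw [Measure.restrict_apply_univ]; exact isCompact_shell.measure_lt_top⟩
  unfold μ; infer_instance

lemma measurePreserving_φ (t : ℝ) : MeasurePreserving (I.φ t) I.μ I.μ := by
  refine ⟨(I.continuous_φ t).measurable, ?_⟩
  have h1 := (I.measurePreserving_ν t).restrict_preimage isClosed_shell.measurableSet
  have h2 : I.Φ.φ t ⁻¹' shell = shell := by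
    ext z
    change |‖I.Φ.φ t z‖ ^ 2 - 1| ≤ 1 / 2 ↔ |‖z‖ ^ 2 - 1| ≤ 1 / 2
    rw [I.norm_Φ]
  rw [h2] at h1
  rw [μ, Measure.map_map (I.continuous_φ t).measurable measurable_rd]
  have h3 : I.φ t ∘ rd =ᵐ[I.ν.restrict shell] rd ∘ I.Φ.φ t := by
    filter_upwards [ae_restrict_mem isClosed_shell.measurableSet] with z hz
    exact (I.rd_Φ hz t).symm
  rw [Measure.map_congr h3, ← Measure.map_map measurable_rd (I.Φ.continuous t).measurable, h1.map_eq]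

lemma μ_pos {O : Set S3} (hO : IsOpen O) (hne : O.Nonempty) : 0 < I.μ O := by
  obtain ⟨x, hx⟩ := hne
  have hx1 : ‖(x : V)‖ = 1 := mem_sphere_zero_iff_norm.1 x.2
  have hx0 : (x : V) ≠ 0 := by rw [← norm_pos_iff, hx1]; exact one_pos
  have e : rd x = x := by
    ext1
    have := rad_smul hx1 one_pos
    rwa [one_smul] at this
  have n1 : rd ⁻¹' O ∈ 𝓝 (x : V) :=
    (continuousAt_rd hx0).preimage_mem_nhds (by rw [e]; exact hO.mem_nhds hx)
  have n2 : shell ∈ 𝓝 (x : V) := by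
    have : {z : V | |‖z‖ ^ 2 - 1| < 1 / 2} ∈ 𝓝 (x : V) :=
      (isOpen_lt (by fun_prop) continuous_const).mem_nhds (by
        change |‖(x : V)‖ ^ 2 - 1| < 1 / 2
        rw [hx1]; norm_num)
    filter_upwards [this] with z hz
    exact le_of_lt hz
  rw [μ, Measure.map_apply measurable_rd hO.measurableSet,
    Measure.restrict_apply (measurable_rd hO.measurableSet)]
  exact (Measure.measure_pos_of_mem_nhds volume (inter_mem n1 n2)).trans_le (I.volume_le_ν _)

end Ins

theorem exists_aperiodic_of_ins {m : Mod} (I : Ins m) :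
    ∃ (X : V → V) (φ : ℝ → S3 → S3) (μ : Measure S3),
      ContDiff ℝ 1 X ∧ (∀ x : V, x ∈ S3 → ⟪X x, x⟫ = 0) ∧ (∀ x : V, x ∈ S3 → X x ≠ 0) ∧
      (¬ ∃ γ : ℝ → V, (∀ t, γ t ∈ S3) ∧ (∀ t, HasDerivAt γ (X (γ t)) t) ∧
        (∃ T > 0, ∀ t, γ (t + T) = γ t) ∧ (∃ t s, γ t ≠ γ s)) ∧
      φ 0 = id ∧ (∀ s t, φ (s + t) = φ s ∘ φ t) ∧
      (∀ (x : S3) (t : ℝ), HasDerivAt (fun τ => (φ τ x : V)) (X (φ t x)) t) ∧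
      IsFiniteMeasure μ ∧ (∀ U : Set S3, IsOpen U → U.Nonempty → 0 < μ U) ∧
      (∀ t, MeasurePreserving (φ t) μ μ) := by
  refine ⟨I.X, I.φ, I.μ, I.contDiff_X, fun x _ => I.inner_X x,
    fun x hx => I.X_ne_zero (mem_sphere_zero_iff_norm.1 hx), ?_, ?_, ?_, ?_, inferInstance,
    fun U => I.μ_pos, I.measurePreserving_φ⟩
  · rintro ⟨γ, h1, h2, ⟨T, hT, h3⟩, -⟩
    exact I.no_periodic h2 (fun t => mem_sphere_zero_iff_norm.1 (h1 t)) hT h3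
  · funext x; ext1; exact I.Φ.zero x
  · intro s t; funext x; ext1; exact I.Φ.add s t x
  · intro x t; exact I.Φ.hasDerivAt x t

namespace Emb

/-- The argument coordinate of the immersed base. -/
noncomputable def cf (p : ℝ × ℝ) : ℝ :=
  2 * Real.pi * p.1 + (2 + Real.sin (2 * Real.pi * p.1)) * (Real.cos (2 * Real.pi * p.2) - 1)

/-- The logarithmic radius coordinate of the immersed base. -/
noncomputable def rf (p : ℝ × ℝ) : ℝ :=
  (2 + Real.sin (2 * Real.pi * p.1)) * Real.sin (2 * Real.pi * p.2)

/-- The height coordinate resolving the double points of the immersed base. -/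
noncomputable def tf (p : ℝ × ℝ) : ℝ := (1 - Real.cos (2 * Real.pi * p.2)) / 10

/-- The normalized Jacobian of the immersion. -/
noncomputable def jf (p : ℝ × ℝ) : ℝ :=
  1 - (1 - Real.cos (2 * Real.pi * p.1)) * (1 - Real.cos (2 * Real.pi * p.2))

/-- First Cartesian coordinate of the immersed base. -/
noncomputable def uf (p : ℝ × ℝ) : ℝ := Real.exp (rf p) * Real.cos (cf p)

/-- Second Cartesian coordinate of the immersed base. -/
noncomputable def vf (p : ℝ × ℝ) : ℝ := Real.exp (rf p) * Real.sin (cf p)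

lemma contDiff_cf : ContDiff ℝ 2 cf := by unfold cf; fun_prop
lemma contDiff_rf : ContDiff ℝ 2 rf := by unfold rf; fun_prop
lemma contDiff_tf : ContDiff ℝ 2 tf := by unfold tf; fun_prop
lemma contDiff_jf : ContDiff ℝ 2 jf := by unfold jf; fun_prop
lemma contDiff_uf : ContDiff ℝ 2 uf := by
  have := contDiff_cf; have := contDiff_rf; unfold uf; fun_prop
lemma contDiff_vf : ContDiff ℝ 2 vf := by
  have := contDiff_cf; have := contDiff_rf; unfold vf; fun_prop

lemma cos_add_int (x : ℝ) (k : ℤ) :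
    Real.cos (2 * Real.pi * (x + k)) = Real.cos (2 * Real.pi * x) := by
  rw [show 2 * Real.pi * (x + k) = 2 * Real.pi * x + k * (2 * Real.pi) by ring,
    Real.cos_add_int_mul_two_pi]

lemma sin_add_int (x : ℝ) (k : ℤ) :
    Real.sin (2 * Real.pi * (x + k)) = Real.sin (2 * Real.pi * x) := by
  rw [show 2 * Real.pi * (x + k) = 2 * Real.pi * x + k * (2 * Real.pi) by ring,
    Real.sin_add_int_mul_two_pi]

lemma rf_add (x y : ℝ) (k n : ℤ) : rf (x + k, y + n) = rf (x, y) := by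
  simp only [rf, sin_add_int]

lemma tf_add (x y : ℝ) (k n : ℤ) : tf (x + k, y + n) = tf (x, y) := by
  simp only [tf, cos_add_int]

lemma jf_add (x y : ℝ) (k n : ℤ) : jf (x + k, y + n) = jf (x, y) := by
  simp only [jf, cos_add_int]

lemma cf_add (x y : ℝ) (k n : ℤ) : cf (x + k, y + n) = cf (x, y) + k * (2 * Real.pi) := by
  simp only [cf, cos_add_int, sin_add_int]; ring

lemma uf_add (x y : ℝ) (k n : ℤ) : uf (x + k, y + n) = uf (x, y) := by
  simp only [uf, rf_add, cf_add, Real.cos_add_int_mul_two_pi]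

lemma vf_add (x y : ℝ) (k n : ℤ) : vf (x + k, y + n) = vf (x, y) := by
  simp only [vf, rf_add, cf_add, Real.sin_add_int_mul_two_pi]

lemma jf_eq (p : ℝ × ℝ) : jf p = 1 - 4 * sn p.1 ^ 2 * sn p.2 ^ 2 := by
  have h (x : ℝ) : Real.cos (2 * Real.pi * x) = 1 - 2 * sn x ^ 2 := by
    rw [sn, sq_abs, show 2 * Real.pi * x = 2 * (Real.pi * x) by ring, Real.cos_two_mul]
    linarith [Real.sin_sq_add_cos_sq (Real.pi * x)]
  rw [jf, h, h]; ring

lemma abs_rf_le (p : ℝ × ℝ) : |rf p| ≤ 3 := by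
  rw [rf, abs_mul]
  have h1 := Real.abs_sin_le_one (2 * Real.pi * p.2)
  have h2 := abs_le.1 (Real.abs_sin_le_one (2 * Real.pi * p.1))
  have h3 : |2 + Real.sin (2 * Real.pi * p.1)| ≤ 3 := abs_le.2 ⟨by linarith, by linarith⟩
  nlinarith [abs_nonneg (Real.sin (2 * Real.pi * p.2))]

lemma abs_uf_le (p : ℝ × ℝ) : |uf p| ≤ Real.exp 3 := by
  rw [uf, abs_mul, Real.abs_exp]
  have h1 := Real.exp_le_exp.2 (abs_le.1 (abs_rf_le p)).2
  nlinarith [Real.abs_cos_le_one (cf p), abs_nonneg (Real.cos (cf p)), Real.exp_pos (rf p)]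

lemma abs_vf_le (p : ℝ × ℝ) : |vf p| ≤ Real.exp 3 := by
  rw [vf, abs_mul, Real.abs_exp]
  have h1 := Real.exp_le_exp.2 (abs_le.1 (abs_rf_le p)).2
  nlinarith [Real.abs_sin_le_one (cf p), abs_nonneg (Real.sin (cf p)), Real.exp_pos (rf p)]

lemma two_add_sin_pos (x : ℝ) : 0 < 2 + Real.sin x := by linarith [Real.neg_one_le_sin x]

lemma exists_add_int_of_cos_sin_eq {x y : ℝ} (hc : Real.cos x = Real.cos y)
    (hs : Real.sin x = Real.sin y) : ∃ k : ℤ, y = x + k * (2 * Real.pi) := by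
  have h := Real.Angle.cos_sin_inj hc hs
  obtain ⟨k, hk⟩ := Real.Angle.angle_eq_iff_two_pi_dvd_sub.1 h
  exact ⟨-k, by push_cast; linarith⟩

lemma polar_inj {r c r' c' : ℝ} (hu : Real.exp r * Real.cos c = Real.exp r' * Real.cos c')
    (hv : Real.exp r * Real.sin c = Real.exp r' * Real.sin c') :
    r = r' ∧ ∃ k : ℤ, c' = c + k * (2 * Real.pi) := by
  have h1 : Real.exp r ^ 2 = Real.exp r' ^ 2 := by
    linear_combination (Real.exp r * Real.cos c + Real.exp r' * Real.cos c') * hu +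
      (Real.exp r * Real.sin c + Real.exp r' * Real.sin c') * hv -
      Real.exp r ^ 2 * Real.sin_sq_add_cos_sq c + Real.exp r' ^ 2 * Real.sin_sq_add_cos_sq c'
  have h2 := (pow_left_inj₀ (Real.exp_pos r).le (Real.exp_pos r').le two_ne_zero).1 h1
  rw [h2] at hu hv
  have h3 := (Real.exp_pos r').ne'
  exact ⟨Real.exp_injective h2, exists_add_int_of_cos_sin_eq (mul_left_cancel₀ h3 hu)
    (mul_left_cancel₀ h3 hv)⟩

/-- The map `x ↦ x - 2 sin x` is injective near zero. -/
lemma sub_two_sin_inj {x y : ℝ} (hx : |x| ≤ 1) (hx' : 3 / 4 ≤ Real.cos x) (hy : |y| ≤ 1)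
    (hy' : 3 / 4 ≤ Real.cos y) (h : x - 2 * Real.sin x = y - 2 * Real.sin y) : x = y := by
  wlog hxy : x < y generalizing x y
  · rcases eq_or_lt_of_le (not_lt.1 hxy) with h1 | h1
    · exact h1.symm
    · exact (this hy hy' hx hx' h.symm h1).symm
  exfalso
  obtain ⟨c, hc, h2⟩ := exists_deriv_eq_slope Real.sin hxy Real.continuous_sin.continuousOn
    Real.differentiable_sin.differentiableOn
  rw [Real.deriv_sin, eq_div_iff (by linarith)] at h2
  have h3 : Real.cos c = 1 / 2 := by
    have : (y - x) * (2 * Real.cos c - 1) = 0 := by linarith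
    rcases mul_eq_zero.1 this with h | h <;> linarith
  have hpi := Real.pi_gt_three
  have h4 : min (Real.cos x) (Real.cos y) ≤ Real.cos c := by
    rw [← Real.cos_abs x, ← Real.cos_abs y, ← Real.cos_abs c]
    rcases abs_le_max_abs_abs hc.1.le hc.2.le |> le_max_iff.1 with h | h
    · exact (min_le_left _ _).trans (Real.cos_le_cos_of_nonneg_of_le_pi (abs_nonneg _)
        (by linarith) h)
    · exact (min_le_right _ _).trans (Real.cos_le_cos_of_nonneg_of_le_pi (abs_nonneg _)
        (by linarith) h)
  rcases min_le_iff.1 h4 with h | h <;> linarith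

/-- Reduction of an angle with large cosine. -/
lemma exists_int_small {x : ℝ} (h : 3 / 4 ≤ Real.cos x) :
    ∃ k : ℤ, |x + k * (2 * Real.pi)| ≤ 1 := by
  obtain ⟨n, hn, -⟩ := existsUnique_add_zsmul_mem_Ioc Real.two_pi_pos x (-Real.pi)
  refine ⟨n, ?_⟩
  rw [zsmul_eq_mul] at hn
  set z := x + n * (2 * Real.pi) with hz
  have h1 : 3 / 4 ≤ Real.cos |z| := by rwa [Real.cos_abs, hz, Real.cos_add_int_mul_two_pi]
  by_contra! h2
  have h3 : |z| ≤ Real.pi := abs_le.2 ⟨hn.1.le, by linarith [hn.2]⟩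
  have h4 := Real.cos_le_cos_of_nonneg_of_le_pi zero_le_one h3 h2.le
  linarith [Real.cos_one_le]

lemma int_eq_zero_of_mul_two_pi {n : ℤ} {d : ℝ} (h : (n : ℝ) * (2 * Real.pi) = d) (hd : |d| < 6) :
    n = 0 := by
  have hpi := Real.pi_gt_three
  have h2 : |(n : ℝ)| < 1 := by
    rw [← h, abs_mul, abs_of_pos (a := 2 * Real.pi) (by linarith)] at hd
    nlinarith [abs_nonneg (n : ℝ)]
  exact Int.abs_lt_one_iff.1 (by exact_mod_cast h2)

set_option maxHeartbeats 1000000 in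
lemma injective_aux {p p' : ℝ × ℝ} (hj : 1 / 2 ≤ jf p) (hj' : 1 / 2 ≤ jf p') (hu : uf p = uf p')
    (hv : vf p = vf p') (ht : tf p = tf p') : ∃ k n : ℤ, p' = (p.1 + k, p.2 + n) := by
  obtain ⟨x, y⟩ := p
  obtain ⟨x', y'⟩ := p'
  have hpi := Real.pi_pos
  obtain ⟨hr, m, hc⟩ := polar_inj hu hv
  have hcy : Real.cos (2 * Real.pi * y) = Real.cos (2 * Real.pi * y') := by
    simp only [tf] at ht; linarith
  simp only [rf] at hr
  simp only [cf] at hc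
  simp only [jf] at hj hj'
  have a1 := two_add_sin_pos (2 * Real.pi * x)
  have a2 := two_add_sin_pos (2 * Real.pi * x')
  have s1 := Real.sin_sq_add_cos_sq (2 * Real.pi * y)
  have s2 := Real.sin_sq_add_cos_sq (2 * Real.pi * y')
  have hsy : Real.sin (2 * Real.pi * y) = Real.sin (2 * Real.pi * y') := by
    have h1 : Real.sin (2 * Real.pi * y) ^ 2 = Real.sin (2 * Real.pi * y') ^ 2 := by
      rw [← hcy] at s2; linarith
    rcases sq_eq_sq_iff_eq_or_eq_neg.1 h1 with h | h
    · exact h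
    · rw [h] at hr
      have : Real.sin (2 * Real.pi * y') *
        ((2 + Real.sin (2 * Real.pi * x)) + (2 + Real.sin (2 * Real.pi * x'))) = 0 := by linarith
      rcases mul_eq_zero.1 this with h2 | h2
      · rw [h, h2, neg_zero]
      · linarith
  have hy : ∃ n : ℤ, y' = y + n := by
    obtain ⟨n, hn⟩ := exists_add_int_of_cos_sin_eq hcy hsy
    exact ⟨n, mul_left_cancel₀ (by positivity : 2 * Real.pi ≠ 0) (by linarith)⟩
  obtain ⟨n, hn⟩ := hy
  rw [← hcy] at hc hj'
  rw [← hsy] at hr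
  suffices hx : ∃ k : ℤ, 2 * Real.pi * x' = 2 * Real.pi * x + k * (2 * Real.pi) by
    obtain ⟨k, hk⟩ := hx
    exact ⟨k, n, Prod.ext (mul_left_cancel₀ (by positivity : 2 * Real.pi ≠ 0) (by
      simp only; linarith)) hn⟩
  by_cases hs : Real.sin (2 * Real.pi * y) = 0
  · have h1 : Real.cos (2 * Real.pi * y) = 1 ∨ Real.cos (2 * Real.pi * y) = -1 := by
      rw [hs] at s1
      exact sq_eq_sq_iff_eq_or_eq_neg.1 (by linarith)
    rcases h1 with h1 | h1
    · rw [h1] at hc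
      exact ⟨m, by linarith⟩
    · rw [h1] at hc hj hj'
      obtain ⟨k, hk⟩ := exists_int_small (x := 2 * Real.pi * x) (by linarith)
      obtain ⟨k', hk'⟩ := exists_int_small (x := 2 * Real.pi * x') (by linarith)
      have e1 := Real.sin_add_int_mul_two_pi (2 * Real.pi * x) k
      have e2 := Real.sin_add_int_mul_two_pi (2 * Real.pi * x') k'
      have e3 := Real.cos_add_int_mul_two_pi (2 * Real.pi * x) k
      have e4 := Real.cos_add_int_mul_two_pi (2 * Real.pi * x') k'
      have b1 : Real.sin (2 * Real.pi * x) ^ 2 ≤ (2 / 3) ^ 2 := by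
        nlinarith [Real.sin_sq_add_cos_sq (2 * Real.pi * x)]
      have b2 : Real.sin (2 * Real.pi * x') ^ 2 ≤ (2 / 3) ^ 2 := by
        nlinarith [Real.sin_sq_add_cos_sq (2 * Real.pi * x')]
      have b3 := abs_le.1 (abs_le_of_sq_le_sq b1 (by norm_num))
      have b4 := abs_le.1 (abs_le_of_sq_le_sq b2 (by norm_num))
      rw [← e1] at b3
      rw [← e2] at b4
      have c1 := abs_le.1 hk
      have c2 := abs_le.1 hk'
      have hi : ((m - k + k' : ℤ) : ℝ) * (2 * Real.pi) =
          (2 * Real.pi * x' + k' * (2 * Real.pi) -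
            2 * Real.sin (2 * Real.pi * x' + k' * (2 * Real.pi))) -
          (2 * Real.pi * x + k * (2 * Real.pi) -
            2 * Real.sin (2 * Real.pi * x + k * (2 * Real.pi))) := by
        rw [e1, e2]; push_cast; linarith
      have hz : m - k + k' = 0 := by
        refine int_eq_zero_of_mul_two_pi hi (abs_lt.2 ⟨?_, ?_⟩)
        · linarith only [b3.1, b3.2, b4.1, b4.2, c1.1, c1.2, c2.1, c2.2]
        · linarith only [b3.1, b3.2, b4.1, b4.2, c1.1, c1.2, c2.1, c2.2]
      rw [hz, Int.cast_zero, zero_mul] at hi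
      have h3 := sub_two_sin_inj hk (by rw [e3]; linarith) hk' (by rw [e4]; linarith) (by linarith)
      exact ⟨k - k', by push_cast; linarith⟩
  · have h1 : Real.sin (2 * Real.pi * x) = Real.sin (2 * Real.pi * x') := by
      have := mul_right_cancel₀ hs hr
      linarith
    rw [h1] at hc
    exact ⟨m, by linarith⟩

end Emb

namespace Emb

/-- Coordinates on the product of the plug with a line. -/
noncomputable def e4 : V ≃L[ℝ] Q × ℝ :=
  LinearEquiv.toContinuousLinearEquiv
    { toFun := fun z => ((z 0, z 1, z 2), z 3)
      invFun := fun x => !₂[x.1.1, x.1.2.1, x.1.2.2, x.2]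
      map_add' := fun _ _ => rfl
      map_smul' := fun _ _ => rfl
      left_inv := fun z => by ext i; fin_cases i <;> rfl
      right_inv := fun _ => rfl }

lemma e4_apply (z : V) : e4 z = ((z 0, z 1, z 2), z 3) := rfl

lemma measurePreserving_e4 : MeasurePreserving e4 (volume : Measure V) volume := by
  have hm : Measurable (fun x : Q × ℝ => (![x.1.1, x.1.2.1, x.1.2.2, x.2] : Fin 4 → ℝ)) := by
    refine measurable_pi_lambda _ fun i => ?_
    fin_cases i
    · exact measurable_fst.comp measurable_fst
    · exact measurable_fst.comp (measurable_snd.comp measurable_fst)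
    · exact measurable_snd.comp (measurable_snd.comp measurable_fst)
    · exact measurable_snd
  have h1 : MeasurePreserving (fun x : Q × ℝ => (![x.1.1, x.1.2.1, x.1.2.2, x.2] : Fin 4 → ℝ))
      volume volume := by
    refine ⟨hm, ?_⟩
    rw [volume_pi]
    refine (Measure.pi_eq fun s hs => ?_).symm
    rw [Measure.map_apply hm (MeasurableSet.univ_pi hs)]
    have : (fun x : Q × ℝ => (![x.1.1, x.1.2.1, x.1.2.2, x.2] : Fin 4 → ℝ)) ⁻¹' univ.pi s =
        (s 0 ×ˢ s 1 ×ˢ s 2) ×ˢ s 3 := by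
      ext x
      simp [Fin.forall_fin_succ, and_assoc]
    rw [this, Measure.volume_eq_prod, Measure.prod_prod, Measure.volume_eq_prod, Measure.prod_prod,
      Measure.volume_eq_prod, Measure.prod_prod]
    simp [Fin.prod_univ_succ, mul_assoc]
  have h2 := (PiLp.volume_preserving_toLp (Fin 4)).comp h1
  have h3 : MeasurePreserving (e4.symm : Q × ℝ → V) volume volume := h2
  exact h3.symm e4.symm.toHomeomorph.toMeasurableEquiv

lemma map_withDensity_of_hasFDerivAt {f : Q × ℝ → V} (hf : Continuous f)
    {f' : Q × ℝ → Q × ℝ →L[ℝ] V} {S : Set (Q × ℝ)} (hS : MeasurableSet S)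
    (h : ∀ x ∈ S, HasFDerivAt f (f' x) x) (hi : InjOn f S) {ρ : Q × ℝ → ℝ}
    (hρ : ∀ x ∈ S, |((f' x).comp (e4 : V →L[ℝ] Q × ℝ)).det| = ρ x) :
    Measure.map f ((volume.restrict S).withDensity fun x => ENNReal.ofReal (ρ x)) =
      volume.restrict (f '' S) := by
  ext T hT
  have hT' : MeasurableSet (f ⁻¹' T) := hf.measurable hT
  rw [Measure.map_apply hf.measurable hT, withDensity_apply _ hT', Measure.restrict_restrict hT',
    Measure.restrict_apply hT]
  set A := f ⁻¹' T ∩ S with hA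
  have hAm : MeasurableSet A := hT'.inter hS
  have e : MeasurableEmbedding (e4 : V → Q × ℝ) :=
    e4.toHomeomorph.measurableEmbedding
  rw [← measurePreserving_e4.setLIntegral_comp_preimage_emb e]
  have hB : MeasurableSet ((e4 : V → Q × ℝ) ⁻¹' A) := e4.continuous.measurable hAm
  have h1 := lintegral_abs_det_fderiv_eq_addHaar_image volume hB (f := f ∘ e4)
    (f' := fun z => (f' (e4 z)).comp (e4 : V →L[ℝ] Q × ℝ))
    (fun z hz => ((h _ hz.2).comp z e4.hasFDerivAt).hasFDerivWithinAt)
    (fun z hz w hw hzw => e4.injective (hi hz.2 hw.2 hzw))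
  have h2 : f ∘ e4 '' (e4 ⁻¹' A) = T ∩ f '' S := by
    rw [image_comp, image_preimage_eq _ e4.surjective, hA, inter_comm, image_inter_preimage,
      inter_comm]
  rw [h2] at h1
  rw [← h1]
  exact setLIntegral_congr_fun hB fun z hz => by rw [hρ _ hz.2]

lemma det_comp_e4 (f' : Q × ℝ →L[ℝ] V) : (f'.comp (e4 : V →L[ℝ] Q × ℝ)).det =
    (Matrix.of fun i j : Fin 4 => f' (![((1, 0, 0), 0), ((0, 1, 0), 0), ((0, 0, 1), 0),
      ((0, 0, 0), 1)] j) i).det := by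
  rw [ContinuousLinearMap.det, ← LinearMap.det_toMatrix (EuclideanSpace.basisFun (Fin 4) ℝ).toBasis]
  congr 1
  ext i j
  rw [LinearMap.toMatrix_apply]
  rw [OrthonormalBasis.coe_toBasis, EuclideanSpace.basisFun_apply, Matrix.of_apply]
  have h : e4 (EuclideanSpace.single j (1 : ℝ)) = (![((1, 0, 0), 0), ((0, 1, 0), 0),
      ((0, 0, 1), 0), ((0, 0, 0), 1)] : Fin 4 → Q × ℝ) j := by
    rw [e4_apply]
    fin_cases j <;> simp
  rw [← h]
  rfl

/-- The frame determinant of the cone over a chart. -/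
lemma det_chart {α β a b k c₁ s₁ c₂ s₂ ax bx kx ay byy ky tx t E : ℝ} (h1 : s₁ ^ 2 + c₁ ^ 2 = 1)
    (h2 : s₂ ^ 2 + c₂ ^ 2 = 1) (hk : k * k = 1 - a ^ 2 - b ^ 2) (hx : k * kx = -(a * ax + b * bx))
    (hy : k * ky = -(a * ay + b * byy)) {M : Matrix (Fin 4) (Fin 4) ℝ}
    (hM : M = E • (!![c₁, -s₁, 0, 0; s₁, c₁, 0, 0; 0, 0, c₂, -s₂; 0, 0, s₂, c₂] *
      !![ax - α * tx * b, ay - α * t * b, -(α * b), a;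
        bx + α * tx * a, byy + α * t * a, α * a, b; kx, ky, 0, k;
        β * tx * k, β * t * k, β * k, 0])) :
    M.det = - (E ^ 4 * β * (ax * byy - ay * bx)) := by
  have d1 : (!![c₁, -s₁, 0, 0; s₁, c₁, 0, 0; 0, 0, c₂, -s₂; 0, 0, s₂, c₂] :
      Matrix (Fin 4) (Fin 4) ℝ).det = 1 := by
    simp [Matrix.det_succ_row_zero, Fin.sum_univ_succ, Fin.succAbove]
    linear_combination h1 * (s₂ ^ 2 + c₂ ^ 2) + h2
  have d2 : (!![ax - α * tx * b, ay - α * t * b, -(α * b), a;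
        bx + α * tx * a, byy + α * t * a, α * a, b; kx, ky, 0, k;
        β * tx * k, β * t * k, β * k, 0] : Matrix (Fin 4) (Fin 4) ℝ).det = -(β * (ax * byy - ay * bx)) := by
    simp [Matrix.det_succ_row_zero, Fin.sum_univ_succ, Fin.succAbove]
    linear_combination -β * ((ay * b - a * byy) * hx - (ax * b - a * bx) * hy +
      (ax * byy - ay * bx) * hk)
  rw [hM, Matrix.det_smul, Matrix.det_mul, d1, d2, Fintype.card_fin]
  ring

end Emb

namespace Emb

/-- The standard basis vectors. -/
noncomputable abbrev ee (i : Fin 4) : V := EuclideanSpace.single i 1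

/-- The point of the space with given coordinates. -/
noncomputable def pt (a b c d : ℝ) : V := a • ee 0 + b • ee 1 + c • ee 2 + d • ee 3

lemma pt_apply (a b c d : ℝ) :
    pt a b c d 0 = a ∧ pt a b c d 1 = b ∧ pt a b c d 2 = c ∧ pt a b c d 3 = d := by
  simp [pt]

lemma ext4 {z w : V} (h0 : z 0 = w 0) (h1 : z 1 = w 1) (h2 : z 2 = w 2) (h3 : z 3 = w 3) :
    z = w := by
  ext i; fin_cases i <;> assumption

lemma norm_sq_eq (z : V) : ‖z‖ ^ 2 = z 0 ^ 2 + z 1 ^ 2 + z 2 ^ 2 + z 3 ^ 2 := by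
  rw [EuclideanSpace.real_norm_sq_eq, Fin.sum_univ_four]

lemma eq_pt (z : V) : z = pt (z 0) (z 1) (z 2) (z 3) := by
  obtain ⟨h0, h1, h2, h3⟩ := pt_apply (z 0) (z 1) (z 2) (z 3)
  exact ext4 h0.symm h1.symm h2.symm h3.symm

/-- The coordinate functionals. -/
noncomputable abbrev pr (i : Fin 4) : V →L[ℝ] ℝ := EuclideanSpace.proj i

/-- The double rotation with speeds `α` and `β`. -/
noncomputable def rot (α β t : ℝ) : V →L[ℝ] V :=
  (Real.cos (α * t) • pr 0 - Real.sin (α * t) • pr 1).smulRight (ee 0) +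
  (Real.sin (α * t) • pr 0 + Real.cos (α * t) • pr 1).smulRight (ee 1) +
  (Real.cos (β * t) • pr 2 - Real.sin (β * t) • pr 3).smulRight (ee 2) +
  (Real.sin (β * t) • pr 2 + Real.cos (β * t) • pr 3).smulRight (ee 3)

lemma rot_eq (α β t : ℝ) (z : V) : rot α β t z =
    pt (Real.cos (α * t) * z 0 - Real.sin (α * t) * z 1)
      (Real.sin (α * t) * z 0 + Real.cos (α * t) * z 1)
      (Real.cos (β * t) * z 2 - Real.sin (β * t) * z 3)
      (Real.sin (β * t) * z 2 + Real.cos (β * t) * z 3) := rfl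

/-- The generator of the double rotation. -/
noncomputable def gen (α β : ℝ) : V →L[ℝ] V :=
  (-α • pr 1).smulRight (ee 0) + (α • pr 0).smulRight (ee 1) +
    (-β • pr 3).smulRight (ee 2) + (β • pr 2).smulRight (ee 3)

lemma gen_eq (α β : ℝ) (z : V) :
    gen α β z = pt (-α * z 1) (α * z 0) (-β * z 3) (β * z 2) := rfl

lemma rot_zero (α β : ℝ) (z : V) : rot α β 0 z = z := by
  rw [rot_eq]; conv_rhs => rw [eq_pt z]
  simp

lemma rot_add (α β s t : ℝ) (z : V) : rot α β (s + t) z = rot α β s (rot α β t z) := by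
  obtain ⟨h0, h1, h2, h3⟩ := pt_apply (Real.cos (α * t) * z 0 - Real.sin (α * t) * z 1)
    (Real.sin (α * t) * z 0 + Real.cos (α * t) * z 1)
    (Real.cos (β * t) * z 2 - Real.sin (β * t) * z 3)
    (Real.sin (β * t) * z 2 + Real.cos (β * t) * z 3)
  rw [rot_eq α β s, rot_eq α β t, h0, h1, h2, h3, rot_eq, mul_add, mul_add, Real.cos_add,
    Real.sin_add, Real.cos_add, Real.sin_add]
  congr 1 <;> ring

lemma norm_rot (α β t : ℝ) (z : V) : ‖rot α β t z‖ = ‖z‖ := by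
  rw [← pow_left_inj₀ (norm_nonneg _) (norm_nonneg _) two_ne_zero, norm_sq_eq, norm_sq_eq, rot_eq]
  obtain ⟨h0, h1, h2, h3⟩ := pt_apply (Real.cos (α * t) * z 0 - Real.sin (α * t) * z 1)
    (Real.sin (α * t) * z 0 + Real.cos (α * t) * z 1)
    (Real.cos (β * t) * z 2 - Real.sin (β * t) * z 3)
    (Real.sin (β * t) * z 2 + Real.cos (β * t) * z 3)
  rw [h0, h1, h2, h3]
  linear_combination (z 0 ^ 2 + z 1 ^ 2) * Real.sin_sq_add_cos_sq (α * t) +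
    (z 2 ^ 2 + z 3 ^ 2) * Real.sin_sq_add_cos_sq (β * t)

lemma hasDerivAt_pt {a b c d : ℝ → ℝ} {a' b' c' d' t : ℝ} (ha : HasDerivAt a a' t)
    (hb : HasDerivAt b b' t) (hc : HasDerivAt c c' t) (hd : HasDerivAt d d' t) :
    HasDerivAt (fun s => pt (a s) (b s) (c s) (d s)) (pt a' b' c' d') t :=
  (((ha.smul_const _).add (hb.smul_const _)).add (hc.smul_const _)).add (hd.smul_const _)

lemma hasDerivAt_rot (α β : ℝ) (z : V) (t : ℝ) :
    HasDerivAt (fun s => rot α β s z) (gen α β (rot α β t z)) t := by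
  have c (γ : ℝ) : HasDerivAt (fun s => Real.cos (γ * s)) (-Real.sin (γ * t) * γ) t := by
    simpa using ((hasDerivAt_id t).const_mul γ).cos
  have s (γ : ℝ) : HasDerivAt (fun s => Real.sin (γ * s)) (Real.cos (γ * t) * γ) t := by
    simpa using ((hasDerivAt_id t).const_mul γ).sin
  have h := hasDerivAt_pt (((c α).mul_const (z 0)).sub ((s α).mul_const (z 1)))
    (((s α).mul_const (z 0)).add ((c α).mul_const (z 1)))
    (((c β).mul_const (z 2)).sub ((s β).mul_const (z 3)))
    (((s β).mul_const (z 2)).add ((c β).mul_const (z 3)))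
  obtain ⟨h0, h1, h2, h3⟩ := pt_apply (Real.cos (α * t) * z 0 - Real.sin (α * t) * z 1)
    (Real.sin (α * t) * z 0 + Real.cos (α * t) * z 1)
    (Real.cos (β * t) * z 2 - Real.sin (β * t) * z 3)
    (Real.sin (β * t) * z 2 + Real.cos (β * t) * z 3)
  rw [gen_eq, rot_eq, h0, h1, h2, h3]
  refine (h.congr_deriv ?_)
  congr 1 <;> ring

/-- Data of an embedding of the plug along the orbits of a double rotation. -/
structure Ch where
  α : ℝ
  β : ℝ
  a : ℝ × ℝ → ℝ
  b : ℝ × ℝ → ℝ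
  τ : ℝ × ℝ → ℝ
  ha : ContDiff ℝ 2 a
  hb : ContDiff ℝ 2 b
  hτ : ContDiff ℝ 2 τ
  hab : ∀ p, a p ^ 2 + b p ^ 2 ≤ 1 / 4

namespace Ch
variable (c : Ch)

/-- The third coordinate of the transversal. -/
noncomputable def k (p : ℝ × ℝ) : ℝ := √(1 - c.a p ^ 2 - c.b p ^ 2)

lemma k_sq (p : ℝ × ℝ) : c.k p * c.k p = 1 - c.a p ^ 2 - c.b p ^ 2 :=
  Real.mul_self_sqrt (by linarith [c.hab p])

lemma k_pos (p : ℝ × ℝ) : 0 < c.k p := Real.sqrt_pos.2 (by linarith [c.hab p])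

lemma contDiff_k : ContDiff ℝ 2 c.k := by
  have := c.ha; have := c.hb
  exact ContDiff.sqrt (by fun_prop) fun p => by linarith [c.hab p]

/-- Time along the rotation. -/
noncomputable def t (q : Q) : ℝ := c.τ (xy q) + q.2.2

/-- The embedding. -/
noncomputable def ψ (q : Q) : V :=
  pt (Real.cos (c.α * c.t q) * c.a (xy q) - Real.sin (c.α * c.t q) * c.b (xy q))
    (Real.sin (c.α * c.t q) * c.a (xy q) + Real.cos (c.α * c.t q) * c.b (xy q))
    (Real.cos (c.β * c.t q) * c.k (xy q)) (Real.sin (c.β * c.t q) * c.k (xy q))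

lemma ψ_eq (q : Q) :
    c.ψ q = rot c.α c.β (c.t q) (pt (c.a (xy q)) (c.b (xy q)) (c.k (xy q)) 0) := by
  obtain ⟨h0, h1, h2, h3⟩ := pt_apply (c.a (xy q)) (c.b (xy q)) (c.k (xy q)) 0
  rw [rot_eq, h0, h1, h2, h3, ψ]
  congr 1 <;> ring

lemma ψ_up (q : Q) (t : ℝ) : c.ψ (q + (0, 0, t)) = rot c.α c.β t (c.ψ q) := by
  have h1 : xy (q + (0, 0, t)) = xy q := by simp [xy]
  have h2 : c.t (q + (0, 0, t)) = t + c.t q := by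
    simp only [Ch.t, h1, Prod.snd_add]; ring
  rw [ψ_eq, ψ_eq, h1, h2, rot_add]

lemma norm_ψ (q : Q) : ‖c.ψ q‖ = 1 := by
  rw [ψ_eq, norm_rot, ← pow_left_inj₀ (norm_nonneg _) zero_le_one two_ne_zero, norm_sq_eq]
  obtain ⟨h0, h1, h2, h3⟩ := pt_apply (c.a (xy q)) (c.b (xy q)) (c.k (xy q)) 0
  rw [h0, h1, h2, h3]
  linear_combination c.k_sq (xy q)

lemma contDiff_xy : ContDiff ℝ 2 xy := by unfold xy; fun_prop

lemma contDiff_t : ContDiff ℝ 2 c.t := by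
  have := c.hτ.comp contDiff_xy
  exact this.add (by fun_prop)

lemma contDiff_ψ : ContDiff ℝ 2 c.ψ := by
  have := c.contDiff_t
  have h1 : ContDiff ℝ 2 fun q => c.a (xy q) := c.ha.comp contDiff_xy
  have h2 : ContDiff ℝ 2 fun q => c.b (xy q) := c.hb.comp contDiff_xy
  have h3 : ContDiff ℝ 2 fun q => c.k (xy q) := c.contDiff_k.comp contDiff_xy
  unfold ψ pt
  fun_prop

/-- Parts of the norm of a chart point. -/
lemma ψ_sq (q : Q) : (c.ψ q) 0 ^ 2 + (c.ψ q) 1 ^ 2 = c.a (xy q) ^ 2 + c.b (xy q) ^ 2 ∧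
    (c.ψ q) 2 ^ 2 + (c.ψ q) 3 ^ 2 = c.k (xy q) ^ 2 := by
  obtain ⟨h0, h1, h2, h3⟩ := pt_apply
    (Real.cos (c.α * c.t q) * c.a (xy q) - Real.sin (c.α * c.t q) * c.b (xy q))
    (Real.sin (c.α * c.t q) * c.a (xy q) + Real.cos (c.α * c.t q) * c.b (xy q))
    (Real.cos (c.β * c.t q) * c.k (xy q)) (Real.sin (c.β * c.t q) * c.k (xy q))
  rw [ψ, h0, h1, h2, h3]
  exact ⟨by linear_combination (c.a (xy q) ^ 2 + c.b (xy q) ^ 2) *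
    Real.sin_sq_add_cos_sq (c.α * c.t q),
    by linear_combination c.k (xy q) ^ 2 * Real.sin_sq_add_cos_sq (c.β * c.t q)⟩

lemma ψ_inj {q q' : Q} (h : c.ψ q = c.ψ q') (ht : |c.β * (c.t q' - c.t q)| < 6) (hβ : c.β ≠ 0) :
    c.t q = c.t q' ∧ c.a (xy q) = c.a (xy q') ∧ c.b (xy q) = c.b (xy q') := by
  have hk : c.k (xy q) = c.k (xy q') := by
    rw [← pow_left_inj₀ (c.k_pos _).le (c.k_pos _).le two_ne_zero, ← (c.ψ_sq q).2,
      ← (c.ψ_sq q').2, h]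
  have hk0 := (c.k_pos (xy q')).ne'
  have e2 := congrArg (fun z : V => z 2) h
  have e3 := congrArg (fun z : V => z 3) h
  simp only [ψ, pt_apply] at e2 e3
  rw [hk] at e2 e3
  obtain ⟨m, hm⟩ := exists_add_int_of_cos_sin_eq (mul_right_cancel₀ hk0 e2)
    (mul_right_cancel₀ hk0 e3)
  have hm0 := int_eq_zero_of_mul_two_pi (n := m) (d := c.β * (c.t q' - c.t q)) (by linarith) ht
  rw [hm0, Int.cast_zero, zero_mul, add_zero] at hm
  have ht := mul_left_cancel₀ hβ hm
  rw [ψ_eq, ψ_eq, ht] at h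
  have h' := congrArg (rot c.α c.β (-c.t q)) h
  rw [← rot_add, ← rot_add, neg_add_cancel, rot_zero, rot_zero] at h'
  refine ⟨ht.symm, ?_, ?_⟩
  · simpa only [pt_apply] using congrArg (fun z : V => z 0) h'
  · simpa only [pt_apply] using congrArg (fun z : V => z 1) h'

end Ch
end Emb

namespace Emb
namespace Ch
variable (c : Ch)

lemma hasDerivAt_line {f : ℝ × ℝ → ℝ} (hf : ContDiff ℝ 2 f) (p v : ℝ × ℝ) :
    HasDerivAt (fun s : ℝ => f (p + s • v)) (fderiv ℝ f p v) 0 := by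
  have h1 : HasDerivAt (fun s : ℝ => p + s • v) v 0 := by
    simpa using ((hasDerivAt_id (0 : ℝ)).smul_const v).const_add p
  have h2 : HasFDerivAt f (fderiv ℝ f p) (p + (0 : ℝ) • v) := by
    rw [zero_smul, add_zero]
    exact (hf.differentiable (by norm_num) p).hasFDerivAt
  exact h2.comp_hasDerivAt 0 h1

lemma k_fderiv (p v : ℝ × ℝ) : c.k p * fderiv ℝ c.k p v =
    -(c.a p * fderiv ℝ c.a p v + c.b p * fderiv ℝ c.b p v) := by
  have hk := hasDerivAt_line c.contDiff_k p v
  have h1 := hk.mul hk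
  have h2 := (((hasDerivAt_line c.ha p v).pow 2).const_sub 1).sub
    ((hasDerivAt_line c.hb p v).pow 2)
  have h3 : (fun s : ℝ => c.k (p + s • v)) * (fun s : ℝ => c.k (p + s • v)) =
      (fun s : ℝ => 1 - ((fun s : ℝ => c.a (p + s • v)) ^ 2) s) -
        (fun s : ℝ => c.b (p + s • v)) ^ 2 := funext fun s => c.k_sq _
  rw [h3] at h1
  have h4 := h1.unique h2
  simp only [zero_smul, add_zero] at h4
  norm_num at h4
  linarith

lemma differentiable_cone : Differentiable ℝ (coneOf c.ψ) := by
  have := c.contDiff_ψ.differentiable (by norm_num)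
  unfold coneOf
  fun_prop

/-- The derivative of the cone over the chart in a given direction. -/
lemma fderiv_cone_apply (x v : Q × ℝ) : fderiv ℝ (coneOf c.ψ) x v =
    Real.exp x.2 • rot c.α c.β (c.t x.1) (pt
      (v.2 * c.a (xy x.1) + fderiv ℝ c.a (xy x.1) (xy v.1) -
        c.α * (fderiv ℝ c.τ (xy x.1) (xy v.1) + v.1.2.2) * c.b (xy x.1))
      (v.2 * c.b (xy x.1) + fderiv ℝ c.b (xy x.1) (xy v.1) +
        c.α * (fderiv ℝ c.τ (xy x.1) (xy v.1) + v.1.2.2) * c.a (xy x.1))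
      (v.2 * c.k (xy x.1) + fderiv ℝ c.k (xy x.1) (xy v.1))
      (c.β * (fderiv ℝ c.τ (xy x.1) (xy v.1) + v.1.2.2) * c.k (xy x.1))) := by
  have h1 : HasDerivAt (fun s : ℝ => x + s • v) v 0 := by
    simpa using ((hasDerivAt_id (0 : ℝ)).smul_const v).const_add x
  have h2 : HasFDerivAt (coneOf c.ψ) (fderiv ℝ (coneOf c.ψ) x) (x + (0 : ℝ) • v) := by
    rw [zero_smul, add_zero]
    exact (c.differentiable_cone x).hasFDerivAt
  have h3 := h2.comp_hasDerivAt 0 h1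
  have ha := hasDerivAt_line c.ha (xy x.1) (xy v.1)
  have hb := hasDerivAt_line c.hb (xy x.1) (xy v.1)
  have hk := hasDerivAt_line c.contDiff_k (xy x.1) (xy v.1)
  have ht : HasDerivAt (fun s : ℝ => c.τ (xy x.1 + s • xy v.1) + (x.1.2.2 + s * v.1.2.2))
      (fderiv ℝ c.τ (xy x.1) (xy v.1) + v.1.2.2) 0 := by
    have := ((hasDerivAt_id (0 : ℝ)).mul_const v.1.2.2).const_add x.1.2.2
    rw [one_mul] at this
    exact (hasDerivAt_line c.hτ (xy x.1) (xy v.1)).add this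
  have hσ : HasDerivAt (fun s : ℝ => Real.exp (x.2 + s * v.2)) (Real.exp (x.2 + 0 * v.2) * v.2)
      0 := by
    have := ((hasDerivAt_id (0 : ℝ)).mul_const v.2).const_add x.2
    rw [one_mul] at this
    exact this.exp
  have hα := ht.const_mul c.α
  have hβ := ht.const_mul c.β
  have h4 := hσ.fun_smul (hasDerivAt_pt ((hα.cos.fun_mul ha).fun_sub (hα.sin.fun_mul hb))
    ((hα.sin.fun_mul ha).fun_add (hα.cos.fun_mul hb)) (hβ.cos.fun_mul hk) (hβ.sin.fun_mul hk))
  have h5 := h3.unique h4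
  have e : c.t x.1 = c.τ (xy x.1) + x.1.2.2 := rfl
  rw [h5, rot_eq, e]
  simp only [zero_smul, zero_mul, add_zero, pt_apply]
  apply ext4 <;>
  · simp only [PiLp.add_apply, PiLp.smul_apply, smul_eq_mul, pt_apply]
    ring

/-- The Jacobian of the transversal coordinates. -/
noncomputable def jac (p : ℝ × ℝ) : ℝ :=
  fderiv ℝ c.a p (1, 0) * fderiv ℝ c.b p (0, 1) - fderiv ℝ c.a p (0, 1) * fderiv ℝ c.b p (1, 0)

lemma det_cone (x : Q × ℝ) :
    ((fderiv ℝ (coneOf c.ψ) x).comp (e4 : V →L[ℝ] Q × ℝ)).det =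
      -(Real.exp x.2 ^ 4 * c.β * c.jac (xy x.1)) := by
  rw [det_comp_e4, jac]
  refine det_chart (α := c.α) (tx := fderiv ℝ c.τ (xy x.1) (1, 0))
    (t := fderiv ℝ c.τ (xy x.1) (0, 1)) (k := c.k (xy x.1)) (a := c.a (xy x.1))
    (b := c.b (xy x.1)) (Real.sin_sq_add_cos_sq (c.α * c.t x.1))
    (Real.sin_sq_add_cos_sq (c.β * c.t x.1)) (c.k_sq _) (c.k_fderiv _ (1, 0))
    (c.k_fderiv _ (0, 1)) ?_
  have e00 : ((0 : ℝ), (0 : ℝ)) = 0 := rfl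
  ext i j
  rw [Matrix.of_apply, fderiv_cone_apply, rot_eq]
  fin_cases j <;> fin_cases i <;>
    simp [pt_apply, xy, e00] <;> ring

end Ch
end Emb

namespace Emb

/-- A positive smooth modification of the identity away from `1/4`. -/
noncomputable def posPart (j : ℝ) : ℝ :=
  Real.smoothTransition (8 * j - 1) * j + (1 - Real.smoothTransition (8 * j - 1))

lemma posPart_pos (j : ℝ) : 0 < posPart j := by
  unfold posPart
  have h0 := Real.smoothTransition.nonneg (8 * j - 1)
  have h1 := Real.smoothTransition.le_one (8 * j - 1)
  rcases le_or_gt j (1 / 8) with h | h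
  · rw [Real.smoothTransition.zero_of_nonpos (by linarith)]; norm_num
  · rcases eq_or_lt_of_le h0 with h2 | h2
    · rw [← h2]; norm_num
    · nlinarith

lemma posPart_eq {j : ℝ} (h : 1 / 4 ≤ j) : posPart j = j := by
  unfold posPart
  rw [Real.smoothTransition.one_of_one_le (by linarith)]; ring

/-- The density induced by the immersion. -/
noncomputable def wf (p : ℝ × ℝ) : ℝ :=
  Real.exp (2 * rf p) * (2 + Real.sin (2 * Real.pi * p.1)) * posPart (jf p)

/-- The density as data for the plug. -/
noncomputable def den : Den where
  w := wf
  contDiff := by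
    have h1 := contDiff_rf
    have h2 := contDiff_jf
    have h3 : ContDiff ℝ 2 Real.smoothTransition := Real.smoothTransition.contDiff
    have : ContDiff ℝ 2 wf := by unfold wf posPart; fun_prop
    exact this.of_le (by norm_num)
  pos p := mul_pos (mul_pos (Real.exp_pos _) (two_add_sin_pos _)) (posPart_pos _)
  add_x x y := by
    have h1 := rf_add x y 1 0
    have h2 := jf_add x y 1 0
    have h3 := sin_add_int x 1
    simp only [Int.cast_one, Int.cast_zero, add_zero] at h1 h2 h3
    simp only [wf, h1, h2, h3]
  add_y x y := by
    have h1 := rf_add x y 0 1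
    have h2 := jf_add x y 0 1
    simp only [Int.cast_one, Int.cast_zero, add_zero] at h1 h2
    simp only [wf, h1, h2]

lemma fderiv_uf_vf (p v : ℝ × ℝ) : ∃ c' r' : ℝ,
    c' = 2 * Real.pi * (v.1 * (1 + Real.cos (2 * Real.pi * p.1) *
      (Real.cos (2 * Real.pi * p.2) - 1)) -
      v.2 * ((2 + Real.sin (2 * Real.pi * p.1)) * Real.sin (2 * Real.pi * p.2))) ∧
    r' = 2 * Real.pi * (v.1 * (Real.cos (2 * Real.pi * p.1) * Real.sin (2 * Real.pi * p.2)) +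
      v.2 * ((2 + Real.sin (2 * Real.pi * p.1)) * Real.cos (2 * Real.pi * p.2))) ∧
    fderiv ℝ uf p v = Real.exp (rf p) * (r' * Real.cos (cf p) - c' * Real.sin (cf p)) ∧
    fderiv ℝ vf p v = Real.exp (rf p) * (r' * Real.sin (cf p) + c' * Real.cos (cf p)) := by
  have hx : HasDerivAt (fun s : ℝ => 2 * Real.pi * (p.1 + s * v.1)) (2 * Real.pi * v.1) 0 := by
    simpa using (((hasDerivAt_id (0 : ℝ)).mul_const v.1).const_add p.1).const_mul (2 * Real.pi)
  have hy : HasDerivAt (fun s : ℝ => 2 * Real.pi * (p.2 + s * v.2)) (2 * Real.pi * v.2) 0 := by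
    simpa using (((hasDerivAt_id (0 : ℝ)).mul_const v.2).const_add p.2).const_mul (2 * Real.pi)
  have hc := hx.fun_add ((hx.sin.const_add 2).fun_mul (hy.cos.sub_const 1))
  have hr := (hx.sin.const_add 2).fun_mul hy.sin
  have hu := (Ch.hasDerivAt_line contDiff_uf p v).unique (hr.exp.fun_mul hc.cos)
  have hv := (Ch.hasDerivAt_line contDiff_vf p v).unique (hr.exp.fun_mul hc.sin)
  refine ⟨_, _, rfl, rfl, ?_, ?_⟩
  · rw [hu]; simp only [zero_mul, zero_smul, add_zero]
    change Real.exp (rf p) * _ * Real.cos (cf p) + Real.exp (rf p) * (-Real.sin (cf p) * _) = _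
    ring
  · rw [hv]; simp only [zero_mul, zero_smul, add_zero]
    change Real.exp (rf p) * _ * Real.sin (cf p) + Real.exp (rf p) * (Real.cos (cf p) * _) = _
    ring

lemma jac_uf_vf (p : ℝ × ℝ) :
    fderiv ℝ uf p (1, 0) * fderiv ℝ vf p (0, 1) - fderiv ℝ uf p (0, 1) * fderiv ℝ vf p (1, 0) =
      -((2 * Real.pi) ^ 2 * (Real.exp (2 * rf p) * (2 + Real.sin (2 * Real.pi * p.1)) * jf p)) := by
  obtain ⟨c, r, hc, hr, hu, hv⟩ := fderiv_uf_vf p (1, 0)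
  obtain ⟨c', r', hc', hr', hu', hv'⟩ := fderiv_uf_vf p (0, 1)
  have h : r * c' - r' * c =
      -((2 * Real.pi) ^ 2 * ((2 + Real.sin (2 * Real.pi * p.1)) * jf p)) := by
    rw [hc, hr, hc', hr', jf]
    linear_combination -(2 * Real.pi) ^ 2 * (2 + Real.sin (2 * Real.pi * p.1)) *
      Real.cos (2 * Real.pi * p.1) * Real.sin_sq_add_cos_sq (2 * Real.pi * p.2)
  rw [hu, hv, hu', hv', two_mul (rf p), Real.exp_add]
  linear_combination Real.exp (rf p) ^ 2 * (r * c' - r' * c) * Real.sin_sq_add_cos_sq (cf p) +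
    Real.exp (rf p) ^ 2 * h

/-- The scale of the transversal. -/
noncomputable def ε₀ : ℝ := Real.exp (-3) / 8

lemma ε₀_pos : 0 < ε₀ := by unfold ε₀; positivity

/-- The embedding of the plug centered at a point of the base. -/
noncomputable def ch (α β ε : ℝ) (h0 : 0 ≤ ε) (h1 : ε ≤ ε₀) (o : ℝ × ℝ) : Ch where
  α := α
  β := β
  a p := ε * (uf p - uf o)
  b p := ε * (vf p - vf o)
  τ := tf
  ha := by have := contDiff_uf; fun_prop
  hb := by have := contDiff_vf; fun_prop
  hτ := contDiff_tf
  hab p := by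
    have key : ∀ x y : ℝ, |x| ≤ Real.exp 3 → |y| ≤ Real.exp 3 → (ε * (x - y)) ^ 2 ≤ 1 / 8 := by
      intro x y hx hy
      have h2 : |ε * (x - y)| ≤ 1 / 4 := by
        rw [abs_mul, abs_of_nonneg h0]
        have h3 : |x - y| ≤ 2 * Real.exp 3 := (abs_sub x y).trans (by linarith)
        have := ε₀_pos.le
        calc ε * |x - y| ≤ ε₀ * (2 * Real.exp 3) := by gcongr
          _ = 1 / 4 * (Real.exp (-3) * Real.exp 3) := by unfold ε₀; ring
          _ = 1 / 4 := by rw [← Real.exp_add]; norm_num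
      rw [← sq_abs]
      nlinarith [abs_nonneg (ε * (x - y))]
    have := key _ _ (abs_uf_le p) (abs_uf_le o)
    have := key _ _ (abs_vf_le p) (abs_vf_le o)
    linarith

variable {α β ε : ℝ} (h0 : 0 ≤ ε) (h1 : ε ≤ ε₀) (o : ℝ × ℝ)

lemma jac_ch (p : ℝ × ℝ) : (ch α β ε h0 h1 o).jac p =
    -(ε ^ 2 * (2 * Real.pi) ^ 2 *
      (Real.exp (2 * rf p) * (2 + Real.sin (2 * Real.pi * p.1)) * jf p)) := by
  have h (f : ℝ × ℝ → ℝ) (hf : ContDiff ℝ 2 f) (v : ℝ × ℝ) :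
      fderiv ℝ (fun p => ε * (f p - f o)) p v = ε * fderiv ℝ f p v := by
    have h2 := ((hf.differentiable (by norm_num) p).hasFDerivAt.sub_const (f o)).const_mul ε
    rw [h2.fderiv]; rfl
  unfold Ch.jac ch
  simp only [h uf contDiff_uf, h vf contDiff_vf]
  linear_combination ε ^ 2 * jac_uf_vf p

lemma abs_det_ch (hβ : 0 ≤ β) {p : ℝ × ℝ} (hp : 1 / 4 ≤ jf p) :
    |β * (ch α β ε h0 h1 o).jac p| = β * ε ^ 2 * (2 * Real.pi) ^ 2 * wf p := by
  rw [jac_ch, mul_neg, abs_neg, wf, posPart_eq hp, abs_of_nonneg]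
  · ring
  · have := two_add_sin_pos (2 * Real.pi * p.1)
    have : 0 ≤ jf p := by linarith
    positivity

lemma ψ_tr (q : Q) (k n : ℤ) :
    (ch α β ε h0 h1 o).ψ (q + tr k n) = (ch α β ε h0 h1 o).ψ q := by
  obtain ⟨x, y, s⟩ := q
  have e : ((x, y, s) : Q) + tr k n = (x + k, y + n, s) := by simp [tr]
  rw [e]
  simp only [Ch.ψ, Ch.t, Ch.k, ch, xy, uf_add, vf_add, tf_add]

end Emb

namespace Emb.Ch
variable (c : Ch)

lemma exists_equiv {x : Q × ℝ} (h : c.β * c.jac (xy x.1) ≠ 0) :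
    ∃ L : (Q × ℝ) ≃L[ℝ] V, HasFDerivAt (coneOf c.ψ) (L : Q × ℝ →L[ℝ] V) x := by
  have hd : ((fderiv ℝ (coneOf c.ψ) x).comp (e4 : V →L[ℝ] Q × ℝ)).det ≠ 0 := by
    rw [c.det_cone, mul_assoc]
    exact neg_ne_zero.2 (mul_ne_zero (by positivity) h)
  refine ⟨e4.symm.trans (ContinuousLinearMap.toContinuousLinearEquivOfDetNeZero _ hd), ?_⟩
  have e : ((e4.symm.trans (ContinuousLinearMap.toContinuousLinearEquivOfDetNeZero _ hd) :
      (Q × ℝ) ≃L[ℝ] V) : Q × ℝ →L[ℝ] V) = fderiv ℝ (coneOf c.ψ) x := by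
    refine ContinuousLinearMap.ext fun v => ?_
    simp
  rw [e]
  exact (c.differentiable_cone x).hasFDerivAt

lemma map_cone {S : Set (Q × ℝ)} (hS : MeasurableSet S) (hi : InjOn (coneOf c.ψ) S) {κ : ℝ}
    {w : Q → ℝ} (h : ∀ x ∈ S, |c.β * c.jac (xy x.1)| = κ * w x.1) :
    Measure.map (coneOf c.ψ) ((volume.restrict S).withDensity fun x =>
      ENNReal.ofReal (κ * (Real.exp (4 * x.2) * w x.1))) = volume.restrict (coneOf c.ψ '' S) := by
  refine map_withDensity_of_hasFDerivAt c.differentiable_cone.continuous hS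
    (fun x _ => (c.differentiable_cone x).hasFDerivAt) hi fun x hx => ?_
  rw [c.det_cone, abs_neg, mul_assoc, abs_mul, h x hx, abs_of_pos (by positivity), ← Real.exp_nat_mul]
  push_cast; ring

lemma locally_inj {q : Q} (h : c.β * c.jac (xy q) ≠ 0) :
    ∃ W ∈ 𝓝 q, ∀ q₁ ∈ W, ∀ q₂ ∈ W, c.ψ q₁ = c.ψ q₂ → q₁ = q₂ := by
  obtain ⟨L, hL⟩ := c.exists_equiv (x := (q, 0)) h
  have hcd : ContDiff ℝ 2 (coneOf c.ψ) := by
    have := c.contDiff_ψ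
    unfold coneOf; fun_prop
  have hs := hcd.contDiffAt.hasStrictFDerivAt' hL (by norm_num)
  set P := hs.toOpenPartialHomeomorph (coneOf c.ψ)
  have hW : P.source ∈ 𝓝 (q, (0 : ℝ)) :=
    P.open_source.mem_nhds hs.mem_toOpenPartialHomeomorph_source
  refine ⟨(fun q => (q, (0 : ℝ))) ⁻¹' P.source,
    (by fun_prop : Continuous fun q : Q => (q, (0 : ℝ))).continuousAt hW, fun q₁ h₁ q₂ h₂ h3 => ?_⟩
  exact congrArg Prod.fst (P.injOn h₁ h₂ (congrArg (fun z => Real.exp 0 • z) h3))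

end Emb.Ch

namespace Emb

/-- The three coordinates which the embedding separates locally. -/
noncomputable def Gf (q : Q) : ℝ × ℝ × ℝ := (uf (xy q), vf (xy q), tf (xy q) + q.2.2)

lemma continuous_Gf : Continuous Gf := by
  have hx := Ch.contDiff_xy.continuous
  have h1 := contDiff_uf.continuous.comp hx
  have h2 := contDiff_vf.continuous.comp hx
  have h3 := contDiff_tf.continuous.comp hx
  exact h1.prodMk (h2.prodMk (h3.add (by fun_prop)))

lemma xy_add_tr (q : Q) (k n : ℤ) : xy (q + tr k n) = (q.1 + k, q.2.1 + n) := rfl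

lemma Gf_tr (q : Q) (k n : ℤ) : Gf (q + tr k n) = Gf q := by
  simp only [Gf, xy_add_tr, uf_add, vf_add, tf_add]
  simp [tr, xy]

lemma Gf_locally_inj {q : Q} (h : 1 / 2 ≤ jf (xy q)) :
    ∃ W ∈ 𝓝 q, ∀ q₁ ∈ W, ∀ q₂ ∈ W, Gf q₁ = Gf q₂ → q₁ = q₂ := by
  let c := ch 1 1 ε₀ ε₀_pos.le le_rfl 0
  have hne : c.β * c.jac (xy q) ≠ 0 := by
    have h2 := abs_det_ch (α := 1) (β := 1) ε₀_pos.le le_rfl 0 zero_le_one (p := xy q) (by linarith)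
    have h3 := ε₀_pos
    refine abs_pos.1 (lt_of_lt_of_eq ?_ h2.symm)
    exact mul_pos (by positivity) (den.pos (xy q))
  obtain ⟨W, hW, h⟩ := c.locally_inj hne
  refine ⟨W, hW, fun q₁ h₁ q₂ h₂ e => h _ h₁ _ h₂ ?_⟩
  simp only [Gf, Prod.mk.injEq] at e
  have ea : c.a (xy q₁) = c.a (xy q₂) := by simp only [c, ch, e.1]
  have eb : c.b (xy q₁) = c.b (xy q₂) := by simp only [c, ch, e.2.1]
  have et : c.t q₁ = c.t q₂ := e.2.2
  simp only [Ch.ψ, Ch.k, ea, eb, et]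

lemma exists_good : ∃ δ : ℝ, 0 < δ ∧ δ ≤ 1 / 4 ∧ ∀ q q' : Q, 1 / 2 - δ < jf (xy q) →
    1 / 2 - δ < jf (xy q') → |q.2.2| < δ → |q'.2.2| < δ → Gf q = Gf q' →
    ∃ k n, q' = q + tr k n := by
  let O : Set (Q × Q) := {z | Gf z.1 = Gf z.2 → ∃ k n, z.2 = z.1 + tr k n}
  let h : Q × Q → ℝ := fun z =>
    max (max (1 / 2 - jf (xy z.1)) (1 / 2 - jf (xy z.2))) (max |z.1.2.2| |z.2.2.2|)
  have hcont : Continuous h := by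
    have h1 : Continuous fun q : Q => jf (xy q) :=
      contDiff_jf.continuous.comp Ch.contDiff_xy.continuous
    exact ((continuous_const.sub (h1.comp continuous_fst)).max
      (continuous_const.sub (h1.comp continuous_snd))).max
      (Continuous.max (by fun_prop) (by fun_prop))
  let K : Set Q := Icc ((0 : ℝ), (0 : ℝ), (-1 : ℝ)) (1, 1, 1)
  have hK : IsCompact ((K ×ˢ K) \ interior O) := (isCompact_Icc.prod isCompact_Icc).diff isOpen_interior
  have hpos : ∀ z ∈ (K ×ˢ K) \ interior O, 0 < h z := by
    rintro ⟨q, q'⟩ ⟨-, hz⟩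
    by_contra! hle
    apply hz
    simp only [h, max_le_iff, sub_nonpos] at hle
    obtain ⟨⟨h1, h2⟩, h3, h4⟩ := hle
    have h3 := abs_nonpos_iff.1 h3
    have h4 := abs_nonpos_iff.1 h4
    by_cases hG : Gf q = Gf q'
    · obtain ⟨k, n, hkn⟩ : ∃ k n : ℤ, xy q' = ((xy q).1 + k, (xy q).2 + n) := by
        simp only [Gf, Prod.mk.injEq, h3, h4, add_zero] at hG
        exact injective_aux h1 h2 hG.1 hG.2.1 hG.2.2
      have hq' : q' = q + tr k n := by
        obtain ⟨x, y, s⟩ := q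
        obtain ⟨x', y', s'⟩ := q'
        simp only [xy, Prod.mk.injEq] at hkn h3 h4
        simp [tr, hkn.1, hkn.2, h3, h4]
      obtain ⟨W, hW, hinj⟩ := Gf_locally_inj h1
      have hW' : (fun w => w - tr k n) ⁻¹' W ∈ 𝓝 q' := by
        refine (by fun_prop : Continuous fun w : Q => w - tr k n).continuousAt ?_
        rw [hq', add_sub_cancel_right]; exact hW
      refine mem_interior_iff_mem_nhds.2 (mem_of_superset (prod_mem_nhds hW hW') ?_)
      rintro ⟨w, w'⟩ ⟨hw, hw'⟩ e
      refine ⟨k, n, ?_⟩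
      have h5 : Gf (w' - tr k n) = Gf w' := by
        rw [← Gf_tr (w' - tr k n) k n, sub_add_cancel]
      rw [hinj w hw _ hw' (e.trans h5.symm), sub_add_cancel]
    · have ho : IsOpen {z : Q × Q | Gf z.1 ≠ Gf z.2} :=
        isOpen_ne_fun (continuous_Gf.comp continuous_fst) (continuous_Gf.comp continuous_snd)
      refine mem_interior_iff_mem_nhds.2 (mem_of_superset (ho.mem_nhds hG) ?_)
      exact fun z hz e => (hz e).elim
  obtain ⟨δ, hδ, hmin⟩ := hK.exists_forall_le' hcont.continuousOn hpos
  refine ⟨min δ (1 / 4), lt_min hδ (by norm_num), min_le_right _ _, fun q q' h1 h2 h3 h4 hG => ?_⟩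
  obtain ⟨k, n, hc⟩ := Mod.exists_tr_mem_cell q
  obtain ⟨k', n', hc'⟩ := Mod.exists_tr_mem_cell q'
  have hmemK : ∀ w : Q, w ∈ cell → |w.2.2| < min δ (1 / 4) → w ∈ K := by
    intro w hw hs
    have := abs_lt.1 (hs.trans_le (min_le_right _ _))
    exact ⟨⟨hw.1.1, hw.2.1, by change -1 ≤ w.2.2; linarith⟩,
      hw.1.2.le, hw.2.2.le, by change w.2.2 ≤ 1; linarith⟩
  have ej : ∀ (w : Q) (k n : ℤ), jf (xy (w + tr k n)) = jf (xy w) := fun w k n => by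
    rw [xy_add_tr, jf_add]; rfl
  have es : ∀ (w : Q) (k n : ℤ), (w + tr k n).2.2 = w.2.2 := fun w k n => add_zero _
  have hO : (q + tr k n, q' + tr k' n') ∈ O := by
    by_contra hn
    have h5 := hmin (q + tr k n, q' + tr k' n') ⟨⟨hmemK _ hc (by rwa [es]), hmemK _ hc' (by rwa [es])⟩,
      fun hi => hn (interior_subset hi)⟩
    have hm := min_le_left δ (1 / 4)
    have h6 : h (q + tr k n, q' + tr k' n') < min δ (1 / 4) := by
      simp only [h, ej, es]
      exact max_lt (max_lt (by linarith) (by linarith)) (max_lt h3 h4)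
    linarith
  obtain ⟨i, j, hij⟩ := hO (by rw [Gf_tr, Gf_tr, hG])
  refine ⟨k + i - k', n + j - n', ?_⟩
  have h7 := congrArg (fun w => w - tr k' n') hij
  simp only [add_sub_cancel_right] at h7
  rw [h7]
  simp only [tr]
  refine Prod.ext ?_ (Prod.ext ?_ ?_) <;> simp <;> ring

end Emb

namespace Emb

lemma integrable_fderiv_mul {K : NNReal} {g : V → ℝ} (hg : LipschitzWith K g)
    (hc : HasCompactSupport g) {f : V → ℝ} (hf : Continuous f) (v : V) :
    Integrable fun z => fderiv ℝ g z v * f z := by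
  have h1 : LocallyIntegrable (fun z => fderiv ℝ g z v) (volume : Measure V) := by
    have h3 : MemLp (fun z => fderiv ℝ g z v) ⊤ (volume : Measure V) :=
      memLp_top_of_bound (measurable_fderiv_apply_const ℝ g v).aestronglyMeasurable (K * ‖v‖)
        (.of_forall fun z => ((fderiv ℝ g z).le_opNorm v).trans (by
          gcongr; exact norm_fderiv_le_of_lipschitz ℝ hg))
    exact h3.locallyIntegrable le_top
  have h4 := (hc.fderiv_apply (𝕜 := ℝ) v).isCompact
  have h2 := (h1.integrableOn_isCompact h4).mul_continuousOn hf.continuousOn h4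
  refine (integrableOn_iff_integrable_of_support_subset ?_).1 h2
  intro z hz
  exact subset_tsupport _ (left_ne_zero_of_mul hz)

lemma integral_fderiv_coord {K : NNReal} {g : V → ℝ} (hg : LipschitzWith K g)
    (hc : HasCompactSupport g) {i j : Fin 4} (hij : i ≠ j) :
    ∫ z, fderiv ℝ g z (ee j) * z i = 0 := by
  have h1 : ∀ᵐ z ∂(volume : Measure V), fderiv ℝ g z (ee j) * z i = lineDeriv ℝ g z (ee j) * z i := by
    filter_upwards [hg.ae_differentiableAt] with z hz
    rw [hz.lineDeriv_eq_fderiv]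
  rw [integral_congr_ae h1]
  have h2 := LipschitzWith.integral_lineDeriv_mul_eq (μ := (volume : Measure V))
    (pr i).lipschitz hg hc (-ee j)
  rw [neg_neg] at h2
  change _ = ∫ z, lineDeriv ℝ g z (ee j) * z i at h2
  rw [← h2]
  have h3 : ∀ z : V, lineDeriv ℝ (pr i) z (-ee j) = 0 := fun z => by
    rw [(pr i).differentiableAt.lineDeriv_eq_fderiv, ContinuousLinearMap.fderiv, map_neg]
    simp [hij]
  simp only [h3, zero_mul, integral_zero]

lemma integral_gen {α β : ℝ} (K : NNReal) (g : V → ℝ) (hg : LipschitzWith K g)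
    (hc : HasCompactSupport g) : ∫ z, fderiv ℝ g z (gen α β z) = 0 := by
  have i (i j : Fin 4) (a : ℝ) := (integrable_fderiv_mul hg hc
    (f := fun z => z i) (by fun_prop) (ee j)).const_mul a
  have e : (fun z => fderiv ℝ g z (gen α β z)) = fun z =>
      -α * (fderiv ℝ g z (ee 0) * z 1) + α * (fderiv ℝ g z (ee 1) * z 0) +
      -β * (fderiv ℝ g z (ee 2) * z 3) + β * (fderiv ℝ g z (ee 3) * z 2) := by
    funext z
    rw [gen_eq, pt]
    simp only [map_add, map_smul, smul_eq_mul]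
    ring
  have i1 := (i 1 0 (-α)).fun_add (i 0 1 α)
  have i2 := i1.fun_add (i 3 2 (-β))
  rw [e, integral_add i2 (i 2 3 β), integral_add i1 (i 3 2 (-β)), integral_add (i 1 0 (-α)) (i 0 1 α)]
  simp only [integral_const_mul]
  rw [integral_fderiv_coord hg hc (by decide), integral_fderiv_coord hg hc (by decide),
    integral_fderiv_coord hg hc (by decide), integral_fderiv_coord hg hc (by decide)]
  simp

/-- The exchange of the two coordinate planes. -/
noncomputable def sw : V ≃ₗᵢ[ℝ] V := LinearIsometryEquiv.piLpCongrLeft 2 ℝ ℝ (Equiv.addRight 2)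

lemma sw_apply (z : V) : sw z = pt (z 2) (z 3) (z 0) (z 1) := by
  rw [eq_pt (sw z)]; rfl

lemma sw_rot (α β t : ℝ) (z : V) : sw (rot β α t z) = rot α β t (sw z) := by
  rw [sw_apply, sw_apply, rot_eq, rot_eq]
  simp only [pt_apply]

lemma inner_gen (α β : ℝ) (z : V) : ⟪gen α β z, z⟫ = 0 := by
  rw [gen_eq, PiLp.inner_apply, Fin.sum_univ_four]
  simp only [pt_apply]
  simp
  ring

lemma gen_ne_zero {α β : ℝ} (hα : α ≠ 0) (hβ : β ≠ 0) {z : V} (hz : z ≠ 0) : gen α β z ≠ 0 := by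
  intro h
  rw [gen_eq] at h
  have h0 := congrArg (fun z : V => z 0) h
  have h1 := congrArg (fun z : V => z 1) h
  have h2 := congrArg (fun z : V => z 2) h
  have h3 := congrArg (fun z : V => z 3) h
  simp only [pt_apply, PiLp.zero_apply, mul_eq_zero, neg_eq_zero, hα, hβ, false_or] at h0 h1 h2 h3
  exact hz (ext4 h1 h0 h3 h2)

/-- Points of a circle are related by a rotation. -/
lemma exists_angle {a b a' b' γ : ℝ} (hγ : γ ≠ 0) (h : a ^ 2 + b ^ 2 = 1)
    (h' : a' ^ 2 + b' ^ 2 = 1) :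
    ∃ s, Real.cos (γ * s) * a - Real.sin (γ * s) * b = a' ∧
      Real.sin (γ * s) * a + Real.cos (γ * s) * b = b' := by
  let w : ℂ := ⟨a * a' + b * b', a * b' - b * a'⟩
  have hw : ‖w‖ = 1 := by
    rw [← pow_left_inj₀ (norm_nonneg _) zero_le_one two_ne_zero, ← Complex.normSq_eq_norm_sq,
      Complex.normSq_apply]
    simp only [w]
    linear_combination (a' ^ 2 + b' ^ 2) * h + h'
  have hw0 : w ≠ 0 := fun h0 => by rw [h0, norm_zero] at hw; exact zero_ne_one hw
  refine ⟨Complex.arg w / γ, ?_⟩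
  rw [mul_div_cancel₀ _ hγ, Complex.cos_arg hw0, Complex.sin_arg, hw]
  simp only [w, div_one]
  constructor
  · linear_combination a' * h
  · linear_combination b' * h

lemma cos_eq_one_of_rot {a b θ : ℝ} (h : a ^ 2 + b ^ 2 ≠ 0)
    (h1 : Real.cos θ * a - Real.sin θ * b = a) (h2 : Real.sin θ * a + Real.cos θ * b = b) :
    Real.cos θ = 1 := by
  have : (Real.cos θ - 1) * (a ^ 2 + b ^ 2) = 0 := by linear_combination a * h1 + b * h2
  rcases mul_eq_zero.1 this with h3 | h3
  · linarith
  · exact (h h3).elim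

/-- The only periodic orbits of an irrational double rotation are the two axes. -/
lemma axis_of_periodic {β : ℝ} (hβ : Irrational β) {z : V} (hz : ‖z‖ = 1) {T : ℝ} (hT : 0 < T)
    (h : rot 1 β T z = z) :
    (z 0 = 0 ∧ z 1 = 0 ∧ z 2 ^ 2 + z 3 ^ 2 = 1) ∨ (z 2 = 0 ∧ z 3 = 0 ∧ z 0 ^ 2 + z 1 ^ 2 = 1) := by
  have hn := norm_sq_eq z
  rw [hz, one_pow] at hn
  by_cases hA : z 0 ^ 2 + z 1 ^ 2 = 0
  · have h0 : z 0 = 0 := by nlinarith [sq_nonneg (z 0), sq_nonneg (z 1)]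
    have h1 : z 1 = 0 := by nlinarith [sq_nonneg (z 0), sq_nonneg (z 1)]
    exact Or.inl ⟨h0, h1, by linarith⟩
  by_cases hB : z 2 ^ 2 + z 3 ^ 2 = 0
  · have h0 : z 2 = 0 := by nlinarith [sq_nonneg (z 2), sq_nonneg (z 3)]
    have h1 : z 3 = 0 := by nlinarith [sq_nonneg (z 2), sq_nonneg (z 3)]
    exact Or.inr ⟨h0, h1, by linarith⟩
  exfalso
  rw [rot_eq] at h
  have h0 := congrArg (fun z : V => z 0) h
  have h1 := congrArg (fun z : V => z 1) h
  have h2 := congrArg (fun z : V => z 2) h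
  have h3 := congrArg (fun z : V => z 3) h
  simp only [pt_apply] at h0 h1 h2 h3
  obtain ⟨m, hm⟩ := (Real.cos_eq_one_iff _).1 (cos_eq_one_of_rot hA h0 h1)
  obtain ⟨n, hn⟩ := (Real.cos_eq_one_iff _).1 (cos_eq_one_of_rot hB h2 h3)
  have hpi := Real.pi_pos
  rw [one_mul] at hm
  have hm0 : (m : ℝ) ≠ 0 := fun h0 => by rw [h0, zero_mul] at hm; exact hT.ne hm
  have h5 : β * m = n := mul_right_cancel₀ (by positivity : 2 * Real.pi ≠ 0) (by
    rw [hn, ← hm]; ring)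
  exact hβ ⟨n / m, by push_cast; rw [div_eq_iff hm0]; exact h5.symm⟩

end Emb

namespace Emb

lemma abs_t_sub_lt {β : ℝ} (hβ : |β| ≤ 2) {p p' : ℝ × ℝ} {s s' : ℝ} (hs : |s| < 1 / 4)
    (hs' : |s'| < 1 / 4) : |β * ((tf p' + s') - (tf p + s))| < 6 := by
  have h1 := Real.cos_le_one (2 * Real.pi * p.2)
  have h2 := Real.cos_le_one (2 * Real.pi * p'.2)
  have h3 := Real.neg_one_le_cos (2 * Real.pi * p.2)
  have h4 := Real.neg_one_le_cos (2 * Real.pi * p'.2)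
  rw [abs_lt] at hs hs'
  have h5 : |(tf p' + s') - (tf p + s)| ≤ 1 := by
    unfold tf
    rw [abs_le]; constructor <;> linarith
  rw [abs_mul]
  nlinarith [abs_nonneg β, abs_nonneg ((tf p' + s') - (tf p + s))]

lemma Gf_eq_of_ψ_eq {α β ε : ℝ} (h0 : 0 < ε) (h1 : ε ≤ ε₀) (o : ℝ × ℝ) (hβ : 0 < β) (hβ' : β ≤ 2)
    {q q' : Q} (hq : |q.2.2| < 1 / 4) (hq' : |q'.2.2| < 1 / 4)
    (h : (ch α β ε h0.le h1 o).ψ q = (ch α β ε h0.le h1 o).ψ q') : Gf q = Gf q' := by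
  obtain ⟨ht, ha, hb⟩ := (ch α β ε h0.le h1 o).ψ_inj h
    (abs_t_sub_lt ((abs_of_pos hβ).trans_le hβ') hq hq') hβ.ne'
  have hu := sub_left_injective (mul_left_cancel₀ h0.ne' ha)
  have hv := sub_left_injective (mul_left_cancel₀ h0.ne' hb)
  exact Prod.ext hu (Prod.ext hv ht)

/-- Two copies of a small plug in the irrational rotation flow, one on each axis. -/
theorem exists_ins : ∃ m : Mod, Nonempty (Ins m) := by
  obtain ⟨δ, hδ, hδ', hgood⟩ := exists_good
  obtain ⟨L⟩ := nonempty_lam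
  let m : Mod := ⟨L, den, δ / 2, half_pos hδ⟩
  obtain ⟨p, hp, htrap⟩ := m.exists_trapped
  have hs0 : 0 < √(2 : ℝ) := by positivity
  have hs1 : 1 ≤ √(2 : ℝ) := Real.one_le_sqrt.2 one_le_two
  have hs2 : √(2 : ℝ) ≤ 2 := Real.sqrt_le_iff.2 ⟨zero_le_two, by norm_num⟩
  have hss : 1 ≤ √√(2 : ℝ) := Real.one_le_sqrt.2 hs1
  have hε₀ := ε₀_pos
  have hε : 0 < ε₀ / √√2 := by positivity
  have hε' : ε₀ / √√2 ≤ ε₀ := div_le_self hε₀.le hss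
  let c : Ch := ch 1 √2 (ε₀ / √√2) hε.le hε' p
  let c' : Ch := ch √2 1 ε₀ hε₀.le le_rfl p
  let U : Set Q := {q | 1 / 2 - δ < jf (xy q) ∧ |q.2.2| < δ}
  let κ : ℝ := ε₀ ^ 2 * (2 * Real.pi) ^ 2
  have hκ : 0 < κ := by have := Real.pi_pos; positivity
  have hj {q : Q} (hq : q ∈ U) : 1 / 4 ≤ jf (xy q) := by linarith [hq.1]
  have hc {q : Q} (hq : q ∈ U) : |c.β * c.jac (xy q)| = κ * m.w q := by
    refine (abs_det_ch (α := 1) hε.le hε' p hs0.le (hj hq)).trans ?_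
    rw [div_pow, Real.sq_sqrt hs0.le, mul_div_cancel₀ _ hs0.ne']
    rfl
  have hc' {q : Q} (hq : q ∈ U) : |c'.β * c'.jac (xy q)| = κ * m.w q := by
    refine (abs_det_ch (α := √2) hε₀.le le_rfl p zero_le_one (hj hq)).trans ?_
    rw [one_mul]
    rfl
  have hw (q : Q) : 0 < m.w q := den.pos _
  have hne {x : ℝ} {q : Q} (h : |x| = κ * m.w q) : x ≠ 0 :=
    abs_pos.1 (h ▸ mul_pos hκ (hw q))
  have hcone (x : Q × ℝ) : coneOf (fun q => sw (c'.ψ q)) x = sw (coneOf c'.ψ x) := by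
    simp only [coneOf, map_smul]
  have hsq (c : Ch) (q : Q) : c.ψ q 0 ^ 2 + c.ψ q 1 ^ 2 < 1 / 2 := by
    rw [(c.ψ_sq q).1]; linarith [c.hab (xy q)]
  have hdisj (q q' : Q) : c.ψ q ≠ sw (c'.ψ q') := by
    intro h
    have h1 := hsq c q
    have h2 := hsq c' q'
    have h3 := norm_sq_eq (c.ψ q)
    rw [c.norm_ψ] at h3
    rw [h, sw_apply] at h1 h3
    simp only [pt_apply] at h1 h3
    linarith
  have htr (q q' : Q) (hq : q ∈ U) (hq' : q' ∈ U) (h : Gf q = Gf q') : ∃ k n, q' = q + tr k n :=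
    hgood q q' hq.1 hq'.1 hq.2 hq'.2 h
  have hab : c.a p = 0 ∧ c.b p = 0 := ⟨by simp [c, ch], by simp [c, ch]⟩
  have hab' : c'.a p = 0 ∧ c'.b p = 0 := ⟨by simp [c', ch], by simp [c', ch]⟩
  have h4 {q : Q} (hq : q ∈ U) : |q.2.2| < 1 / 4 := hq.2.trans_le hδ'
  refine ⟨m, ⟨{
    A := gen 1 √2
    inner_A := inner_gen _ _
    A_ne := fun x => gen_ne_zero one_ne_zero hs0.ne'
    integral_A := integral_gen
    R := rot 1 √2
    R_zero := rot_zero _ _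
    norm_R := norm_rot _ _
    hasDerivAt_R := hasDerivAt_rot _ _
    κ := κ
    κ_pos := hκ
    Ψ := fun j => bif j then fun q => sw (c'.ψ q) else c.ψ
    contDiff_Ψ := ?_
    norm_Ψ := ?_
    Ψ_tr := ?_
    Ψ_up := ?_
    U := U
    isOpen_U := ?_
    C_subset := ?_
    inj := ?_
    hasFDerivAt_cone := ?_
    cov := ?_
    p := p
    p_mem := hp
    trapped := htrap
    axis := ?_ }⟩⟩
  · rintro (_ | _)
    · exact c.contDiff_ψ
    · exact sw.contDiff.comp c'.contDiff_ψ
  · rintro (_ | _) q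
    · exact c.norm_ψ q
    · exact (sw.norm_map _).trans (c'.norm_ψ q)
  · rintro (_ | _) q k n
    · exact ψ_tr _ _ _ _ _ _
    · exact congrArg sw (ψ_tr _ _ _ _ _ _)
  · rintro (_ | _) q t
    · exact c.ψ_up q t
    · exact (congrArg sw (c'.ψ_up q t)).trans (sw_rot _ _ _ _)
  · have h1 : Continuous fun q : Q => jf (xy q) := contDiff_jf.continuous.comp Ch.contDiff_xy.continuous
    have h2 : Continuous fun q : Q => |q.2.2| := by fun_prop
    exact (isOpen_lt continuous_const h1).inter (isOpen_lt h2 continuous_const)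
  · intro q hq
    refine ⟨?_, hq.2.trans_lt (half_lt_self hδ)⟩
    rw [jf_eq]
    have := hq.1
    change 1 / 2 - δ < 1 - 4 * sn q.1 ^ 2 * sn q.2.1 ^ 2
    linarith
  · rintro (_ | _) (_ | _) q q' hq hq' h
    · exact ⟨rfl, htr q q' hq hq' (Gf_eq_of_ψ_eq hε hε' p hs0 hs2 (h4 hq) (h4 hq') h)⟩
    · exact (hdisj q q' h).elim
    · exact (hdisj q' q h.symm).elim
    · exact ⟨rfl, htr q q' hq hq'
        (Gf_eq_of_ψ_eq hε₀ le_rfl p one_pos one_le_two (h4 hq) (h4 hq') (sw.injective h))⟩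
  · rintro (_ | _) q σ hq
    · exact c.exists_equiv (x := (q, σ)) (hne (hc hq))
    · obtain ⟨L, hL⟩ := c'.exists_equiv (x := (q, σ)) (hne (hc' hq))
      refine ⟨L.trans sw.toContinuousLinearEquiv, ?_⟩
      have h1 := (sw.toContinuousLinearEquiv.hasFDerivAt (x := coneOf c'.ψ (q, σ))).comp (q, σ) hL
      exact h1.congr_of_eventuallyEq (.of_forall hcone)
  · rintro (_ | _) S hS hSU hi
    · exact c.map_cone hS hi fun x hx => hc (hSU hx).1
    · have he : coneOf (fun q => sw (c'.ψ q)) = sw ∘ coneOf c'.ψ := funext hcone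
      change InjOn (coneOf fun q => sw (c'.ψ q)) S at hi
      change Measure.map (coneOf fun q => sw (c'.ψ q)) _ =
        volume.restrict ((coneOf fun q => sw (c'.ψ q)) '' S)
      rw [he] at hi ⊢
      have hi' : InjOn (coneOf c'.ψ) S := hi.of_comp
      rw [← Measure.map_map sw.continuous.measurable c'.differentiable_cone.continuous.measurable,
        c'.map_cone hS hi' fun x hx => hc' (hSU hx).1, image_comp]
      exact (sw.measurePreserving.restrict_image_emb
        sw.toHomeomorph.measurableEmbedding _).map_eq
  · intro x hx T hT h
    have hk (c : Ch) (h : c.a p = 0 ∧ c.b p = 0) (s : ℝ) : c.ψ (p.1, p.2, s) =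
        pt 0 0 (Real.cos (c.β * c.t (p.1, p.2, s))) (Real.sin (c.β * c.t (p.1, p.2, s))) := by
      have h1 : c.k p = 1 := by simp [Ch.k, h]
      have h2 : xy (p.1, p.2, s) = p := rfl
      rw [Ch.ψ, h2, h.1, h.2, h1]
      simp
    rcases axis_of_periodic irrational_sqrt_two hx hT h with ⟨h0, h1, h2⟩ | ⟨h0, h1, h2⟩
    · obtain ⟨s, h3, h4⟩ := exists_angle hs0.ne' h2
        (Real.cos_sq_add_sin_sq (c.β * c.t (p.1, p.2, -m.b)))
      refine ⟨false, s, ?_⟩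
      change rot 1 √2 s x = c.ψ _
      rw [hk c hab, rot_eq, h0, h1, h3, h4]
      simp
    · obtain ⟨s, h3, h4⟩ := exists_angle one_ne_zero h2
        (Real.cos_sq_add_sin_sq (c'.β * c'.t (p.1, p.2, -m.b)))
      refine ⟨true, s, ?_⟩
      change rot 1 √2 s x = sw (c'.ψ _)
      rw [hk c' hab', rot_eq, sw_apply, h0, h1, h3, h4]
      simp only [pt_apply]
      simp

end Emb

end Seifert

open scoped RealInnerProductSpace
open MeasureTheory

/-- **G. Kuperberg's volume-preserving `C¹` counterexample to the Seifert conjecture on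
`S³`**: there is a `C¹` nonvanishing tangent vector field on `S³ ⊂ ℝ⁴` without periodic
orbits, admitting a flow which preserves a finite Borel measure positive on nonempty
open sets. -/
theorem kuperberg_volume_preserving_C1_aperiodic_S3 :
    ∃ (X : EuclideanSpace ℝ (Fin 4) → EuclideanSpace ℝ (Fin 4))
      (φ : ℝ → Metric.sphere (0 : EuclideanSpace ℝ (Fin 4)) 1 →
        Metric.sphere (0 : EuclideanSpace ℝ (Fin 4)) 1)
      (μ : Measure (Metric.sphere (0 : EuclideanSpace ℝ (Fin 4)) 1)),
      ContDiff ℝ 1 X ∧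
      (∀ x : EuclideanSpace ℝ (Fin 4),
        x ∈ Metric.sphere (0 : EuclideanSpace ℝ (Fin 4)) 1 → ⟪X x, x⟫ = 0) ∧
      (∀ x : EuclideanSpace ℝ (Fin 4),
        x ∈ Metric.sphere (0 : EuclideanSpace ℝ (Fin 4)) 1 → X x ≠ 0) ∧
      (¬ ∃ γ : ℝ → EuclideanSpace ℝ (Fin 4),
        (∀ t, γ t ∈ Metric.sphere (0 : EuclideanSpace ℝ (Fin 4)) 1) ∧
        (∀ t, HasDerivAt γ (X (γ t)) t) ∧
        (∃ T > 0, ∀ t, γ (t + T) = γ t) ∧ (∃ t s, γ t ≠ γ s)) ∧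
      φ 0 = id ∧ (∀ s t, φ (s + t) = φ s ∘ φ t) ∧
      (∀ (x : Metric.sphere (0 : EuclideanSpace ℝ (Fin 4)) 1) (t : ℝ),
        HasDerivAt (fun τ => (φ τ x : EuclideanSpace ℝ (Fin 4))) (X (φ t x)) t) ∧
      IsFiniteMeasure μ ∧
      (∀ U : Set (Metric.sphere (0 : EuclideanSpace ℝ (Fin 4)) 1),
        IsOpen U → U.Nonempty → 0 < μ U) ∧
      (∀ t, MeasurePreserving (φ t) μ μ) := by
  obtain ⟨_, ⟨I⟩⟩ := Seifert.Emb.exists_ins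
  exact Seifert.exists_aperiodic_of_ins I
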